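/- For every integer n ≥ 0, the set Γ_n is nonempty and is the image of an injective continuous proper map from ℝ to ℝ² (a properly embedded simple curve); the sets Γ_n, n ≥ 0, are pairwise disjoint, and their union is the whole real spectral locus Z(ℝ). -/

import Mathlib

open Complex Filter

/-- `y` is an eigenfunction of the PT-symmetric cubic oscillator with
parameter `a` and eigenvalue `λ`. -/
def IsCubicEigenfunction (a lam : ℂ) (y : ℂ → ℂ) : Prop :=
  Differentiable ℂ y ∧ y ≠ 0 ∧
  (∀ z : ℂ, -(deriv (deriv y) z) + (z ^ 3 - a * z) * y z = -lam * y z) ∧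
  Tendsto (fun t : ℝ => y (Complex.I * t)) atTop (nhds 0) ∧
  Tendsto (fun t : ℝ => y (Complex.I * t)) atBot (nhds 0)

/-- The real spectral locus of the PT-symmetric cubic oscillator. -/
def cubicRealLocus : Set (ℝ × ℝ) :=
  {q : ℝ × ℝ | ∃ y : ℂ → ℂ, IsCubicEigenfunction (q.1 : ℂ) (q.2 : ℂ) y}

/-- The set of nonreal zeros of `y`. -/
def nonrealZeros (y : ℂ → ℂ) : Set ℂ := {z : ℂ | y z = 0 ∧ z.im ≠ 0}

/-- `Γ_n`: the points of the real spectral locus admitting an eigenfunction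
with exactly `2n` nonreal zeros. -/
def cubicGamma (n : ℕ) : Set (ℝ × ℝ) :=
  {q : ℝ × ℝ | ∃ y : ℂ → ℂ, IsCubicEigenfunction (q.1 : ℂ) (q.2 : ℂ) y ∧
    (nonrealZeros y).Finite ∧ (nonrealZeros y).ncard = 2 * n}



namespace Cub

/-! ### Power series with locally uniform bounds -/

/-- locally uniformly entire coefficients -/
def LUE {E : Type*} [TopologicalSpace E] (c : E → ℕ → ℂ) : Prop :=
  (∀ n, Continuous (fun p => c p n)) ∧
  ∀ p : E, ∀ R : ℝ, 0 < R → ∃ U ∈ nhds p, ∃ K : ℝ, ∀ q ∈ U, ∀ n, ‖c q n‖ * R ^ n ≤ K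

noncomputable def pser (c : ℕ → ℂ) (z : ℂ) : ℂ := ∑' n, c n * z ^ n

def shiftc (c : ℕ → ℂ) (n : ℕ) : ℂ := ((n : ℂ) + 1) * c (n + 1)

lemma geo_bound {c : ℕ → ℂ} {R K : ℝ} (hR : 0 < R) (h : ∀ n, ‖c n‖ * (2 * R) ^ n ≤ K)
    {z : ℂ} (hz : ‖z‖ ≤ R) (n : ℕ) : ‖c n * z ^ n‖ ≤ K * (1 / 2) ^ n := by
  rw [norm_mul, norm_pow]
  have h1 : ‖z‖ ^ n ≤ R ^ n := pow_le_pow_left₀ (norm_nonneg _) hz n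
  have h2 := h n
  calc ‖c n‖ * ‖z‖ ^ n ≤ ‖c n‖ * R ^ n := by gcongr
    _ = (‖c n‖ * (2 * R) ^ n) * (1 / 2) ^ n := by
        rw [mul_pow, one_div, inv_pow]; field_simp
    _ ≤ _ := by gcongr

lemma geo_summable (K : ℝ) : Summable (fun n : ℕ => K * (1 / 2 : ℝ) ^ n) :=
  (summable_geometric_of_lt_one (by norm_num) (by norm_num)).mul_left K

lemma LUE.shift {E : Type*} [TopologicalSpace E] {c : E → ℕ → ℂ} (h : LUE c) :
    LUE (fun p => shiftc (c p)) := by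
  refine ⟨fun n => ?_, fun p R hR => ?_⟩
  · unfold shiftc
    exact continuous_const.mul (h.1 _)
  · obtain ⟨U, hU, K, hK⟩ := h.2 p (2 * R) (by positivity)
    refine ⟨U, hU, K / R, fun q hq n => ?_⟩
    have h1 := hK q hq (n + 1)
    rw [le_div_iff₀ hR]
    unfold shiftc
    rw [norm_mul]
    have h2 : ‖(n : ℂ) + 1‖ ≤ 2 ^ (n + 1) := by
      have : ((n : ℂ) + 1) = ((n + 1 : ℕ) : ℂ) := by push_cast; ring
      rw [this, Complex.norm_natCast]
      exact_mod_cast (Nat.lt_two_pow_self).le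
    calc ‖(n : ℂ) + 1‖ * ‖c q (n + 1)‖ * R ^ n * R
        ≤ 2 ^ (n + 1) * ‖c q (n + 1)‖ * R ^ n * R := by gcongr
      _ = ‖c q (n + 1)‖ * (2 * R) ^ (n + 1) := by rw [mul_pow]; ring
      _ ≤ K := h1

lemma LUE.summable {E : Type*} [TopologicalSpace E] {c : E → ℕ → ℂ} (h : LUE c) (p : E) (z : ℂ) :
    Summable (fun n => c p n * z ^ n) := by
  have hR : 0 < ‖z‖ + 1 := by positivity
  obtain ⟨U, hU, K, hK⟩ := h.2 p (2 * (‖z‖ + 1)) (by positivity)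
  exact Summable.of_norm_bounded (geo_summable K)
    (geo_bound hR (hK p (mem_of_mem_nhds hU)) (by linarith))

lemma LUE.continuous {E : Type*} [TopologicalSpace E] {c : E → ℕ → ℂ} (h : LUE c) :
    Continuous (fun q : E × ℂ => pser (c q.1) q.2) := by
  rw [continuous_iff_continuousAt]
  rintro ⟨p, z⟩
  have hR : 0 < ‖z‖ + 1 := by positivity
  obtain ⟨U, hU, K, hK⟩ := h.2 p (2 * (‖z‖ + 1)) (by positivity)
  have : ContinuousOn (fun q : E × ℂ => pser (c q.1) q.2) (U ×ˢ Metric.closedBall 0 (‖z‖ + 1)) := by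
    apply continuousOn_tsum (u := fun n => K * (1 / 2) ^ n)
    · intro n
      apply Continuous.continuousOn
      exact ((h.1 n).comp continuous_fst).mul (continuous_snd.pow n)
    · exact geo_summable K
    · rintro n ⟨q, w⟩ ⟨hq, hw⟩
      exact geo_bound hR (hK q hq) (by simpa using hw) n
  apply this.continuousAt
  apply prod_mem_nhds hU
  apply mem_of_superset (Metric.ball_mem_nhds z one_pos)
  intro w hw
  simp only [Metric.mem_ball, Metric.mem_closedBall, dist_zero_right] at *
  rw [dist_eq_norm] at hw
  calc ‖w‖ = ‖(w - z) + z‖ := by ring_nf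
    _ ≤ ‖w - z‖ + ‖z‖ := norm_add_le _ _
    _ ≤ _ := by linarith

/-- holomorphy along curves -/
lemma LUE.differentiable {c : ℂ → ℕ → ℂ} (h : LUE c) (hc : ∀ n, Differentiable ℂ (fun t => c t n))
    {z : ℂ → ℂ} (hz : Differentiable ℂ z) :
    Differentiable ℂ (fun t => pser (c t) (z t)) := by
  intro p
  have hR : 0 < ‖z p‖ + 1 := by positivity
  obtain ⟨U, hU, K, hK⟩ := h.2 p (2 * (‖z p‖ + 1)) (by positivity)
  have hV : {t | ‖z t‖ < ‖z p‖ + 1} ∈ nhds p :=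
    (isOpen_lt hz.continuous.norm continuous_const).mem_nhds (by simp)
  obtain ⟨V, hVsub, hVo, hpV⟩ := mem_nhds_iff.1 (inter_mem hU hV)
  have : DifferentiableOn ℂ (fun t => pser (c t) (z t)) V := by
    apply differentiableOn_tsum_of_summable_norm (u := fun n => K * (1 / 2) ^ n) (geo_summable K)
    · intro n
      exact ((hc n).mul (hz.pow n)).differentiableOn
    · exact hVo
    · intro n t ht
      exact geo_bound hR (hK t (hVsub ht).1) (hVsub ht).2.le n
  exact this.differentiableAt (hVo.mem_nhds hpV)

lemma pser_hasDerivAt {c : ℕ → ℂ} (h : ∀ R : ℝ, 0 < R → ∃ K : ℝ, ∀ n, ‖c n‖ * R ^ n ≤ K) (z : ℂ) :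
    HasDerivAt (pser c) (pser (shiftc c) z) z := by
  have hL : LUE (fun _ : ℂ => c) := by
    refine ⟨fun n => continuous_const, fun p R hR => ?_⟩
    obtain ⟨K, hK⟩ := h R hR
    exact ⟨Set.univ, univ_mem, K, fun q _ => hK⟩
  have hR : 0 < ‖z‖ + 1 := by positivity
  obtain ⟨K, hK⟩ := h (2 * (‖z‖ + 1)) (by positivity)
  have h1 := hasSum_deriv_of_summable_norm (F := fun n w => c n * w ^ n)
    (U := Metric.ball 0 (‖z‖ + 1)) (geo_summable K)
    (fun n => ((differentiable_id.pow n).const_mul (c n)).differentiableOn) Metric.isOpen_ball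
    (fun n w hw => geo_bound hR hK (by simpa using (Metric.mem_ball.1 hw).le) n)
    (z := z) (by simp)
  have h2 : deriv (pser c) z = pser (shiftc c) z := by
    have h3 : HasSum (fun n => deriv (fun w => c n * w ^ n) z) (deriv (pser c) z) := h1
    have h4 : ∀ n, deriv (fun w : ℂ => c n * w ^ n) z = c n * (n * z ^ (n - 1)) := by
      intro n; simp
    rw [← h3.tsum_eq, ← Summable.sum_add_tsum_nat_add 1 h3.summable]
    simp only [h4]
    simp only [Finset.range_one, Finset.sum_singleton, pser, shiftc]
    simp
    congr 1; ext n; ring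
  rw [← h2]
  have := (hL.differentiable (fun n => differentiable_const _) differentiable_id) z
  exact this.hasDerivAt

/-! ### The fundamental system -/

noncomputable def cf (a l y0 y1 : ℂ) : ℕ → ℂ
  | 0 => y0
  | 1 => y1
  | 2 => l * y0 / 2
  | 3 => (l * y1 - a * y0) / 6
  | 4 => (l * (l * y0 / 2) - a * y1) / 12
  | n + 5 => (l * cf a l y0 y1 (n + 3) - a * cf a l y0 y1 (n + 2) + cf a l y0 y1 n) /
      (((n : ℂ) + 5) * ((n : ℂ) + 4))

lemma cf_bound {B R : ℝ} (hB : 1 ≤ B) (hR : 1 ≤ R) : ∃ K : ℝ, ∀ a l y0 y1 : ℂ, ‖a‖ ≤ B → ‖l‖ ≤ B →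
    ‖y0‖ ≤ 1 → ‖y1‖ ≤ 1 → ∀ n, ‖cf a l y0 y1 n‖ * R ^ n ≤ K := by
  set A : ℝ := 1 + R + 2 * B * R ^ 2 + 2 * B * R ^ 3 + (B * B + B) * R ^ 4 + R ^ 5 with hA
  have hR0 : 0 < R := by linarith
  have hB0 : 0 < B := by linarith
  have hA1 : 1 ≤ A := by
    have : 0 ≤ R + 2 * B * R ^ 2 + 2 * B * R ^ 3 + (B * B + B) * R ^ 4 + R ^ 5 := by positivity
    linarith
  obtain ⟨n0, hn0⟩ := exists_nat_ge A
  refine ⟨A ^ n0, fun a l y0 y1 ha hl h0 h1 => ?_⟩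
  have mono : ∀ m n : ℕ, m ≤ n → A ^ (min m n0) ≤ A ^ (min n n0) := fun m n hmn =>
    pow_le_pow_right₀ hA1 (min_le_min_right _ hmn)
  have one : ∀ n : ℕ, 1 ≤ A ^ n := fun n => one_le_pow₀ hA1
  have key : ∀ (n : ℕ) (X D : ℝ), 0 ≤ X → X ≤ A * A ^ (min n n0) → ((n:ℝ) + 1) ≤ D →
      X / D ≤ A ^ (min (n + 1) n0) := by
    intro n X D hX0 hX hD
    have hD0 : 0 < D := by have : (0:ℝ) ≤ n := Nat.cast_nonneg n
                           linarith
    rw [div_le_iff₀ hD0]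
    rcases Nat.lt_or_ge n n0 with hlt | hge
    · rw [min_eq_left hlt.le] at hX
      rw [min_eq_left hlt, pow_succ]
      have : (1:ℝ) ≤ D := by have : (0:ℝ) ≤ n := Nat.cast_nonneg n
                             linarith
      have h2 : 0 ≤ A ^ n * A := by positivity
      nlinarith
    · rw [min_eq_right hge] at hX
      rw [min_eq_right (by omega)]
      have : A ≤ D := by
        have : (n0:ℝ) ≤ n := by exact_mod_cast hge
        linarith
      have h2 : 0 ≤ A ^ n0 := by positivity
      nlinarith
  have main : ∀ n, ‖cf a l y0 y1 n‖ * R ^ n ≤ A ^ (min n n0) := by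
    intro n
    induction n using Nat.strong_induction_on with
    | _ n ih =>
      match n, ih with
      | 0, _ => simpa [cf] using h0
      | 1, _ =>
        have := key 0 (‖y1‖ * R) 1 (by positivity) (by
          simp only [zero_le, inf_of_le_left, pow_zero, mul_one]
          have : 0 ≤ 2 * B * R ^ 2 + 2 * B * R ^ 3 + (B * B + B) * R ^ 4 + R ^ 5 := by positivity
          nlinarith) (by simp)
        simpa [cf] using this
      | 2, _ =>
        have := key 1 (‖l‖ * ‖y0‖ * R ^ 2) 2 (by positivity) (by
          have h3 : ‖l‖ * ‖y0‖ * R ^ 2 ≤ B * 1 * R ^ 2 := by gcongr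
          have h4 : A ≤ A * A ^ (min 1 n0) := by nlinarith [one (min 1 n0)]
          have : 0 ≤ R + B * R ^ 2 + 2 * B * R ^ 3 + (B * B + B) * R ^ 4 + R ^ 5 := by positivity
          linarith) (by norm_num)
        refine le_trans (le_of_eq ?_) this
        simp [cf]; ring
      | 3, _ =>
        have := key 2 ((‖l‖ * ‖y1‖ + ‖a‖ * ‖y0‖) * R ^ 3) 6 (by positivity) (by
          have h3 : (‖l‖ * ‖y1‖ + ‖a‖ * ‖y0‖) * R ^ 3 ≤ (B * 1 + B * 1) * R ^ 3 := by gcongr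
          have h4 : A ≤ A * A ^ (min 2 n0) := by nlinarith [one (min 2 n0)]
          have : 0 ≤ R + 2 * B * R ^ 2 + (B * B + B) * R ^ 4 + R ^ 5 := by positivity
          linarith) (by norm_num)
        refine le_trans ?_ this
        simp only [cf, norm_div]
        rw [div_mul_eq_mul_div]
        have h6 : ‖(6:ℂ)‖ = 6 := by simp
        rw [h6]
        have h7 := norm_sub_le (l * y1) (a * y0)
        rw [norm_mul, norm_mul] at h7
        gcongr
      | 4, _ =>
        have := key 3 ((‖l‖ * (‖l‖ * ‖y0‖ / 2) + ‖a‖ * ‖y1‖) * R ^ 4) 12 (by positivity) (by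
          have h3 : (‖l‖ * (‖l‖ * ‖y0‖ / 2) + ‖a‖ * ‖y1‖) * R ^ 4 ≤
              (B * (B * 1 / 2) + B * 1) * R ^ 4 := by gcongr
          have h4 : A ≤ A * A ^ (min 3 n0) := by nlinarith [one (min 3 n0)]
          have : 0 ≤ R + 2 * B * R ^ 2 + 2 * B * R ^ 3 + (B * B / 2) * R ^ 4 + R ^ 5 := by positivity
          linarith) (by norm_num)
        refine le_trans ?_ this
        simp only [cf, norm_div]
        rw [div_mul_eq_mul_div]
        have h6 : ‖(12:ℂ)‖ = 12 := by simp
        rw [h6]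
        have h7 := norm_sub_le (l * (l * y0 / 2)) (a * y1)
        rw [norm_mul, norm_mul, norm_div, norm_mul] at h7
        have h8 : ‖(2:ℂ)‖ = 2 := by simp
        rw [h8] at h7
        gcongr
      | n + 5, ih =>
        have i3 := ih (n + 3) (by omega)
        have i2 := ih (n + 2) (by omega)
        have i0 := ih n (by omega)
        have m3 := mono (n + 3) (n + 4) (by omega)
        have m2 := mono (n + 2) (n + 4) (by omega)
        have m0 := mono n (n + 4) (by omega)
        have hpos : 0 ≤ A ^ (min (n + 4) n0) := by positivity
        have := key (n + 4) ((‖l‖ * ‖cf a l y0 y1 (n + 3)‖ + ‖a‖ * ‖cf a l y0 y1 (n + 2)‖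
            + ‖cf a l y0 y1 n‖) * R ^ (n + 5)) (((n : ℝ) + 5) * ((n : ℝ) + 4)) (by positivity) (by
          calc (‖l‖ * ‖cf a l y0 y1 (n + 3)‖ + ‖a‖ * ‖cf a l y0 y1 (n + 2)‖
            + ‖cf a l y0 y1 n‖) * R ^ (n + 5)
              = ‖l‖ * R ^ 2 * (‖cf a l y0 y1 (n + 3)‖ * R ^ (n + 3))
                + ‖a‖ * R ^ 3 * (‖cf a l y0 y1 (n + 2)‖ * R ^ (n + 2))
                + R ^ 5 * (‖cf a l y0 y1 n‖ * R ^ n) := by ring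
            _ ≤ B * R ^ 2 * A ^ (min (n + 4) n0) + B * R ^ 3 * A ^ (min (n + 4) n0)
                + R ^ 5 * A ^ (min (n + 4) n0) := by
                  gcongr
                  · exact i3.trans m3
                  · exact i2.trans m2
                  · exact i0.trans m0
            _ = (B * R ^ 2 + B * R ^ 3 + R ^ 5) * A ^ (min (n + 4) n0) := by ring
            _ ≤ A * A ^ (min (n + 4) n0) := by
                  gcongr
                  have : 0 ≤ 1 + R + B * R ^ 2 + B * R ^ 3 + (B * B + B) * R ^ 4 := by positivity
                  linarith) (by push_cast; nlinarith [(Nat.cast_nonneg n : (0:ℝ) ≤ n)])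
        refine le_trans ?_ this
        rw [cf, norm_div, div_mul_eq_mul_div]
        have h6 : ‖((n : ℂ) + 5) * ((n : ℂ) + 4)‖ = ((n : ℝ) + 5) * ((n : ℝ) + 4) := by
          have : ((n : ℂ) + 5) * ((n : ℂ) + 4) = (((n + 5) * (n + 4) : ℕ) : ℂ) := by push_cast; ring
          rw [this, Complex.norm_natCast]; push_cast; ring
        rw [h6]
        have h7 : ‖l * cf a l y0 y1 (n + 3) - a * cf a l y0 y1 (n + 2) + cf a l y0 y1 n‖ ≤
            ‖l‖ * ‖cf a l y0 y1 (n + 3)‖ + ‖a‖ * ‖cf a l y0 y1 (n + 2)‖ + ‖cf a l y0 y1 n‖ := by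
          refine (norm_add_le _ _).trans ?_
          gcongr
          refine (norm_sub_le _ _).trans ?_
          rw [norm_mul, norm_mul]
        gcongr
  intro n
  exact (main n).trans (pow_le_pow_right₀ hA1 (min_le_right _ _))

lemma cf_bound' (B R : ℝ) : ∃ K : ℝ, ∀ a l y0 y1 : ℂ, ‖a‖ ≤ B → ‖l‖ ≤ B →
    ‖y0‖ ≤ 1 → ‖y1‖ ≤ 1 → 0 < R → ∀ n, ‖cf a l y0 y1 n‖ * R ^ n ≤ K := by
  obtain ⟨K, hK⟩ := cf_bound (le_max_right B 1) (le_max_right R 1)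
  refine ⟨K, fun a l y0 y1 ha hl h0 h1 hR n => le_trans ?_
    (hK a l y0 y1 (ha.trans (le_max_left _ _)) (hl.trans (le_max_left _ _)) h0 h1 n)⟩
  gcongr
  exact le_max_left _ _

lemma cf_continuous (y0 y1 : ℂ) (n : ℕ) : Continuous (fun p : ℂ × ℂ => cf p.1 p.2 y0 y1 n) := by
  induction n using Nat.strong_induction_on with
  | _ n ih =>
    match n, ih with
    | 0, _ => simp only [cf]; fun_prop
    | 1, _ => simp only [cf]; fun_prop
    | 2, _ => simp only [cf]; fun_prop
    | 3, _ => simp only [cf]; fun_prop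
    | 4, _ => simp only [cf]; fun_prop
    | n + 5, ih =>
      have i3 := ih (n + 3) (by omega)
      have i2 := ih (n + 2) (by omega)
      have i0 := ih n (by omega)
      simp only [cf]; fun_prop

lemma cf_differentiable {a l : ℂ → ℂ} (ha : Differentiable ℂ a) (hl : Differentiable ℂ l)
    (y0 y1 : ℂ) (n : ℕ) : Differentiable ℂ (fun t => cf (a t) (l t) y0 y1 n) := by
  induction n using Nat.strong_induction_on with
  | _ n ih =>
    match n, ih with
    | 0, _ => simp only [cf]; fun_prop
    | 1, _ => simp only [cf]; fun_prop
    | 2, _ => simp only [cf]; fun_prop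
    | 3, _ => simp only [cf]; fun_prop
    | 4, _ => simp only [cf]; fun_prop
    | n + 5, ih =>
      have i3 := ih (n + 3) (by omega)
      have i2 := ih (n + 2) (by omega)
      have i0 := ih n (by omega)
      simp only [cf]
      exact (((hl.mul i3).sub (ha.mul i2)).add i0).div_const _

lemma cf_LUE (y0 y1 : ℂ) (h0 : ‖y0‖ ≤ 1) (h1 : ‖y1‖ ≤ 1) :
    LUE (fun p : ℂ × ℂ => cf p.1 p.2 y0 y1) := by
  refine ⟨cf_continuous y0 y1, fun p R hR => ?_⟩
  obtain ⟨K, hK⟩ := cf_bound' (‖p‖ + 1) R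
  refine ⟨Metric.ball p 1, Metric.ball_mem_nhds p one_pos, K, fun q hq n => ?_⟩
  have hq' : ‖q‖ ≤ ‖p‖ + 1 := by
    rw [Metric.mem_ball, dist_eq_norm] at hq
    calc ‖q‖ = ‖(q - p) + p‖ := by simp
      _ ≤ ‖q - p‖ + ‖p‖ := norm_add_le _ _
      _ ≤ _ := by linarith
  exact hK q.1 q.2 y0 y1 ((norm_fst_le q).trans hq') ((norm_snd_le q).trans hq') h0 h1 hR n

lemma LUE.comp {E F : Type*} [TopologicalSpace E] [TopologicalSpace F] {c : E → ℕ → ℂ} (h : LUE c)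
    {f : F → E} (hf : Continuous f) : LUE (fun p => c (f p)) := by
  refine ⟨fun n => (h.1 n).comp hf, fun p R hR => ?_⟩
  obtain ⟨U, hU, K, hK⟩ := h.2 (f p) R hR
  exact ⟨f ⁻¹' U, hf.continuousAt hU, K, fun q hq n => hK _ hq n⟩

/-- `(y, y')` is an entire solution pair of `y'' = (z^3 - a z + l) y`. -/
def IsSol (a l : ℂ) (y y' : ℂ → ℂ) : Prop :=
  (∀ z, HasDerivAt y (y' z) z) ∧ ∀ z, HasDerivAt y' ((z ^ 3 - a * z + l) * y z) z

lemma cf_entire (a l y0 y1 : ℂ) (h0 : ‖y0‖ ≤ 1) (h1 : ‖y1‖ ≤ 1) (R : ℝ) (hR : 0 < R) :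
    ∃ K : ℝ, ∀ n, ‖cf a l y0 y1 n‖ * R ^ n ≤ K := by
  obtain ⟨U, hU, K, hK⟩ := (cf_LUE y0 y1 h0 h1).2 (a, l) R hR
  exact ⟨K, hK _ (mem_of_mem_nhds hU)⟩

lemma isSol_pser (a l y0 y1 : ℂ) (h0 : ‖y0‖ ≤ 1) (h1 : ‖y1‖ ≤ 1) :
    IsSol a l (pser (cf a l y0 y1)) (pser (shiftc (cf a l y0 y1))) := by
  refine ⟨fun z => pser_hasDerivAt (cf_entire a l y0 y1 h0 h1) z, fun z => ?_⟩
  have hL := cf_LUE y0 y1 h0 h1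
  have hent : ∀ R : ℝ, 0 < R → ∃ K : ℝ, ∀ n, ‖shiftc (cf a l y0 y1) n‖ * R ^ n ≤ K := by
    intro R hR
    obtain ⟨U, hU, K, hK⟩ := hL.shift.2 (a, l) R hR
    exact ⟨K, hK _ (mem_of_mem_nhds hU)⟩
  have h := pser_hasDerivAt hent z
  convert h using 1
  have s0 : Summable (fun n => cf a l y0 y1 n * z ^ n) := hL.summable (a, l) z
  have s2 : Summable (fun n => shiftc (shiftc (cf a l y0 y1)) n * z ^ n) :=
    hL.shift.shift.summable (a, l) z
  set c := cf a l y0 y1 with hc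
  have e1 := Summable.sum_add_tsum_nat_add 1 s0
  have e2 := Summable.sum_add_tsum_nat_add 2 s0
  have e3 := Summable.sum_add_tsum_nat_add 3 s0
  have f3 := Summable.sum_add_tsum_nat_add 3 s2
  have t3 := (summable_nat_add_iff 3).2 s0
  have t2 := (summable_nat_add_iff 2).2 s0
  unfold pser
  have g : ∀ n, shiftc (shiftc c) (n + 3) * z ^ (n + 3) =
      l * (c (n + 3) * z ^ (n + 3)) - (a * z) * (c (n + 2) * z ^ (n + 2)) + z ^ 3 * (c n * z ^ n) := by
    intro n
    simp only [shiftc, hc]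
    have : cf a l y0 y1 (n + 3 + 1 + 1) = (l * cf a l y0 y1 (n + 3) - a * cf a l y0 y1 (n + 2) + cf a l y0 y1 n) /
      (((n : ℂ) + 5) * ((n : ℂ) + 4)) := by rw [cf]
    rw [this]
    have hn5 : (n : ℂ) + 5 ≠ 0 := by exact_mod_cast (show n + 5 ≠ 0 by omega)
    have hn4 : (n : ℂ) + 4 ≠ 0 := by exact_mod_cast (show n + 4 ≠ 0 by omega)
    push_cast
    have : ((n : ℂ) + 3 + 1 + 1) = n + 5 := by ring
    rw [this]
    have : ((n : ℂ) + 3 + 1) = n + 4 := by ring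
    rw [this]
    field_simp
    ring
  rw [← f3]
  simp only [g]
  rw [Summable.tsum_add ((t3.mul_left l).sub (t2.mul_left (a * z))) (s0.mul_left (z ^ 3)),
    Summable.tsum_sub (t3.mul_left l) (t2.mul_left (a * z)), tsum_mul_left, tsum_mul_left,
    tsum_mul_left]
  have e3' : ∑' n, c (n + 3) * z ^ (n + 3) = ∑' n, c n * z ^ n - (c 0 + c 1 * z + c 2 * z ^ 2) := by
    rw [← e3]; simp [Finset.sum_range_succ]
  have e2' : ∑' n, c (n + 2) * z ^ (n + 2) = ∑' n, c n * z ^ n - (c 0 + c 1 * z) := by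
    rw [← e2]; simp [Finset.sum_range_succ]
  rw [e3', e2']
  simp only [Finset.sum_range_succ, Finset.sum_range_zero, shiftc, hc, cf]
  push_cast
  ring

noncomputable def phi (a l z : ℂ) : ℂ := pser (cf a l 1 0) z
noncomputable def phi' (a l z : ℂ) : ℂ := pser (shiftc (cf a l 1 0)) z
noncomputable def chi (a l z : ℂ) : ℂ := pser (cf a l 0 1) z
noncomputable def chi' (a l z : ℂ) : ℂ := pser (shiftc (cf a l 0 1)) z

lemma phi_isSol (a l : ℂ) : IsSol a l (phi a l) (phi' a l) := isSol_pser a l 1 0 (by simp) (by simp)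
lemma chi_isSol (a l : ℂ) : IsSol a l (chi a l) (chi' a l) := isSol_pser a l 0 1 (by simp) (by simp)

lemma pser_zero (c : ℕ → ℂ) : pser c 0 = c 0 := by
  unfold pser
  rw [tsum_eq_single 0]
  · simp
  · intro n hn; simp [hn]

@[simp] lemma phi_zero (a l : ℂ) : phi a l 0 = 1 := by simp [phi, pser_zero, cf]
@[simp] lemma phi'_zero (a l : ℂ) : phi' a l 0 = 0 := by simp [phi', pser_zero, cf, shiftc]
@[simp] lemma chi_zero (a l : ℂ) : chi a l 0 = 0 := by simp [chi, pser_zero, cf]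
@[simp] lemma chi'_zero (a l : ℂ) : chi' a l 0 = 1 := by simp [chi', pser_zero, cf, shiftc]

lemma phi_cont : Continuous (fun q : (ℂ × ℂ) × ℂ => phi q.1.1 q.1.2 q.2) :=
  (cf_LUE 1 0 (by simp) (by simp)).continuous
lemma phi'_cont : Continuous (fun q : (ℂ × ℂ) × ℂ => phi' q.1.1 q.1.2 q.2) :=
  (cf_LUE 1 0 (by simp) (by simp)).shift.continuous
lemma chi_cont : Continuous (fun q : (ℂ × ℂ) × ℂ => chi q.1.1 q.1.2 q.2) :=
  (cf_LUE 0 1 (by simp) (by simp)).continuous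
lemma chi'_cont : Continuous (fun q : (ℂ × ℂ) × ℂ => chi' q.1.1 q.1.2 q.2) :=
  (cf_LUE 0 1 (by simp) (by simp)).shift.continuous


lemma pser_curve {a l z : ℂ → ℂ} (ha : Differentiable ℂ a) (hl : Differentiable ℂ l)
    (hz : Differentiable ℂ z) (y0 y1 : ℂ) (h0 : ‖y0‖ ≤ 1) (h1 : ‖y1‖ ≤ 1) :
    Differentiable ℂ (fun t => pser (cf (a t) (l t) y0 y1) (z t)) :=
  ((cf_LUE y0 y1 h0 h1).comp (f := fun t => (a t, l t))
    (ha.continuous.prodMk hl.continuous)).differentiable (cf_differentiable ha hl y0 y1) hz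

lemma pser_curve' {a l z : ℂ → ℂ} (ha : Differentiable ℂ a) (hl : Differentiable ℂ l)
    (hz : Differentiable ℂ z) (y0 y1 : ℂ) (h0 : ‖y0‖ ≤ 1) (h1 : ‖y1‖ ≤ 1) :
    Differentiable ℂ (fun t => pser (shiftc (cf (a t) (l t) y0 y1)) (z t)) :=
  ((cf_LUE y0 y1 h0 h1).shift.comp (f := fun t => (a t, l t))
    (ha.continuous.prodMk hl.continuous)).differentiable
    (fun n => (cf_differentiable ha hl y0 y1 (n + 1)).const_mul _) hz

/-! ### Wronskians -/

lemma wr_const {a l : ℂ} {f f' g g' : ℂ → ℂ} (hf : IsSol a l f f') (hg : IsSol a l g g') (z : ℂ) :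
    f z * g' z - f' z * g z = f 0 * g' 0 - f' 0 * g 0 := by
  have h : ∀ z, HasDerivAt (fun z => f z * g' z - f' z * g z) 0 z := by
    intro z
    have := ((hf.1 z).mul (hg.2 z)).sub ((hf.2 z).mul (hg.1 z))
    refine this.congr_deriv ?_
    ring
  exact is_const_of_deriv_eq_zero (fun z => (h z).differentiableAt) (fun z => (h z).deriv) z 0

lemma IsSol.eq_comb {a l : ℂ} {y y' : ℂ → ℂ} (h : IsSol a l y y') (z : ℂ) :
    y z = y 0 * phi a l z + y' 0 * chi a l z ∧ y' z = y 0 * phi' a l z + y' 0 * chi' a l z := by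
  have w := wr_const (phi_isSol a l) (chi_isSol a l) z
  have w1 := wr_const h (chi_isSol a l) z
  have w2 := wr_const (phi_isSol a l) h z
  simp at w w1 w2
  rw [← w1, ← w2]
  constructor
  · linear_combination (-y z) * w
  · linear_combination (-y' z) * w

lemma IsSol.comb {a l : ℂ} {f f' g g' : ℂ → ℂ} (hf : IsSol a l f f') (hg : IsSol a l g g') (c d : ℂ) :
    IsSol a l (fun z => c * f z + d * g z) (fun z => c * f' z + d * g' z) := by
  refine ⟨fun z => ((hf.1 z).const_mul c).add ((hg.1 z).const_mul d), fun z => ?_⟩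
  have := ((hf.2 z).const_mul c).add ((hg.2 z).const_mul d)
  refine this.congr_deriv ?_
  ring

end Cub


namespace Cub

/-! ### The WKB comparison function -/

noncomputable def rt (z : ℂ) : ℂ := z ^ (1 / 4 : ℂ)

noncomputable def Tf (a z : ℂ) : ℂ := (rt z)⁻¹ ^ 3 * exp (-(2 / 5) * rt z ^ 10 + a * rt z ^ 2)

noncomputable def sf (a z : ℂ) : ℂ := -(rt z) ^ 6 + a / 2 * (rt z)⁻¹ ^ 2 - 3 / 4 * (rt z)⁻¹ ^ 4

noncomputable def sf' (a z : ℂ) : ℂ :=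
  -(3 / 2) * rt z ^ 2 - a / 4 * (rt z)⁻¹ ^ 6 + 3 / 4 * (rt z)⁻¹ ^ 8

lemma rt_pow {z : ℂ} : rt z ^ 4 = z := by
  unfold rt
  rw [← Complex.cpow_nat_mul]
  norm_num

lemma rt_ne {z : ℂ} (hz : z ≠ 0) : rt z ≠ 0 := by
  intro h
  apply hz
  rw [← rt_pow (z := z), h]; simp

lemma norm_rt (z : ℂ) : ‖rt z‖ ^ 4 = ‖z‖ := by
  rw [← norm_pow, rt_pow]

lemma rt_hasDerivAt {z : ℂ} (hz : z ∈ slitPlane) : HasDerivAt rt ((rt z)⁻¹ ^ 3 / 4) z := by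
  have h := (hasDerivAt_id z).cpow_const (c := (1 / 4 : ℂ)) hz
  have hz0 : z ≠ 0 := slitPlane_ne_zero hz
  refine h.congr_deriv ?_
  have h1 : rt z ≠ 0 := rt_ne hz0
  rw [id, Complex.cpow_sub _ _ hz0, Complex.cpow_one]
  change 1 / 4 * (rt z / z) * 1 = _
  nth_rewrite 2 [← rt_pow (z := z)]
  field_simp

lemma Tf_ne {a z : ℂ} (hz : z ≠ 0) : Tf a z ≠ 0 :=
  mul_ne_zero (pow_ne_zero _ (inv_ne_zero (rt_ne hz))) (exp_ne_zero _)

lemma Tf_hasDerivAt (a : ℂ) {z : ℂ} (hz : z ∈ slitPlane) :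
    HasDerivAt (Tf a) (sf a z * Tf a z) z := by
  have hw := rt_hasDerivAt hz
  have h1 : rt z ≠ 0 := rt_ne (slitPlane_ne_zero hz)
  have := ((hw.fun_inv h1).fun_pow 3).mul
    ((((hw.fun_pow 10).const_mul (-(2 / 5 : ℂ))).fun_add ((hw.fun_pow 2).const_mul a)).cexp)
  refine this.congr_deriv ?_
  simp only [Tf, sf]
  push_cast
  field_simp
  ring

lemma sf_hasDerivAt (a : ℂ) {z : ℂ} (hz : z ∈ slitPlane) :
    HasDerivAt (sf a) (sf' a z) z := by
  have hw := rt_hasDerivAt hz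
  have h1 : rt z ≠ 0 := rt_ne (slitPlane_ne_zero hz)
  have := (((hw.fun_pow 6).fun_neg).add (((hw.fun_inv h1).fun_pow 2).const_mul (a / 2))).sub
    (((hw.fun_inv h1).fun_pow 4).const_mul (3 / 4))
  refine this.congr_deriv ?_
  simp only [sf']
  push_cast
  field_simp
  ring

noncomputable def rf (a l z : ℂ) : ℂ :=
  l - a ^ 2 / 4 * (rt z)⁻¹ ^ 4 + a * (rt z)⁻¹ ^ 6 - 21 / 16 * (rt z)⁻¹ ^ 8

lemma rf_eq (a l : ℂ) {z : ℂ} (hz : z ≠ 0) :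
    z ^ 3 - a * z + l = rf a l z + sf a z ^ 2 + sf' a z := by
  have h1 : rt z ≠ 0 := rt_ne hz
  have h2 := rt_pow (z := z)
  simp only [rf, sf, sf']
  nth_rewrite 1 2 [← h2]
  field_simp
  ring

/-! ### The energy inequality -/

lemma energy_pt {N k A b σ : ℂ} {c δ S : ℝ} (hc : 0 ≤ c) (hA : ‖A‖ ≤ δ) (hS : S ≤ σ.re)
    (hb : ‖b‖ ≤ S) (hb2 : ‖b‖ ^ 2 ≤ δ * S) :
    -(7 * δ * (‖N - c‖ ^ 2 + ‖k‖ ^ 2 + c ^ 2)) ≤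
      2 * inner ℝ (N - c) (A * (N - k) - b * k) + 2 * inner ℝ k (2 * σ * k - b * k + A * (N - k)) := by
  set p := ‖N - c‖ with hp
  set κ := ‖k‖ with hκ
  have hp0 : 0 ≤ p := norm_nonneg _
  have hκ0 : 0 ≤ κ := norm_nonneg _
  have hδ : 0 ≤ δ := (norm_nonneg _).trans hA
  have hS0 : 0 ≤ S := (norm_nonneg _).trans hb
  have hn : ‖N - k‖ ≤ p + κ + c := by
    have : N - k = (N - c) - k + c := by ring
    rw [this]
    refine (norm_add_le _ _).trans ?_
    have := norm_sub_le (N - c) k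
    have h2 : ‖(c:ℂ)‖ = c := by simp [abs_of_nonneg hc]
    linarith
  have i1 : -(δ * (p * (p + κ + c))) - ‖b‖ * (p * κ) ≤ inner ℝ (N - c) (A * (N - k) - b * k) := by
    have h1 := abs_real_inner_le_norm (N - c) (A * (N - k) - b * k)
    have h2 : ‖A * (N - k) - b * k‖ ≤ δ * (p + κ + c) + ‖b‖ * κ := by
      refine (norm_sub_le _ _).trans ?_
      rw [norm_mul, norm_mul]
      gcongr
    have h3 := (abs_le.1 h1).1
    have h4 : p * ‖A * (N - k) - b * k‖ ≤ p * (δ * (p + κ + c) + ‖b‖ * κ) := by gcongr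
    nlinarith
  have i2 : inner ℝ k (2 * σ * k - b * k + A * (N - k)) =
      2 * σ.re * κ ^ 2 + inner ℝ k (-(b * k) + A * (N - k)) := by
    have : 2 * σ * k - b * k + A * (N - k) = 2 * σ * k + (-(b * k) + A * (N - k)) := by ring
    rw [this, inner_add_right]
    congr 1
    rw [Complex.inner, hκ, ← Complex.normSq_eq_norm_sq, Complex.normSq_apply]
    simp
    ring
  have i3 : -(δ * (κ * (p + κ + c))) - ‖b‖ * κ ^ 2 ≤ inner ℝ k (-(b * k) + A * (N - k)) := by
    have h1 := abs_real_inner_le_norm k (-(b * k) + A * (N - k))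
    have h2 : ‖-(b * k) + A * (N - k)‖ ≤ ‖b‖ * κ + δ * (p + κ + c) := by
      refine (norm_add_le _ _).trans ?_
      rw [norm_neg, norm_mul, norm_mul]
      gcongr
    have h3 := (abs_le.1 h1).1
    have h4 : κ * ‖-(b * k) + A * (N - k)‖ ≤ κ * (‖b‖ * κ + δ * (p + κ + c)) := by gcongr
    nlinarith
  have i4 : 2 * (‖b‖ * (p * κ)) ≤ δ * p ^ 2 + S * κ ^ 2 := by
    have h0 : 0 ≤ δ * p ^ 2 + S * κ ^ 2 := by positivity
    apply le_of_sq_le_sq _ h0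
    have : ‖b‖ ^ 2 * (p * κ) ^ 2 ≤ δ * S * (p * κ) ^ 2 := by gcongr
    nlinarith [sq_nonneg (δ * p ^ 2 - S * κ ^ 2)]
  have i5 : ‖b‖ * κ ^ 2 ≤ S * κ ^ 2 := by gcongr
  have i6 : S * κ ^ 2 ≤ σ.re * κ ^ 2 := by gcongr
  have i8 : δ * ((p + κ) * (p + κ + c)) ≤ δ * (3 * (p ^ 2 + κ ^ 2 + c ^ 2)) := by
    apply mul_le_mul_of_nonneg_left _ hδ
    nlinarith [sq_nonneg (p - κ), sq_nonneg (p + κ - c), sq_nonneg c]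
  have i9 : 0 ≤ S * κ ^ 2 := by positivity
  have i10 : 0 ≤ δ * (κ ^ 2 + c ^ 2) := by positivity
  rw [i2]
  nlinarith

/-- Gronwall-type step. -/
lemma energy_gronwall {V V' : ℝ → ℝ} {L m D c : ℝ} (hL : 0 ≤ L) (hm : 0 < m) (hD : 0 ≤ D)
    (hV0 : ∀ t, 0 ≤ V t)
    (hV : ∀ t ∈ Set.Icc 0 L, HasDerivAt V (V' t) t)
    (hineq : ∀ t ∈ Set.Icc 0 L, -(D * (m + t) ^ (-(3 / 2) : ℝ) * (V t + c ^ 2)) ≤ V' t) :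
    V 0 + c ^ 2 ≤ (V L + c ^ 2) * Real.exp (2 * D * m ^ (-(1 / 2) : ℝ)) := by
  set F : ℝ → ℝ := fun t => (V t + c ^ 2) * Real.exp (-(2 * D) * (m + t) ^ (-(1 / 2) : ℝ)) with hF
  have hd : ∀ t ∈ Set.Icc 0 L, HasDerivAt F ((V' t + D * (m + t) ^ (-(3 / 2) : ℝ) * (V t + c ^ 2)) *
      Real.exp (-(2 * D) * (m + t) ^ (-(1 / 2) : ℝ))) t := by
    intro t ht
    have hmt : 0 < m + t := by linarith [ht.1]
    have h1 : HasDerivAt (fun t => (m + t) ^ (-(1 / 2) : ℝ)) _ t :=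
      ((hasDerivAt_id' t).const_add m).rpow_const (p := (-(1 / 2) : ℝ)) (Or.inl hmt.ne')
    have h2 := ((hV t ht).add_const (c ^ 2)).mul ((h1.const_mul (-(2 * D))).exp)
    refine h2.congr_deriv ?_
    have : (-(1 / 2) - 1 : ℝ) = -(3 / 2) := by norm_num
    rw [this]
    ring
  have hmono : MonotoneOn F (Set.Icc 0 L) := by
    apply monotoneOn_of_deriv_nonneg (convex_Icc 0 L)
    · exact fun t ht => (hd t ht).continuousAt.continuousWithinAt
    · intro t ht
      rw [interior_Icc] at ht
      exact (hd t (Set.Ioo_subset_Icc_self ht)).differentiableAt.differentiableWithinAt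
    · intro t ht
      rw [interior_Icc] at ht
      have ht' := Set.Ioo_subset_Icc_self ht
      rw [(hd t ht').deriv]
      have := hineq t ht'
      exact mul_nonneg (by linarith) (Real.exp_pos _).le
  have h := hmono (Set.left_mem_Icc.2 hL) (Set.right_mem_Icc.2 hL) hL
  simp only [hF, add_zero] at h
  have h2 : F L ≤ V L + c ^ 2 := by
    simp only [hF]
    have h3 : Real.exp (-(2 * D) * (m + L) ^ (-(1 / 2) : ℝ)) ≤ 1 := by
      rw [Real.exp_le_one_iff]
      have : 0 ≤ (m + L) ^ (-(1 / 2) : ℝ) := Real.rpow_nonneg (by linarith) _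
      nlinarith
    have : 0 ≤ V L + c ^ 2 := by have := hV0 L
                                 positivity
    nlinarith
  have h4 : (V 0 + c ^ 2) * Real.exp (-(2 * D) * m ^ (-(1 / 2) : ℝ)) ≤ V L + c ^ 2 := h.trans h2
  calc V 0 + c ^ 2 = (V 0 + c ^ 2) * Real.exp (-(2 * D) * m ^ (-(1 / 2) : ℝ)) *
        Real.exp (2 * D * m ^ (-(1 / 2) : ℝ)) := by
        rw [mul_assoc, ← Real.exp_add]; ring_nf; simp
    _ ≤ _ := by gcongr

noncomputable def Nf (a z y y' : ℂ) : ℂ := (y / Tf a z + y' / (Tf a z * sf a z)) / 2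
noncomputable def kf (a z y y' : ℂ) : ℂ := (y' / (Tf a z * sf a z) - y / Tf a z) / 2
noncomputable def Vf (a : ℂ) (c : ℝ) (z y y' : ℂ) : ℝ := ‖Nf a z y y' - c‖ ^ 2 + ‖kf a z y y'‖ ^ 2

lemma Nk_deriv {a l : ℂ} {y y' : ℂ → ℂ} (h : IsSol a l y y') {z : ℂ} (hz : z ∈ slitPlane)
    (hs : sf a z ≠ 0) :
    HasDerivAt (fun z => Nf a z (y z) (y' z))
      (rf a l z / (2 * sf a z) * (Nf a z (y z) (y' z) - kf a z (y z) (y' z))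
        - sf' a z / sf a z * kf a z (y z) (y' z)) z ∧
    HasDerivAt (fun z => kf a z (y z) (y' z))
      (-(2 * sf a z) * kf a z (y z) (y' z) - sf' a z / sf a z * kf a z (y z) (y' z)
        + rf a l z / (2 * sf a z) * (Nf a z (y z) (y' z) - kf a z (y z) (y' z))) z := by
  have hz0 := slitPlane_ne_zero hz
  have hT := Tf_hasDerivAt a hz
  have hsd := sf_hasDerivAt a hz
  have hT0 : Tf a z ≠ 0 := Tf_ne hz0
  have h1 := (h.1 z).fun_div hT hT0
  have h2 := (h.2 z).fun_div (hT.mul hsd) (mul_ne_zero hT0 hs)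
  have hq := rf_eq a l hz0
  constructor
  · refine ((h1.add h2).div_const 2).congr_deriv ?_
    simp only [Nf, kf, Pi.mul_apply]
    rw [hq]
    field_simp
    ring
  · refine ((h2.sub h1).div_const 2).congr_deriv ?_
    simp only [Nf, kf, Pi.mul_apply]
    rw [hq]
    field_simp
    ring

end Cub


namespace Cub

lemma norm_inv_pow_le_one {w : ℂ} (hw : 1 ≤ ‖w‖) (n : ℕ) : ‖w⁻¹ ^ n‖ ≤ 1 := by
  rw [norm_pow, norm_inv]
  exact pow_le_one₀ (by positivity) (inv_le_one_of_one_le₀ hw)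

lemma wkb_bounds (B : ℝ) (hB : 0 ≤ B) : ∃ W D : ℝ, 1 ≤ W ∧ 0 ≤ D ∧ ∀ a l z : ℂ, ‖a‖ ≤ B → ‖l‖ ≤ B →
    W ≤ ‖rt z‖ → ‖sf a z + rt z ^ 6‖ ≤ ‖rt z‖ ^ 6 / 10 ∧ ‖rt z‖ ^ 6 / 2 ≤ ‖sf a z‖ ∧
      ‖sf a z + rt z ^ 6‖ ≤ B + 1 ∧
      ‖rf a l z / (2 * sf a z)‖ ≤ D * ‖rt z‖⁻¹ ^ 6 ∧ ‖sf' a z / sf a z‖ ≤ ‖rt z‖ ^ 6 / 10 ∧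
      ‖sf' a z / sf a z‖ ^ 2 ≤ D / 10 := by
  refine ⟨20 * (B + 3), 2 * B + B ^ 2 + 2 + 40 * (B + 3) ^ 2, by linarith, by positivity, ?_⟩
  intro a l z ha hl hW
  set w := rt z with hw
  have h1 : 1 ≤ ‖w‖ := by linarith
  have hw0 : 0 < ‖w‖ := by linarith
  have hle : ‖w‖ ≤ ‖w‖ ^ 6 := by
    calc ‖w‖ = ‖w‖ ^ 1 := by simp
      _ ≤ ‖w‖ ^ 6 := pow_le_pow_right₀ h1 (by norm_num)
  have e2 : ‖w‖ ^ 2 ≤ ‖w‖ ^ 6 := pow_le_pow_right₀ h1 (by norm_num)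
  have k2 := norm_inv_pow_le_one h1 2
  have k4 := norm_inv_pow_le_one h1 4
  have k6 := norm_inv_pow_le_one h1 6
  have k8 := norm_inv_pow_le_one h1 8
  have s1 : ‖sf a z + w ^ 6‖ ≤ B + 1 := by
    have : sf a z + w ^ 6 = a / 2 * w⁻¹ ^ 2 - 3 / 4 * w⁻¹ ^ 4 := by simp only [sf]; ring
    rw [this]
    refine (norm_sub_le _ _).trans ?_
    rw [norm_mul, norm_mul, norm_div]
    have h2 : ‖(2:ℂ)‖ = 2 := by simp
    have h3 : ‖(3/4:ℂ)‖ = 3/4 := by simp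
    rw [h2, h3]
    have : ‖a‖ / 2 * ‖w⁻¹ ^ 2‖ ≤ B / 2 * 1 := by gcongr
    nlinarith
  have s2 : ‖w‖ ^ 6 / 2 ≤ ‖sf a z‖ := by
    have h2 : ‖w ^ 6‖ ≤ ‖sf a z + w ^ 6‖ + ‖sf a z‖ := by
      have : w ^ 6 = (sf a z + w ^ 6) - sf a z := by ring
      calc ‖w ^ 6‖ = ‖(sf a z + w ^ 6) - sf a z‖ := by rw [← this]
        _ ≤ _ := norm_sub_le _ _
    rw [norm_pow] at h2
    nlinarith
  have hs0 : 0 < ‖sf a z‖ := lt_of_lt_of_le (by positivity) s2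
  have r1 : ‖rf a l z‖ ≤ 2 * B + B ^ 2 + 2 := by
    have : ‖rf a l z‖ ≤ ‖l‖ + ‖a ^ 2 / 4 * w⁻¹ ^ 4‖ + ‖a * w⁻¹ ^ 6‖ + ‖21 / 16 * w⁻¹ ^ 8‖ := by
      refine (norm_sub_le _ _).trans ?_
      gcongr
      refine (norm_add_le _ _).trans ?_
      gcongr
      exact norm_sub_le _ _
    rw [norm_mul, norm_mul, norm_mul, norm_div, norm_pow] at this
    have h2 : ‖(4:ℂ)‖ = 4 := by simp
    have h3 : ‖(21/16:ℂ)‖ = 21/16 := by simp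
    rw [h2, h3] at this
    have h5 : ‖a‖ ^ 2 / 4 * ‖w⁻¹ ^ 4‖ ≤ B ^ 2 / 4 * 1 := by gcongr
    have h6 : ‖a‖ * ‖w⁻¹ ^ 6‖ ≤ B * 1 := by gcongr
    nlinarith [sq_nonneg B]
  have d1 : ‖sf' a z‖ ≤ (B + 3) * ‖w‖ ^ 2 := by
    have : ‖sf' a z‖ ≤ ‖-(3 / 2) * w ^ 2‖ + ‖a / 4 * w⁻¹ ^ 6‖ + ‖3 / 4 * w⁻¹ ^ 8‖ := by
      refine (norm_add_le _ _).trans ?_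
      gcongr
      exact norm_sub_le _ _
    rw [norm_mul, norm_mul, norm_mul, norm_div, norm_pow w 2] at this
    have h2 : ‖(4:ℂ)‖ = 4 := by simp
    have h3 : ‖(3/4:ℂ)‖ = 3/4 := by simp
    have h4 : ‖(-(3/2):ℂ)‖ = 3/2 := by simp
    rw [h2, h3, h4] at this
    have h6 : ‖a‖ / 4 * ‖w⁻¹ ^ 6‖ ≤ B / 4 * 1 := by gcongr
    have h7 : 1 ≤ ‖w‖ ^ 2 := one_le_pow₀ h1
    nlinarith
  have q1 : ‖sf' a z / sf a z‖ ≤ 2 * (B + 3) := by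
    rw [norm_div, div_le_iff₀ hs0]
    have : (B + 3) * ‖w‖ ^ 2 ≤ (B + 3) * ‖w‖ ^ 6 := by gcongr
    nlinarith
  refine ⟨by nlinarith, s2, s1, ?_, ?_, ?_⟩
  · have h2 : ‖(2:ℂ)‖ = 2 := by simp
    rw [norm_div, norm_mul, h2, div_le_iff₀ (by linarith)]
    have h3 : ‖w‖⁻¹ ^ 6 * ‖w‖ ^ 6 = 1 := by
      rw [← mul_pow, inv_mul_cancel₀ hw0.ne', one_pow]
    have h4 : 0 ≤ ‖w‖⁻¹ ^ 6 := by positivity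
    have h5 : 1 ≤ ‖w‖⁻¹ ^ 6 * (2 * ‖sf a z‖) := by nlinarith
    have h6 : 0 ≤ 40 * (B + 3) ^ 2 := by positivity
    have h7 : 0 ≤ 2 * B + B ^ 2 + 2 := by positivity
    calc ‖rf a l z‖ ≤ (2 * B + B ^ 2 + 2 + 40 * (B + 3) ^ 2) * 1 := by linarith
      _ ≤ (2 * B + B ^ 2 + 2 + 40 * (B + 3) ^ 2) * (‖w‖⁻¹ ^ 6 * (2 * ‖sf a z‖)) := by gcongr
      _ = _ := by ring
  · nlinarith
  · have : ‖sf' a z / sf a z‖ ^ 2 ≤ (2 * (B + 3)) ^ 2 := by gcongr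
    nlinarith [sq_nonneg B]

/-- Segment lemma. -/
lemma segment_bound (B : ℝ) (hB : 0 ≤ B) : ∃ R D : ℝ, 1 ≤ R ∧ 0 ≤ D ∧ ∀ a l : ℂ, ‖a‖ ≤ B → ‖l‖ ≤ B →
    ∀ y y' : ℂ → ℂ, IsSol a l y y' → ∀ c : ℝ, 0 ≤ c → ∀ (z0 e : ℂ) (L m : ℝ), 0 ≤ L → R ≤ m → ‖e‖ = 1 →
    (∀ t ∈ Set.Icc 0 L, z0 + t * e ∈ slitPlane ∧ (m + t) / 2 ≤ ‖z0 + t * e‖ ∧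
      2 / 5 * ‖rt (z0 + t * e)‖ ^ 6 ≤ (e * rt (z0 + t * e) ^ 6).re) →
    Vf a c z0 (y z0) (y' z0) + c ^ 2 ≤
      (Vf a c (z0 + L * e) (y (z0 + L * e)) (y' (z0 + L * e)) + c ^ 2) *
        Real.exp (D * m ^ (-(1 / 2) : ℝ)) := by
  obtain ⟨W, D, hW, hD, hb⟩ := wkb_bounds B hB
  refine ⟨2 * W ^ 4, 2 * (21 * D), ?_, by positivity, ?_⟩
  · have : 1 ≤ W ^ 4 := one_le_pow₀ hW
    linarith
  intro a l ha hl y y' hy c hc z0 e L m hL hm he hpath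
  have hW0 : 0 < W := by linarith
  have hm0 : 0 < m := lt_of_lt_of_le (by positivity) hm
  set V : ℝ → ℝ := fun t => Vf a c (z0 + t * e) (y (z0 + t * e)) (y' (z0 + t * e)) with hV
  set V' : ℝ → ℝ := fun t =>
    let z := z0 + t * e
    let N := Nf a z (y z) (y' z)
    let k := kf a z (y z) (y' z)
    2 * inner ℝ (N - c) (e * (rf a l z / (2 * sf a z)) * (N - k) - e * (sf' a z / sf a z) * k) +
    2 * inner ℝ k (2 * (-(e * sf a z)) * k - e * (sf' a z / sf a z) * k +
      e * (rf a l z / (2 * sf a z)) * (N - k)) with hV'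
  have hW' : ∀ t ∈ Set.Icc 0 L, W ≤ ‖rt (z0 + t * e)‖ := by
    intro t ht
    have h1 := (hpath t ht).2.1
    rw [← norm_rt] at h1
    have h2 : W ^ 4 ≤ ‖rt (z0 + t * e)‖ ^ 4 := by linarith [ht.1]
    exact le_of_pow_le_pow_left₀ (by norm_num) (norm_nonneg _) h2
  have main := energy_gronwall (V := V) (V' := V') (L := L) (m := m) (D := 21 * D) (c := c) hL
    hm0 (by positivity) (fun t => by simp only [hV, Vf]; positivity) ?_ ?_
  · simpa [hV] using main
  · intro t ht
    obtain ⟨h1, h2, h3⟩ := hpath t ht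
    obtain ⟨b1, b2, b3, b4, b5, b6⟩ := hb a l _ ha hl (hW' t ht)
    have hwt : 0 < ‖rt (z0 + t * e)‖ := lt_of_lt_of_le hW0 (hW' t ht)
    have hs : sf a (z0 + t * e) ≠ 0 := by
      rw [← norm_pos_iff]
      exact lt_of_lt_of_le (by positivity) b2
    have hz : HasDerivAt (fun t : ℝ => z0 + t * e) e t := by
      have := ((hasDerivAt_id' t).ofReal_comp.mul_const e).const_add z0
      simpa using this
    obtain ⟨d1, d2⟩ := Nk_deriv hy h1 hs
    have n1 := (d1.scomp t hz).sub_const (c : ℂ)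
    have n2 := d2.scomp t hz
    have := n1.norm_sq.fun_add n2.norm_sq
    refine this.congr_deriv ?_
    simp only [hV', Function.comp]
    congr 3
    · rw [smul_eq_mul]; ring
    · rw [smul_eq_mul]; ring
  · intro t ht
    obtain ⟨h1, h2, h3⟩ := hpath t ht
    obtain ⟨b1, b2, b3, b4, b5, b6⟩ := hb a l _ ha hl (hW' t ht)
    have hwt : 0 < ‖rt (z0 + t * e)‖ := lt_of_lt_of_le hW0 (hW' t ht)
    set z := z0 + t * e with hz
    have hmt : 0 < m + t := by linarith [ht.1]
    have hδ : ‖rt z‖⁻¹ ^ 6 ≤ 3 * (m + t) ^ (-(3 / 2) : ℝ) := by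
      have e1 : ‖rt z‖⁻¹ ^ 6 = (‖z‖) ^ (-(3 / 2) : ℝ) := by
        rw [← norm_rt z, ← Real.rpow_natCast ‖rt z‖ 4, ← Real.rpow_mul hwt.le, inv_pow,
          ← Real.rpow_natCast ‖rt z‖ 6, ← Real.rpow_neg hwt.le]
        norm_num
      rw [e1]
      have e2 : ‖z‖ ^ (-(3 / 2) : ℝ) ≤ ((m + t) / 2) ^ (-(3 / 2) : ℝ) :=
        Real.rpow_le_rpow_of_nonpos (by positivity) h2 (by norm_num)
      refine e2.trans ?_
      rw [Real.div_rpow hmt.le (by norm_num), div_le_iff₀ (by positivity)]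
      have e3 : (1:ℝ) ≤ 3 * (2:ℝ) ^ (-(3 / 2) : ℝ) := by
        have : (2:ℝ) ^ (-(3/2) : ℝ) = (2 ^ (3/2 : ℝ))⁻¹ := Real.rpow_neg (by norm_num) _
        rw [this]
        have h9 : (2:ℝ) ^ (3/2 : ℝ) ≤ 3 := by
          have : (2:ℝ) ^ (3/2 : ℝ) = Real.sqrt 8 := by
            rw [Real.sqrt_eq_rpow, show (8:ℝ) = 2 ^ (3:ℝ) by norm_num, ← Real.rpow_mul (by norm_num)]
            norm_num
          rw [this, Real.sqrt_le_left (by norm_num)]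
          norm_num
        have h10 : (0:ℝ) < 2 ^ (3/2 : ℝ) := by positivity
        rw [← div_eq_mul_inv, le_div_iff₀ h10]; linarith
      have e4 : 0 ≤ (m + t) ^ (-(3 / 2) : ℝ) := by positivity
      nlinarith
    have key := energy_pt (N := Nf a z (y z) (y' z)) (k := kf a z (y z) (y' z))
      (A := e * (rf a l z / (2 * sf a z))) (b := e * (sf' a z / sf a z)) (σ := -(e * sf a z))
      (c := c) (δ := D * ‖rt z‖⁻¹ ^ 6) (S := ‖rt z‖ ^ 6 / 10) hc
      (by rw [norm_mul, he, one_mul]; exact b4)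
      (by
        have e1 : -(e * sf a z) = e * rt z ^ 6 - e * (sf a z + rt z ^ 6) := by ring
        rw [e1, Complex.sub_re]
        have e2 : (e * (sf a z + rt z ^ 6)).re ≤ ‖rt z‖ ^ 6 / 10 := by
          refine (Complex.re_le_norm _).trans ?_
          rw [norm_mul, he, one_mul]; exact b1
        have : 0 ≤ ‖rt z‖ ^ 6 := by positivity
        linarith)
      (by rw [norm_mul, he, one_mul]; exact b5)
      (by
        rw [norm_mul, he, one_mul]
        have : D * ‖rt z‖⁻¹ ^ 6 * (‖rt z‖ ^ 6 / 10) = D / 10 := by field_simp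
        rw [this]; exact b6)
    refine le_trans ?_ key
    rw [neg_le_neg_iff]
    have hV0 : 0 ≤ V t + c ^ 2 := by simp only [hV, Vf]; positivity
    have : 7 * (D * ‖rt z‖⁻¹ ^ 6) ≤ 21 * D * (m + t) ^ (-(3 / 2) : ℝ) := by nlinarith
    exact mul_le_mul_of_nonneg_right this hV0

end Cub


namespace Cub

lemma rt_ofReal {x : ℝ} (hx : 0 ≤ x) : rt (x : ℂ) = ((x ^ (1 / 4 : ℝ) : ℝ) : ℂ) := by
  unfold rt
  rw [Complex.ofReal_cpow hx]
  norm_num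

lemma real_path {x t : ℝ} (hx : 0 < x) (ht : 0 ≤ t) :
    (x : ℂ) + t * 1 ∈ slitPlane ∧ (x + t) / 2 ≤ ‖(x : ℂ) + t * 1‖ ∧
      2 / 5 * ‖rt ((x : ℂ) + t * 1)‖ ^ 6 ≤ (1 * rt ((x : ℂ) + t * 1) ^ 6).re := by
  have e : (x : ℂ) + t * 1 = ((x + t : ℝ) : ℂ) := by push_cast; ring
  have hxt : 0 < x + t := by linarith
  rw [e]
  refine ⟨?_, ?_, ?_⟩
  · exact Complex.ofReal_mem_slitPlane.2 hxt
  · rw [Complex.norm_real, Real.norm_of_nonneg hxt.le]; linarith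
  · rw [rt_ofReal hxt.le, Complex.norm_real, Real.norm_of_nonneg (by positivity), one_mul,
      ← Complex.ofReal_pow, Complex.ofReal_re]
    have : 0 ≤ ((x + t) ^ (1 / 4 : ℝ)) ^ 6 := by positivity
    linarith

noncomputable def y0n (n : ℕ) (a l : ℂ) : ℂ := Tf a n * chi' a l n - sf a n * Tf a n * chi a l n
noncomputable def y1n (n : ℕ) (a l : ℂ) : ℂ := -(Tf a n * phi' a l n) + sf a n * Tf a n * phi a l n

noncomputable def cmb (a l c d z : ℂ) : ℂ := c * phi a l z + d * chi a l z
noncomputable def cmb' (a l c d z : ℂ) : ℂ := c * phi' a l z + d * chi' a l z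

lemma cmb_isSol (a l c d : ℂ) : IsSol a l (cmb a l c d) (cmb' a l c d) :=
  (phi_isSol a l).comb (chi_isSol a l) c d

lemma wr_phichi (a l z : ℂ) : phi a l z * chi' a l z - phi' a l z * chi a l z = 1 := by
  have := wr_const (phi_isSol a l) (chi_isSol a l) z
  simpa using this

lemma cmb_at (n : ℕ) (a l : ℂ) : cmb a l (y0n n a l) (y1n n a l) n = Tf a n ∧
    cmb' a l (y0n n a l) (y1n n a l) n = sf a n * Tf a n := by
  have w := wr_phichi a l n
  simp only [cmb, cmb', y0n, y1n]
  constructor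
  · linear_combination (Tf a n) * w
  · linear_combination (sf a n * Tf a n) * w

lemma Vf_exact {a z : ℂ} (hT : Tf a z ≠ 0) (hs : sf a z ≠ 0) (c : ℝ) (y y' : ℂ) :
    Vf a c z (y) (y') = Vf a 0 z (y - c * Tf a z) (y' - c * (sf a z * Tf a z)) := by
  simp only [Vf]
  congr 3
  · simp only [Nf]; field_simp; push_cast; ring
  · simp only [kf]; field_simp; ring

lemma Vf_bound {a z : ℂ} (hT : Tf a z ≠ 0) (hs : sf a z ≠ 0) (c : ℝ) (y y' : ℂ) :
    ‖y / Tf a z - c‖ ≤ 2 * Real.sqrt (Vf a c z y y') ∧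
    ‖y' / (Tf a z * sf a z) - c‖ ≤ 2 * Real.sqrt (Vf a c z y y') := by
  have h1 : ‖Nf a z y y' - c‖ ≤ Real.sqrt (Vf a c z y y') := by
    apply Real.le_sqrt_of_sq_le; simp only [Vf]; nlinarith [sq_nonneg ‖kf a z y y'‖]
  have h2 : ‖kf a z y y'‖ ≤ Real.sqrt (Vf a c z y y') := by
    apply Real.le_sqrt_of_sq_le; simp only [Vf]; nlinarith [sq_nonneg ‖Nf a z y y' - c‖]
  constructor
  · have : y / Tf a z - c = (Nf a z y y' - c) - kf a z y y' := by simp only [Nf, kf]; ring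
    rw [this]
    refine (norm_sub_le _ _).trans (by linarith)
  · have : y' / (Tf a z * sf a z) - c = (Nf a z y y' - c) + kf a z y y' := by
      simp only [Nf, kf]; ring
    rw [this]
    refine (norm_add_le _ _).trans (by linarith)

lemma sf_ne_of_large (B : ℝ) (hB : 0 ≤ B) : ∃ R : ℝ, 1 ≤ R ∧ ∀ a z : ℂ, ‖a‖ ≤ B → R ≤ ‖z‖ →
    sf a z ≠ 0 := by
  obtain ⟨W, D, hW, hD, hb⟩ := wkb_bounds B hB
  refine ⟨W ^ 4, one_le_pow₀ hW, fun a z ha hz => ?_⟩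
  have hw : W ≤ ‖rt z‖ := by
    rw [← norm_rt] at hz
    exact le_of_pow_le_pow_left₀ (by norm_num) (norm_nonneg _) hz
  have := (hb a 0 z ha (by simpa using hB) hw).2.1
  have h0 : 0 < ‖rt z‖ := by linarith
  rw [← norm_pos_iff]
  exact lt_of_lt_of_le (by positivity) this

/-- the energy of the approximations along the real axis -/
lemma approx_V (B : ℝ) (hB : 0 ≤ B) : ∃ R D : ℝ, 1 ≤ R ∧ 0 ≤ D ∧ ∀ a l : ℂ, ‖a‖ ≤ B → ‖l‖ ≤ B →
    ∀ (x : ℝ) (p : ℕ), R ≤ x → x ≤ p →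
    Vf a 1 x (cmb a l (y0n p a l) (y1n p a l) x) (cmb' a l (y0n p a l) (y1n p a l) x) + 1 ≤
      Real.exp (D * x ^ (-(1 / 2) : ℝ)) := by
  obtain ⟨R1, D, hR1, hD, h⟩ := segment_bound B hB
  obtain ⟨R2, hR2, hs⟩ := sf_ne_of_large B hB
  refine ⟨max R1 R2, D, hR1.trans (le_max_left _ _), hD, ?_⟩
  intro a l ha hl x p hx hxp
  have hx0 : 0 < x := by linarith [le_max_left R1 R2]
  have := h a l ha hl _ _ (cmb_isSol a l (y0n p a l) (y1n p a l)) 1 zero_le_one x 1 (p - x) x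
    (by linarith) ((le_max_left _ _).trans hx) (by simp) (fun t ht => real_path hx0 ht.1)
  have e : (x : ℂ) + ((p - x : ℝ) : ℂ) * 1 = p := by push_cast; ring
  rw [e, (cmb_at p a l).1, (cmb_at p a l).2] at this
  have hp0 : 0 < (p : ℝ) := by linarith
  have hp : (p : ℂ) ≠ 0 := by exact_mod_cast hp0.ne'
  have hT : Tf a p ≠ 0 := Tf_ne hp
  have hsp : sf a p ≠ 0 := hs a p ha (by
    rw [Complex.norm_natCast]; exact ((le_max_right _ _).trans hx).trans hxp)
  have hV : Vf a 1 p (Tf a p) (sf a p * Tf a p) = 0 := by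
    rw [Vf_exact hT hsp]; simp [Vf, Nf, kf]
  rw [hV] at this
  simpa using this

lemma Tf_cont (z : ℂ) : Continuous (fun a => Tf a z) := by unfold Tf; fun_prop
lemma sf_cont (z : ℂ) : Continuous (fun a => sf a z) := by unfold sf; fun_prop



lemma coef_of_values (a l c d z : ℂ) :
    c = cmb a l c d z * chi' a l z - cmb' a l c d z * chi a l z ∧
    d = -(cmb a l c d z * phi' a l z) + cmb' a l c d z * phi a l z := by
  have w := wr_phichi a l z
  simp only [cmb, cmb']
  constructor
  · linear_combination (-c) * w
  · linear_combination (-d) * w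

lemma coef_cauchy (B : ℝ) (hB : 0 ≤ B) : ∃ (n0 : ℕ) (η : ℕ → ℝ), Tendsto η atTop (nhds 0) ∧
    ∀ n p : ℕ, n0 ≤ n → n ≤ p → ∀ a l : ℂ, ‖a‖ ≤ B → ‖l‖ ≤ B →
      ‖y0n p a l - y0n n a l‖ ≤ η n ∧ ‖y1n p a l - y1n n a l‖ ≤ η n := by
  obtain ⟨R1, D1, hR1, hD1, h1⟩ := segment_bound B hB
  obtain ⟨R2, D2, hR2, hD2, h2⟩ := approx_V B hB
  obtain ⟨R3, hR3, hs⟩ := sf_ne_of_large B hB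
  obtain ⟨m, hm⟩ := exists_nat_ge (max R1 (max R2 R3))
  have hmR1 : R1 ≤ m := (le_max_left _ _).trans hm
  have hmR2 : R2 ≤ m := ((le_max_left _ _).trans (le_max_right _ _)).trans hm
  have hmR3 : R3 ≤ m := ((le_max_right _ _).trans (le_max_right _ _)).trans hm
  set F : ℂ × ℂ → ℝ := fun q => ‖Tf q.1 m‖ * (‖chi' q.1 q.2 m‖ + ‖phi' q.1 q.2 m‖) +
      ‖Tf q.1 m * sf q.1 m‖ * (‖chi q.1 q.2 m‖ + ‖phi q.1 q.2 m‖) with hF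
  have hFc : Continuous F := by
    have c1 : Continuous (fun q : ℂ × ℂ => Tf q.1 m) := (Tf_cont _).comp continuous_fst
    have c2 : Continuous (fun q : ℂ × ℂ => sf q.1 m) := (sf_cont _).comp continuous_fst
    have k : Continuous (fun q : ℂ × ℂ => (q, (m : ℂ))) := by fun_prop
    have c3 : Continuous (fun q : ℂ × ℂ => phi q.1 q.2 m) := phi_cont.comp k
    have c4 : Continuous (fun q : ℂ × ℂ => phi' q.1 q.2 m) := phi'_cont.comp k
    have c5 : Continuous (fun q : ℂ × ℂ => chi q.1 q.2 m) := chi_cont.comp k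
    have c6 : Continuous (fun q : ℂ × ℂ => chi' q.1 q.2 m) := chi'_cont.comp k
    fun_prop
  obtain ⟨C, hC⟩ := ((isCompact_closedBall (0:ℂ) B).prod (isCompact_closedBall (0:ℂ) B)).exists_bound_of_continuousOn
    hFc.continuousOn
  refine ⟨m, fun n => 2 * Real.sqrt ((Real.exp (D2 * (n:ℝ) ^ (-(1 / 2) : ℝ)) - 1) *
      Real.exp (D1 * (m:ℝ) ^ (-(1 / 2) : ℝ))) * C, ?_, ?_⟩
  · have t1 : Tendsto (fun n : ℕ => (n:ℝ) ^ (-(1 / 2) : ℝ)) atTop (nhds 0) :=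
      (tendsto_rpow_neg_atTop (by norm_num)).comp tendsto_natCast_atTop_atTop
    have t2 : Tendsto (fun n : ℕ => 2 * Real.sqrt ((Real.exp (D2 * (n:ℝ) ^ (-(1 / 2) : ℝ)) - 1) *
      Real.exp (D1 * (m:ℝ) ^ (-(1 / 2) : ℝ))) * C) atTop (nhds (2 * Real.sqrt ((Real.exp (D2 * 0) - 1) *
      Real.exp (D1 * (m:ℝ) ^ (-(1 / 2) : ℝ))) * C)) := by
      apply Tendsto.mul_const
      apply Tendsto.const_mul
      apply (Real.continuous_sqrt.tendsto _).comp
      apply Tendsto.mul_const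
      apply Tendsto.sub_const
      exact (Real.continuous_exp.tendsto _).comp (t1.const_mul D2)
    simpa using t2
  intro n p hn hp a l ha hl
  have hmn : (m:ℝ) ≤ n := by exact_mod_cast hn
  have hnp : (n:ℝ) ≤ p := by exact_mod_cast hp
  have hm0 : (0:ℝ) < m := by linarith
  have hn0 : (0:ℝ) < n := by linarith
  set c := y0n p a l - y0n n a l with hc
  set d := y1n p a l - y1n n a l with hd
  have lin : ∀ z, cmb a l c d z = cmb a l (y0n p a l) (y1n p a l) z - cmb a l (y0n n a l) (y1n n a l) z := by
    intro z; simp only [cmb, hc, hd]; ring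
  have lin' : ∀ z, cmb' a l c d z =
      cmb' a l (y0n p a l) (y1n p a l) z - cmb' a l (y0n n a l) (y1n n a l) z := by
    intro z; simp only [cmb', hc, hd]; ring
  have hTn : Tf a n ≠ 0 := Tf_ne (by exact_mod_cast hn0.ne')
  have hTm : Tf a m ≠ 0 := Tf_ne (by exact_mod_cast hm0.ne')
  have hsn : sf a n ≠ 0 := hs a n ha (by rw [Complex.norm_natCast]; linarith)
  have hsm : sf a m ≠ 0 := hs a m ha (by rw [Complex.norm_natCast]; linarith)
  have v1 : Vf a 0 n (cmb a l c d n) (cmb' a l c d n) ≤ Real.exp (D2 * (n:ℝ) ^ (-(1 / 2) : ℝ)) - 1 := by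
    have := h2 a l ha hl n p (by linarith) hnp
    rw [Vf_exact (by exact_mod_cast hTn) (by exact_mod_cast hsn)] at this
    rw [lin, lin', (cmb_at n a l).1, (cmb_at n a l).2]
    simp at this
    simp
    linarith
  have v2 := h1 a l ha hl _ _ (cmb_isSol a l c d) 0 le_rfl m 1 (n - m) m
    (by linarith) hmR1 (by simp) (fun t ht => by
      have := real_path hm0 ht.1
      exact_mod_cast this)
  have e : (m : ℂ) + ((n - m : ℝ) : ℂ) * 1 = n := by push_cast; ring
  rw [e] at v2
  have v3 : Vf a 0 m (cmb a l c d m) (cmb' a l c d m) ≤ (Real.exp (D2 * (n:ℝ) ^ (-(1 / 2) : ℝ)) - 1) *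
      Real.exp (D1 * (m:ℝ) ^ (-(1 / 2) : ℝ)) := by
    have : Vf a 0 m (cmb a l c d m) (cmb' a l c d m) ≤ Vf a 0 n (cmb a l c d n) (cmb' a l c d n) *
      Real.exp (D1 * (m:ℝ) ^ (-(1 / 2) : ℝ)) := by simpa using v2
    exact this.trans (mul_le_mul_of_nonneg_right v1 (Real.exp_pos _).le)
  obtain ⟨b1, b2⟩ := Vf_bound hTm hsm 0 (cmb a l c d m) (cmb' a l c d m)
  have sq := Real.sqrt_le_sqrt v3
  set E := Real.sqrt ((Real.exp (D2 * (n:ℝ) ^ (-(1 / 2) : ℝ)) - 1) *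
      Real.exp (D1 * (m:ℝ) ^ (-(1 / 2) : ℝ))) with hE
  have hE0 : 0 ≤ E := Real.sqrt_nonneg _
  rw [Complex.ofReal_zero, sub_zero, norm_div, div_le_iff₀ (norm_pos_iff.2 hTm)] at b1
  rw [Complex.ofReal_zero, sub_zero, norm_div, div_le_iff₀ (norm_pos_iff.2 (mul_ne_zero hTm hsm))] at b2
  have b1' : ‖cmb a l c d m‖ ≤ 2 * E * ‖Tf a m‖ := b1.trans (by gcongr)
  have b2' : ‖cmb' a l c d m‖ ≤ 2 * E * ‖Tf a m * sf a m‖ := b2.trans (by gcongr)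
  have hFC : F (a, l) ≤ C := (le_abs_self _).trans (hC (a, l) ⟨by simpa using ha, by simpa using hl⟩)
  have fin : 2 * E * F (a, l) ≤ 2 * E * C := by gcongr
  obtain ⟨q1, q2⟩ := coef_of_values a l c d m
  constructor
  · refine le_trans ?_ fin
    rw [q1]
    refine (norm_sub_le _ _).trans ?_
    rw [norm_mul, norm_mul]
    have i1 : ‖cmb a l c d m‖ * ‖chi' a l m‖ ≤ 2 * E * ‖Tf a m‖ * ‖chi' a l m‖ := by gcongr
    have i2 : ‖cmb' a l c d m‖ * ‖chi a l m‖ ≤ 2 * E * ‖Tf a m * sf a m‖ * ‖chi a l m‖ := by gcongr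
    have i3 : 0 ≤ 2 * E * ‖Tf a m‖ * ‖phi' a l m‖ := by positivity
    have i4 : 0 ≤ 2 * E * ‖Tf a m * sf a m‖ * ‖phi a l m‖ := by positivity
    simp only [hF]
    nlinarith
  · refine le_trans ?_ fin
    rw [q2]
    refine (norm_add_le _ _).trans ?_
    rw [norm_neg, norm_mul, norm_mul]
    have i1 : ‖cmb a l c d m‖ * ‖phi' a l m‖ ≤ 2 * E * ‖Tf a m‖ * ‖phi' a l m‖ := by gcongr
    have i2 : ‖cmb' a l c d m‖ * ‖phi a l m‖ ≤ 2 * E * ‖Tf a m * sf a m‖ * ‖phi a l m‖ := by gcongr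
    have i3 : 0 ≤ 2 * E * ‖Tf a m‖ * ‖chi' a l m‖ := by positivity
    have i4 : 0 ≤ 2 * E * ‖Tf a m * sf a m‖ * ‖chi a l m‖ := by positivity
    simp only [hF]
    nlinarith

end Cub


namespace Cub

lemma y0n_cauchySeq (a l : ℂ) : CauchySeq (fun n => y0n n a l) ∧ CauchySeq (fun n => y1n n a l) := by
  obtain ⟨n0, η, hη, h⟩ := coef_cauchy (max ‖a‖ ‖l‖) (le_max_of_le_left (norm_nonneg _))
  constructor
  all_goals
    rw [Metric.cauchySeq_iff']
    intro ε hε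
    obtain ⟨n1, hn1⟩ := eventually_atTop.1 (hη.eventually (gt_mem_nhds hε))
    refine ⟨max n0 n1, fun n hn => ?_⟩
    rw [dist_eq_norm]
    refine lt_of_le_of_lt ?_ (hn1 (max n0 n1) (le_max_right _ _))
  · exact (h (max n0 n1) n (le_max_left _ _) hn a l (le_max_left _ _) (le_max_right _ _)).1
  · exact (h (max n0 n1) n (le_max_left _ _) hn a l (le_max_left _ _) (le_max_right _ _)).2

noncomputable def y0 (a l : ℂ) : ℂ := limUnder atTop (fun n => y0n n a l)
noncomputable def y1 (a l : ℂ) : ℂ := limUnder atTop (fun n => y1n n a l)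

lemma y0_tendsto (a l : ℂ) : Tendsto (fun n => y0n n a l) atTop (nhds (y0 a l)) :=
  (y0n_cauchySeq a l).1.tendsto_limUnder
lemma y1_tendsto (a l : ℂ) : Tendsto (fun n => y1n n a l) atTop (nhds (y1 a l)) :=
  (y0n_cauchySeq a l).2.tendsto_limUnder

lemma coef_limit (B : ℝ) (hB : 0 ≤ B) : ∃ (n0 : ℕ) (η : ℕ → ℝ), Tendsto η atTop (nhds 0) ∧
    ∀ n : ℕ, n0 ≤ n → ∀ a l : ℂ, ‖a‖ ≤ B → ‖l‖ ≤ B →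
      ‖y0 a l - y0n n a l‖ ≤ η n ∧ ‖y1 a l - y1n n a l‖ ≤ η n := by
  obtain ⟨n0, η, hη, h⟩ := coef_cauchy B hB
  refine ⟨n0, η, hη, fun n hn a l ha hl => ⟨?_, ?_⟩⟩
  · refine le_of_tendsto ((y0_tendsto a l).sub_const _).norm ?_
    filter_upwards [eventually_ge_atTop n] with p hp
    exact (h n p hn hp a l ha hl).1
  · refine le_of_tendsto ((y1_tendsto a l).sub_const _).norm ?_
    filter_upwards [eventually_ge_atTop n] with p hp
    exact (h n p hn hp a l ha hl).2

lemma y_unif (B : ℝ) (hB : 0 ≤ B) :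
    TendstoUniformlyOn (fun n (q : ℂ × ℂ) => y0n n q.1 q.2) (fun q => y0 q.1 q.2) atTop
      {q | ‖q.1‖ ≤ B ∧ ‖q.2‖ ≤ B} ∧
    TendstoUniformlyOn (fun n (q : ℂ × ℂ) => y1n n q.1 q.2) (fun q => y1 q.1 q.2) atTop
      {q | ‖q.1‖ ≤ B ∧ ‖q.2‖ ≤ B} := by
  obtain ⟨n0, η, hη, h⟩ := coef_limit B hB
  constructor
  all_goals
    rw [Metric.tendstoUniformlyOn_iff]
    intro ε hε
    filter_upwards [eventually_ge_atTop n0, hη.eventually (gt_mem_nhds hε)] with n hn hε' q hq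
    rw [dist_eq_norm]
    refine lt_of_le_of_lt ?_ hε'
  · exact (h n hn q.1 q.2 hq.1 hq.2).1
  · exact (h n hn q.1 q.2 hq.1 hq.2).2

lemma yn_cont (n : ℕ) : Continuous (fun q : ℂ × ℂ => y0n n q.1 q.2) ∧
    Continuous (fun q : ℂ × ℂ => y1n n q.1 q.2) := by
  have c1 : Continuous (fun q : ℂ × ℂ => Tf q.1 n) := (Tf_cont _).comp continuous_fst
  have c2 : Continuous (fun q : ℂ × ℂ => sf q.1 n) := (sf_cont _).comp continuous_fst
  have k : Continuous (fun q : ℂ × ℂ => (q, (n : ℂ))) := by fun_prop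
  have c3 : Continuous (fun q : ℂ × ℂ => phi q.1 q.2 n) := phi_cont.comp k
  have c4 : Continuous (fun q : ℂ × ℂ => phi' q.1 q.2 n) := phi'_cont.comp k
  have c5 : Continuous (fun q : ℂ × ℂ => chi q.1 q.2 n) := chi_cont.comp k
  have c6 : Continuous (fun q : ℂ × ℂ => chi' q.1 q.2 n) := chi'_cont.comp k
  unfold y0n y1n
  constructor <;> fun_prop

lemma cont_of_bdd_unif {F : ℕ → ℂ × ℂ → ℂ} {f : ℂ × ℂ → ℂ} (hF : ∀ n, Continuous (F n))
    (h : ∀ B : ℝ, 0 ≤ B → TendstoUniformlyOn F f atTop {q | ‖q.1‖ ≤ B ∧ ‖q.2‖ ≤ B}) :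
    Continuous f := by
  rw [continuous_iff_continuousAt]
  intro q
  have hc : ContinuousOn f {p : ℂ × ℂ | ‖p.1‖ ≤ ‖q‖ + 1 ∧ ‖p.2‖ ≤ ‖q‖ + 1} :=
    (h (‖q‖ + 1) (by positivity)).continuousOn (Eventually.of_forall fun n => (hF n).continuousOn).frequently
  apply hc.continuousAt
  apply mem_of_superset (Metric.ball_mem_nhds q one_pos)
  intro p hp
  rw [Metric.mem_ball, dist_eq_norm] at hp
  have : ‖p‖ ≤ ‖q‖ + 1 := by
    calc ‖p‖ = ‖(p - q) + q‖ := by simp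
      _ ≤ ‖p - q‖ + ‖q‖ := norm_add_le _ _
      _ ≤ _ := by linarith
  exact ⟨(norm_fst_le p).trans this, (norm_snd_le p).trans this⟩

lemma y0_cont : Continuous (fun q : ℂ × ℂ => y0 q.1 q.2) :=
  cont_of_bdd_unif (fun n => (yn_cont n).1) (fun B hB => (y_unif B hB).1)
lemma y1_cont : Continuous (fun q : ℂ × ℂ => y1 q.1 q.2) :=
  cont_of_bdd_unif (fun n => (yn_cont n).2) (fun B hB => (y_unif B hB).2)

lemma Tf_curve {a : ℂ → ℂ} (ha : Differentiable ℂ a) (z : ℂ) : Differentiable ℂ (fun t => Tf (a t) z) := by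
  unfold Tf; fun_prop
lemma sf_curve {a : ℂ → ℂ} (ha : Differentiable ℂ a) (z : ℂ) : Differentiable ℂ (fun t => sf (a t) z) := by
  unfold sf; fun_prop

lemma yn_curve {a l : ℂ → ℂ} (ha : Differentiable ℂ a) (hl : Differentiable ℂ l) (n : ℕ) :
    Differentiable ℂ (fun t => y0n n (a t) (l t)) ∧ Differentiable ℂ (fun t => y1n n (a t) (l t)) := by
  have c1 := Tf_curve ha n
  have c2 := sf_curve ha n
  have c3 : Differentiable ℂ (fun t => phi (a t) (l t) n) :=
    pser_curve ha hl (differentiable_const (n : ℂ)) 1 0 (by simp) (by simp)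
  have c4 : Differentiable ℂ (fun t => chi (a t) (l t) n) :=
    pser_curve ha hl (differentiable_const (n : ℂ)) 0 1 (by simp) (by simp)
  have c5 : Differentiable ℂ (fun t => phi' (a t) (l t) n) :=
    pser_curve' ha hl (differentiable_const (n : ℂ)) 1 0 (by simp) (by simp)
  have c6 : Differentiable ℂ (fun t => chi' (a t) (l t) n) :=
    pser_curve' ha hl (differentiable_const (n : ℂ)) 0 1 (by simp) (by simp)
  unfold y0n y1n
  exact ⟨(c1.mul c6).sub ((c2.mul c1).mul c4), (c1.mul c5).neg.add ((c2.mul c1).mul c3)⟩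

lemma diff_of_bdd_unif {F : ℕ → ℂ × ℂ → ℂ} {f : ℂ × ℂ → ℂ}
    (h : ∀ B : ℝ, 0 ≤ B → TendstoUniformlyOn F f atTop {q | ‖q.1‖ ≤ B ∧ ‖q.2‖ ≤ B})
    {a l : ℂ → ℂ} (ha : Differentiable ℂ a) (hl : Differentiable ℂ l)
    (hF : ∀ n, Differentiable ℂ (fun t => F n (a t, l t))) :
    Differentiable ℂ (fun t => f (a t, l t)) := by
  intro p
  set B := max (‖a p‖ + 1) (‖l p‖ + 1) with hB
  set U := {t | ‖a t‖ < B ∧ ‖l t‖ < B} with hU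
  have hUo : IsOpen U :=
    (isOpen_lt ha.continuous.norm continuous_const).inter (isOpen_lt hl.continuous.norm continuous_const)
  have hp : p ∈ U := ⟨lt_of_lt_of_le (by linarith) (le_max_left _ _),
    lt_of_lt_of_le (by linarith) (le_max_right _ _)⟩
  have h1 : TendstoUniformlyOn (fun n t => F n (a t, l t)) (fun t => f (a t, l t)) atTop U :=
    ((h B (le_max_of_le_left (by positivity))).comp (fun t => (a t, l t))).mono
      (fun t ht => ⟨ht.1.le, ht.2.le⟩)
  exact (h1.tendstoLocallyUniformlyOn.differentiableOn
    (Eventually.of_forall fun n => (hF n).differentiableOn) hUo).differentiableAt (hUo.mem_nhds hp)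

lemma y_curve {a l : ℂ → ℂ} (ha : Differentiable ℂ a) (hl : Differentiable ℂ l) :
    Differentiable ℂ (fun t => y0 (a t) (l t)) ∧ Differentiable ℂ (fun t => y1 (a t) (l t)) :=
  ⟨diff_of_bdd_unif (fun B hB => (y_unif B hB).1) ha hl (fun n => (yn_curve ha hl n).1),
   diff_of_bdd_unif (fun B hB => (y_unif B hB).2) ha hl (fun n => (yn_curve ha hl n).2)⟩

/-- The subdominant solution and its derivative. -/
noncomputable def Y (a l z : ℂ) : ℂ := cmb a l (y0 a l) (y1 a l) z
noncomputable def Y' (a l z : ℂ) : ℂ := cmb' a l (y0 a l) (y1 a l) z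

lemma Y_isSol (a l : ℂ) : IsSol a l (Y a l) (Y' a l) := cmb_isSol _ _ _ _

lemma Y_cont : Continuous (fun q : (ℂ × ℂ) × ℂ => Y q.1.1 q.1.2 q.2) := by
  have h0 := y0_cont.comp (continuous_fst : Continuous (fun q : (ℂ × ℂ) × ℂ => q.1))
  have h1 := y1_cont.comp (continuous_fst : Continuous (fun q : (ℂ × ℂ) × ℂ => q.1))
  exact (h0.mul phi_cont).add (h1.mul chi_cont)

lemma Y'_cont : Continuous (fun q : (ℂ × ℂ) × ℂ => Y' q.1.1 q.1.2 q.2) := by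
  have h0 := y0_cont.comp (continuous_fst : Continuous (fun q : (ℂ × ℂ) × ℂ => q.1))
  have h1 := y1_cont.comp (continuous_fst : Continuous (fun q : (ℂ × ℂ) × ℂ => q.1))
  exact (h0.mul phi'_cont).add (h1.mul chi'_cont)

lemma Y_curve {a l z : ℂ → ℂ} (ha : Differentiable ℂ a) (hl : Differentiable ℂ l)
    (hz : Differentiable ℂ z) : Differentiable ℂ (fun t => Y (a t) (l t) (z t)) ∧
      Differentiable ℂ (fun t => Y' (a t) (l t) (z t)) := by
  obtain ⟨h0, h1⟩ := y_curve ha hl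
  constructor
  · exact (h0.mul (pser_curve ha hl hz 1 0 (by simp) (by simp))).add
      (h1.mul (pser_curve ha hl hz 0 1 (by simp) (by simp)))
  · exact (h0.mul (pser_curve' ha hl hz 1 0 (by simp) (by simp))).add
      (h1.mul (pser_curve' ha hl hz 0 1 (by simp) (by simp)))

/-! ### Conjugation symmetry -/

local notation "cj" => starRingEnd ℂ

lemma cf_conj (a l y0 y1 : ℂ) (n : ℕ) : cf (cj a) (cj l) (cj y0) (cj y1) n = cj (cf a l y0 y1 n) := by
  induction n using Nat.strong_induction_on with
  | _ n ih =>
    match n, ih with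
    | 0, _ => simp [cf]
    | 1, _ => simp [cf]
    | 2, _ => simp [map_ofNat, cf]
    | 3, _ => simp [map_ofNat, cf]
    | 4, _ => simp [map_ofNat, cf]
    | n + 5, ih =>
      have i3 := ih (n + 3) (by omega)
      have i2 := ih (n + 2) (by omega)
      have i0 := ih n (by omega)
      simp [map_ofNat, cf, i3, i2, i0]

lemma pser_conj (c : ℕ → ℂ) (z : ℂ) : pser (fun n => cj (c n)) (cj z) = cj (pser c z) := by
  unfold pser
  rw [Complex.conj_tsum]
  simp

lemma sol_conj (a l z : ℂ) : phi (cj a) (cj l) (cj z) = cj (phi a l z) ∧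
    phi' (cj a) (cj l) (cj z) = cj (phi' a l z) ∧ chi (cj a) (cj l) (cj z) = cj (chi a l z) ∧
    chi' (cj a) (cj l) (cj z) = cj (chi' a l z) := by
  have h1 : ∀ n, cf (cj a) (cj l) 1 0 n = cj (cf a l 1 0 n) := fun n => by
    have := cf_conj a l 1 0 n
    simpa using this
  have h2 : ∀ n, cf (cj a) (cj l) 0 1 n = cj (cf a l 0 1 n) := fun n => by
    have := cf_conj a l 0 1 n
    simpa using this
  have e1 : cf (cj a) (cj l) 1 0 = fun n => cj (cf a l 1 0 n) := funext h1
  have e2 : cf (cj a) (cj l) 0 1 = fun n => cj (cf a l 0 1 n) := funext h2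
  have e3 : shiftc (cf (cj a) (cj l) 1 0) = fun n => cj (shiftc (cf a l 1 0) n) := by
    funext n; simp [shiftc, e1]
  have e4 : shiftc (cf (cj a) (cj l) 0 1) = fun n => cj (shiftc (cf a l 0 1) n) := by
    funext n; simp [shiftc, e2]
  refine ⟨?_, ?_, ?_, ?_⟩
  · rw [phi, e1, pser_conj]; rfl
  · rw [phi', e3, pser_conj]; rfl
  · rw [chi, e2, pser_conj]; rfl
  · rw [chi', e4, pser_conj]; rfl

lemma rt_conj {z : ℂ} (hz : z.arg ≠ Real.pi) : rt (cj z) = cj (rt z) := by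
  unfold rt
  rw [Complex.conj_cpow _ _ hz]
  simp [map_ofNat]

lemma Tf_conj (a : ℂ) {z : ℂ} (hz : z.arg ≠ Real.pi) : Tf (cj a) (cj z) = cj (Tf a z) := by
  simp [Tf, rt_conj hz, ← Complex.exp_conj, map_ofNat]

lemma sf_conj (a : ℂ) {z : ℂ} (hz : z.arg ≠ Real.pi) : sf (cj a) (cj z) = cj (sf a z) := by
  simp [sf, rt_conj hz, map_ofNat]

lemma yn_conj (n : ℕ) (a l : ℂ) : y0n n (cj a) (cj l) = cj (y0n n a l) ∧
    y1n n (cj a) (cj l) = cj (y1n n a l) := by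
  have hn : (n : ℂ).arg ≠ Real.pi := by
    rw [Complex.natCast_arg]; exact Real.pi_ne_zero.symm
  have hc : cj (n : ℂ) = n := by simp
  obtain ⟨h1, h2, h3, h4⟩ := sol_conj a l n
  have h5 := Tf_conj a hn
  have h6 := sf_conj a hn
  rw [hc] at h1 h2 h3 h4 h5 h6
  simp [y0n, y1n, h1, h2, h3, h4, h5, h6]

lemma y_conj (a l : ℂ) : y0 (cj a) (cj l) = cj (y0 a l) ∧ y1 (cj a) (cj l) = cj (y1 a l) := by
  constructor
  · refine tendsto_nhds_unique (y0_tendsto (cj a) (cj l)) ?_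
    have := (Complex.continuous_conj.tendsto _).comp (y0_tendsto a l)
    refine this.congr fun n => ?_
    exact (yn_conj n a l).1.symm
  · refine tendsto_nhds_unique (y1_tendsto (cj a) (cj l)) ?_
    have := (Complex.continuous_conj.tendsto _).comp (y1_tendsto a l)
    refine this.congr fun n => ?_
    exact (yn_conj n a l).2.symm

lemma Y_conj (a l z : ℂ) : Y (cj a) (cj l) (cj z) = cj (Y a l z) ∧
    Y' (cj a) (cj l) (cj z) = cj (Y' a l z) := by
  obtain ⟨h1, h2, h3, h4⟩ := sol_conj a l z
  obtain ⟨h5, h6⟩ := y_conj a l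
  simp [Y, Y', cmb, cmb', h1, h2, h3, h4, h5, h6]

end Cub


namespace Cub

local notation "cj" => starRingEnd ℂ

lemma rt_polar (z : ℂ) (hz : z ≠ 0) : rt z = ‖rt z‖ * exp ((z.arg / 4 : ℝ) * I) := by
  have h1 : rt z = exp (((Real.log ‖z‖ / 4 : ℝ) : ℂ)) * exp ((z.arg / 4 : ℝ) * I) := by
    rw [rt, Complex.cpow_def_of_ne_zero hz, ← Complex.exp_add]
    congr 1
    rw [Complex.log]
    push_cast
    ring
  have h2 : ‖rt z‖ = Real.exp (Real.log ‖z‖ / 4) := by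
    rw [h1, norm_mul, Complex.norm_exp_ofReal_mul_I, mul_one, ← Complex.ofReal_exp, Complex.norm_real,
      Real.norm_of_nonneg (Real.exp_pos _).le]
  rw [h2]
  rw [h1]
  push_cast
  rfl

lemma cos_72 : 0.3 ≤ Real.cos (2 * Real.pi / 5) := by
  have h : 2 * Real.pi / 5 = 2 * (Real.pi / 5) := by ring
  rw [h, Real.cos_two_mul, Real.cos_pi_div_five]
  have h5 : Real.sqrt 5 ^ 2 = 5 := Real.sq_sqrt (by norm_num)
  have : 2.2 ≤ Real.sqrt 5 := Real.le_sqrt_of_sq_le (by norm_num)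
  nlinarith

lemma sin_27 : 0.45 ≤ Real.sin (3 * Real.pi / 20) := by
  have h1 : 0.47 ≤ 3 * Real.pi / 20 := by linarith [Real.pi_gt_d2]
  have h2 : Real.sin 0.47 ≤ Real.sin (3 * Real.pi / 20) :=
    Real.sin_le_sin_of_le_of_le_pi_div_two (by linarith [Real.pi_gt_d2]) (by linarith [Real.pi_pos]) h1
  have h3 := Real.sin_gt_sub_cube (x := 0.47) (by norm_num)
  norm_num at h3 h2 ⊢
  linarith

lemma cone_arg {x y : ℝ} (hx : 0 < x) (hy : 0 ≤ y)
    (h : y * Real.cos (2 * Real.pi / 5) ≤ x * Real.sin (2 * Real.pi / 5)) :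
    0 ≤ (⟨x, y⟩ : ℂ).arg ∧ (⟨x, y⟩ : ℂ).arg ≤ 2 * Real.pi / 5 := by
  set z : ℂ := ⟨x, y⟩ with hz
  have h0 : 0 ≤ z.arg := Complex.arg_nonneg_iff.2 hy
  have h1 : |z.arg| < Real.pi / 2 := Complex.abs_arg_lt_pi_div_two_iff.2 (Or.inl hx)
  refine ⟨h0, ?_⟩
  by_contra hlt
  push Not at hlt
  have hzn : z ≠ 0 := fun hh => by
    have := congrArg Complex.re hh
    simp [hz] at this
    linarith
  have hpos : 0 < ‖z‖ := norm_pos_iff.2 hzn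
  have h2 : 0 < Real.sin (z.arg - 2 * Real.pi / 5) :=
    Real.sin_pos_of_pos_of_lt_pi (by linarith) (by linarith [le_abs_self z.arg, Real.pi_pos])
  rw [Real.sin_sub, Complex.sin_arg, Complex.cos_arg hzn] at h2
  have e : z.im / ‖z‖ * Real.cos (2 * Real.pi / 5) - z.re / ‖z‖ * Real.sin (2 * Real.pi / 5)
    = (y * Real.cos (2 * Real.pi / 5) - x * Real.sin (2 * Real.pi / 5)) / ‖z‖ := by
    simp only [hz]; ring
  rw [e] at h2
  have := (div_pos_iff_of_pos_right hpos).1 h2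
  linarith

lemma arg_cone {z : ℂ} (hz : z ≠ 0) (h0 : 0 ≤ z.arg) (h1 : z.arg ≤ 2 * Real.pi / 5) :
    0.3 * ‖z‖ ≤ z.re ∧ 0 ≤ z.im ∧
      z.im * Real.cos (2 * Real.pi / 5) ≤ z.re * Real.sin (2 * Real.pi / 5) := by
  have hpos : 0 < ‖z‖ := norm_pos_iff.2 hz
  have hc : Real.cos (2 * Real.pi / 5) ≤ Real.cos z.arg :=
    Real.cos_le_cos_of_nonneg_of_le_pi h0 (by linarith [Real.pi_pos]) h1
  have hre : z.re = ‖z‖ * Real.cos z.arg := (Complex.norm_mul_cos_arg z).symm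
  have him : z.im = ‖z‖ * Real.sin z.arg := (Complex.norm_mul_sin_arg z).symm
  refine ⟨?_, Complex.arg_nonneg_iff.1 h0, ?_⟩
  · rw [hre]; nlinarith [cos_72]
  · have h2 : 0 ≤ Real.sin (2 * Real.pi / 5 - z.arg) :=
      Real.sin_nonneg_of_nonneg_of_le_pi (by linarith) (by linarith [Real.pi_pos])
    rw [Real.sin_sub] at h2
    rw [hre, him]
    nlinarith

lemma exp_pi4 : exp ((-(Real.pi / 4) : ℝ) * I) = ⟨Real.sqrt 2 / 2, -(Real.sqrt 2 / 2)⟩ := by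
  apply Complex.ext
  · rw [Complex.exp_ofReal_mul_I_re]; simp
  · rw [Complex.exp_ofReal_mul_I_im]; simp

lemma cone_path {z0 : ℂ} (hz : z0 ≠ 0) (h0 : 0 ≤ z0.arg) (h1 : z0.arg ≤ 2 * Real.pi / 5) {t : ℝ}
    (ht : t ∈ Set.Icc 0 (Real.sqrt 2 * z0.im)) :
    z0 + t * exp ((-(Real.pi / 4) : ℝ) * I) ∈ slitPlane ∧
      (‖z0‖ + t) / 2 ≤ ‖z0 + t * exp ((-(Real.pi / 4) : ℝ) * I)‖ ∧
      2 / 5 * ‖rt (z0 + t * exp ((-(Real.pi / 4) : ℝ) * I))‖ ^ 6 ≤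
        (exp ((-(Real.pi / 4) : ℝ) * I) * rt (z0 + t * exp ((-(Real.pi / 4) : ℝ) * I)) ^ 6).re := by
  obtain ⟨hre, him, hcone⟩ := arg_cone hz h0 h1
  have hpos : 0 < ‖z0‖ := norm_pos_iff.2 hz
  have hs2 : Real.sqrt 2 ^ 2 = 2 := Real.sq_sqrt (by norm_num)
  have hs1 : 1.41 ≤ Real.sqrt 2 := Real.le_sqrt_of_sq_le (by norm_num)
  have hs3 : Real.sqrt 2 ≤ 1.42 := Real.sqrt_le_iff.2 ⟨by norm_num, by norm_num⟩
  have ht0 := ht.1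
  have hx : 0 < z0.re := by linarith
  set ζ := z0 + t * exp ((-(Real.pi / 4) : ℝ) * I) with hζ
  have hζe : ζ = ⟨z0.re + t * (Real.sqrt 2 / 2), z0.im - t * (Real.sqrt 2 / 2)⟩ := by
    rw [hζ, exp_pi4]
    apply Complex.ext
    · simp
    · simp; ring
  have him' : 0 ≤ z0.im - t * (Real.sqrt 2 / 2) := by
    have := mul_le_mul_of_nonneg_right ht.2 (show 0 ≤ Real.sqrt 2 / 2 by positivity)
    nlinarith
  have hre' : 0 < z0.re + t * (Real.sqrt 2 / 2) := by positivity
  have hca := cone_arg hre' him' (by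
    have hc : 0 ≤ Real.cos (2 * Real.pi / 5) := by linarith [cos_72]
    have hsn : 0 ≤ Real.sin (2 * Real.pi / 5) :=
      Real.sin_nonneg_of_nonneg_of_le_pi (by positivity) (by linarith [Real.pi_pos])
    have h3 : 0 ≤ t * (Real.sqrt 2 / 2) := by positivity
    nlinarith [mul_nonneg h3 hc, mul_nonneg h3 hsn])
  rw [← hζe] at hca
  have hsl : ζ ∈ slitPlane := by
    left; rw [hζe]; exact hre'
  refine ⟨hsl, ?_, ?_⟩
  · have hn : ‖ζ‖ ^ 2 = ‖z0‖ ^ 2 + Real.sqrt 2 * t * (z0.re - z0.im) + t ^ 2 := by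
      rw [Complex.sq_norm, Complex.sq_norm, hζe, Complex.normSq_mk, Complex.normSq_apply]
      linear_combination (t ^ 2 / 2) * hs2
    have hn0 : ‖z0‖ ^ 2 = z0.re ^ 2 + z0.im ^ 2 := by
      rw [Complex.sq_norm, Complex.normSq_apply]; ring
    have him1 : z0.im ≤ 0.955 * ‖z0‖ := by
      refine le_of_pow_le_pow_left₀ two_ne_zero (by positivity) ?_
      nlinarith
    have h4 : -(0.655 * ‖z0‖) ≤ z0.re - z0.im := by linarith
    have h5 : -(0.94 * ‖z0‖ * t) ≤ Real.sqrt 2 * t * (z0.re - z0.im) := by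
      have h6 : Real.sqrt 2 * t * (-(0.655 * ‖z0‖)) ≤ Real.sqrt 2 * t * (z0.re - z0.im) :=
        mul_le_mul_of_nonneg_left h4 (by positivity)
      nlinarith [mul_nonneg ht0 hpos.le]
    refine le_of_pow_le_pow_left₀ two_ne_zero (norm_nonneg _) ?_
    rw [hn]
    nlinarith [sq_nonneg (‖z0‖ - t), mul_nonneg ht0 hpos.le]
  · have hz0 : ζ ≠ 0 := slitPlane_ne_zero hsl
    have e : exp ((-(Real.pi / 4) : ℝ) * I) * rt ζ ^ 6
        = ((‖rt ζ‖ ^ 6 : ℝ) : ℂ) * exp ((3 / 2 * ζ.arg - Real.pi / 4 : ℝ) * I) := by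
      conv_lhs => rw [rt_polar ζ hz0]
      rw [mul_pow, ← Complex.exp_nat_mul, mul_left_comm, ← Complex.exp_add]
      push_cast
      congr 2
      ring
    rw [e, Complex.re_ofReal_mul, Complex.exp_ofReal_mul_I_re]
    have hcos : 0.45 ≤ Real.cos (3 / 2 * ζ.arg - Real.pi / 4) := by
      refine sin_27.trans ?_
      rw [← Real.cos_abs, ← Real.sin_pi_div_two_sub]
      have hab : |3 / 2 * ζ.arg - Real.pi / 4| ≤ 7 * Real.pi / 20 := by
        rw [abs_le]; constructor <;> linarith [Real.pi_pos, hca.1, hca.2]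
      apply Real.sin_le_sin_of_le_of_le_pi_div_two
      · linarith [Real.pi_pos]
      · linarith [abs_nonneg (3 / 2 * ζ.arg - Real.pi / 4)]
      · linarith
    have : 0 ≤ ‖rt ζ‖ ^ 6 := by positivity
    nlinarith

/-- energy bound in the upper part of the sector -/
lemma Y_V (B : ℝ) (hB : 0 ≤ B) : ∃ R D : ℝ, 1 ≤ R ∧ 0 ≤ D ∧ ∀ a l z : ℂ, ‖a‖ ≤ B → ‖l‖ ≤ B →
    R ≤ ‖z‖ → 0 ≤ z.arg → z.arg ≤ 2 * Real.pi / 5 →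
    Vf a 1 z (Y a l z) (Y' a l z) + 1 ≤ Real.exp (D * ‖z‖ ^ (-(1 / 2) : ℝ)) := by
  obtain ⟨R1, D1, hR1, hD1, h1⟩ := approx_V B hB
  obtain ⟨R2, D2, hR2, hD2, h2⟩ := segment_bound B hB
  refine ⟨max R1 R2, D1 + D2, hR1.trans (le_max_left _ _), by positivity, ?_⟩
  intro a l z ha hl hz hz0 hz1
  have hpos : 0 < ‖z‖ := by linarith [le_max_left R1 R2]
  have hzn : z ≠ 0 := norm_pos_iff.1 hpos
  obtain ⟨hre, him, hcone⟩ := arg_cone hzn hz0 hz1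
  have hs2 : Real.sqrt 2 ^ 2 = 2 := Real.sq_sqrt (by norm_num)
  set x1 := z.re + z.im with hx1
  have hx1z : ‖z‖ ≤ x1 := by
    refine (Complex.norm_le_abs_re_add_abs_im z).trans ?_
    rw [abs_of_nonneg (by nlinarith), abs_of_nonneg him]
  have hend : z + ((Real.sqrt 2 * z.im : ℝ) : ℂ) * exp ((-(Real.pi / 4) : ℝ) * I) = x1 := by
    rw [exp_pi4]
    apply Complex.ext
    · simp [hx1]; linear_combination (z.im / 2) * hs2
    · simp; linear_combination (-z.im / 2) * hs2
  have key : ∀ᶠ p : ℕ in atTop,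
      Vf a 1 z (cmb a l (y0n p a l) (y1n p a l) z) (cmb' a l (y0n p a l) (y1n p a l) z) + 1 ≤
        Real.exp ((D1 + D2) * ‖z‖ ^ (-(1 / 2) : ℝ)) := by
    filter_upwards [eventually_ge_atTop ⌈x1⌉₊] with p hp
    have hp' : x1 ≤ p := Nat.ceil_le.1 hp
    have k1 := h1 a l ha hl x1 p ((le_max_left _ _).trans (hz.trans hx1z)) hp'
    have k2 := h2 a l ha hl _ _ (cmb_isSol a l (y0n p a l) (y1n p a l)) 1 zero_le_one z
      (exp ((-(Real.pi / 4) : ℝ) * I)) (Real.sqrt 2 * z.im) ‖z‖ (by positivity)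
      ((le_max_right _ _).trans hz) (Complex.norm_exp_ofReal_mul_I _)
      (fun t ht => cone_path hzn hz0 hz1 ht)
    rw [hend] at k2
    norm_num only [one_pow] at k2
    refine k2.trans ?_
    have k3 : x1 ^ (-(1 / 2) : ℝ) ≤ ‖z‖ ^ (-(1 / 2) : ℝ) :=
      Real.rpow_le_rpow_of_nonpos hpos hx1z (by norm_num)
    rw [add_mul D1 D2, Real.exp_add]
    norm_num only at k1 k3 ⊢
    apply mul_le_mul_of_nonneg_right _ (Real.exp_pos _).le
    refine k1.trans ?_
    apply Real.exp_le_exp.2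
    exact mul_le_mul_of_nonneg_left k3 hD1
  have lim : Tendsto (fun p : ℕ =>
      Vf a 1 z (cmb a l (y0n p a l) (y1n p a l) z) (cmb' a l (y0n p a l) (y1n p a l) z) + 1) atTop
      (nhds (Vf a 1 z (Y a l z) (Y' a l z) + 1)) := by
    have e0 := y0_tendsto a l
    have e1 := y1_tendsto a l
    have c1 : Tendsto (fun p : ℕ => cmb a l (y0n p a l) (y1n p a l) z) atTop (nhds (Y a l z)) :=
      (e0.mul_const _).add (e1.mul_const _)
    have c2 : Tendsto (fun p : ℕ => cmb' a l (y0n p a l) (y1n p a l) z) atTop (nhds (Y' a l z)) :=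
      (e0.mul_const _).add (e1.mul_const _)
    have c3 := ((c1.div_const (Tf a z)).add (c2.div_const (Tf a z * sf a z))).div_const 2
    have c4 := ((c2.div_const (Tf a z * sf a z)).sub (c1.div_const (Tf a z))).div_const 2
    exact (((c3.sub_const ((1 : ℝ) : ℂ)).norm.pow 2).add (c4.norm.pow 2)).add_const 1
  exact le_of_tendsto lim key

lemma exists_large (D ε : ℝ) (hε : 0 < ε) : ∃ R : ℝ, 1 ≤ R ∧ ∀ x, R ≤ x →
    Real.exp (D * x ^ (-(1 / 2) : ℝ)) - 1 ≤ ε := by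
  have h1 : Tendsto (fun x : ℝ => Real.exp (D * x ^ (-(1 / 2) : ℝ)) - 1) atTop (nhds 0) := by
    have h2 := tendsto_rpow_neg_atTop (show (0 : ℝ) < 1 / 2 by norm_num)
    have h3 := ((Real.continuous_exp.tendsto _).comp (h2.const_mul D)).sub_const 1
    simpa using h3
  obtain ⟨R, hR⟩ := eventually_atTop.1 (h1.eventually (ge_mem_nhds hε))
  exact ⟨max 1 R, le_max_left _ _, fun x hx => hR x ((le_max_right _ _).trans hx)⟩

lemma FT_upper (B ε : ℝ) (hB : 0 ≤ B) (hε : 0 < ε) : ∃ R : ℝ, 1 ≤ R ∧ ∀ a l z : ℂ, ‖a‖ ≤ B → ‖l‖ ≤ B →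
    R ≤ ‖z‖ → 0 ≤ z.arg → z.arg ≤ 2 * Real.pi / 5 →
    ‖Y a l z / Tf a z - 1‖ ≤ ε ∧ ‖Y' a l z / (-(rt z ^ 6) * Tf a z) - 1‖ ≤ ε := by
  obtain ⟨R1, D1, hR1, hD1, h1⟩ := Y_V B hB
  obtain ⟨W, D, hW, hD, hb⟩ := wkb_bounds B hB
  set ε1 := min ε 1 / 3 with hε1
  have hε1p : 0 < ε1 := by positivity
  have hε1le : ε1 ≤ 1 / 3 := by rw [hε1]; linarith [min_le_right ε 1]
  have hε1le' : 3 * ε1 ≤ ε := by rw [hε1]; linarith [min_le_left ε 1]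
  obtain ⟨R3, hR3, h3⟩ := exists_large D1 ((ε1 / 2) ^ 2) (by positivity)
  set W2 := max W ((B + 1) / ε1 + 1) with hW2
  refine ⟨max (max R1 R3) (W2 ^ 4), hR1.trans ((le_max_left _ _).trans (le_max_left _ _)), ?_⟩
  intro a l z ha hl hz hz0 hz1
  have hzR1 : R1 ≤ ‖z‖ := ((le_max_left _ _).trans (le_max_left _ _)).trans hz
  have hzR3 : R3 ≤ ‖z‖ := ((le_max_right _ _).trans (le_max_left _ _)).trans hz
  have hpos : 0 < ‖z‖ := by linarith
  have hzn : z ≠ 0 := norm_pos_iff.1 hpos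
  have hw : W2 ≤ ‖rt z‖ := by
    have := (le_max_right _ _).trans hz
    rw [← norm_rt] at this
    exact le_of_pow_le_pow_left₀ (by norm_num) (norm_nonneg _) this
  have hwW : W ≤ ‖rt z‖ := (le_max_left _ _).trans hw
  have hwE : (B + 1) / ε1 + 1 ≤ ‖rt z‖ := (le_max_right _ _).trans hw
  obtain ⟨b1, b2, b3, -⟩ := hb a l z ha hl hwW
  have hwp : 0 < ‖rt z‖ := by linarith
  have hsn : sf a z ≠ 0 := by
    rw [← norm_pos_iff]
    exact lt_of_lt_of_le (by positivity) b2
  have hT := Tf_ne (a := a) hzn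
  have hV : Vf a 1 z (Y a l z) (Y' a l z) ≤ (ε1 / 2) ^ 2 := by
    linarith [h1 a l z ha hl hzR1 hz0 hz1, h3 _ hzR3]
  have hsq : 2 * Real.sqrt (Vf a 1 z (Y a l z) (Y' a l z)) ≤ ε1 := by
    have := Real.sqrt_le_sqrt hV
    rw [Real.sqrt_sq (by positivity)] at this
    linarith
  obtain ⟨v1, v2⟩ := Vf_bound hT hsn 1 (Y a l z) (Y' a l z)
  rw [Complex.ofReal_one] at v1 v2
  refine ⟨by linarith, ?_⟩
  have hw6 : rt z ^ 6 ≠ 0 := pow_ne_zero _ (rt_ne hzn)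
  set A := Y' a l z / (Tf a z * sf a z) with hA
  set C := (sf a z + rt z ^ 6) / (-(rt z ^ 6)) with hC
  have hCn : ‖C‖ ≤ ε1 := by
    rw [hC, norm_div, norm_neg, norm_pow, div_le_iff₀ (by positivity)]
    refine b3.trans ?_
    have h6 : ‖rt z‖ ≤ ‖rt z‖ ^ 6 := by
      calc ‖rt z‖ = ‖rt z‖ ^ 1 := by simp
      _ ≤ ‖rt z‖ ^ 6 := pow_le_pow_right₀ (by linarith) (by norm_num)
    have h7 : B + 1 ≤ ε1 * ‖rt z‖ := by
      have := mul_le_mul_of_nonneg_left hwE hε1p.le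
      rw [mul_add, mul_div_cancel₀ _ hε1p.ne'] at this
      linarith
    nlinarith
  have e : Y' a l z / (-(rt z ^ 6) * Tf a z) - 1 = (A - 1) + (A - 1) * C + C := by
    have hr := rt_ne hzn
    rw [hA, hC]; field_simp; ring
  rw [e]
  calc ‖(A - 1) + (A - 1) * C + C‖ ≤ ‖A - 1‖ + ‖A - 1‖ * ‖C‖ + ‖C‖ := by
        refine (norm_add_le _ _).trans (add_le_add_left ((norm_add_le _ _).trans ?_) _)
        rw [norm_mul]
    _ ≤ ε1 + ε1 * ε1 + ε1 := by
        gcongr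
        · exact v2.trans hsq
        · exact v2.trans hsq
    _ ≤ ε := by nlinarith

/-- The asymptotics theorem. -/
theorem FT (B ε : ℝ) (hB : 0 ≤ B) (hε : 0 < ε) : ∃ R : ℝ, 1 ≤ R ∧ ∀ a l z : ℂ, ‖a‖ ≤ B → ‖l‖ ≤ B →
    R ≤ ‖z‖ → |z.arg| ≤ 2 * Real.pi / 5 →
    ‖Y a l z / Tf a z - 1‖ ≤ ε ∧ ‖Y' a l z / (-(rt z ^ 6) * Tf a z) - 1‖ ≤ ε := by
  obtain ⟨R, hR, h⟩ := FT_upper B ε hB hε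
  refine ⟨R, hR, fun a l z ha hl hz harg => ?_⟩
  rcases le_total 0 z.arg with h0 | h0
  · exact h a l z ha hl hz h0 (by rwa [abs_of_nonneg h0] at harg)
  · have hpi : z.arg ≠ Real.pi := by linarith [Real.pi_pos]
    have hca : (cj z).arg = -z.arg := by rw [Complex.arg_conj, if_neg hpi]
    have := h (cj a) (cj l) (cj z) (by simpa using ha) (by simpa using hl) (by simpa using hz)
      (by rw [hca]; linarith) (by rw [hca]; rwa [abs_of_nonpos h0] at harg)
    rw [(Y_conj a l z).1, (Y_conj a l z).2, Tf_conj a hpi, rt_conj hpi] at this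
    constructor
    · rw [← Complex.norm_conj]; simpa using this.1
    · rw [← Complex.norm_conj]; simpa using this.2

end Cub


namespace Cub

local notation "cj" => starRingEnd ℂ

/-- unit complex number with argument t -/
noncomputable def er (t : ℝ) : ℂ := exp ((t : ℂ) * I)

lemma er_add (s t : ℝ) : er (s + t) = er s * er t := by
  simp only [er]; rw [← Complex.exp_add]; push_cast; ring_nf
lemma er_zero : er 0 = 1 := by simp [er]
lemma er_neg_mul (t : ℝ) : er (-t) * er t = 1 := by rw [← er_add]; simp [er_zero]
lemma er_ne (t : ℝ) : er t ≠ 0 := Complex.exp_ne_zero _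
lemma er_neg (t : ℝ) : er (-t) = (er t)⁻¹ := eq_inv_of_mul_eq_one_left (er_neg_mul t)
lemma norm_er (t : ℝ) : ‖er t‖ = 1 := Complex.norm_exp_ofReal_mul_I t
lemma er_pow (t : ℝ) (n : ℕ) : er t ^ n = er (n * t) := by
  simp only [er]; rw [← Complex.exp_nat_mul]; push_cast; ring_nf
lemma er_inv_pow (t : ℝ) (n : ℕ) : (er t)⁻¹ ^ n = er (-(n * t)) := by
  rw [er_neg, inv_pow, er_pow]
lemma er_conj (t : ℝ) : cj (er t) = er (-t) := by
  simp only [er]; rw [← Complex.exp_conj]; simp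
lemma er_re (t : ℝ) : (er t).re = Real.cos t := Complex.exp_ofReal_mul_I_re t
lemma er_im (t : ℝ) : (er t).im = Real.sin t := Complex.exp_ofReal_mul_I_im t
lemma er_pi : er Real.pi = -1 := by simp [er]
lemma er_int_pi (k : ℤ) : er (k * Real.pi) = (-1) ^ k := by
  simp only [er]
  rw [← Complex.exp_pi_mul_I, ← Complex.exp_int_mul]; push_cast; ring_nf
lemma er_two_pi (k : ℤ) : er (k * (2 * Real.pi)) = 1 := by
  simp only [er]
  have := Complex.exp_int_mul_two_pi_mul_I k
  rw [← this]; push_cast; ring_nf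
lemma er_pi_div_two : er (Real.pi / 2) = I := by
  simp [er, Complex.exp_pi_div_two_mul_I]
lemma er_congr {s t : ℝ} (k : ℤ) (h : s = t + k * (2 * Real.pi)) : er s = er t := by
  rw [h, er_add, er_two_pi, mul_one]

lemma rt_of {ρ β : ℝ} (hρ : 0 < ρ) (hβ : |β| ≤ Real.pi / 10) : rt ((ρ * er β) ^ 4) = ρ * er β ∧
    ((ρ * er β) ^ 4).arg = 4 * β := by
  have e : (ρ * er β) ^ 4 = ((ρ ^ 4 : ℝ) : ℂ) * (Complex.cos ((4 * β : ℝ) : ℂ) + Complex.sin ((4 * β : ℝ) : ℂ) * I) := by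
    rw [mul_pow, er_pow, ← Complex.exp_mul_I, er]; push_cast; ring_nf
  have harg : ((ρ * er β) ^ 4).arg = 4 * β := by
    rw [e]
    apply Complex.arg_mul_cos_add_sin_mul_I (by positivity)
    have := abs_le.1 hβ
    constructor <;> linarith [Real.pi_pos]
  refine ⟨?_, harg⟩
  have hne : (ρ * er β) ^ 4 ≠ 0 := pow_ne_zero _ (mul_ne_zero (by exact_mod_cast hρ.ne') (er_ne _))
  rw [rt_polar _ hne, harg]
  have hn : ‖rt ((ρ * er β) ^ 4)‖ = ρ := by
    have := norm_rt ((ρ * er β) ^ 4)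
    rw [norm_pow, norm_mul, norm_er, mul_one, Complex.norm_real, Real.norm_of_nonneg hρ.le] at this
    exact (pow_left_inj₀ (norm_nonneg _) hρ.le (by norm_num)).1 this
  rw [hn, er]
  congr 3
  push_cast; ring

noncomputable def Yk (k : ℤ) (a l z : ℂ) : ℂ :=
  Y (er (6 * Real.pi * k / 5) * a) (er (4 * Real.pi * k / 5) * l) (er (-(2 * Real.pi * k / 5)) * z)
noncomputable def Yk' (k : ℤ) (a l z : ℂ) : ℂ :=
  er (-(2 * Real.pi * k / 5)) *
  Y' (er (6 * Real.pi * k / 5) * a) (er (4 * Real.pi * k / 5) * l) (er (-(2 * Real.pi * k / 5)) * z)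

lemma Yk_isSol (k : ℤ) (a l : ℂ) : IsSol a l (Yk k a l) (Yk' k a l) := by
  obtain ⟨h1, h2⟩ := Y_isSol (er (6 * Real.pi * k / 5) * a) (er (4 * Real.pi * k / 5) * l)
  set e := er (-(2 * Real.pi * k / 5)) with he
  have hlin : ∀ z : ℂ, HasDerivAt (fun z => e * z) e z := fun z => by
    simpa using (hasDerivAt_id z).const_mul e
  refine ⟨fun z => ?_, fun z => ?_⟩
  · refine ((h1 (e * z)).comp z (hlin z)).congr_deriv ?_
    rw [Yk', mul_comm]
  · refine (((h2 (e * z)).comp z (hlin z)).const_mul e).congr_deriv ?_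
    rw [Yk]
    have e5 : e ^ 5 = 1 := by
      rw [he, er_pow]
      rw [er_congr (t := 0) (-k) (by push_cast; ring), er_zero]
    have e3 : er (6 * Real.pi * k / 5) * e ^ 3 = 1 := by
      rw [he, er_pow, ← er_add, ← er_zero]; congr 1; push_cast; ring
    have e2 : er (4 * Real.pi * k / 5) * e ^ 2 = 1 := by
      rw [he, er_pow, ← er_add, ← er_zero]; congr 1; push_cast; ring
    linear_combination (Y (er (6 * Real.pi * k / 5) * a) (er (4 * Real.pi * k / 5) * l) (e * z)) *
      (z ^ 3 * e5 - a * z * e3 + l * e2)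

lemma Yk_zero (a l z : ℂ) : Yk 0 a l z = Y a l z ∧ Yk' 0 a l z = Y' a l z := by
  simp [Yk, Yk', er_zero]

lemma Yk_period (k : ℤ) : Yk (k + 5) = Yk k ∧ Yk' (k + 5) = Yk' k := by
  have h1 : er (6 * Real.pi * (k + 5 : ℤ) / 5) = er (6 * Real.pi * k / 5) :=
    er_congr 3 (by push_cast; ring)
  have h2 : er (4 * Real.pi * (k + 5 : ℤ) / 5) = er (4 * Real.pi * k / 5) :=
    er_congr 2 (by push_cast; ring)
  have h3 : er (-(2 * Real.pi * (k + 5 : ℤ) / 5)) = er (-(2 * Real.pi * k / 5)) :=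
    er_congr (-1) (by push_cast; ring)
  constructor
  · funext a l z; simp only [Yk]; rw [h1, h2, h3]
  · funext a l z; simp only [Yk']; rw [h1, h2, h3]

lemma Yk_conj (k : ℤ) (a l : ℝ) (z : ℂ) : Yk (-k) a l (cj z) = cj (Yk k a l z) ∧
    Yk' (-k) a l (cj z) = cj (Yk' k a l z) := by
  have h := Y_conj (er (6 * Real.pi * k / 5) * a) (er (4 * Real.pi * k / 5) * l)
    (er (-(2 * Real.pi * k / 5)) * z)
  simp only [map_mul, er_conj, Complex.conj_ofReal, neg_neg] at h
  have e1 : 6 * Real.pi * ((-k : ℤ) : ℝ) / 5 = -(6 * Real.pi * k / 5) := by push_cast; ring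
  have e2 : 4 * Real.pi * ((-k : ℤ) : ℝ) / 5 = -(4 * Real.pi * k / 5) := by push_cast; ring
  have e3 : -(2 * Real.pi * ((-k : ℤ) : ℝ) / 5) = 2 * Real.pi * k / 5 := by push_cast; ring
  simp only [Yk, Yk', e1, e2, e3]
  refine ⟨h.1, ?_⟩
  rw [map_mul, er_conj, neg_neg, h.2]

lemma Yk_cont (k : ℤ) : Continuous (fun q : (ℂ × ℂ) × ℂ => Yk k q.1.1 q.1.2 q.2) := by
  have h : Continuous (fun q : (ℂ × ℂ) × ℂ => ((er (6 * Real.pi * k / 5) * q.1.1,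
    er (4 * Real.pi * k / 5) * q.1.2), er (-(2 * Real.pi * k / 5)) * q.2)) := by fun_prop
  have h2 := Y_cont.comp h
  exact h2
lemma Yk'_cont (k : ℤ) : Continuous (fun q : (ℂ × ℂ) × ℂ => Yk' k q.1.1 q.1.2 q.2) := by
  have h : Continuous (fun q : (ℂ × ℂ) × ℂ => ((er (6 * Real.pi * k / 5) * q.1.1,
    er (4 * Real.pi * k / 5) * q.1.2), er (-(2 * Real.pi * k / 5)) * q.2)) := by fun_prop
  have h2 := Y'_cont.comp h
  have h3 := h2.const_mul (er (-(2 * Real.pi * k / 5)))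
  exact h3

lemma Yk_curve (k : ℤ) {a l z : ℂ → ℂ} (ha : Differentiable ℂ a) (hl : Differentiable ℂ l)
    (hz : Differentiable ℂ z) : Differentiable ℂ (fun t => Yk k (a t) (l t) (z t)) ∧
      Differentiable ℂ (fun t => Yk' k (a t) (l t) (z t)) := by
  have := Y_curve (ha.const_mul (er (6 * Real.pi * k / 5))) (hl.const_mul (er (4 * Real.pi * k / 5)))
    (hz.const_mul (er (-(2 * Real.pi * k / 5))))
  exact ⟨this.1, this.2.const_mul _⟩

/-- the phase polynomial -/
noncomputable def Sv (a v : ℂ) : ℂ := 2 / 5 * v ^ 10 - a * v ^ 2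

noncomputable def Tk (k : ℤ) (a v : ℂ) : ℂ := er (3 * Real.pi * k / 10) * v⁻¹ ^ 3 * exp (-((-1) ^ k * Sv a v))

lemma Tk_ne (k : ℤ) (a : ℂ) {v : ℂ} (hv : v ≠ 0) : Tk k a v ≠ 0 :=
  mul_ne_zero (mul_ne_zero (er_ne _) (pow_ne_zero _ (inv_ne_zero hv))) (Complex.exp_ne_zero _)

/-- asymptotics of all the rotated solutions -/
theorem AS (B ε : ℝ) (hB : 0 ≤ B) (hε : 0 < ε) : ∃ R : ℝ, 1 ≤ R ∧ ∀ a l : ℂ, ‖a‖ ≤ B → ‖l‖ ≤ B →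
    ∀ (k : ℤ) (ρ β : ℝ), R ≤ ρ → |β - k * Real.pi / 10| ≤ Real.pi / 10 →
    ‖Yk k a l ((ρ * er β) ^ 4) / Tk k a (ρ * er β) - 1‖ ≤ ε ∧
    ‖Yk' k a l ((ρ * er β) ^ 4) / (-((-1) ^ k * (ρ * er β) ^ 6) * Tk k a (ρ * er β)) - 1‖ ≤ ε := by
  obtain ⟨R, hR, h⟩ := FT B ε hB hε
  refine ⟨R, hR, fun a l ha hl k ρ β hρ hβ => ?_⟩
  have hρ0 : 0 < ρ := by linarith
  have hρ1 : 1 ≤ ρ := by linarith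
  set w : ℂ := ρ * er (β - k * Real.pi / 10) with hw
  set v : ℂ := ρ * er β with hv
  have hv0 : v ≠ 0 := mul_ne_zero (by exact_mod_cast hρ0.ne') (er_ne _)
  have hwv : w = er (-(k * Real.pi / 10)) * v := by
    rw [hw, hv, sub_eq_add_neg, er_add]; ring
  obtain ⟨r1, r2⟩ := rt_of hρ0 hβ
  rw [← hw] at r1 r2
  have hz : er (-(2 * Real.pi * k / 5)) * v ^ 4 = w ^ 4 := by
    have : er (-(2 * Real.pi * k / 5)) = er (-(k * Real.pi / 10)) ^ 4 := by
      rw [er_pow]; congr 1; push_cast; ring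
    rw [hwv, this]; ring
  have hnw : R ≤ ‖w ^ 4‖ := by
    rw [hw, norm_pow, norm_mul, norm_er, mul_one, Complex.norm_real, Real.norm_of_nonneg hρ0.le]
    refine hρ.trans ?_
    calc ρ = ρ ^ 1 := by simp
      _ ≤ ρ ^ 4 := pow_le_pow_right₀ hρ1 (by norm_num)
  have := h (er (6 * Real.pi * k / 5) * a) (er (4 * Real.pi * k / 5) * l) (w ^ 4)
    (by rw [norm_mul, norm_er, one_mul]; exact ha) (by rw [norm_mul, norm_er, one_mul]; exact hl) hnw
    (by rw [r2, abs_mul, abs_of_pos (by norm_num : (0 : ℝ) < 4)]; linarith)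
  have hT : Tf (er (6 * Real.pi * k / 5) * a) (w ^ 4) = Tk k a v := by
    rw [Tf, r1, Tk]
    have e1 : w⁻¹ ^ 3 = er (3 * Real.pi * k / 10) * v⁻¹ ^ 3 := by
      rw [hwv, mul_inv, mul_pow, er_inv_pow]; congr 2; push_cast; ring
    rw [e1]
    congr 2
    have e2 : w ^ 10 = (-1) ^ k * v ^ 10 := by
      rw [hwv, mul_pow, er_pow, ← er_int_pi]
      congr 1
      apply er_congr (-k); push_cast; ring
    have e3 : er (6 * Real.pi * k / 5) * w ^ 2 = (-1) ^ k * v ^ 2 := by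
      rw [hwv, mul_pow, er_pow, ← mul_assoc, ← er_add, ← er_int_pi]
      congr 2; push_cast; ring
    rw [Sv, e2]
    linear_combination a * e3
  have h6 : er (-(2 * Real.pi * k / 5)) * w ^ 6 = (-1) ^ k * v ^ 6 := by
    rw [hwv, mul_pow, er_pow, ← mul_assoc, ← er_add, ← er_int_pi]
    congr 1; apply er_congr (-k); push_cast; ring
  rw [hT, r1] at this
  refine ⟨?_, ?_⟩
  · rw [Yk, hz]; exact this.1
  · rw [Yk', hz, ← h6]
    have e : er (-(2 * Real.pi * k / 5)) * Y' (er (6 * Real.pi * k / 5) * a) (er (4 * Real.pi * k / 5) * l) (w ^ 4) /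
      (-(er (-(2 * Real.pi * k / 5)) * w ^ 6) * Tk k a v) =
      Y' (er (6 * Real.pi * k / 5) * a) (er (4 * Real.pi * k / 5) * l) (w ^ 4) / (-w ^ 6 * Tk k a v) := by
      have := er_ne (-(2 * Real.pi * k / 5))
      have hw6 : w ^ 6 ≠ 0 := pow_ne_zero _ (by rw [hwv]; exact mul_ne_zero (er_ne _) hv0)
      have := Tk_ne k a hv0
      field_simp
    rw [e]
    exact this.2

lemma AS_tendsto (a l : ℂ) (k : ℤ) (β : ℝ) (hβ : |β - k * Real.pi / 10| ≤ Real.pi / 10) :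
    Tendsto (fun ρ : ℝ => Yk k a l ((ρ * er β) ^ 4) / Tk k a (ρ * er β)) atTop (nhds 1) ∧
    Tendsto (fun ρ : ℝ => Yk' k a l ((ρ * er β) ^ 4) / (-((-1) ^ k * (ρ * er β) ^ 6) * Tk k a (ρ * er β)))
      atTop (nhds 1) := by
  constructor
  all_goals
    rw [Metric.tendsto_nhds]
    intro ε hε
    obtain ⟨R, hR, h⟩ := AS (max ‖a‖ ‖l‖) (ε / 2) (le_max_of_le_left (norm_nonneg _)) (by positivity)
    filter_upwards [eventually_ge_atTop R] with ρ hρ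
    rw [dist_eq_norm]
    have := h a l (le_max_left _ _) (le_max_right _ _) k ρ β hρ hβ
  · linarith [this.1]
  · linarith [this.2]

noncomputable def Wr (j k : ℤ) (a l : ℂ) : ℂ := Yk j a l 0 * Yk' k a l 0 - Yk' j a l 0 * Yk k a l 0

lemma Wr_eq (j k : ℤ) (a l z : ℂ) : Yk j a l z * Yk' k a l z - Yk' j a l z * Yk k a l z = Wr j k a l :=
  wr_const (Yk_isSol j a l) (Yk_isSol k a l) z

lemma Wr_swap (j k : ℤ) (a l : ℂ) : Wr k j a l = -Wr j k a l := by simp only [Wr]; ring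
lemma Wr_self (k : ℤ) (a l : ℂ) : Wr k k a l = 0 := by simp only [Wr]; ring

lemma Wr_adj (k : ℤ) (a l : ℂ) : Wr k (k + 1) a l = 2 * (-1) ^ k * er (3 * Real.pi * (2 * k + 1) / 10) := by
  set β : ℝ := k * Real.pi / 10 + Real.pi / 20 with hβ
  have hpi := Real.pi_pos
  have h1 := AS_tendsto a l k β (by
    rw [hβ]; ring_nf; rw [abs_of_pos (by positivity)]; linarith)
  have h2 := AS_tendsto a l (k + 1) β (by
    rw [hβ]; push_cast; ring_nf; rw [abs_of_neg (by linarith)]; linarith)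
  have h3 := ((h1.1.mul h2.2).add (h1.2.mul h2.1)).const_mul ((-1) ^ k * er (3 * Real.pi * (2 * k + 1) / 10))
  have h4 : Tendsto (fun _ : ℝ => Wr k (k + 1) a l) atTop
      (nhds ((-1) ^ k * er (3 * Real.pi * (2 * k + 1) / 10) * (1 * 1 + 1 * 1))) := by
    refine h3.congr' ?_
    filter_upwards [eventually_gt_atTop 0] with ρ hρ
    rw [← Wr_eq k (k + 1) a l ((ρ * er β) ^ 4)]
    set v : ℂ := ρ * er β with hv
    have hv0 : v ≠ 0 := mul_ne_zero (by exact_mod_cast hρ.ne') (er_ne _)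
    have t1 := Tk_ne k a hv0
    have t2 := Tk_ne (k + 1) a hv0
    have hs : ((-1 : ℂ)) ^ (k + 1) = -(-1) ^ k := by rw [zpow_add₀ (by norm_num)]; simp
    have hs0 : ((-1 : ℂ)) ^ k ≠ 0 := zpow_ne_zero _ (by norm_num)
    have hs1 : ((-1 : ℂ)) ^ k * (-1) ^ k = 1 := by rw [← mul_zpow]; simp
    have hTT : Tk k a v * Tk (k + 1) a v * v ^ 6 = er (3 * Real.pi * (2 * k + 1) / 10) := by
      rw [Tk, Tk, hs]
      have e1 : er (3 * Real.pi * (2 * k + 1) / 10) =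
          er (3 * Real.pi * k / 10) * er (3 * Real.pi * (k + 1 : ℤ) / 10) := by
        rw [← er_add]; congr 1; push_cast; ring
      have e2 : exp (-((-1) ^ k * Sv a v)) * exp (-(-(-1) ^ k * Sv a v)) = 1 := by
        rw [← Complex.exp_add]; simp
      have e3 : v⁻¹ ^ 3 * v⁻¹ ^ 3 * v ^ 6 = 1 := by field_simp
      rw [e1]
      linear_combination (er (3 * Real.pi * k / 10) * er (3 * Real.pi * (k + 1 : ℤ) / 10)) *
        (e2 * (v⁻¹ ^ 3 * v⁻¹ ^ 3 * v ^ 6) + e3)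
    rw [← hTT, hs]
    have hv6 : v ^ 6 ≠ 0 := pow_ne_zero _ hv0
    have s2 : ((-1 : ℂ) ^ k) ^ 2 = 1 := by rw [pow_two, hs1]
    field_simp
    ring_nf
  have := tendsto_nhds_unique tendsto_const_nhds h4
  rw [this]; ring

end Cub


namespace Cub

local notation "cj" => starRingEnd ℂ

lemma comb_of_wr {a l : ℂ} {f f' g g' y y' : ℂ → ℂ} (hf : IsSol a l f f') (hg : IsSol a l g g')
    (hy : IsSol a l y y') {w : ℂ} (hw : f 0 * g' 0 - f' 0 * g 0 = w) (hw0 : w ≠ 0) (z : ℂ) :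
    y z = ((y 0 * g' 0 - y' 0 * g 0) / w) * f z + ((f 0 * y' 0 - f' 0 * y 0) / w) * g z ∧
    y' z = ((y 0 * g' 0 - y' 0 * g 0) / w) * f' z + ((f 0 * y' 0 - f' 0 * y 0) / w) * g' z := by
  rw [← wr_const hy hg z, ← wr_const hf hy z]
  have h := (wr_const hf hg z).trans hw
  constructor
  · field_simp; rw [← h]; ring
  · field_simp; rw [← h]; ring

lemma eig_isSol {a l : ℂ} {y : ℂ → ℂ} (h : IsCubicEigenfunction a l y) : IsSol a l y (deriv y) := by
  have hd : Differentiable ℂ (deriv y) :=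
    differentiableOn_univ.1 (h.1.differentiableOn.deriv isOpen_univ)
  refine ⟨fun z => (h.1 z).hasDerivAt, fun z => ?_⟩
  refine (hd z).hasDerivAt.congr_deriv ?_
  linear_combination -(h.2.2.1 z)

lemma Sv_eq (a ρ β : ℝ) : Sv a (ρ * er β) =
    ((2 / 5 * ρ ^ 10 * Real.cos (10 * β) - a * ρ ^ 2 * Real.cos (2 * β) : ℝ) : ℂ)
    + ((2 / 5 * ρ ^ 10 * Real.sin (10 * β) - a * ρ ^ 2 * Real.sin (2 * β) : ℝ) : ℂ) * I := by
  rw [Sv, mul_pow, mul_pow, er_pow, er_pow]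
  apply Complex.ext
  · simp only [Complex.sub_re, Complex.add_re, Complex.mul_re, Complex.ofReal_re, Complex.ofReal_im, er_re, er_im,
      ← Complex.ofReal_pow, I_re, I_im, Complex.mul_im]
    norm_num
    ring
  · simp only [Complex.sub_im, Complex.add_im, Complex.mul_re, Complex.ofReal_re, Complex.ofReal_im, er_re, er_im,
      ← Complex.ofReal_pow, I_re, I_im, Complex.mul_im]
    norm_num
    ring

lemma Sv_re (a ρ β : ℝ) : (Sv a (ρ * er β)).re =
    2 / 5 * ρ ^ 10 * Real.cos (10 * β) - a * ρ ^ 2 * Real.cos (2 * β) := by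
  rw [Sv_eq]; simp [-Complex.ofReal_sub, -Complex.ofReal_mul]
lemma Sv_im (a ρ β : ℝ) : (Sv a (ρ * er β)).im =
    2 / 5 * ρ ^ 10 * Real.sin (10 * β) - a * ρ ^ 2 * Real.sin (2 * β) := by
  rw [Sv_eq]; simp [-Complex.ofReal_sub, -Complex.ofReal_mul]

lemma norm_Tk (k : ℤ) (a : ℂ) (v : ℂ) : ‖Tk k a v‖ = ‖v‖⁻¹ ^ 3 * Real.exp (-((-1) ^ k * (Sv a v).re)) := by
  rw [Tk, norm_mul, norm_mul, norm_er, one_mul, norm_pow, norm_inv, Complex.norm_exp]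
  congr 2
  rw [Complex.neg_re]
  have : ((-1 : ℂ)) ^ k = (((-1 : ℝ) ^ k : ℝ) : ℂ) := by push_cast; rfl
  rw [this, Complex.re_ofReal_mul]

lemma norm_rho {ρ : ℝ} (hρ : 0 < ρ) (β : ℝ) : ‖(ρ : ℂ) * er β‖ = ρ := by
  rw [norm_mul, norm_er, mul_one, Complex.norm_real, Real.norm_of_nonneg hρ.le]

lemma S_imag (a : ℝ) : ∀ᶠ ρ : ℝ in atTop, (Sv a (ρ * er (Real.pi / 8))).re ≤ -ρ := by
  filter_upwards [eventually_ge_atTop (|a| + 10)] with ρ hρ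
  rw [Sv_re]
  have h1 : Real.cos (10 * (Real.pi / 8)) = -(Real.sqrt 2 / 2) := by
    rw [show 10 * (Real.pi / 8) = Real.pi / 4 + Real.pi by ring, Real.cos_add_pi, Real.cos_pi_div_four]
  have h2 : Real.cos (2 * (Real.pi / 8)) = Real.sqrt 2 / 2 := by
    rw [show 2 * (Real.pi / 8) = Real.pi / 4 by ring, Real.cos_pi_div_four]
  rw [h1, h2]
  have hs : 1.4 ≤ Real.sqrt 2 := Real.le_sqrt_of_sq_le (by norm_num)
  have ha := abs_nonneg a
  have hρ0 : 10 ≤ ρ := by linarith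
  have h3 : 10 * ρ ^ 3 ≤ ρ ^ 10 := by
    have : ρ ^ 10 = ρ ^ 6 * ρ * ρ ^ 3 := by ring
    rw [this]
    have : 1 ≤ ρ ^ 6 := one_le_pow₀ (by linarith)
    have : 10 ≤ ρ ^ 6 * ρ := by nlinarith
    exact mul_le_mul_of_nonneg_right this (by positivity)
  have h4 : -(ρ ^ 3) ≤ a * ρ ^ 2 := by
    have : -ρ ≤ a := by linarith [neg_abs_le a]
    nlinarith [sq_nonneg ρ]
  have h5 : ρ * 100 ≤ ρ ^ 3 := by
    have : ρ ^ 3 = ρ * (ρ * ρ) := by ring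
    nlinarith
  have h6 : Real.sqrt 2 / 2 * (2 / 5 * ρ ^ 10 + a * ρ ^ 2) ≥ ρ := by
    have : 2 / 5 * ρ ^ 10 + a * ρ ^ 2 ≥ 2 * ρ := by linarith
    nlinarith
  linarith

lemma imag_point {t : ℝ} (ht : 0 ≤ t) : (((t ^ (1 / 4 : ℝ) : ℝ) : ℂ) * er (Real.pi / 8)) ^ 4 = I * t := by
  rw [mul_pow, er_pow, ← Complex.ofReal_pow, ← Real.rpow_natCast, ← Real.rpow_mul ht]
  norm_num
  rw [show 4 * (Real.pi / 8) = Real.pi / 2 by ring, er_pi_div_two]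
  ring

lemma Y1_tendsto (a : ℝ) (l : ℂ) : Tendsto (fun t : ℝ => Yk 1 a l (I * t)) atTop (nhds 0) := by
  have h := (AS_tendsto a l 1 (Real.pi / 8) (by
    push_cast; rw [abs_of_pos] <;> linarith [Real.pi_pos])).1
  have hT : Tendsto (fun ρ : ℝ => Tk 1 a (ρ * er (Real.pi / 8))) atTop (nhds 0) := by
    rw [tendsto_zero_iff_norm_tendsto_zero]
    refine squeeze_zero' (Eventually.of_forall fun _ => norm_nonneg _) ?_ Real.tendsto_exp_neg_atTop_nhds_zero
    filter_upwards [S_imag a, eventually_ge_atTop 1] with ρ h1 h2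
    rw [norm_Tk, norm_rho (by linarith)]
    simp only [zpow_one, neg_mul, one_mul, neg_neg]
    have h3 : ρ⁻¹ ^ 3 ≤ 1 := pow_le_one₀ (by positivity) (inv_le_one_of_one_le₀ h2)
    calc _ ≤ 1 * Real.exp (-ρ) := by gcongr
      _ = _ := one_mul _
  have h2 := h.mul hT
  have h3 := h2.comp (tendsto_rpow_atTop (show (0 : ℝ) < 1 / 4 by norm_num))
  rw [mul_zero] at h3
  refine h3.congr' ?_
  filter_upwards [eventually_gt_atTop 0] with t ht
  simp only [Function.comp]
  rw [imag_point ht.le, div_mul_cancel₀]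
  apply Tk_ne
  exact mul_ne_zero (by exact_mod_cast (Real.rpow_pos_of_pos ht _).ne') (er_ne _)

lemma Y2_tendsto (a : ℝ) (l : ℂ) : Tendsto (fun t : ℝ => ‖Yk 2 a l (I * t)‖) atTop atTop := by
  have h := (AS_tendsto a l 2 (Real.pi / 8) (by
    push_cast; rw [abs_of_neg] <;> linarith [Real.pi_pos])).1
  have hT : Tendsto (fun ρ : ℝ => ‖Tk 2 a (ρ * er (Real.pi / 8))‖) atTop atTop := by
    refine tendsto_atTop_mono' _ ?_ (Real.tendsto_exp_div_pow_atTop 3)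
    filter_upwards [S_imag a, eventually_ge_atTop 1] with ρ h1 h2
    rw [norm_Tk, norm_rho (by linarith)]
    have e : ((-1 : ℝ)) ^ (2 : ℤ) = 1 := by norm_num
    rw [e, one_mul, div_eq_inv_mul, inv_pow]
    gcongr
    linarith
  have h2 := h.norm.pos_mul_atTop (by simp) hT
  have h3 := h2.comp (tendsto_rpow_atTop (show (0 : ℝ) < 1 / 4 by norm_num))
  refine h3.congr' ?_
  filter_upwards [eventually_gt_atTop 0] with t ht
  simp only [Function.comp]
  rw [imag_point ht.le, ← norm_mul, div_mul_cancel₀]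
  apply Tk_ne
  exact mul_ne_zero (by exact_mod_cast (Real.rpow_pos_of_pos ht _).ne') (er_ne _)

lemma Wr_adj_ne (k : ℤ) (a l : ℂ) : Wr k (k + 1) a l ≠ 0 := by
  rw [Wr_adj]
  exact mul_ne_zero (mul_ne_zero two_ne_zero (zpow_ne_zero _ (by norm_num))) (er_ne _)

lemma sol_mult_Y1 {a : ℝ} {l : ℂ} {y y' : ℂ → ℂ} (hy : IsSol a l y y')
    (ht : Tendsto (fun t : ℝ => y (I * t)) atTop (nhds 0)) : ∃ c : ℂ, ∀ z, y z = c * Yk 1 a l z ∧ y' z = c * Yk' 1 a l z := by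
  have hc := comb_of_wr (w := Wr 1 2 a l) (Yk_isSol 1 a l) (Yk_isSol 2 a l) hy rfl (Wr_adj_ne 1 a l)
  set p := (y 0 * Yk' 2 a l 0 - y' 0 * Yk 2 a l 0) / Wr 1 2 a l with hp
  set r := (Yk 1 a l 0 * y' 0 - Yk' 1 a l 0 * y 0) / Wr 1 2 a l with hr
  have hr0 : r = 0 := by
    by_contra hne
    have h1 : Tendsto (fun t : ℝ => r * Yk 2 a l (I * t)) atTop (nhds (0 - p * 0)) := by
      refine (ht.sub ((Y1_tendsto a l).const_mul p)).congr fun t => ?_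
      rw [(hc _).1]; ring
    have h2 := h1.norm
    simp only [norm_mul] at h2
    have h3 := (Y2_tendsto a l).const_mul_atTop (norm_pos_iff.2 hne)
    exact not_tendsto_nhds_of_tendsto_atTop h3 _ h2
  refine ⟨p, fun z => ?_⟩
  have := hc z
  rw [hr0] at this
  simpa using this

lemma Wr_conj (j k : ℤ) (a l : ℝ) : Wr (-j) (-k) a l = cj (Wr j k a l) := by
  have h1 := Yk_conj j a l 0
  have h2 := Yk_conj k a l 0
  rw [map_zero] at h1 h2
  simp only [Wr, h1, h2, map_sub, map_mul]

lemma Wr_period (j k : ℤ) : Wr (j + 5) k = Wr j k ∧ Wr j (k + 5) = Wr j k := by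
  constructor
  · funext a l; simp only [Wr, (Yk_period j).1, (Yk_period j).2]
  · funext a l; simp only [Wr, (Yk_period k).1, (Yk_period k).2]

lemma IsSol.conj {a l : ℝ} {y y' : ℂ → ℂ} (h : IsSol a l y y') :
    IsSol a l (fun z => cj (y (cj z))) (fun z => cj (y' (cj z))) := by
  refine ⟨fun z => ?_, fun z => ?_⟩
  · have := (h.1 (cj z)).conj_conj
    simpa [Function.comp_def] using this
  · have := (h.2 (cj z)).conj_conj
    rw [Complex.conj_conj] at this
    refine (HasDerivAt.congr_deriv (f := fun z => cj (y' (cj z))) this ?_)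
    simp

lemma eig_mult {a l : ℝ} {y : ℂ → ℂ} (h : IsCubicEigenfunction a l y) :
    ∃ c : ℂ, c ≠ 0 ∧ ∀ z, y z = c * Yk 1 a l z := by
  obtain ⟨c, hc⟩ := sol_mult_Y1 (eig_isSol h) h.2.2.2.1
  refine ⟨c, ?_, fun z => (hc z).1⟩
  rintro rfl
  exact h.2.1 (funext fun z => by simpa using (hc z).1)

lemma Yk_ne (k : ℤ) (a l : ℂ) : Yk k a l ≠ 0 := by
  intro h
  have h1 := Wr_adj_ne k a l
  have h2 : Yk' k a l 0 = 0 := by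
    have := (Yk_isSol k a l).1 0
    rw [h] at this
    exact (this.unique (hasDerivAt_const 0 0))
  apply h1
  rw [Wr, h2, h]; simp

lemma sol_prop_of_wr {a l : ℂ} {k : ℤ} {y y' : ℂ → ℂ} (hy : IsSol a l y y')
    (h : y 0 * Yk' k a l 0 - y' 0 * Yk k a l 0 = 0) : ∃ c : ℂ, ∀ z, y z = c * Yk k a l z := by
  have hc := comb_of_wr (w := Wr k (k+1) a l) (Yk_isSol k a l) (Yk_isSol (k + 1) a l) hy rfl (Wr_adj_ne k a l)
  refine ⟨(y 0 * Yk' (k+1) a l 0 - y' 0 * Yk (k+1) a l 0)/Wr k (k+1) a l, fun z => ?_⟩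
  rw [(hc z).1]
  have : Yk k a l 0 * y' 0 - Yk' k a l 0 * y 0 = 0 := by linear_combination -h
  rw [this]; simp

lemma eig_iff_wr (a l : ℝ) : (∃ y, IsCubicEigenfunction a l y) ↔ Wr 1 (-1) a l = 0 := by
  constructor
  · rintro ⟨y, hy⟩
    obtain ⟨c, hc0, hc⟩ := eig_mult hy
    have hs := eig_isSol hy
    have ht : Tendsto (fun t : ℝ => cj (y (cj (I * t)))) atTop (nhds 0) := by
      have h1 := hy.2.2.2.2.comp tendsto_neg_atTop_atBot
      have h2 := (Complex.continuous_conj.tendsto 0).comp h1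
      rw [map_zero] at h2
      refine h2.congr fun t => ?_
      simp
    obtain ⟨d, hd⟩ := sol_mult_Y1 hs.conj ht
    have e1 : ∀ z, y z = cj d * Yk (-1) a l z := by
      intro z
      have := congrArg cj (hd (cj z)).1
      simp only [Complex.conj_conj, map_mul] at this
      rw [this, ← (Yk_conj 1 a l (cj z)).1, Complex.conj_conj]
    have hd0 : cj d ≠ 0 := by
      intro h0
      apply hy.2.1; funext z; rw [e1 z, h0]; simp
    have e2 : ∀ z, Yk 1 a l z = (c⁻¹ * cj d) * Yk (-1) a l z := by
      intro z
      have h1 := hc z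
      rw [e1 z] at h1
      field_simp
      linear_combination -h1
    have e3 : Yk' 1 a l 0 = (c⁻¹ * cj d) * Yk' (-1) a l 0 := by
      have h1 := (Yk_isSol 1 a l).1 0
      have h2 := ((Yk_isSol (-1) a l).1 0).const_mul (c⁻¹ * cj d)
      rw [show Yk 1 a l = fun z => (c⁻¹ * cj d) * Yk (-1) a l z from funext e2] at h1
      exact h1.unique h2
    rw [Wr, e2 0, e3]; ring
  · intro h
    obtain ⟨c, hc⟩ := sol_prop_of_wr (k := -1) (Yk_isSol 1 a l) h
    have hdiff : ∀ z, HasDerivAt (Yk 1 a l) (Yk' 1 a l z) z := (Yk_isSol 1 a l).1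
    have hderiv : deriv (Yk 1 a l) = Yk' 1 a l := funext fun z => (hdiff z).deriv
    refine ⟨Yk 1 a l, fun z => (hdiff z).differentiableAt, Yk_ne 1 a l, fun z => ?_, Y1_tendsto a l, ?_⟩
    · rw [hderiv, ((Yk_isSol 1 a l).2 z).deriv]; ring
    · have h1 := (Complex.continuous_conj.tendsto 0).comp (Y1_tendsto a l)
      have h2 := (h1.comp tendsto_neg_atBot_atTop).const_mul c
      rw [map_zero, mul_zero] at h2
      refine h2.congr fun t => ?_
      rw [hc]
      have := (Yk_conj 1 a l (cj (I * t))).1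
      rw [Complex.conj_conj] at this
      rw [this]
      simp

lemma rel_012 (a l z : ℂ) : Yk 0 a l z + er (2 * Real.pi / 5) * Yk 2 a l z = Wr 0 2 a l / Wr 1 2 a l * Yk 1 a l z ∧
    Yk' 0 a l z + er (2 * Real.pi / 5) * Yk' 2 a l z = Wr 0 2 a l / Wr 1 2 a l * Yk' 1 a l z := by
  have hc := comb_of_wr (w := Wr 1 2 a l) (Yk_isSol 1 a l) (Yk_isSol 2 a l) (Yk_isSol 0 a l) rfl (Wr_adj_ne 1 a l) z
  have e1 : (Yk 1 a l 0 * Yk' 0 a l 0 - Yk' 1 a l 0 * Yk 0 a l 0) = -Wr 0 1 a l := by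
    simp only [Wr]; ring
  have h01 := Wr_adj 0 a l
  have h12 := Wr_adj 1 a l
  norm_num at h01 h12
  have e2 : -Wr 0 1 a l / Wr 1 2 a l = -er (2 * Real.pi / 5) := by
    rw [h01, h12]
    have := er_ne (3 * Real.pi * 3 / 10)
    rw [div_eq_iff (by simpa using this)]
    have e3 : er (2 * Real.pi / 5) * er (3 * Real.pi * 3 / 10) = -er (3 * Real.pi / 10) := by
      rw [← er_add, show 2 * Real.pi / 5 + 3 * Real.pi * 3 / 10 = 3 * Real.pi / 10 + Real.pi by ring, er_add, er_pi]
      ring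
    linear_combination -2 * e3
  rw [e1, e2] at hc
  rw [hc.1, hc.2]
  constructor
  · simp only [Wr]; ring
  · simp only [Wr]; ring

lemma Wr_2_neg2 (a l : ℂ) : Wr 2 (-2) a l = -2 * I := by
  have h := Wr_adj 2 a l
  have h2 : Wr 2 (-2 + 5) a l = Wr 2 (-2) a l := by rw [(Wr_period 2 (-2)).2]
  rw [← h2]
  norm_num at h ⊢
  rw [h, show 3 * Real.pi * 5 / 10 = Real.pi / 2 + Real.pi by ring, er_add, er_pi, er_pi_div_two]
  ring

noncomputable def DD (a l : ℝ) : ℂ := I / 2 * (er (-(2 * Real.pi / 5)) * Wr 0 (-2) a l)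

lemma wr_iff_DD (a l : ℝ) : Wr 1 (-1) a l = 0 ↔ (DD a l).re = -1 / 2 := by
  set κ := Wr 0 2 a l / Wr 1 2 a l with hκ
  have r1 := rel_012 a l 0
  rw [← hκ] at r1
  have cz : ∀ k : ℤ, Yk (-k) a l 0 = cj (Yk k a l 0) ∧ Yk' (-k) a l 0 = cj (Yk' k a l 0) := fun k => by
    have := Yk_conj k a l 0; rwa [map_zero] at this
  have c0 := cz 0
  rw [neg_zero] at c0
  have r2 := congrArg cj r1.1
  have r3 := congrArg cj r1.2
  simp only [map_add, map_mul, ← (cz 2).1, ← (cz 1).1, ← (cz 2).2, ← (cz 1).2, ← c0.1, ← c0.2, er_conj] at r2 r3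
  set ω := er (2 * Real.pi / 5) with hω
  set ω' := er (-(2 * Real.pi / 5)) with hω'
  have hωω : ω' * ω = 1 := er_neg_mul _
  have hW := Wr_2_neg2 a l
  have hκ0 : κ ≠ 0 := by
    intro h0
    rw [h0] at r1 r2 r3
    simp only [map_zero, zero_mul] at r1 r2 r3
    have : Wr 2 (-2) a l = 0 := by
      have h2 : ω * ω' * Wr 2 (-2) a l = 0 := by
        simp only [Wr]
        linear_combination (ω' * Yk' (-2) a l 0) * r1.1 - (ω' * Yk (-2) a l 0) * r1.2
          - Yk 0 a l 0 * r3 + Yk' 0 a l 0 * r2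
      rw [mul_comm ω, hωω, one_mul] at h2
      exact h2
    rw [this] at hW
    have := congrArg Complex.im hW
    norm_num at this
  set X := ω' * Wr 0 (-2) a l with hX
  have hXc : cj X = ω * Wr 0 2 a l := by
    rw [hX, map_mul, hω', er_conj, neg_neg, ← Wr_conj]; simp [hω]
  have key : X - cj X - 2 * I = κ * cj κ * Wr 1 (-1) a l := by
    rw [hXc, hX]
    have : -2 * I = Wr 2 (-2) a l := hW.symm
    have h3 : κ * cj κ * Wr 1 (-1) a l = (κ * Yk 1 a l 0) * (cj κ * Yk' (-1) a l 0)
      - (κ * Yk' 1 a l 0) * (cj κ * Yk (-1) a l 0) := by simp only [Wr]; ring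
    rw [h3, ← r1.1, ← r1.2, ← r2, ← r3]
    simp only [Wr] at this ⊢
    linear_combination this - (Yk 2 a l 0 * Yk' (-2) a l 0 - Yk' 2 a l 0 * Yk (-2) a l 0) * hωω
  have hD : (DD a l).re = -X.im / 2 := by
    rw [DD, ← hω', ← hX]
    simp [Complex.mul_re, Complex.div_re, Complex.div_im]
    ring
  have hXX : X - cj X = (2 * X.im : ℝ) * I := by
    rw [Complex.sub_conj]
  rw [hD]
  constructor
  · intro h
    rw [h, mul_zero, hXX] at key
    have := congrArg Complex.im key
    simp at this
    linarith
  · intro h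
    have hX1 : X.im = 1 := by linarith
    rw [hXX, hX1] at key
    have h0 : κ * cj κ * Wr 1 (-1) a l = 0 := by rw [← key]; push_cast; ring
    rcases mul_eq_zero.1 h0 with h1 | h1
    · rcases mul_eq_zero.1 h1 with h2 | h2
      · exact absurd h2 hκ0
      · exact absurd ((map_eq_zero _).1 h2) hκ0
    · exact h1

lemma eig_iff (a l : ℝ) : (∃ y, IsCubicEigenfunction a l y) ↔ (DD a l).re = -1 / 2 :=
  (eig_iff_wr a l).trans (wr_iff_DD a l)

end Cub


namespace Cub

local notation "cj" => starRingEnd ℂ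

/-- fourth root on the real line -/
noncomputable def rq (x : ℝ) : ℝ := Real.sqrt (Real.sqrt x)
/-- WKB phase -/
noncomputable def ph (a x : ℝ) : ℝ := 2 / 5 * Real.sqrt x ^ 5 - a * Real.sqrt x
noncomputable def PP (a l x : ℝ) : ℝ := x ^ 3 - a * x - l
noncomputable def uu (a l x : ℝ) : ℝ := (Yk 0 a l (-(x : ℂ))).re
noncomputable def uu' (a l x : ℝ) : ℝ := -(Yk' 0 a l (-(x : ℂ))).re
noncomputable def gg (a l x : ℝ) : ℂ := er (-(3 * Real.pi / 20)) * Yk (-2) a l (-(x : ℂ))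
noncomputable def gg' (a l x : ℝ) : ℂ := -(er (-(3 * Real.pi / 20)) * Yk' (-2) a l (-(x : ℂ)))

lemma rq_sq (x : ℝ) : rq x ^ 2 = Real.sqrt x := Real.sq_sqrt (Real.sqrt_nonneg x)
lemma rq_four {x : ℝ} (hx : 0 ≤ x) : rq x ^ 4 = x := by
  rw [show (4 : ℕ) = 2 * 2 by norm_num, pow_mul, rq_sq, Real.sq_sqrt hx]
lemma rq_pos {x : ℝ} (hx : 0 < x) : 0 < rq x := Real.sqrt_pos.2 (Real.sqrt_pos.2 hx)
lemma rq_nonneg (x : ℝ) : 0 ≤ rq x := Real.sqrt_nonneg _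

lemma ph_eq (a x : ℝ) : ph a x = 2 / 5 * rq x ^ 10 - a * rq x ^ 2 := by
  rw [ph, ← rq_sq]; ring

lemma Y0_real (a l x : ℝ) : Yk 0 a l (x : ℂ) = ((Yk 0 a l (x : ℂ)).re : ℂ) ∧
    Yk' 0 a l (x : ℂ) = ((Yk' 0 a l (x : ℂ)).re : ℂ) := by
  have h := Yk_conj 0 a l x
  rw [neg_zero, Complex.conj_ofReal] at h
  exact ⟨(Complex.conj_eq_iff_re.1 h.1.symm).symm, (Complex.conj_eq_iff_re.1 h.2.symm).symm⟩

lemma uu_c (a l x : ℝ) : (uu a l x : ℂ) = Yk 0 a l (-(x : ℂ)) := by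
  have := (Y0_real a l (-x)).1
  push_cast at this
  rw [uu, ← this]
lemma uu'_c (a l x : ℝ) : (uu' a l x : ℂ) = -Yk' 0 a l (-(x : ℂ)) := by
  have := (Y0_real a l (-x)).2
  push_cast at this
  rw [uu', ofReal_neg, ← this]

lemma Yk_real_der (k : ℤ) (a l x : ℝ) :
    HasDerivAt (fun x : ℝ => Yk k a l (-(x : ℂ))) (-Yk' k a l (-(x : ℂ))) x ∧
    HasDerivAt (fun x : ℝ => -Yk' k a l (-(x : ℂ))) (-(PP a l x : ℂ) * Yk k a l (-(x : ℂ))) x := by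
  have hn : HasDerivAt (fun z : ℂ => -z) (-1) (x : ℂ) := hasDerivAt_neg _
  have h1 := (((Yk_isSol k a l).1 (-(x : ℂ))).comp (x : ℂ) hn).comp_ofReal
  have h2 := (((Yk_isSol k a l).2 (-(x : ℂ))).comp (x : ℂ) hn).neg.comp_ofReal
  refine ⟨h1.congr_deriv (by ring), h2.congr_deriv ?_⟩
  rw [PP]; push_cast; ring

lemma re_der {f : ℝ → ℂ} {f' : ℂ} {x : ℝ} (h : HasDerivAt f f' x) :
    HasDerivAt (fun x => (f x).re) f'.re x := by
  have := Complex.reCLM.hasFDerivAt.comp_hasDerivAt x h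
  exact this
lemma im_der {f : ℝ → ℂ} {f' : ℂ} {x : ℝ} (h : HasDerivAt f f' x) :
    HasDerivAt (fun x => (f x).im) f'.im x := by
  have := Complex.imCLM.hasFDerivAt.comp_hasDerivAt x h
  exact this
lemma conj_der {f : ℝ → ℂ} {f' : ℂ} {x : ℝ} (h : HasDerivAt f f' x) :
    HasDerivAt (fun x => cj (f x)) (cj f') x := by
  have := Complex.conjCLE.toContinuousLinearMap.hasFDerivAt.comp_hasDerivAt x h
  exact this

lemma uu_der (a l x : ℝ) : HasDerivAt (uu a l) (uu' a l x) x := by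
  have := re_der (Yk_real_der 0 a l x).1
  exact this
lemma uu'_der (a l x : ℝ) : HasDerivAt (uu' a l) (-(PP a l x) * uu a l x) x := by
  have := re_der (Yk_real_der 0 a l x).2
  refine this.congr_deriv ?_
  rw [← ofReal_neg, Complex.re_ofReal_mul, uu]
lemma gg_der (a l x : ℝ) : HasDerivAt (gg a l) (gg' a l x) x := by
  have := (Yk_real_der (-2) a l x).1.const_mul (er (-(3 * Real.pi / 20)))
  exact this.congr_deriv (by rw [gg']; ring)
lemma gg'_der (a l x : ℝ) : HasDerivAt (gg' a l) (-(PP a l x : ℂ) * gg a l x) x := by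
  have := (Yk_real_der (-2) a l x).2.const_mul (er (-(3 * Real.pi / 20)))
  refine (this.congr_of_eventuallyEq (Eventually.of_forall fun y => ?_)).congr_deriv (by rw [gg]; ring)
  simp only [gg']; ring

lemma gg_conj (a l x : ℝ) : cj (gg a l x) = er (3 * Real.pi / 20) * Yk 2 a l (-(x : ℂ)) ∧
    cj (gg' a l x) = -(er (3 * Real.pi / 20) * Yk' 2 a l (-(x : ℂ))) := by
  have h := Yk_conj (-2) a l (-(x : ℂ))
  simp only [map_neg, Complex.conj_ofReal, neg_neg] at h
  simp only [gg, gg', map_mul, map_neg, er_conj, ← h.1, ← h.2, neg_neg, and_self]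

lemma gg_wr (a l x : ℝ) : (cj (gg a l x) * gg' a l x).im = 1 := by
  have h := gg_conj a l x
  have hW := (Wr_eq 2 (-2) a l (-(x : ℂ))).trans (Wr_2_neg2 a l)
  have h2 : cj (gg a l x) * gg' a l x - cj (cj (gg a l x) * gg' a l x) = 2 * I := by
    rw [map_mul, Complex.conj_conj, h.1, h.2, gg, gg']
    have := er_neg_mul (3 * Real.pi / 20)
    linear_combination (-1) * hW - (Yk 2 a l (-(x : ℂ)) * Yk' (-2) a l (-(x : ℂ)) - Yk' 2 a l (-(x : ℂ)) * Yk (-2) a l (-(x : ℂ))) * this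
  rw [Complex.sub_conj] at h2
  have := congrArg Complex.im h2
  generalize cj (gg a l x) * gg' a l x = w at this ⊢
  simp at this
  linarith

noncomputable def cc (a l : ℝ) : ℂ := I * (uu a l 0 * cj (gg' a l 0) - uu' a l 0 * cj (gg a l 0))

lemma cc_conj_eq (a l x : ℝ) : cj (I * (uu a l x * cj (gg' a l x) - uu' a l x * cj (gg a l x)))
    = I * er (-(3 * Real.pi / 20)) * Wr 0 (-2) a l := by
  simp only [map_mul, map_sub, Complex.conj_conj, Complex.conj_ofReal, conj_I]
  simp only [uu_c, uu'_c, gg, gg']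
  rw [← Wr_eq 0 (-2) a l (-(x : ℂ))]
  ring

lemma cc_eq (a l x : ℝ) : cc a l = I * (uu a l x * cj (gg' a l x) - uu' a l x * cj (gg a l x)) := by
  apply (starRingEnd ℂ).injective
  rw [cc_conj_eq, cc, cc_conj_eq]

lemma DD_eq (a l : ℝ) : DD a l = 1 / 2 * er (-(Real.pi / 4)) * cj (cc a l) := by
  rw [cc, cc_conj_eq, DD, show -(2 * Real.pi / 5) = -(Real.pi / 4) + -(3 * Real.pi / 20) by ring, er_add]
  ring

/-- real-part representation, for an arbitrary frame -/
lemma re_repr (u u' : ℝ) (G G' : ℂ) (h : (cj G * G').im = 1) :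
    I * (u * cj G' - u' * cj G) * G = u + I * (u * (cj G * G').re - u' * ‖G‖ ^ 2 : ℝ) := by
  have h1 : cj G' * G = (cj G * G').re - I := by
    have : cj G' * G = cj (cj G * G') := by simp [mul_comm]
    rw [this]
    apply Complex.ext
    · simp
    · rw [Complex.conj_im, h]; simp
  have h2 : cj G * G = (‖G‖ ^ 2 : ℝ) := by
    rw [Complex.conj_mul']; push_cast; rfl
  push_cast at h2 ⊢
  linear_combination I * u * h1 - I * u' * h2 - u * I_sq

lemma cc_gg (a l x : ℝ) : cc a l * gg a l x = uu a l x +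
    I * (uu a l x * (cj (gg a l x) * gg' a l x).re - uu' a l x * ‖gg a l x‖ ^ 2 : ℝ) := by
  rw [cc_eq a l x, re_repr _ _ _ _ (gg_wr a l x)]

lemma uu_eq (a l x : ℝ) : uu a l x = (cc a l * gg a l x).re := by
  rw [cc_gg]; simp [-ofReal_sub, -ofReal_mul]

lemma gg_ne (a l x : ℝ) : gg a l x ≠ 0 := by
  intro h
  have := gg_wr a l x
  rw [h] at this; simp at this

lemma Y_real_cont (k : ℤ) : Continuous (fun q : (ℝ × ℝ) × ℝ => Yk k q.1.1 q.1.2 (-(q.2 : ℂ))) ∧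
    Continuous (fun q : (ℝ × ℝ) × ℝ => Yk' k q.1.1 q.1.2 (-(q.2 : ℂ))) := by
  have h : Continuous (fun q : (ℝ × ℝ) × ℝ => (((q.1.1 : ℂ), (q.1.2 : ℂ)), -(q.2 : ℂ))) := by fun_prop
  have h1 := (Yk_cont k).comp h
  have h2 := (Yk'_cont k).comp h
  exact ⟨h1, h2⟩

lemma uu_cont : Continuous (fun q : (ℝ × ℝ) × ℝ => uu q.1.1 q.1.2 q.2) :=
  Complex.continuous_re.comp (Y_real_cont 0).1
lemma uu'_cont : Continuous (fun q : (ℝ × ℝ) × ℝ => uu' q.1.1 q.1.2 q.2) :=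
  (Complex.continuous_re.comp (Y_real_cont 0).2).neg
lemma gg_cont : Continuous (fun q : (ℝ × ℝ) × ℝ => gg q.1.1 q.1.2 q.2) :=
  (Y_real_cont (-2)).1.const_mul _
lemma gg'_cont : Continuous (fun q : (ℝ × ℝ) × ℝ => gg' q.1.1 q.1.2 q.2) :=
  ((Y_real_cont (-2)).2.const_mul _).neg

lemma cc_cont : Continuous (fun q : ℝ × ℝ => cc q.1 q.2) := by
  have h : Continuous (fun q : ℝ × ℝ => ((q.1, q.2), (0 : ℝ))) := by fun_prop
  have h1 := uu_cont.comp h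
  have h2 := uu'_cont.comp h
  have h3 := gg_cont.comp h
  have h4 := gg'_cont.comp h
  exact ((Complex.continuous_ofReal.comp h1).mul (Complex.continuous_conj.comp h4)).sub
    ((Complex.continuous_ofReal.comp h2).mul (Complex.continuous_conj.comp h3)) |>.const_mul I

lemma DD_cont : Continuous (fun q : ℝ × ℝ => DD q.1 q.2) := by
  simp only [DD_eq]
  exact (Complex.continuous_conj.comp cc_cont).const_mul _

lemma Tk0 (a ρ : ℝ) : Tk 0 a ρ = ((ρ⁻¹ ^ 3 * Real.exp (-(2 / 5 * ρ ^ 10 - a * ρ ^ 2)) : ℝ) : ℂ) := by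
  rw [Tk, Sv]; push_cast; simp [er_zero]

lemma Tkm2 (a ρ : ℝ) : er (-(3 * Real.pi / 20)) * Tk (-2) a (ρ * er (-(Real.pi / 4))) =
    (ρ⁻¹ ^ 3 : ℝ) * er (2 / 5 * ρ ^ 10 - a * ρ ^ 2) := by
  have h10 : er (-(Real.pi / 4)) ^ 10 = -I := by
    rw [er_pow, ← er_pi_div_two, ← neg_one_mul (er _), ← er_pi, ← er_add]
    exact er_congr (-2) (by push_cast; ring)
  have h2 : er (-(Real.pi / 4)) ^ 2 = -I := by
    rw [er_pow, ← er_pi_div_two, ← neg_one_mul (er _), ← er_pi, ← er_add]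
    exact er_congr (-1) (by push_cast; ring)
  have e1 : exp (-((-1) ^ (-2 : ℤ) * Sv a (ρ * er (-(Real.pi / 4))))) = er (2 / 5 * ρ ^ 10 - a * ρ ^ 2) := by
    rw [Sv, mul_pow, mul_pow, h10, h2, er]
    congr 1
    push_cast
    norm_num
    ring
  rw [Tk, e1, mul_inv, mul_pow, er_inv_pow]
  have e2 : er (-(3 * Real.pi / 20)) * er (3 * Real.pi * ((-2 : ℤ) : ℝ) / 10) * er (-(((3 : ℕ) : ℝ) * -(Real.pi / 4))) = 1 := by
    rw [← er_add, ← er_add, ← er_zero]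
    congr 1
    push_cast; ring
  push_cast
  push_cast at e2
  linear_combination ((ρ : ℂ)⁻¹ ^ 3 * er (2 / 5 * ρ ^ 10 - a * ρ ^ 2)) * e2

lemma gg_as (B ε : ℝ) (hB : 0 ≤ B) (hε : 0 < ε) : ∃ R : ℝ, 1 ≤ R ∧ ∀ a l : ℝ, |a| ≤ B → |l| ≤ B →
    ∀ x, R ≤ x → ‖gg a l x * rq x ^ 3 * er (-ph a x) - 1‖ ≤ ε ∧
      ‖gg' a l x * ((rq x : ℂ) ^ 3)⁻¹ * er (-ph a x) * (-I) - 1‖ ≤ ε := by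
  obtain ⟨R, hR1, hR⟩ := AS B ε hB hε
  refine ⟨R ^ 4, one_le_pow₀ hR1, fun a l ha hl x hx => ?_⟩
  have hx0 : 0 < x := by have : 0 < R ^ 4 := by positivity
                         linarith
  have hρ : R ≤ rq x := by
    apply le_of_pow_le_pow_left₀ four_ne_zero (rq_nonneg x)
    rwa [rq_four hx0.le]
  have hρ0 := rq_pos hx0
  have h := hR a l (by rwa [Complex.norm_real]) (by rwa [Complex.norm_real]) (-2) (rq x) (-(Real.pi / 4)) hρ
    (by push_cast; rw [abs_of_neg] <;> linarith [Real.pi_pos])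
  have hz : ((rq x : ℂ) * er (-(Real.pi / 4))) ^ 4 = -x := by
    rw [mul_pow, er_pow, ← Complex.ofReal_pow, rq_four hx0.le,
      show ((4 : ℕ) : ℝ) * -(Real.pi / 4) = -Real.pi by push_cast; ring, er_neg, er_pi]
    norm_num
  have hT := Tkm2 a (rq x)
  rw [← ph_eq] at hT
  rw [hz] at h
  have hρc : (rq x : ℂ) ≠ 0 := by exact_mod_cast hρ0.ne'
  have hv : (rq x : ℂ) * er (-(Real.pi / 4)) ≠ 0 := mul_ne_zero hρc (er_ne _)
  have hT0 := Tk_ne (-2) a hv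
  have h6 : ((rq x : ℂ) * er (-(Real.pi / 4))) ^ 6 = rq x ^ 6 * I := by
    rw [mul_pow, er_pow, ← er_pi_div_two]
    congr 1
    exact er_congr (-1) (by push_cast; ring)
  rw [h6] at h
  set T := Tk (-2) a (rq x * er (-(Real.pi / 4)))
  have e0 := er_ne (-(3 * Real.pi / 20))
  have e1 := er_ne (ph a x)
  have hTe : T = (er (-(3 * Real.pi / 20)))⁻¹ * ((rq x)⁻¹ ^ 3 : ℝ) * er (ph a x) := by
    rw [mul_assoc, ← hT]; field_simp
  have hm : ((-1 : ℂ)) ^ (-2 : ℤ) = 1 := by norm_num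
  rw [hm, one_mul] at h
  constructor
  · convert h.1 using 2
    rw [hTe, gg, er_neg (ph a x)]
    push_cast
    field_simp
  · convert h.2 using 2
    rw [hTe, gg', er_neg (ph a x)]
    push_cast
    field_simp
    linear_combination (er (-(3 * Real.pi / 20)) * Yk' (-2) (↑a) (↑l) (-↑x)) * I_sq

lemma uu_as (B ε : ℝ) (hB : 0 ≤ B) (hε : 0 < ε) : ∃ R : ℝ, 1 ≤ R ∧ ∀ a l : ℝ, |a| ≤ B → |l| ≤ B →
    ∀ x, R ≤ x → |uu a l (-x) * rq x ^ 3 * Real.exp (ph a x) - 1| ≤ ε ∧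
      |uu' a l (-x) * ((rq x) ^ 3)⁻¹ * Real.exp (ph a x) - 1| ≤ ε := by
  obtain ⟨R, hR1, hR⟩ := AS B ε hB hε
  refine ⟨R ^ 4, one_le_pow₀ hR1, fun a l ha hl x hx => ?_⟩
  have hx0 : 0 < x := by have : 0 < R ^ 4 := by positivity
                         linarith
  have hρ : R ≤ rq x := by
    apply le_of_pow_le_pow_left₀ four_ne_zero (rq_nonneg x)
    rwa [rq_four hx0.le]
  have hρ0 := rq_pos hx0
  have h := hR a l (by rwa [Complex.norm_real]) (by rwa [Complex.norm_real]) 0 (rq x) 0 hρ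
    (by simp; positivity)
  rw [er_zero, mul_one, Tk0, ← ph_eq, ← Complex.ofReal_pow, rq_four hx0.le, ← Complex.ofReal_pow] at h
  have h1 : Yk 0 a l (x : ℂ) = (uu a l (-x) : ℂ) := by rw [uu_c]; simp
  have h2 : Yk' 0 a l (x : ℂ) = -(uu' a l (-x) : ℂ) := by rw [uu'_c]; simp
  rw [h1, h2] at h
  have hE := Real.exp_pos (-ph a x)
  rw [Real.exp_neg] at h
  have hE := Real.exp_pos (ph a x)
  constructor
  · have := h.1
    rw [← Complex.ofReal_div, ← Complex.ofReal_one, ← Complex.ofReal_sub, Complex.norm_real] at this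
    convert this using 1
    rw [Real.norm_eq_abs]
    congr 2
    field_simp
  · have := h.2
    rw [zpow_zero, one_mul, ← Complex.ofReal_neg, ← Complex.ofReal_neg, ← Complex.ofReal_mul,
      ← Complex.ofReal_div, ← Complex.ofReal_one, ← Complex.ofReal_sub, Complex.norm_real] at this
    convert this using 1
    rw [Real.norm_eq_abs]
    congr 2
    field_simp

end Cub


namespace Cub

local notation "cj" => starRingEnd ℂ

lemma ph_der (a : ℝ) {x : ℝ} (hx : 0 < x) :
    HasDerivAt (ph a) (Real.sqrt x ^ 3 - a / 2 * (Real.sqrt x)⁻¹) x := by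
  have h := Real.hasDerivAt_sqrt hx.ne'
  have h2 := ((h.pow 5).const_mul (2 / 5 : ℝ)).sub (h.const_mul a)
  refine HasDerivAt.congr_deriv (f := ph a) h2 ?_
  have hs := Real.sqrt_pos.2 hx
  field_simp
  push_cast
  ring

lemma er_der {f : ℝ → ℝ} {f' x : ℝ} (h : HasDerivAt f f' x) :
    HasDerivAt (fun x => er (f x)) (I * f' * er (f x)) x := by
  have h1 := ((h.ofReal_comp).mul_const I).cexp
  refine HasDerivAt.congr_deriv (f := fun x => er (f x)) h1 ?_
  rw [er]; ring

lemma im_div_of_wr {G G' : ℂ} (h : (cj G * G').im = 1) : (G' / G).im = 1 / ‖G‖ ^ 2 := by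
  have : G' / G = cj G * G' / ((‖G‖ ^ 2 : ℝ) : ℂ) := by
    have hG : G ≠ 0 := by rintro rfl; simp at h
    rw [← Complex.normSq_eq_norm_sq, Complex.normSq_eq_conj_mul_self]
    have : cj G ≠ 0 := by simpa using hG
    field_simp
  rw [this, Complex.div_ofReal_im, h]

lemma arg_der {f : ℝ → ℂ} {f' : ℂ} {x : ℝ} (h : HasDerivAt f f' x) (hs : f x ∈ slitPlane) :
    HasDerivAt (fun x => (f x).arg) (f' / f x).im x := by
  have h1 := im_der (h.clog_real hs)
  simpa [Complex.log_im] using h1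

lemma gg_int (a l : ℝ) : Continuous (fun t => 1 / ‖gg a l t‖ ^ 2) := by
  have h : Continuous (fun t : ℝ => ((a, l), t)) := by fun_prop
  have h2 := gg_cont.comp h
  have h3 : Continuous (gg a l) := h2
  exact continuous_const.div (h3.norm.pow 2) (fun t => pow_ne_zero _ (norm_ne_zero_iff.2 (gg_ne a l t)))

noncomputable def Igg (a l x : ℝ) : ℝ := ∫ t in (0 : ℝ)..x, 1 / ‖gg a l t‖ ^ 2

lemma Igg_der (a l x : ℝ) : HasDerivAt (Igg a l) (1 / ‖gg a l x‖ ^ 2) x :=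
  intervalIntegral.integral_hasDerivAt_right ((gg_int a l).intervalIntegrable _ _)
    ((gg_int a l).stronglyMeasurableAtFilter _ _) (gg_int a l).continuousAt

lemma Igg_cont (x : ℝ) : Continuous (fun q : ℝ × ℝ => Igg q.1 q.2 x) := by
  have h3 : Continuous (fun p : (ℝ × ℝ) × ℝ => 1 / ‖gg p.1.1 p.1.2 p.2‖ ^ 2) :=
    continuous_const.div (gg_cont.norm.pow 2) (fun t => pow_ne_zero _ (norm_ne_zero_iff.2 (gg_ne _ _ _)))
  exact intervalIntegral.continuous_parametric_intervalIntegral_of_continuous' (f := fun (q : ℝ × ℝ) t => 1 / ‖gg q.1 q.2 t‖ ^ 2) h3 0 x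

noncomputable def mm (a l x : ℝ) : ℂ := gg a l x * er (-ph a x)

lemma slit_of_near {z : ℂ} (h : ‖z - 1‖ ≤ 1 / 2) : z ∈ slitPlane := by
  left
  have := (abs_re_le_norm (z - 1)).trans h
  simp only [sub_re, one_re] at this
  linarith [(abs_le.1 this).1]

noncomputable def kk (a l x : ℝ) : ℝ := ph a x + (mm a l x).arg - Igg a l x

lemma mm_slit {a l x : ℝ} (hx : 0 < x) (h : ‖gg a l x * rq x ^ 3 * er (-ph a x) - 1‖ ≤ 1 / 2) :
    mm a l x ∈ slitPlane := by
  have h1 := slit_of_near h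
  have h2 : gg a l x * rq x ^ 3 * er (-ph a x) = ((rq x ^ 3 : ℝ) : ℂ) * mm a l x := by
    rw [mm]; push_cast; ring
  have h3 : 0 < rq x ^ 3 := pow_pos (rq_pos hx) 3
  rw [h2] at h1
  rcases h1 with h1 | h1
  · left
    rw [Complex.re_ofReal_mul] at h1
    exact pos_of_mul_pos_right h1 h3.le
  · right
    rw [Complex.im_ofReal_mul] at h1
    exact right_ne_zero_of_mul h1

lemma kk_der {a l x : ℝ} (hx : 0 < x) (hs : mm a l x ∈ slitPlane) : HasDerivAt (kk a l) 0 x := by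
  have h1 := ph_der a hx
  have h2 := (gg_der a l x).mul (er_der h1.neg)
  have h3 := arg_der (f := mm a l) h2 hs
  refine ((h1.add h3).sub (Igg_der a l x)).congr_deriv ?_
  have hg := gg_ne a l x
  have he := er_ne (-ph a x)
  have e : (gg' a l x * er (-ph a x) + gg a l x * (I * ((-(Real.sqrt x ^ 3 - a / 2 * (Real.sqrt x)⁻¹) : ℝ) : ℂ) * er (-ph a x))) / mm a l x
     = gg' a l x / gg a l x - (Real.sqrt x ^ 3 - a / 2 * (Real.sqrt x)⁻¹ : ℝ) * I := by
    rw [mm]; field_simp; push_cast; ring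
  erw [e]
  rw [Complex.sub_im, im_div_of_wr (gg_wr a l x), Complex.im_ofReal_mul, I_im]
  ring

lemma kk_const {a l R : ℝ} (hR : 1 ≤ R) (h : ∀ x, R ≤ x → mm a l x ∈ slitPlane) :
    ∀ x, R ≤ x → kk a l x = kk a l R := by
  intro x hx
  have := constant_of_has_deriv_right_zero (f := kk a l) (a := R) (b := x)
    (fun y hy => (kk_der (by linarith [hy.1]) (h y hy.1)).continuousAt.continuousWithinAt)
    (fun y hy => (kk_der (by linarith [hy.1]) (h y hy.1)).hasDerivWithinAt)
  exact this x ⟨hx, le_rfl⟩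

lemma mm_slit_ev (B : ℝ) (hB : 0 ≤ B) : ∃ R : ℝ, 1 ≤ R ∧ ∀ a l : ℝ, |a| ≤ B → |l| ≤ B →
    ∀ x, R ≤ x → mm a l x ∈ slitPlane := by
  obtain ⟨R, hR1, hR⟩ := gg_as B (1 / 2) hB (by norm_num)
  exact ⟨R, hR1, fun a l ha hl x hx => mm_slit (by linarith) (hR a l ha hl x hx).1⟩

lemma psi0_ex (a l : ℝ) : ∃ p : ℝ, ∀ᶠ X in atTop, kk a l X = p := by
  obtain ⟨R, hR1, hR⟩ := mm_slit_ev (|a| + |l|) (by positivity)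
  exact ⟨kk a l R, eventually_atTop.2 ⟨R, kk_const hR1 (hR a l (by linarith [abs_nonneg l]) (by linarith [abs_nonneg a]))⟩⟩

noncomputable def psi0 (a l : ℝ) : ℝ := (psi0_ex a l).choose
lemma psi0_spec (a l : ℝ) : ∀ᶠ X in atTop, kk a l X = psi0 a l := (psi0_ex a l).choose_spec

/-- lifted phase of `gg` -/
noncomputable def psi (a l x : ℝ) : ℝ := psi0 a l + Igg a l x

lemma psi_der (a l x : ℝ) : HasDerivAt (psi a l) (1 / ‖gg a l x‖ ^ 2) x :=
  (Igg_der a l x).const_add _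

lemma psi_eq {a l R : ℝ} (hR : 1 ≤ R) (h : ∀ x, R ≤ x → mm a l x ∈ slitPlane) {x : ℝ} (hx : R ≤ x) :
    psi a l x = ph a x + (mm a l x).arg := by
  have h1 := kk_const hR h
  obtain ⟨X, hX1, hX2⟩ := ((psi0_spec a l).and (eventually_ge_atTop R)).exists
  have : psi0 a l = kk a l x := by rw [h1 x hx, ← hX1, h1 X hX2]
  rw [psi, this, kk]; ring

lemma mm_cont (R : ℝ) : Continuous (fun q : ℝ × ℝ => mm q.1 q.2 R) := by
  have hph : Continuous (fun q : ℝ × ℝ => ph q.1 R) := by unfold ph; fun_prop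
  have h : Continuous (fun q : ℝ × ℝ => ((q.1, q.2), R)) := by fun_prop
  have h3 : Continuous (fun q : ℝ × ℝ => gg q.1 q.2 R) := by
    have h5 := gg_cont.comp h
    exact h5
  have h4 : Continuous (fun q : ℝ × ℝ => er (-ph q.1 R)) := by
    unfold er
    exact Complex.continuous_exp.comp ((Complex.continuous_ofReal.comp hph.neg).mul continuous_const)
  unfold mm
  exact h3.mul h4

lemma box_ev (q0 : ℝ × ℝ) : ∀ᶠ q : ℝ × ℝ in nhds q0, |q.1| ≤ |q0.1| + |q0.2| + 1 ∧ |q.2| ≤ |q0.1| + |q0.2| + 1 := by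
  have h1 : ∀ᶠ q : ℝ × ℝ in nhds q0, |q.1| < |q0.1| + |q0.2| + 1 :=
    (continuous_fst.abs.tendsto q0).eventually_lt_const (by linarith [abs_nonneg q0.2])
  have h2 : ∀ᶠ q : ℝ × ℝ in nhds q0, |q.2| < |q0.1| + |q0.2| + 1 :=
    (continuous_snd.abs.tendsto q0).eventually_lt_const (by linarith [abs_nonneg q0.1])
  filter_upwards [h1, h2] with q h1 h2 using ⟨h1.le, h2.le⟩

lemma kk_contAt (R : ℝ) (q0 : ℝ × ℝ) (hs : mm q0.1 q0.2 R ∈ slitPlane) :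
    ContinuousAt (fun q : ℝ × ℝ => kk q.1 q.2 R) q0 := by
  have hph : Continuous (fun q : ℝ × ℝ => ph q.1 R) := by unfold ph; fun_prop
  have harg : ContinuousAt (fun q : ℝ × ℝ => (mm q.1 q.2 R).arg) q0 :=
    ContinuousAt.comp (f := fun q : ℝ × ℝ => mm q.1 q.2 R) (Complex.continuousAt_arg hs) (mm_cont R).continuousAt
  have hI := (Igg_cont R).continuousAt (x := q0)
  unfold kk
  exact (hph.continuousAt.add harg).sub hI

lemma psi0_kk {a l R : ℝ} (hR : 1 ≤ R) (h : ∀ x, R ≤ x → mm a l x ∈ slitPlane) :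
    psi0 a l = kk a l R := by
  have h := psi_eq hR h le_rfl
  rw [psi] at h
  rw [kk]; linarith

lemma psi0_cont : Continuous (fun q : ℝ × ℝ => psi0 q.1 q.2) := by
  rw [continuous_iff_continuousAt]
  intro q0
  obtain ⟨R, hR1, hR⟩ := mm_slit_ev (|q0.1| + |q0.2| + 1) (by positivity)
  have e : (fun q : ℝ × ℝ => psi0 q.1 q.2) =ᶠ[nhds q0] fun q => kk q.1 q.2 R := by
    filter_upwards [box_ev q0] with q hq using psi0_kk hR1 (hR q.1 q.2 hq.1 hq.2)
  refine ContinuousAt.congr (kk_contAt R q0 ?_) e.symm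
  exact hR q0.1 q0.2 (by linarith [abs_nonneg q0.2]) (by linarith [abs_nonneg q0.1]) R le_rfl

lemma psi_cont (x : ℝ) : Continuous (fun q : ℝ × ℝ => psi q.1 q.2 x) := by
  unfold psi
  exact psi0_cont.add (Igg_cont x)

/-- a reference frame on `[x₁, ∞)` -/
structure Fr (a x₁ : ℝ) (Q : ℝ → ℝ) (G G' : ℝ → ℂ) (θ : ℝ → ℝ) : Prop where
  dG : ∀ x, x₁ ≤ x → HasDerivAt G (G' x) x
  dG' : ∀ x, x₁ ≤ x → HasDerivAt G' (-(Q x : ℂ) * G x) x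
  wr : ∀ x, x₁ ≤ x → (cj (G x) * G' x).im = 1
  th : ∀ x, x₁ ≤ x → HasDerivAt θ (1 / ‖G x‖ ^ 2) x
  pol : ∀ x, x₁ ≤ x → G x = ‖G x‖ * er (θ x)
  lim1 : Tendsto (fun x => θ x - ph a x) atTop (nhds 0)
  lim2 : Tendsto (fun x => G x * rq x ^ 3 * er (-ph a x)) atTop (nhds 1)
  lim3 : Tendsto (fun x => G' x * ((rq x : ℂ) ^ 3)⁻¹ * er (-ph a x) * (-I)) atTop (nhds 1)

lemma gg_lim (a l : ℝ) : Tendsto (fun x => gg a l x * rq x ^ 3 * er (-ph a x)) atTop (nhds 1) ∧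
    Tendsto (fun x => gg' a l x * ((rq x : ℂ) ^ 3)⁻¹ * er (-ph a x) * (-I)) atTop (nhds 1) := by
  constructor
  all_goals
    rw [Metric.tendsto_nhds]
    intro ε hε
    obtain ⟨R, hR1, hR⟩ := gg_as (|a| + |l|) (ε / 2) (by positivity) (by positivity)
    filter_upwards [eventually_ge_atTop R] with x hx
    have := hR a l (by linarith [abs_nonneg l]) (by linarith [abs_nonneg a]) x hx
    rw [dist_eq_norm]
  · linarith [this.1]
  · linarith [this.2]

lemma psi_lim (a l : ℝ) : Tendsto (fun x => psi a l x - ph a x) atTop (nhds 0) := by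
  obtain ⟨R, hR1, hR⟩ := mm_slit_ev (|a| + |l|) (by positivity)
  have h1 : Tendsto (fun x => (gg a l x * rq x ^ 3 * er (-ph a x)).arg) atTop (nhds 0) := by
    have := (Complex.continuousAt_arg (show (1 : ℂ) ∈ slitPlane by simp)).tendsto.comp (gg_lim a l).1
    simpa [Function.comp_def] using this
  refine h1.congr' ?_
  filter_upwards [eventually_ge_atTop R] with x hx
  rw [psi_eq hR1 (hR a l (by linarith [abs_nonneg l]) (by linarith [abs_nonneg a])) hx]
  have h2 : gg a l x * rq x ^ 3 * er (-ph a x) = ((rq x ^ 3 : ℝ) : ℂ) * mm a l x := by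
    rw [mm]; push_cast; ring
  rw [h2, Complex.arg_real_mul _ (pow_pos (rq_pos (by linarith)) 3)]
  ring

lemma norm_der {f : ℝ → ℂ} {f' : ℂ} {x : ℝ} (h : HasDerivAt f f' x) (h0 : f x ≠ 0) :
    HasDerivAt (fun x => ‖f x‖) ((cj (f x) * f').re / ‖f x‖) x := by
  have h1 : HasDerivAt (fun x => ‖f x‖ ^ 2) (2 * (cj (f x) * f').re) x := by
    have := h.norm_sq
    refine this.congr_deriv ?_
    rw [Complex.inner]
    simp [mul_comm]
  have h2 := h1.sqrt (pow_ne_zero _ (norm_ne_zero_iff.2 h0))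
  simp only [Real.sqrt_sq (norm_nonneg _)] at h2
  refine h2.congr_deriv ?_
  rw [mul_div_mul_left _ _ two_ne_zero]

lemma psi_pol (a l x : ℝ) : gg a l x = ‖gg a l x‖ * er (psi a l x) := by
  have hd : ∀ x, HasDerivAt (fun x => gg a l x * er (-psi a l x) / (‖gg a l x‖ : ℂ)) 0 x := by
    intro x
    have hg := gg_ne a l x
    have hN : (‖gg a l x‖ : ℂ) ≠ 0 := by exact_mod_cast norm_ne_zero_iff.2 hg
    have h1 := ((gg_der a l x).mul (er_der (psi_der a l x).neg)).fun_div (norm_der (gg_der a l x) hg).ofReal_comp hN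
    refine h1.congr_deriv ?_
    have hw : cj (gg a l x) * gg' a l x = (cj (gg a l x) * gg' a l x).re + I := by
      apply Complex.ext
      · simp
      · rw [gg_wr]; simp
    have hgg : cj (gg a l x) * gg a l x = ‖gg a l x‖ ^ 2 := Complex.conj_mul' _
    have e : ‖gg a l x‖ ^ 2 * gg' a l x = ((cj (gg a l x) * gg' a l x).re + I) * gg a l x := by
      rw [← hw, ← hgg]; ring
    rw [div_eq_zero_iff]; left
    simp only [Pi.mul_apply]
    generalize (cj (gg a l x) * gg' a l x).re = w at e ⊢
    push_cast
    field_simp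
    linear_combination er ((-psi a l) x) * e
  have hc := is_const_of_deriv_eq_zero (fun x => (hd x).differentiableAt) (fun x => (hd x).deriv)
  obtain ⟨R, hR1, hR⟩ := mm_slit_ev (|a| + |l|) (by positivity)
  have h1 := hc x R
  have hR' := hR a l (by linarith [abs_nonneg l]) (by linarith [abs_nonneg a])
  have h2 : gg a l R * er (-psi a l R) / (‖gg a l R‖ : ℂ) = 1 := by
    rw [psi_eq hR1 hR' le_rfl, neg_add, er_add, ← mul_assoc]
    have := Complex.norm_mul_exp_arg_mul_I (mm a l R)
    have hn : ‖mm a l R‖ = ‖gg a l R‖ := by rw [mm, norm_mul, norm_er, mul_one]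
    rw [hn] at this
    rw [← er] at this
    have e2 : mm a l R * er (-(mm a l R).arg) = ‖gg a l R‖ := by
      calc mm a l R * er (-(mm a l R).arg) = (‖gg a l R‖ * er (mm a l R).arg) * er (-(mm a l R).arg) := by rw [this]
        _ = _ := by rw [mul_assoc, mul_comm (er _), er_neg_mul, mul_one]
    rw [← mm, e2, div_self]
    exact_mod_cast norm_ne_zero_iff.2 (gg_ne a l R)
  rw [h2] at h1
  have hN : (‖gg a l x‖ : ℂ) ≠ 0 := by exact_mod_cast norm_ne_zero_iff.2 (gg_ne a l x)
  rw [div_eq_one_iff_eq hN] at h1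
  rw [← h1, mul_assoc, er_neg_mul, mul_one]

lemma Fr_gg (a l x₁ : ℝ) : Fr a x₁ (PP a l) (gg a l) (gg' a l) (psi a l) where
  dG x _ := gg_der a l x
  dG' x _ := gg'_der a l x
  wr x _ := gg_wr a l x
  th x _ := psi_der a l x
  pol x _ := psi_pol a l x
  lim1 := psi_lim a l
  lim2 := (gg_lim a l).1
  lim3 := (gg_lim a l).2

end Cub


namespace Cub

local notation "cj" => starRingEnd ℂ

lemma uu_pos_ev (B : ℝ) (hB : 0 ≤ B) : ∃ R : ℝ, 1 ≤ R ∧ ∀ a l : ℝ, |a| ≤ B → |l| ≤ B →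
    ∀ x, x ≤ -R → 0 < uu a l x := by
  obtain ⟨R, hR1, hR⟩ := uu_as B (1 / 2) hB (by norm_num)
  refine ⟨R, hR1, fun a l ha hl x hx => ?_⟩
  have h := (abs_le.1 (hR a l ha hl (-x) (by linarith)).1).1
  rw [neg_neg] at h
  have h2 : 0 < uu a l x * (rq (-x) ^ 3 * Real.exp (ph a (-x))) := by nlinarith
  exact pos_of_mul_pos_left h2 (mul_nonneg (pow_nonneg (rq_nonneg _) 3) (Real.exp_pos _).le)

lemma uu_ne_zero (a l : ℝ) : ∃ x0, ∀ x, x ≤ x0 → 0 < uu a l x := by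
  obtain ⟨R, hR1, hR⟩ := uu_pos_ev (|a| + |l|) (by positivity)
  exact ⟨-R, hR a l (by linarith [abs_nonneg l]) (by linarith [abs_nonneg a])⟩

lemma cc_ne (a l : ℝ) : cc a l ≠ 0 := by
  intro h
  obtain ⟨x0, hx⟩ := uu_ne_zero a l
  have := hx x0 le_rfl
  rw [uu_eq, h] at this
  simp at this

lemma cc_er_re {a l x : ℝ} (h : 0 < uu a l x) : 0 < (cc a l * er (psi a l x)).re := by
  have h1 := uu_eq a l x
  rw [psi_pol, mul_left_comm, Complex.re_ofReal_mul] at h1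
  rw [h1] at h
  exact pos_of_mul_pos_right h (norm_nonneg _)

noncomputable def ll (a l x : ℝ) : ℝ := (cc a l * er (psi a l x)).arg - psi a l x

lemma ll_der {a l x : ℝ} (h : 0 < uu a l x) : HasDerivAt (ll a l) 0 x := by
  have h1 := (er_der (psi_der a l x)).const_mul (cc a l)
  have h2 := (arg_der h1 (Or.inl (cc_er_re h))).sub (psi_der a l x)
  refine HasDerivAt.congr_deriv (f := ll a l) h2 ?_
  have hc := cc_ne a l
  have he := er_ne (psi a l x)
  have : cc a l * (I * ((1 / ‖gg a l x‖ ^ 2 : ℝ) : ℂ) * er (psi a l x)) / (cc a l * er (psi a l x)) = ((1 / ‖gg a l x‖ ^ 2 : ℝ) : ℂ) * I := by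
    field_simp
  rw [this, Complex.im_ofReal_mul, I_im]; ring

lemma ll_const {a l x0 : ℝ} (h : ∀ x, x ≤ x0 → 0 < uu a l x) : ∀ x, x ≤ x0 → ll a l x = ll a l x0 := by
  intro x hx
  have := constant_of_has_deriv_right_zero (f := ll a l) (a := x) (b := x0)
    (fun y hy => (ll_der (h y hy.2)).continuousAt.continuousWithinAt)
    (fun y hy => (ll_der (h y hy.2.le)).hasDerivWithinAt)
  exact (this x0 ⟨hx, le_rfl⟩).symm

lemma al_ex (a l : ℝ) : ∃ p : ℝ, ∀ᶠ x in atBot, ll a l x = p := by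
  obtain ⟨x0, hx⟩ := uu_ne_zero a l
  exact ⟨_, eventually_atBot.2 ⟨x0, ll_const hx⟩⟩

/-- the lifted argument of `cc` -/
noncomputable def al (a l : ℝ) : ℝ := (al_ex a l).choose
lemma al_spec (a l : ℝ) : ∀ᶠ x in atBot, ll a l x = al a l := (al_ex a l).choose_spec

lemma al_ll {a l x : ℝ} (h : ∀ y, y ≤ x → 0 < uu a l y) : al a l = ll a l x := by
  obtain ⟨X, hX1, hX2⟩ := ((al_spec a l).and (eventually_le_atBot x)).exists
  rw [← hX1, ll_const h X hX2]

lemma al_arg {a l x : ℝ} (h : ∀ y, y ≤ x → 0 < uu a l y) :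
    psi a l x + al a l = (cc a l * er (psi a l x)).arg := by
  rw [al_ll h, ll]; ring

lemma al_lt {a l x : ℝ} (h : ∀ y, y ≤ x → 0 < uu a l y) : |psi a l x + al a l| < Real.pi / 2 := by
  rw [al_arg h, Complex.abs_arg_lt_pi_div_two_iff]
  exact Or.inl (cc_er_re (h x le_rfl))

lemma cc_pol (a l : ℝ) : cc a l = ‖cc a l‖ * er (al a l) := by
  obtain ⟨x0, hx⟩ := uu_ne_zero a l
  have h := al_arg hx
  have h2 := Complex.norm_mul_exp_arg_mul_I (cc a l * er (psi a l x0))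
  rw [← er, ← h, norm_mul, norm_er, mul_one, er_add] at h2
  have he := er_ne (psi a l x0)
  apply mul_right_cancel₀ he
  rw [← h2]; ring

lemma uu_cos (a l x : ℝ) : uu a l x = ‖cc a l‖ * ‖gg a l x‖ * Real.cos (psi a l x + al a l) := by
  rw [uu_eq, psi_pol a l x, cc_pol a l]
  have : ↑‖cc a l‖ * er (al a l) * (↑‖gg a l x‖ * er (psi a l x)) =
    ((‖cc a l‖ * ‖gg a l x‖ : ℝ) : ℂ) * er (psi a l x + al a l) := by
    rw [er_add]; push_cast; ring
  rw [this, Complex.re_ofReal_mul, er_re]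
  simp only [norm_mul, Complex.norm_real, norm_norm, norm_er, mul_one]

lemma al_cont : Continuous (fun q : ℝ × ℝ => al q.1 q.2) := by
  rw [continuous_iff_continuousAt]
  intro q0
  obtain ⟨R, hR1, hR⟩ := uu_pos_ev (|q0.1| + |q0.2| + 1) (by positivity)
  have e : (fun q : ℝ × ℝ => al q.1 q.2) =ᶠ[nhds q0] fun q => ll q.1 q.2 (-R) := by
    filter_upwards [box_ev q0] with q hq using al_ll (hR q.1 q.2 hq.1 hq.2)
  refine ContinuousAt.congr ?_ e.symm
  have h1 : Continuous (fun q : ℝ × ℝ => cc q.1 q.2 * er (psi q.1 q.2 (-R))) := by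
    refine cc_cont.mul ?_
    unfold er
    exact Complex.continuous_exp.comp ((Complex.continuous_ofReal.comp (psi_cont (-R))).mul continuous_const)
  have hs : cc q0.1 q0.2 * er (psi q0.1 q0.2 (-R)) ∈ slitPlane := Or.inl (cc_er_re
    (hR q0.1 q0.2 (by linarith [abs_nonneg q0.2]) (by linarith [abs_nonneg q0.1]) (-R) le_rfl))
  have harg : ContinuousAt (fun q : ℝ × ℝ => (cc q.1 q.2 * er (psi q.1 q.2 (-R))).arg) q0 :=
    ContinuousAt.comp (f := fun q : ℝ × ℝ => cc q.1 q.2 * er (psi q.1 q.2 (-R))) (Complex.continuousAt_arg hs) h1.continuousAt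
  unfold ll
  exact harg.sub (psi_cont (-R)).continuousAt

lemma psi_strictMono (a l : ℝ) : StrictMono (psi a l) := by
  apply strictMono_of_deriv_pos
  intro x
  rw [(psi_der a l x).deriv]
  have := norm_pos_iff.2 (gg_ne a l x)
  positivity

lemma uu_tendsto (a l : ℝ) : ∃ x0, ∀ x, x ≤ x0 → uu a l x ≤ 1 := by
  obtain ⟨R, hR1, hR⟩ := uu_as (|a| + |l|) 1 (by positivity) (by norm_num)
  have hr := fun x (hx : R ≤ x) => (hR a l (by linarith [abs_nonneg l]) (by linarith [abs_nonneg a]) x hx).1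
  refine ⟨-(R + 16 + 25 * a ^ 2), fun x hx => ?_⟩
  have h := (abs_le.1 (hr (-x) (by nlinarith [sq_nonneg a]))).2
  rw [neg_neg] at h
  set y := -x with hy
  have hy1 : 16 + 25 * a ^ 2 ≤ y := by linarith
  have hy0 : 0 ≤ y := by nlinarith [sq_nonneg a]
  have hs2 := Real.sq_sqrt hy0
  have hs : 4 ≤ Real.sqrt y := by
    apply Real.le_sqrt_of_sq_le; nlinarith [sq_nonneg a]
  have hsa : |a| ≤ Real.sqrt y := by
    apply Real.abs_le_sqrt; nlinarith [sq_nonneg a]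
  have hp : 0 ≤ ph a y := by
    rw [ph]
    have h1 := (abs_le.1 hsa).2
    have h2 : 2 / 5 * Real.sqrt y ^ 5 - a * Real.sqrt y = Real.sqrt y * (2 / 5 * Real.sqrt y ^ 4 - a) := by ring
    rw [h2]
    apply mul_nonneg (by linarith)
    have h3 : (4 : ℝ) ^ 3 ≤ Real.sqrt y ^ 3 := pow_le_pow_left₀ (by norm_num) hs 3
    nlinarith
  have hq : 2 ≤ rq y := by
    rw [rq]; apply Real.le_sqrt_of_sq_le; linarith
  have hq3 : (2 : ℝ) ^ 3 ≤ rq y ^ 3 := pow_le_pow_left₀ (by norm_num) hq 3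
  have he := Real.one_le_exp hp
  by_contra hcon
  push Not at hcon
  have h8 : (8 : ℝ) ≤ rq y ^ 3 * Real.exp (ph a y) := by nlinarith
  nlinarith

lemma Theta_lim (a l : ℝ) : Tendsto (fun x => psi a l x + al a l) atBot (nhds (-(Real.pi / 2))) := by
  obtain ⟨x0, hx0⟩ := uu_ne_zero a l
  obtain ⟨x1, hx1⟩ := uu_tendsto a l
  set X := min x0 x1
  have hu : ∀ x, x ≤ X → 0 < uu a l x ∧ uu a l x ≤ 1 := fun x hx =>
    ⟨hx0 x (hx.trans (min_le_left _ _)), hx1 x (hx.trans (min_le_right _ _))⟩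
  have hTh : ∀ x, x ≤ X → |psi a l x + al a l| < Real.pi / 2 := fun x hx =>
    al_lt fun y hy => (hu y (hy.trans hx)).1
  have hcpos := norm_pos_iff.2 (cc_ne a l)
  have hd : ∀ x, x ≤ X → HasDerivAt (fun x => Real.tan (psi a l x + al a l) - ‖cc a l‖ ^ 2 * x)
      (1 / Real.cos (psi a l x + al a l) ^ 2 * (1 / ‖gg a l x‖ ^ 2) - ‖cc a l‖ ^ 2) x := by
    intro x hx
    have hc : Real.cos (psi a l x + al a l) ≠ 0 :=
      (Real.cos_pos_of_mem_Ioo (abs_lt.1 (hTh x hx))).ne'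
    have h1 := (Real.hasDerivAt_tan hc).comp x ((psi_der a l x).add_const (al a l))
    exact (h1.sub ((hasDerivAt_id x).const_mul _)).congr_deriv (by simp)
  have hmono : MonotoneOn (fun x => Real.tan (psi a l x + al a l) - ‖cc a l‖ ^ 2 * x) (Set.Iic X) := by
    apply monotoneOn_of_deriv_nonneg (convex_Iic X)
    · exact fun x hx => (hd x hx).continuousAt.continuousWithinAt
    · intro x hx
      rw [interior_Iic] at hx
      exact (hd x hx.le).differentiableAt.differentiableWithinAt
    · intro x hx
      rw [interior_Iic] at hx
      rw [(hd x hx.le).deriv]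
      have h1 := hu x hx.le
      have h2 := uu_cos a l x
      have hc : 0 < Real.cos (psi a l x + al a l) := Real.cos_pos_of_mem_Ioo (abs_lt.1 (hTh x hx.le))
      have hg := norm_pos_iff.2 (gg_ne a l x)
      rw [sub_nonneg]
      have h3 : ‖cc a l‖ ^ 2 * (‖gg a l x‖ ^ 2 * Real.cos (psi a l x + al a l) ^ 2) ≤ 1 := by
        have : ‖cc a l‖ ^ 2 * (‖gg a l x‖ ^ 2 * Real.cos (psi a l x + al a l) ^ 2) = uu a l x ^ 2 := by rw [h2]; ring
        rw [this]; nlinarith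
      field_simp
      linarith
  have htan : Tendsto (fun x => Real.tan (psi a l x + al a l)) atBot atBot := by
    have h1 : Tendsto (fun x => (Real.tan (psi a l X + al a l) - ‖cc a l‖ ^ 2 * X) + ‖cc a l‖ ^ 2 * x) atBot atBot :=
      tendsto_atBot_add_const_left _ _ (tendsto_id.const_mul_atBot (by positivity))
    refine tendsto_atBot_mono' _ ?_ h1
    filter_upwards [eventually_le_atBot X] with x hx
    have := hmono (Set.mem_Iic.2 hx) (Set.mem_Iic.2 le_rfl) hx
    simp only at this
    linarith
  have h2 := (tendsto_nhdsWithin_iff.1 Real.tendsto_arctan_atBot).1.comp htan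
  refine h2.congr' ?_
  filter_upwards [eventually_le_atBot X] with x hx
  have := abs_lt.1 (hTh x hx)
  exact Real.arctan_tan this.1 this.2

lemma Theta_gt (a l x : ℝ) : -(Real.pi / 2) < psi a l x + al a l := by
  have h1 : psi a l (x - 1) + al a l < psi a l x + al a l := by
    have := psi_strictMono a l (show x - 1 < x by linarith)
    linarith
  refine lt_of_le_of_lt ?_ h1
  refine le_of_tendsto (Theta_lim a l) ?_
  filter_upwards [eventually_le_atBot (x - 1)] with y hy
  have := (psi_strictMono a l).monotone hy
  linarith

/-- slit-plane membership of the quotient of two vectors with the same real part -/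
lemma slit_quot {u s t : ℝ} (h1 : u = 0 → 0 < s * t) :
    ((u : ℂ) + I * s) / (u + I * t) ∈ slitPlane := by
  have hre : (((u : ℂ) + I * s) * cj (u + I * t)).re = u ^ 2 + s * t := by
    simp; ring
  have him : (((u : ℂ) + I * s) * cj (u + I * t)).im = u * (s - t) := by
    simp; ring
  have hmem : ((u : ℂ) + I * s) * cj (u + I * t) ∈ slitPlane := by
    by_cases hu : u = 0
    · left; rw [hre, hu]; simpa using h1 hu
    · by_cases hst : s = t
      · left; rw [hre, hst]
        have : 0 < u ^ 2 := by positivity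
        nlinarith [mul_self_nonneg t]
      · right; rw [him]; exact mul_ne_zero hu (sub_ne_zero.2 hst)
  have hne : (u : ℂ) + I * t ≠ 0 := by
    intro h
    rw [h] at hmem
    simp at hmem
  have hpos : 0 < (Complex.normSq ((u : ℂ) + I * t))⁻¹ := inv_pos.2 (Complex.normSq_pos.2 hne)
  have e : ((u : ℂ) + I * s) / (u + I * t) = ((Complex.normSq ((u : ℂ) + I * t))⁻¹ : ℝ) * (((u : ℂ) + I * s) * cj (u + I * t)) := by
    rw [div_eq_mul_inv, Complex.inv_def]; ring
  rw [e]
  rcases hmem with h | h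
  · left; rw [Complex.re_ofReal_mul]; exact mul_pos hpos h
  · right; rw [Complex.im_ofReal_mul]; exact mul_ne_zero hpos.ne' h

noncomputable def cG (a l : ℝ) (G G' : ℝ → ℂ) (x : ℝ) : ℂ := I * (uu a l x * cj (G' x) - uu' a l x * cj (G x))

lemma uu_uu' (a l x : ℝ) (h : uu a l x = 0) : uu' a l x ≠ 0 := by
  intro h2
  apply cc_ne a l
  rw [cc_eq a l x, h, h2]; simp

lemma cG_lim {a l x₁ : ℝ} {Q : ℝ → ℝ} {G G' : ℝ → ℂ} {θ : ℝ → ℝ} (F : Fr a x₁ Q G G' θ) :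
    Tendsto (cG a l G G') atTop (nhds (cc a l)) := by
  -- write G = g p, G' = g' r with p, r → 1
  have hg := gg_lim a l
  have hp := F.lim2.div hg.1 one_ne_zero
  have hr := F.lim3.div hg.2 one_ne_zero
  rw [div_one] at hp hr
  have hp' : Tendsto (fun x => G x / gg a l x) atTop (nhds 1) := by
    refine hp.congr' ?_
    filter_upwards [eventually_gt_atTop 0] with x hx
    have h1 : (rq x : ℂ) ≠ 0 := by exact_mod_cast (rq_pos hx).ne'
    have h2 := er_ne (-ph a x)
    have h3 := gg_ne a l x
    simp only [Pi.div_apply]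
    field_simp
  have hr' : Tendsto (fun x => G' x / gg' a l x) atTop (nhds 1) := by
    refine hr.congr' ?_
    filter_upwards [eventually_gt_atTop 0] with x hx
    have h1 : (rq x : ℂ) ≠ 0 := by exact_mod_cast (rq_pos hx).ne'
    have h2 := er_ne (-ph a x)
    have h3 : gg' a l x ≠ 0 := by
      intro h; have := gg_wr a l x; rw [h] at this; simp at this
    simp only [Pi.div_apply]
    field_simp
  -- boundedness of u g', u' g
  have hsc : Tendsto (fun x => ‖gg a l x‖ * ‖gg' a l x‖) atTop (nhds 1) := by
    have := (hg.1.norm).mul hg.2.norm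
    simp only [norm_one, mul_one] at this
    refine this.congr' ?_
    filter_upwards [eventually_gt_atTop 0] with x hx
    have h1 := (rq_pos hx)
    simp only [norm_mul, norm_pow, norm_inv, Complex.norm_real, norm_er, norm_neg, norm_I, Real.norm_of_nonneg h1.le]
    field_simp
  have hb : ∀ x, |uu a l x| ≤ ‖cc a l‖ * ‖gg a l x‖ := fun x => by
    rw [uu_eq, ← norm_mul]; exact abs_re_le_norm _
  have hd : ∀ x, |uu' a l x| ≤ ‖cc a l‖ * ‖gg' a l x‖ := fun x => by
    have : uu' a l x = (cc a l * gg' a l x).re := by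
      have h1 := re_der ((gg_der a l x).const_mul (cc a l))
      have h2 := uu_der a l x
      rw [show uu a l = fun x => (cc a l * gg a l x).re from funext (uu_eq a l)] at h2
      exact h2.unique h1
    rw [this, ← norm_mul]; exact abs_re_le_norm _
  rw [tendsto_iff_norm_sub_tendsto_zero]
  have hz : Tendsto (fun x => ‖cc a l‖ * (‖gg a l x‖ * ‖gg' a l x‖) * (‖G' x / gg' a l x - 1‖ + ‖G x / gg a l x - 1‖)) atTop (nhds 0) := by
    have h1 := (hr'.sub_const 1).norm.add (hp'.sub_const 1).norm
    have h2 := (hsc.const_mul ‖cc a l‖).mul h1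
    simpa using h2
  refine squeeze_zero (fun _ => norm_nonneg _) (fun x => ?_) hz
  have h3 : gg' a l x ≠ 0 := by
    intro h; have := gg_wr a l x; rw [h] at this; simp at this
  have h4 := gg_ne a l x
  have e1 : G' x - gg' a l x = gg' a l x * (G' x / gg' a l x - 1) := by field_simp
  have e2 : G x - gg a l x = gg a l x * (G x / gg a l x - 1) := by field_simp
  have e : cG a l G G' x - cc a l = I * (uu a l x * cj (G' x - gg' a l x) - uu' a l x * cj (G x - gg a l x)) := by
    rw [cG, cc_eq a l x, map_sub, map_sub]; ring
  rw [e, e1, e2, norm_mul, norm_I, one_mul]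
  refine (norm_sub_le _ _).trans ?_
  simp only [norm_mul, RCLike.norm_conj, Complex.norm_real, Real.norm_eq_abs]
  have t1 := mul_le_mul_of_nonneg_right (hb x) (mul_nonneg (norm_nonneg (gg' a l x)) (norm_nonneg (G' x / gg' a l x - 1)))
  have t2 := mul_le_mul_of_nonneg_right (hd x) (mul_nonneg (norm_nonneg (gg a l x)) (norm_nonneg (G x / gg a l x - 1)))
  linarith

noncomputable def chiF (a l : ℝ) (G G' : ℝ → ℂ) (θ : ℝ → ℝ) (x : ℝ) : ℝ :=
  psi a l x + al a l - θ x + (cG a l G G' x * G x / (cc a l * gg a l x)).arg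

theorem Fr_chi' {a x₁ : ℝ} {Q : ℝ → ℝ} {G G' : ℝ → ℂ} {θ : ℝ → ℝ} (F : Fr a x₁ Q G G' θ) (l : ℝ) :
    (∀ x, x₁ ≤ x → HasDerivAt (chiF a l G G' θ) ((PP a l x - Q x) * uu a l x ^ 2 / ‖cG a l G G' x‖ ^ 2) x) ∧
      (∀ x, x₁ ≤ x → cG a l G G' x ≠ 0) ∧
      Tendsto (chiF a l G G' θ) atTop (nhds (al a l)) ∧ (∀ x, x₁ ≤ x → -(3 * Real.pi / 2) < chiF a l G G' θ x + θ x) ∧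
      (∀ x, x₁ ≤ x → (∀ y, y ≤ x → 0 < uu a l y) → |chiF a l G G' θ x + θ x| < Real.pi / 2) := by
  have hGne : ∀ x, x₁ ≤ x → G x ≠ 0 := fun x hx h => by
    have := F.wr x hx; rw [h] at this; simp at this
  have hv : ∀ x, x₁ ≤ x → cG a l G G' x * G x = uu a l x + I * (uu a l x * (cj (G x) * G' x).re - uu' a l x * ‖G x‖ ^ 2 : ℝ) :=
    fun x hx => re_repr _ _ _ _ (F.wr x hx)
  have hs : ∀ x, x₁ ≤ x → cG a l G G' x * G x / (cc a l * gg a l x) ∈ slitPlane := by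
    intro x hx
    rw [hv x hx, cc_gg]
    apply slit_quot
    intro h0
    rw [h0]
    have h1 := uu_uu' a l x h0
    have h2 := norm_pos_iff.2 (hGne x hx)
    have h3 := norm_pos_iff.2 (gg_ne a l x)
    have : (0 * (cj (G x) * G' x).re - uu' a l x * ‖G x‖ ^ 2) * (0 * (cj (gg a l x) * gg' a l x).re - uu' a l x * ‖gg a l x‖ ^ 2)
      = uu' a l x ^ 2 * (‖G x‖ ^ 2 * ‖gg a l x‖ ^ 2) := by ring
    rw [this]; positivity
  have hcne : ∀ x, x₁ ≤ x → cG a l G G' x ≠ 0 := by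
    intro x hx h0
    have := hs x hx
    rw [h0] at this
    simp at this
  unfold chiF
  refine ⟨?_, hcne, ?_, ?_, ?_⟩
  · intro x hx
    have hc := cc_ne a l
    have hg := gg_ne a l x
    have hG := hGne x hx
    have hcG := hcne x hx
    have d1 : HasDerivAt (cG a l G G') (I * ((PP a l x - Q x : ℝ) * (uu a l x * cj (G x)))) x := by
      have h1 := ((uu_der a l x).ofReal_comp.fun_mul (conj_der (F.dG' x hx))).fun_sub
        ((uu'_der a l x).ofReal_comp.fun_mul (conj_der (F.dG x hx)))
      refine HasDerivAt.congr_deriv (f := cG a l G G') (h1.const_mul I) ?_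
      simp only [map_mul, map_neg, Complex.conj_ofReal]
      push_cast
      ring
    have d2 := (d1.mul (F.dG x hx)).fun_div ((gg_der a l x).const_mul (cc a l)) (mul_ne_zero hc hg)
    have d3 := arg_der d2 (hs x hx)
    have d4 := (((psi_der a l x).add_const (al a l)).fun_sub (F.th x hx)).fun_add d3
    refine d4.congr_deriv ?_
    simp only [Pi.mul_apply]
    set W := I * ((PP a l x - Q x : ℝ) * (uu a l x * cj (G x))) with hW
    have e : ((W * G x + cG a l G G' x * G' x) * (cc a l * gg a l x) - cG a l G G' x * G x * (cc a l * gg' a l x)) /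
        (cc a l * gg a l x) ^ 2 / (cG a l G G' x * G x / (cc a l * gg a l x))
        = W / cG a l G G' x + G' x / G x - gg' a l x / gg a l x := by
      field_simp
    rw [e, Complex.sub_im, Complex.add_im, im_div_of_wr (gg_wr a l x), im_div_of_wr (F.wr x hx)]
    have e2 : (W / cG a l G G' x).im = (PP a l x - Q x) * uu a l x ^ 2 / ‖cG a l G G' x‖ ^ 2 := by
      have hre : (cG a l G G' x * G x).re = uu a l x := by
        rw [hv x hx]; simp [-ofReal_sub, -ofReal_mul]
      have h5 : W / cG a l G G' x = ((PP a l x - Q x) * uu a l x / ‖cG a l G G' x‖ ^ 2 : ℝ) * (I * cj (cG a l G G' x * G x)) := by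
        have hn : (‖cG a l G G' x‖ : ℂ) ≠ 0 := by exact_mod_cast norm_ne_zero_iff.2 hcG
        have hnn : cj (cG a l G G' x) * cG a l G G' x = ‖cG a l G G' x‖ ^ 2 := Complex.conj_mul' _
        rw [hW, div_eq_iff hcG, map_mul]
        push_cast
        field_simp
        linear_combination -((PP a l x : ℂ) - Q x) * uu a l x * cj (G x) * hnn
      rw [h5, Complex.im_ofReal_mul, Complex.I_mul_im, Complex.conj_re, hre]
      ring
    rw [e2]; ring
  · have h1 : Tendsto (fun x => cG a l G G' x * G x / (cc a l * gg a l x)) atTop (nhds 1) := by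
      have hp := F.lim2.div (gg_lim a l).1 one_ne_zero
      have hc := (cG_lim (l := l) F).div_const (cc a l)
      rw [div_self (cc_ne a l)] at hc
      have := hc.mul hp
      rw [div_one, mul_one] at this
      refine this.congr' ?_
      filter_upwards [eventually_gt_atTop 0] with x hx
      have h1 : (rq x : ℂ) ≠ 0 := by exact_mod_cast (rq_pos hx).ne'
      have h2 := er_ne (-ph a x)
      have h3 := gg_ne a l x
      have h4 := cc_ne a l
      simp only [Pi.div_apply]
      field_simp
    have h2 := (Complex.continuousAt_arg (show (1 : ℂ) ∈ slitPlane by simp)).tendsto.comp h1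
    have h3 := (((psi_lim a l).sub F.lim1).add_const (al a l)).add h2
    simp only [sub_zero, zero_add, arg_one, add_zero] at h3
    refine h3.congr fun x => ?_
    simp only [Function.comp]
    ring
  · intro x hx
    have h1 := Theta_gt a l x
    have h2 := Complex.neg_pi_lt_arg (cG a l G G' x * G x / (cc a l * gg a l x))
    linarith
  · intro x hx hpos
    have h1 := al_arg hpos
    have hu := hpos x le_rfl
    have hr1 : 0 < (cG a l G G' x * G x).re := by
      rw [hv x hx]; simpa [-ofReal_sub, -ofReal_mul] using hu
    have hr2 : 0 < (cc a l * gg a l x).re := by rw [← uu_eq]; exact hu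
    have hne1 : cG a l G G' x * G x ≠ 0 := mul_ne_zero (hcne x hx) (hGne x hx)
    have hne2 : cc a l * gg a l x ≠ 0 := mul_ne_zero (cc_ne a l) (gg_ne a l x)
    have ha1 := (Complex.abs_arg_lt_pi_div_two_iff.2 (Or.inl hr1))
    have ha2 := (Complex.abs_arg_lt_pi_div_two_iff.2 (Or.inl hr2))
    have e3 : (cc a l * gg a l x).arg = psi a l x + al a l := by
      rw [h1, psi_pol a l x, mul_left_comm, Complex.arg_real_mul _ (norm_pos_iff.2 (gg_ne a l x))]
    have e4 : (cG a l G G' x * G x / (cc a l * gg a l x)).arg = (cG a l G G' x * G x).arg - (cc a l * gg a l x).arg := by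
      have hpi : (cc a l * gg a l x).arg ≠ Real.pi := by
        have := (abs_lt.1 ha2).2
        linarith [Real.pi_pos]
      have hinv : (cc a l * gg a l x)⁻¹.arg = -(cc a l * gg a l x).arg := by
        rw [Complex.arg_inv, if_neg hpi]
      rw [div_eq_mul_inv, Complex.arg_mul hne1 (inv_ne_zero hne2), hinv]
      · ring
      · rw [hinv]
        have := abs_lt.1 ha1
        have := abs_lt.1 ha2
        constructor <;> linarith
    rw [e4, e3]
    rw [show psi a l x + al a l - θ x + ((cG a l G G' x * G x).arg - (psi a l x + al a l)) + θ x = (cG a l G G' x * G x).arg by ring]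
    exact ha1

theorem Fr_chi {a x₁ : ℝ} {Q : ℝ → ℝ} {G G' : ℝ → ℂ} {θ : ℝ → ℝ} (F : Fr a x₁ Q G G' θ) (l : ℝ) :
    ∃ χ : ℝ → ℝ, (∀ x, x₁ ≤ x → HasDerivAt χ ((PP a l x - Q x) * uu a l x ^ 2 / ‖cG a l G G' x‖ ^ 2) x) ∧
      (∀ x, x₁ ≤ x → cG a l G G' x ≠ 0) ∧
      Tendsto χ atTop (nhds (al a l)) ∧ (∀ x, x₁ ≤ x → -(3 * Real.pi / 2) < χ x + θ x) ∧
      (∀ x, x₁ ≤ x → (∀ y, y ≤ x → 0 < uu a l y) → |χ x + θ x| < Real.pi / 2) := ⟨_, Fr_chi' F l⟩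

lemma chi_mono {x₁ : ℝ} {χ d : ℝ → ℝ} (h : ∀ x, x₁ ≤ x → HasDerivAt χ (d x) x) (hd : ∀ x, x₁ ≤ x → 0 ≤ d x) :
    MonotoneOn χ (Set.Ici x₁) := by
  apply monotoneOn_of_deriv_nonneg (convex_Ici x₁)
  · exact fun x hx => (h x hx).continuousAt.continuousWithinAt
  · intro x hx
    rw [interior_Ici] at hx
    exact (h x hx.le).differentiableAt.differentiableWithinAt
  · intro x hx
    rw [interior_Ici] at hx
    rw [(h x hx.le).deriv]; exact hd x hx.le

lemma chi_le {x₁ L : ℝ} {χ d : ℝ → ℝ} (h : ∀ x, x₁ ≤ x → HasDerivAt χ (d x) x) (hd : ∀ x, x₁ ≤ x → 0 ≤ d x)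
    (hL : Tendsto χ atTop (nhds L)) {x : ℝ} (hx : x₁ ≤ x) : χ x ≤ L := by
  refine ge_of_tendsto hL ?_
  filter_upwards [eventually_ge_atTop x] with y hy
  exact chi_mono h hd hx (hx.trans hy) hy

lemma al_lower {a x₁ : ℝ} {Q : ℝ → ℝ} {G G' : ℝ → ℂ} {θ : ℝ → ℝ} (F : Fr a x₁ Q G G' θ) (l : ℝ)
    (h : ∀ x, x₁ ≤ x → Q x ≤ PP a l x) : -(3 * Real.pi / 2) - θ x₁ < al a l ∧
      ((∀ y, y ≤ x₁ → 0 < uu a l y) → -(Real.pi / 2) - θ x₁ < al a l) := by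
  obtain ⟨χ, h1, h2, h3, h4, h5⟩ := Fr_chi F l
  have h6 := chi_le h1 (fun x hx => div_nonneg (mul_nonneg (sub_nonneg.2 (h x hx)) (sq_nonneg _)) (sq_nonneg _)) h3 le_rfl
  refine ⟨by linarith [h4 x₁ le_rfl], fun hp => by linarith [(abs_lt.1 (h5 x₁ le_rfl hp)).1]⟩

lemma al_upper {a x₁ : ℝ} {Q : ℝ → ℝ} {G G' : ℝ → ℂ} {θ : ℝ → ℝ} (F : Fr a x₁ Q G G' θ) (l : ℝ)
    (h : ∀ x, x₁ ≤ x → PP a l x ≤ Q x) (hp : ∀ y, y ≤ x₁ → 0 < uu a l y) : al a l < Real.pi / 2 - θ x₁ := by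
  obtain ⟨χ, h1, h2, h3, h4, h5⟩ := Fr_chi F l
  have h6 := chi_le (χ := fun x => -χ x) (fun x hx => (h1 x hx).neg) (fun x hx => by
    rw [← neg_div, ← neg_mul]
    exact div_nonneg (mul_nonneg (by linarith [h x hx]) (sq_nonneg _)) (sq_nonneg _)) h3.neg le_rfl
  linarith [(abs_lt.1 (h5 x₁ le_rfl hp)).2]

/-- U1 -/
theorem al_strictAnti (a : ℝ) : StrictAnti (al a) := by
  intro l1 l2 hl
  obtain ⟨x0, hx0⟩ := uu_ne_zero a l1
  set χ := chiF a l1 (gg a l2) (gg' a l2) (psi a l2) with hχ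
  have hd : ∀ x, HasDerivAt χ ((l2 - l1) * uu a l1 x ^ 2 / ‖cG a l1 (gg a l2) (gg' a l2) x‖ ^ 2) x := fun x => by
    have := (Fr_chi' (Fr_gg a l2 x) l1).1 x le_rfl
    refine this.congr_deriv ?_
    rw [PP, PP]; ring
  have hnn : ∀ x, 0 ≤ ((l2 - l1) * uu a l1 x ^ 2 / ‖cG a l1 (gg a l2) (gg' a l2) x‖ ^ 2) := fun x =>
    div_nonneg (mul_nonneg (sub_nonneg.2 hl.le) (sq_nonneg _)) (sq_nonneg _)
  have hmono : Monotone χ := fun x y h => chi_mono (x₁ := x) (fun z _ => hd z) (fun z _ => hnn z) (Set.mem_Ici.2 le_rfl) (Set.mem_Ici.2 h) h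
  have h1 : χ x0 ≤ al a l1 := chi_le (x₁ := x0) (fun z _ => hd z) (fun z _ => hnn z) (Fr_chi' (Fr_gg a l2 x0) l1).2.2.1 le_rfl
  have h2 : χ (x0 - 1) < χ x0 := by
    obtain ⟨z, hz, he⟩ := exists_hasDerivAt_eq_slope χ _ (show x0 - 1 < x0 by linarith)
      (fun z _ => (hd z).continuousAt.continuousWithinAt) (fun z _ => hd z)
    have hp : 0 < ((l2 - l1) * uu a l1 z ^ 2 / ‖cG a l1 (gg a l2) (gg' a l2) z‖ ^ 2) := by
      have q1 := hx0 z hz.2.le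
      have q2 := norm_pos_iff.2 ((Fr_chi' (Fr_gg a l2 z) l1).2.1 z le_rfl)
      have q3 := sub_pos.2 hl
      positivity
    rw [he] at hp
    have : x0 - (x0 - 1) = 1 := by ring
    rw [this, div_one] at hp
    linarith
  have h3 : al a l2 ≤ χ (x0 - 1) := by
    have ht := (Theta_lim a l2).neg.sub_const (Real.pi / 2) |>.add_const (al a l2)
    refine le_of_tendsto (show Tendsto (fun x => -(Real.pi / 2) - psi a l2 x) atBot (nhds (al a l2)) from ?_) ?_
    · convert ht using 2 <;> ring_nf
    · filter_upwards [eventually_le_atBot (x0 - 1)] with x hx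
      have q1 := ((Fr_chi' (Fr_gg a l2 x) l1).2.2.2.2 x le_rfl (fun y hy => hx0 y (by linarith)))
      have q2 := hmono hx
      have q3 := (abs_lt.1 q1).1
      rw [← hχ] at q3
      linarith
  linarith

end Cub

namespace Cub
local notation "cj" => starRingEnd ℂ

lemma er_cont : Continuous er := by
  unfold er
  exact (continuous_ofReal.mul continuous_const).cexp

noncomputable def wG (w θ : ℝ → ℝ) (x : ℝ) : ℂ := ((Real.sqrt (w x))⁻¹ : ℝ) * er (θ x)
noncomputable def wG' (w L θ : ℝ → ℝ) (x : ℝ) : ℂ := (-(L x : ℂ) / 2 + I * w x) * wG w θ x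

lemma norm_wG {w θ : ℝ → ℝ} {x : ℝ} : ‖wG w θ x‖ = (Real.sqrt (w x))⁻¹ := by
  rw [wG, norm_mul, norm_er, mul_one, Complex.norm_real, Real.norm_of_nonneg (by positivity)]

lemma wG_der {w L θ : ℝ → ℝ} {x : ℝ} (hw : 0 < w x) (dw : HasDerivAt w (w x * L x) x)
    (dθ : HasDerivAt θ (w x) x) : HasDerivAt (wG w θ) (wG' w L θ x) x := by
  have hs := Real.sqrt_pos.2 hw
  have h1 := ((dw.sqrt hw.ne').fun_inv hs.ne').ofReal_comp
  have h2 := h1.fun_mul (er_der dθ)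
  refine HasDerivAt.congr_deriv (f := wG w θ) h2 ?_
  have e : w x = Real.sqrt (w x) ^ 2 := (Real.sq_sqrt hw.le).symm
  rw [wG', wG]
  generalize er (θ x) = E
  have hc : (Real.sqrt (w x) : ℂ) ≠ 0 := by exact_mod_cast hs.ne'
  generalize Real.sqrt (w x) = s at *
  rw [e]
  push_cast
  field_simp

lemma Fr_wkb {a x₁ : ℝ} {w L L' θ : ℝ → ℝ} (hw : ∀ x, x₁ ≤ x → 0 < w x)
    (dw : ∀ x, x₁ ≤ x → HasDerivAt w (w x * L x) x) (dL : ∀ x, x₁ ≤ x → HasDerivAt L (L' x) x)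
    (dθ : ∀ x, x₁ ≤ x → HasDerivAt θ (w x) x)
    (l1 : Tendsto (fun x => w x / rq x ^ 6) atTop (nhds 1)) (l2 : Tendsto (fun x => L x / rq x ^ 6) atTop (nhds 0))
    (l3 : Tendsto (fun x => θ x - ph a x) atTop (nhds 0)) :
    Fr a x₁ (fun x => w x ^ 2 - (L x ^ 2 / 4 - L' x / 2)) (wG w θ) (wG' w L θ) θ := by
  have hlim2 : Tendsto (fun x => wG w θ x * rq x ^ 3 * er (-ph a x)) atTop (nhds 1) := by
    have h1 := ((l1.sqrt).inv₀ (by simp)).ofReal.mul (show Tendsto (fun x => er (θ x - ph a x)) atTop (nhds (er 0)) from (er_cont.tendsto 0).comp l3)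
    simp only [Real.sqrt_one, inv_one, ofReal_one, er_zero, mul_one] at h1
    refine h1.congr' ?_
    filter_upwards [eventually_ge_atTop x₁, eventually_gt_atTop 0] with x hx h0
    have hr := rq_pos h0
    have e : Real.sqrt (w x / rq x ^ 6) = Real.sqrt (w x) / rq x ^ 3 := by
      rw [Real.sqrt_div (hw x hx).le, show rq x ^ 6 = (rq x ^ 3) ^ 2 by ring, Real.sqrt_sq (by positivity)]
    rw [e, wG, sub_eq_add_neg, er_add]
    push_cast
    rw [inv_div]
    ring
  refine ⟨fun x hx => wG_der (hw x hx) (dw x hx) (dθ x hx), ?_, ?_, ?_, ?_, l3, hlim2, ?_⟩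
  · intro x hx
    have h1 := (((dL x hx).ofReal_comp.fun_neg.div_const 2).fun_add ((dw x hx).ofReal_comp.const_mul I)).fun_mul (wG_der (hw x hx) (dw x hx) (dθ x hx))
    refine HasDerivAt.congr_deriv (f := wG' w L θ) h1 ?_
    rw [wG']
    generalize wG w θ x = E
    push_cast
    linear_combination (w x : ℂ) ^ 2 * E * I_sq
  · intro x hx
    have e : cj (wG w θ x) * wG' w L θ x = (‖wG w θ x‖ ^ 2 : ℝ) * (-(L x : ℂ) / 2 + I * w x) := by
      rw [wG']; push_cast; rw [← Complex.conj_mul']; ring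
    rw [e, Complex.im_ofReal_mul, norm_wG, inv_pow, Real.sq_sqrt (hw x hx).le]
    have : (-(L x : ℂ) / 2 + I * w x) = ((-L x / 2 : ℝ) : ℂ) + I * w x := by push_cast; ring
    rw [this]
    simp [-ofReal_div, -ofReal_neg]
    exact inv_mul_cancel₀ (hw x hx).ne'
  · intro x hx
    refine (dθ x hx).congr_deriv ?_
    rw [norm_wG, inv_pow, Real.sq_sqrt (hw x hx).le, one_div, inv_inv]
  · intro x hx
    rw [norm_wG]; rfl
  · have h1 := ((l2.ofReal.const_mul (I / 2)).add l1.ofReal).mul hlim2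
    simp only [ofReal_zero, mul_zero, zero_add, ofReal_one, mul_one] at h1
    refine h1.congr' ?_
    filter_upwards [eventually_gt_atTop 0] with x h0
    have hr : (rq x : ℂ) ≠ 0 := by exact_mod_cast (rq_pos h0).ne'
    rw [wG']
    generalize wG w θ x = E
    generalize er (-ph a x) = E2
    push_cast
    field_simp
    linear_combination (2 * w x * E * E2 : ℂ) * I_sq

noncomputable def wm (a m x : ℝ) : ℝ := Real.sqrt x ^ 3 - a / 2 * (Real.sqrt x)⁻¹ + m * (Real.sqrt x)⁻¹ ^ 3
noncomputable def wm1 (a m x : ℝ) : ℝ := 3 / 2 * Real.sqrt x + a / 4 * (Real.sqrt x)⁻¹ ^ 3 - 3 * m / 2 * (Real.sqrt x)⁻¹ ^ 5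
noncomputable def wm2 (a m x : ℝ) : ℝ := 3 / 4 * (Real.sqrt x)⁻¹ - 3 * a / 8 * (Real.sqrt x)⁻¹ ^ 5 + 15 * m / 4 * (Real.sqrt x)⁻¹ ^ 7
noncomputable def thm (a m x : ℝ) : ℝ := ph a x - 2 * m * (Real.sqrt x)⁻¹

lemma sqrt_der {x : ℝ} (hx : 0 < x) : HasDerivAt Real.sqrt (1 / 2 * (Real.sqrt x)⁻¹) x := by
  refine (Real.hasDerivAt_sqrt hx.ne').congr_deriv ?_
  rw [one_div, mul_inv, one_div]

lemma isqrt_der {x : ℝ} (hx : 0 < x) : HasDerivAt (fun x => (Real.sqrt x)⁻¹) (-(1 / 2 * (Real.sqrt x)⁻¹ ^ 3)) x := by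
  have hs := Real.sqrt_pos.2 hx
  refine ((sqrt_der hx).fun_inv hs.ne').congr_deriv ?_
  field_simp

lemma wm_der (a m : ℝ) {x : ℝ} (hx : 0 < x) : HasDerivAt (wm a m) (wm1 a m x) x := by
  have hs := Real.sqrt_pos.2 hx
  have h := (((sqrt_der hx).fun_pow 3).fun_sub ((isqrt_der hx).const_mul (a / 2))).fun_add (((isqrt_der hx).fun_pow 3).const_mul m)
  refine HasDerivAt.congr_deriv (f := wm a m) h ?_
  rw [wm1]; norm_num; field_simp; ring

lemma wm1_der (a m : ℝ) {x : ℝ} (hx : 0 < x) : HasDerivAt (wm1 a m) (wm2 a m x) x := by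
  have hs := Real.sqrt_pos.2 hx
  have h := (((sqrt_der hx).const_mul (3 / 2)).fun_add (((isqrt_der hx).fun_pow 3).const_mul (a / 4))).fun_sub (((isqrt_der hx).fun_pow 5).const_mul (3 * m / 2))
  refine HasDerivAt.congr_deriv (f := wm1 a m) h ?_
  rw [wm2]; norm_num; field_simp; ring

lemma thm_der (a m : ℝ) {x : ℝ} (hx : 0 < x) : HasDerivAt (thm a m) (wm a m x) x := by
  have hs := Real.sqrt_pos.2 hx
  have h := (ph_der a hx).fun_sub ((isqrt_der hx).const_mul (2 * m))
  refine HasDerivAt.congr_deriv (f := thm a m) h ?_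
  rw [wm]; field_simp; ring

lemma rq6 (x : ℝ) : rq x ^ 6 = Real.sqrt x ^ 3 := by rw [← rq_sq]; ring

lemma isqrt_lim : Tendsto (fun x : ℝ => (Real.sqrt x)⁻¹) atTop (nhds 0) :=
  tendsto_inv_atTop_zero.comp Real.tendsto_sqrt_atTop

lemma wm_lim (a m : ℝ) : Tendsto (fun x => wm a m x / rq x ^ 6) atTop (nhds 1) := by
  have h := ((isqrt_lim.pow 4).const_mul (a / 2)).const_sub 1 |>.add ((isqrt_lim.pow 6).const_mul m)
  simp only [ne_eq, OfNat.ofNat_ne_zero, not_false_eq_true, zero_pow, mul_zero, sub_zero, add_zero] at h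
  refine h.congr' ?_
  filter_upwards [eventually_gt_atTop 0] with x hx
  have hs := Real.sqrt_pos.2 hx
  rw [rq6, wm]; field_simp

lemma wm1_lim (a m : ℝ) : Tendsto (fun x => wm1 a m x / rq x ^ 6) atTop (nhds 0) := by
  have h := (((isqrt_lim.pow 2).const_mul (3 / 2)).add ((isqrt_lim.pow 6).const_mul (a / 4))).sub ((isqrt_lim.pow 8).const_mul (3 * m / 2))
  simp only [ne_eq, OfNat.ofNat_ne_zero, not_false_eq_true, zero_pow, mul_zero, sub_zero, add_zero] at h
  refine h.congr' ?_
  filter_upwards [eventually_gt_atTop 0] with x hx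
  have hs := Real.sqrt_pos.2 hx
  rw [rq6, wm1]; field_simp

lemma irq6_lim : Tendsto (fun x => (rq x ^ 6)⁻¹) atTop (nhds 0) := by
  have h := isqrt_lim.pow 3
  simp only [ne_eq, OfNat.ofNat_ne_zero, not_false_eq_true, zero_pow] at h
  refine h.congr fun x => ?_
  rw [rq6, inv_pow]

/-- the error term of the WKB frame -/
noncomputable def em (a m x : ℝ) : ℝ := 3 / 4 * (wm1 a m x / wm a m x) ^ 2 - wm2 a m x / (2 * wm a m x)

lemma Fr_m {a m x₁ : ℝ} (hx₁ : 1 ≤ x₁) (hw : ∀ x, x₁ ≤ x → 0 < wm a m x) :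
    Fr a x₁ (fun x => wm a m x ^ 2 - em a m x) (wG (wm a m) (thm a m))
      (wG' (wm a m) (fun x => wm1 a m x / wm a m x) (thm a m)) (thm a m) := by
  have h := Fr_wkb (a := a) (x₁ := x₁) (w := wm a m) (L := fun x => wm1 a m x / wm a m x)
    (L' := fun x => wm2 a m x / wm a m x - (wm1 a m x / wm a m x) ^ 2) (θ := thm a m) hw
    (fun x hx => by
      refine (wm_der a m (show 0 < x by linarith)).congr_deriv ?_
      rw [mul_div_cancel₀ _ (hw x hx).ne'])
    (fun x hx => by
      refine ((wm1_der a m (show 0 < x by linarith)).fun_div (wm_der a m (by linarith)) (hw x hx).ne').congr_deriv ?_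
      have := hw x hx
      field_simp)
    (fun x hx => thm_der a m (by linarith)) (wm_lim a m) (by
      have h1 := ((wm1_lim a m).div (wm_lim a m) one_ne_zero).mul irq6_lim
      simp only [zero_div, zero_mul] at h1
      refine h1.congr' ?_
      filter_upwards [eventually_ge_atTop x₁] with x hx
      have h2 := hw x hx
      have h3 := rq_pos (show 0 < x by linarith)
      simp only [Pi.div_apply]
      field_simp) (by
      have h1 := isqrt_lim.const_mul (-(2 * m))
      rw [mul_zero] at h1
      refine h1.congr fun x => ?_
      rw [thm]; ring)
  have e : (fun x => wm a m x ^ 2 - em a m x) = fun x => wm a m x ^ 2 - ((wm1 a m x / wm a m x) ^ 2 / 4 - (wm2 a m x / wm a m x - (wm1 a m x / wm a m x) ^ 2) / 2) := by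
    funext x
    rw [em, show wm2 a m x / (2 * wm a m x) = wm2 a m x / wm a m x / 2 by rw [mul_comm, div_div]]; ring
  rw [e]; exact h

lemma wm_sq (a m : ℝ) {x : ℝ} (hx : 0 < x) : wm a m x ^ 2 = x ^ 3 - a * x + 2 * m + a ^ 2 / (4 * x) - a * m / x ^ 2 + m ^ 2 / x ^ 3 := by
  have hs := Real.sqrt_pos.2 hx
  have e : x = Real.sqrt x ^ 2 := (Real.sq_sqrt hx.le).symm
  rw [wm]
  generalize Real.sqrt x = s at *
  subst e
  field_simp; ring

lemma wm_lb {a m x : ℝ} (hm : 0 ≤ m) (hx : 1 ≤ x) (ha : |a| ≤ x) : Real.sqrt x ^ 3 / 2 ≤ wm a m x := by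
  have hs : 1 ≤ Real.sqrt x := Real.one_le_sqrt.2 hx
  have e : x = Real.sqrt x ^ 2 := (Real.sq_sqrt (by linarith)).symm
  rw [wm]
  generalize Real.sqrt x = s at *
  have h1 : 0 ≤ m * s⁻¹ ^ 3 := by positivity
  have h2 : a / 2 * s⁻¹ ≤ s ^ 3 / 2 := by
    rw [← div_eq_mul_inv, div_le_iff₀ (by linarith)]
    have : a ≤ s ^ 2 := by rw [← e]; exact (le_abs_self a).trans ha
    nlinarith [pow_le_pow_left₀ zero_le_one hs 2]
  linarith

lemma em_bd {a m x : ℝ} (hm : 0 ≤ m) (hx : 1 ≤ x) (ha : |a| ≤ x) :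
    |em a m x| ≤ 3 * (2 + |a| + 4 * m) ^ 2 + (2 + |a| + 4 * m) := by
  have hlb := wm_lb hm hx ha
  have hs : 1 ≤ Real.sqrt x := Real.one_le_sqrt.2 hx
  set K := 2 + |a| + 4 * m with hK
  have hr0 : 0 < (Real.sqrt x)⁻¹ := by positivity
  have hr1 : (Real.sqrt x)⁻¹ ≤ 1 := inv_le_one_of_one_le₀ hs
  have hs3 : Real.sqrt x ≤ Real.sqrt x ^ 3 := by nlinarith [pow_le_pow_left₀ zero_le_one hs 2]
  have hwp : 0 < wm a m x := by linarith
  have aab := abs_nonneg a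
  have hpow : ∀ n : ℕ, (Real.sqrt x)⁻¹ ^ n ≤ 1 ∧ 0 ≤ (Real.sqrt x)⁻¹ ^ n := fun n => ⟨pow_le_one₀ hr0.le hr1, by positivity⟩
  have pa : ∀ n : ℕ, |a * (Real.sqrt x)⁻¹ ^ n| ≤ |a| := fun n => by
    rw [abs_mul, abs_of_nonneg (hpow n).2]; nlinarith [(hpow n).1, (hpow n).2]
  have pm : ∀ n : ℕ, m * (Real.sqrt x)⁻¹ ^ n ≤ m ∧ 0 ≤ m * (Real.sqrt x)⁻¹ ^ n := fun n => by
    constructor <;> nlinarith [(hpow n).1, (hpow n).2]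
  have b1 : |wm1 a m x| ≤ K * Real.sqrt x := by
    rw [wm1, abs_le]
    have q1 := abs_le.1 (pa 3); have q2 := pm 5
    constructor <;> nlinarith
  have b2 : |wm2 a m x| ≤ K := by
    rw [wm2, abs_le]
    have q1 := abs_le.1 (pa 5); have q2 := pm 7
    constructor <;> nlinarith
  have c1 : |wm1 a m x / wm a m x| ≤ 2 * K := by
    rw [abs_div, abs_of_pos hwp, div_le_iff₀ hwp]
    nlinarith
  have c2 : |wm2 a m x / (2 * wm a m x)| ≤ K := by
    rw [abs_div, abs_of_pos (by linarith : 0 < 2 * wm a m x), div_le_iff₀ (by linarith)]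
    nlinarith
  have c3 : (wm1 a m x / wm a m x) ^ 2 ≤ (2 * K) ^ 2 := sq_le_sq' (by linarith [(abs_le.1 c1).1]) (abs_le.1 c1).2
  rw [em, abs_le]
  have := abs_le.1 c2
  constructor <;> nlinarith [sq_nonneg (wm1 a m x / wm a m x)]

lemma uu_pos_left (a l : ℝ) : ∃ x0, ∀ x, x ≤ x0 → 0 < uu a l x ∧ 0 < uu' a l x := by
  obtain ⟨R, hR1, hR⟩ := uu_as (|a| + |l|) (1 / 2) (by positivity) (by norm_num)
  refine ⟨-R, fun x hx => ?_⟩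
  have h := hR a l (by linarith [abs_nonneg l]) (by linarith [abs_nonneg a]) (-x) (by linarith)
  rw [neg_neg] at h
  have hr := rq_pos (show 0 < -x by linarith)
  have h1 := (abs_le.1 h.1).1
  have h2 := (abs_le.1 h.2).1
  have e1 := Real.exp_pos (ph a (-x))
  constructor
  · by_contra hc
    push Not at hc
    have : uu a l x * rq (-x) ^ 3 * Real.exp (ph a (-x)) ≤ 0 :=
      mul_nonpos_of_nonpos_of_nonneg (mul_nonpos_of_nonpos_of_nonneg hc (by positivity)) e1.le
    linarith
  · by_contra hc
    push Not at hc
    have : uu' a l x * (rq (-x) ^ 3)⁻¹ * Real.exp (ph a (-x)) ≤ 0 :=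
      mul_nonpos_of_nonpos_of_nonneg (mul_nonpos_of_nonpos_of_nonneg hc (by positivity)) e1.le
    linarith

lemma uu_convex {a l x₁ : ℝ} (h : ∀ x, x < x₁ → PP a l x ≤ 0) : ∀ x, x ≤ x₁ → 0 < uu a l x ∧ 0 < uu' a l x := by
  obtain ⟨x0, hx0⟩ := uu_pos_left a l
  have hd : ∀ x, HasDerivAt (fun x => uu a l x * uu' a l x) (uu' a l x ^ 2 - PP a l x * uu a l x ^ 2) x := fun x => by
    refine ((uu_der a l x).fun_mul (uu'_der a l x)).congr_deriv ?_
    ring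
  have hm : MonotoneOn (fun x => uu a l x * uu' a l x) (Set.Iic x₁) := by
    apply monotoneOn_of_deriv_nonneg (convex_Iic x₁)
    · exact fun x hx => (hd x).continuousAt.continuousWithinAt
    · intro x hx
      exact (hd x).differentiableAt.differentiableWithinAt
    · intro x hx
      rw [interior_Iic] at hx
      rw [(hd x).deriv]
      nlinarith [h x hx, sq_nonneg (uu a l x), sq_nonneg (uu' a l x)]
  have hp : ∀ x, x ≤ x₁ → 0 < uu a l x * uu' a l x := fun x hx => by
    have h1 := hx0 (min x x0) (min_le_right _ _)
    have h2 := hm (Set.mem_Iic.2 ((min_le_left x x0).trans hx)) (Set.mem_Iic.2 hx) (min_le_left _ _)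
    exact (mul_pos h1.1 h1.2).trans_le h2
  have hu : ∀ x, x ≤ x₁ → 0 < uu a l x := fun x hx => by
    by_contra hc
    push Not at hc
    have h1 := hx0 (min x x0) (min_le_right _ _)
    have hcont : ContinuousOn (uu a l) (Set.Icc (min x x0) x) := fun y _ => (uu_der a l y).continuousAt.continuousWithinAt
    obtain ⟨y, hy, hy0⟩ := intermediate_value_Icc' (min_le_left x x0) hcont ⟨hc, h1.1.le⟩
    have := hp y (hy.2.trans hx)
    rw [hy0, zero_mul] at this
    exact lt_irrefl _ this
  exact fun x hx => ⟨hu x hx, pos_of_mul_pos_right (hp x hx) (hu x hx).le⟩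
end Cub

namespace Cub
local notation "cj" => starRingEnd ℂ

lemma ph_tendsto (a : ℝ) : Tendsto (ph a) atTop atTop := by
  have h : Tendsto (fun s : ℝ => s * (2 / 5 * s ^ 4 - a)) atTop atTop := by
    refine tendsto_id.atTop_mul_atTop₀ ?_
    exact tendsto_atTop_add_const_right _ _ ((tendsto_pow_atTop (by norm_num)).const_mul_atTop (by norm_num))
  refine (h.comp Real.tendsto_sqrt_atTop).congr fun x => ?_
  simp only [Function.comp]; rw [ph]; ring

/-- U2 -/
lemma al_small (a N : ℝ) : ∃ l, al a l ≤ -N := by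
  obtain ⟨x₁, hx, h1, ha⟩ := ((ph_tendsto a).eventually_ge_atTop (N + Real.pi / 2) |>.and ((eventually_ge_atTop 1).and (eventually_ge_atTop |a|))).exists
  set K := 2 + |a| + 4 * (0:ℝ) with hK
  have aab := abs_nonneg a
  set l := max (3 * K ^ 2 + K) (x₁ ^ 3 + |a| * x₁) with hl
  have l1 : 3 * K ^ 2 + K ≤ l := le_max_left _ _
  have l2 : x₁ ^ 3 + |a| * x₁ ≤ l := le_max_right _ _
  have hw : ∀ x, x₁ ≤ x → 0 < wm a 0 x := fun x hx => by
    have := wm_lb (a := a) (m := 0) le_rfl (h1.trans hx) (ha.trans hx)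
    have hs := Real.sqrt_pos.2 (show 0 < x by linarith)
    have : 0 < Real.sqrt x ^ 3 / 2 := by positivity
    linarith
  have h := al_upper (Fr_m h1 hw) l (fun x hx => by
    have hx0 : 0 < x := by linarith
    have e1 := (abs_le.1 (em_bd (a := a) (m := 0) le_rfl (h1.trans hx) (ha.trans hx))).2
    rw [wm_sq a 0 hx0, PP]
    have : 0 ≤ a ^ 2 / (4 * x) := by positivity
    simp only [mul_zero, zero_div, ne_eq, OfNat.ofNat_ne_zero, not_false_eq_true, zero_pow, sub_zero, add_zero]
    simp only [mul_zero, add_zero] at *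
    linarith) (fun y hy => (uu_convex (a := a) (l := l) (x₁ := x₁) (fun x hx => by
      rw [PP]
      by_cases hc : -x₁ ≤ x
      · have q1 : x ^ 3 ≤ x₁ ^ 3 := by
          have : Odd 3 := by decide
          exact this.strictMono_pow.monotone hx.le
        have q2 : -a * x ≤ |a| * x₁ := by
          refine (le_abs_self _).trans ?_
          rw [abs_mul, abs_neg]
          exact mul_le_mul_of_nonneg_left (abs_le.2 ⟨hc, hx.le⟩) aab
        linarith
      · push Not at hc
        have q1 : 0 ≤ x ^ 2 - a := by nlinarith [le_abs_self a]
        have q2 : 0 ≤ l := by refine le_trans ?_ l2; positivity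
        nlinarith) y hy).1)
  rw [thm] at h
  simp only [mul_zero, zero_mul, sub_zero] at h
  refine ⟨l, ?_⟩
  linarith

/-- U3 -/
lemma al_large (a N : ℝ) : ∃ l, N ≤ al a l := by
  set x₁ := 1 + |a| with hx₁
  have aab := abs_nonneg a
  have h1 : 1 ≤ x₁ := by linarith
  have ha : |a| ≤ x₁ := by linarith
  have hs1 : 0 < Real.sqrt x₁ := Real.sqrt_pos.2 (by linarith)
  set m := (|N| + 3 * Real.pi / 2 + |ph a x₁|) * Real.sqrt x₁ / 2 with hm
  have hm0 : 0 ≤ m := by positivity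
  set K := 2 + |a| + 4 * m with hK
  have hw : ∀ x, x₁ ≤ x → 0 < wm a m x := fun x hx => by
    have := wm_lb (a := a) (m := m) hm0 (h1.trans hx) (ha.trans hx)
    have hs := Real.sqrt_pos.2 (show 0 < x by linarith)
    have : 0 < Real.sqrt x ^ 3 / 2 := by positivity
    linarith
  refine ⟨-(2 * m + a ^ 2 + |a| * m + m ^ 2 + (3 * K ^ 2 + K)), ?_⟩
  have h := (al_lower (Fr_m h1 hw) (-(2 * m + a ^ 2 + |a| * m + m ^ 2 + (3 * K ^ 2 + K))) (fun x hx => by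
    have hx1 : 1 ≤ x := by linarith
    have hx0 : 0 < x := by linarith
    have e1 := (abs_le.1 (em_bd (a := a) (m := m) hm0 (h1.trans hx) (ha.trans hx))).1
    rw [wm_sq a m hx0, PP]
    have q1 : a ^ 2 / (4 * x) ≤ a ^ 2 := div_le_self (sq_nonneg a) (by linarith)
    have q2 : -(a * m / x ^ 2) ≤ |a| * m := by
      rw [← neg_div, ← neg_mul]
      refine (div_le_div_of_nonneg_right (mul_le_mul_of_nonneg_right (neg_le_abs a) hm0) (by positivity)).trans ?_
      exact div_le_self (by positivity) (one_le_pow₀ hx1)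
    have q3 : m ^ 2 / x ^ 3 ≤ m ^ 2 := div_le_self (sq_nonneg m) (one_le_pow₀ hx1)
    linarith)).1
  rw [thm] at h
  have e : 2 * m * (Real.sqrt x₁)⁻¹ = |N| + 3 * Real.pi / 2 + |ph a x₁| := by rw [hm]; field_simp
  rw [e] at h
  linarith [le_abs_self N, le_abs_self (ph a x₁)]

/-- U5 -/
lemma al_neg_b {b : ℝ} (hb : 1 ≤ b) : al (-b) (1 + b) ≤ Real.pi / 2 - 2 / 5 - b := by
  have hw : ∀ x, 1 ≤ x → 0 < wm (-b) 0 x := fun x hx => by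
    have hs := Real.sqrt_pos.2 (show 0 < x by linarith)
    rw [wm]
    have : 0 < Real.sqrt x ^ 3 + b / 2 * (Real.sqrt x)⁻¹ := by positivity
    simp only [zero_mul, add_zero]
    linarith
  have h := al_upper (Fr_m le_rfl hw) (1 + b) (fun x hx => by
    have hx0 : 0 < x := by linarith
    rw [wm_sq (-b) 0 hx0, PP]
    have : 0 ≤ (-b) ^ 2 / (4 * x) := by positivity
    have hs : 1 ≤ Real.sqrt x := Real.one_le_sqrt.2 hx
    have hw1 := hw x hx
    have c2 : 0 ≤ wm2 (-b) 0 x / (2 * wm (-b) 0 x) := by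
      refine div_nonneg ?_ (by linarith)
      rw [wm2]
      have : 0 ≤ 3 / 4 * (Real.sqrt x)⁻¹ + 3 * b / 8 * (Real.sqrt x)⁻¹ ^ 5 := by positivity
      simp only [mul_zero, zero_div, zero_mul, add_zero]
      linarith
    have c1 : |wm1 (-b) 0 x / wm (-b) 0 x| ≤ 3 / 2 := by
      rw [abs_div, abs_of_pos hw1, div_le_iff₀ hw1, wm1, wm]
      simp only [mul_zero, zero_div, zero_mul, add_zero, sub_zero]
      have hr : 0 < (Real.sqrt x)⁻¹ := by positivity
      have hr1 : (Real.sqrt x)⁻¹ ≤ 1 := inv_le_one_of_one_le₀ hs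
      have hr3 : (Real.sqrt x)⁻¹ ^ 3 ≤ (Real.sqrt x)⁻¹ := by
        calc (Real.sqrt x)⁻¹ ^ 3 ≤ (Real.sqrt x)⁻¹ ^ 1 := pow_le_pow_of_le_one hr.le hr1 (by norm_num)
          _ = _ := pow_one _
      have hs3 : Real.sqrt x ≤ Real.sqrt x ^ 3 := by nlinarith [pow_le_pow_left₀ zero_le_one hs 2]
      have hr30 : 0 ≤ (Real.sqrt x)⁻¹ ^ 3 := by positivity
      have hbr : b * (Real.sqrt x)⁻¹ ^ 3 ≤ b * (Real.sqrt x)⁻¹ := mul_le_mul_of_nonneg_left hr3 (by linarith)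
      have hbr0 : 0 ≤ b * (Real.sqrt x)⁻¹ ^ 3 := by positivity
      rw [abs_le]; constructor <;> nlinarith
    have c3 : (wm1 (-b) 0 x / wm (-b) 0 x) ^ 2 ≤ (3 / 2) ^ 2 := sq_le_sq' (by linarith [(abs_le.1 c1).1]) (abs_le.1 c1).2
    have e1 : em (-b) 0 x ≤ 2 := by rw [em]; nlinarith
    simp only [mul_zero, zero_div, ne_eq, OfNat.ofNat_ne_zero, not_false_eq_true, zero_pow, sub_zero, add_zero]
    linarith) (fun y hy => (uu_convex (a := -b) (l := 1 + b) (x₁ := 1) (fun x hx => by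
      rw [PP]
      have q1 : x ^ 3 ≤ 1 ^ 3 := by
        have : Odd 3 := by decide
        exact this.strictMono_pow.monotone hx.le
      nlinarith) y hy).1)
  rw [thm, ph] at h
  simp only [mul_zero, zero_mul, sub_zero, Real.sqrt_one] at h
  linarith

noncomputable def w4 (z x : ℝ) : ℝ := (x + z) * Real.sqrt (x - 2 * z)
noncomputable def L4 (z x : ℝ) : ℝ := (x + z)⁻¹ + 1 / 2 * (x - 2 * z)⁻¹
noncomputable def t4 (z x : ℝ) : ℝ := 2 / 5 * Real.sqrt (x - 2 * z) ^ 5 + 2 * z * Real.sqrt (x - 2 * z) ^ 3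

lemma sq4_der {z x : ℝ} (hx : 2 * z < x) : HasDerivAt (fun x => Real.sqrt (x - 2 * z)) (1 / 2 * (Real.sqrt (x - 2 * z))⁻¹) x := by
  have := (sqrt_der (sub_pos.2 hx)).comp x ((hasDerivAt_id x).sub_const (2 * z))
  rw [mul_one] at this
  exact this

lemma w4_der {z x : ℝ} (hz : 0 < z) (hx : 2 * z < x) : HasDerivAt (w4 z) (w4 z x * L4 z x) x := by
  have hs := Real.sqrt_pos.2 (sub_pos.2 hx)
  refine HasDerivAt.congr_deriv (f := w4 z) (((hasDerivAt_id x).add_const z).fun_mul (sq4_der hx)) ?_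
  rw [w4, L4]
  have e : x - 2 * z = Real.sqrt (x - 2 * z) ^ 2 := (Real.sq_sqrt (sub_pos.2 hx).le).symm
  have hp : 0 < x + z := by linarith
  nth_rewrite 4 [e]
  simp only [id]
  field_simp

lemma L4_der {z x : ℝ} (hz : 0 < z) (hx : 2 * z < x) :
    HasDerivAt (L4 z) (-((x + z) ^ 2)⁻¹ - 1 / 2 * ((x - 2 * z) ^ 2)⁻¹) x := by
  have hp : 0 < x + z := by linarith
  have hq := sub_pos.2 hx
  refine HasDerivAt.congr_deriv (f := L4 z) ((((hasDerivAt_id x).add_const z).fun_inv hp.ne').fun_add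
    ((((hasDerivAt_id x).sub_const (2 * z)).fun_inv hq.ne').const_mul (1 / 2))) ?_
  simp only [id]
  field_simp
  ring

lemma t4_der {z x : ℝ} (hz : 0 < z) (hx : 2 * z < x) : HasDerivAt (t4 z) (w4 z x) x := by
  have hs := Real.sqrt_pos.2 (sub_pos.2 hx)
  refine HasDerivAt.congr_deriv (f := t4 z) ((((sq4_der hx).fun_pow 5).const_mul (2 / 5)).fun_add
    (((sq4_der hx).fun_pow 3).const_mul (2 * z))) ?_
  rw [w4]
  have e : x = Real.sqrt (x - 2 * z) ^ 2 + 2 * z := by rw [Real.sq_sqrt (sub_pos.2 hx).le]; ring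
  norm_num
  generalize Real.sqrt (x - 2 * z) = t at *
  subst e
  field_simp
  ring

lemma w4_lim (z : ℝ) (hz : 0 < z) : Tendsto (fun x => w4 z x / rq x ^ 6) atTop (nhds 1) := by
  have hi : Tendsto (fun x : ℝ => x⁻¹) atTop (nhds 0) := tendsto_inv_atTop_zero
  have h := ((hi.const_mul z).const_add 1).mul ((hi.const_mul (2 * z)).const_sub 1).sqrt
  simp only [mul_zero, add_zero, sub_zero, Real.sqrt_one, mul_one] at h
  refine h.congr' ?_
  filter_upwards [eventually_gt_atTop (2 * z)] with x hx
  have hx0 : 0 < x := by linarith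
  have hs := Real.sqrt_pos.2 hx0
  rw [w4, rq6, show 1 - 2 * z * x⁻¹ = (x - 2 * z) / x by field_simp, Real.sqrt_div (sub_pos.2 hx).le,
    show Real.sqrt x ^ 3 = x * Real.sqrt x by rw [pow_succ, Real.sq_sqrt hx0.le]]
  field_simp

lemma L4_lim (z : ℝ) : Tendsto (fun x => L4 z x / rq x ^ 6) atTop (nhds 0) := by
  have h1 : Tendsto (fun x : ℝ => (x + z)⁻¹) atTop (nhds 0) :=
    tendsto_inv_atTop_zero.comp (tendsto_atTop_add_const_right _ _ tendsto_id)
  have h2 : Tendsto (fun x : ℝ => (x - 2 * z)⁻¹) atTop (nhds 0) :=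
    tendsto_inv_atTop_zero.comp (tendsto_atTop_add_const_right _ _ tendsto_id)
  have h := (h1.add (h2.const_mul (1 / 2))).mul irq6_lim
  simp only [mul_zero, add_zero] at h
  refine h.congr fun x => ?_
  rw [L4]; exact (div_eq_mul_inv _ _).symm

lemma t4_lim (z : ℝ) (hz : 0 < z) : Tendsto (fun x => t4 z x - ph (3 * z ^ 2) x) atTop (nhds 0) := by
  rw [tendsto_zero_iff_norm_tendsto_zero]
  have hb : Tendsto (fun x : ℝ => (5 * (4 / 25 * (10 * z ^ 3 + 4 * z ^ 4 + 72 * z ^ 5))) * (Real.sqrt x)⁻¹) atTop (nhds 0) := by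
    simpa using isqrt_lim.const_mul (5 * (4 / 25 * (10 * z ^ 3 + 4 * z ^ 4 + 72 * z ^ 5)))
  refine squeeze_zero' (Eventually.of_forall fun _ => norm_nonneg _) ?_ hb
  filter_upwards [eventually_ge_atTop (1 + 4 * z)] with x hx
  have hx1 : 1 ≤ x := by linarith
  have hs := Real.sqrt_pos.2 (show 0 < x by linarith)
  have e1 : Real.sqrt (x - 2 * z) ^ 2 = x - 2 * z := Real.sq_sqrt (by linarith)
  have e2 : Real.sqrt x ^ 2 = x := Real.sq_sqrt (by linarith)
  have A0 : 0 ≤ t4 z x := by rw [t4]; positivity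
  have hB : ph (3 * z ^ 2) x = 2 / 5 * Real.sqrt x * (x ^ 2 - 15 / 2 * z ^ 2) := by
    rw [ph, show Real.sqrt x ^ 5 = (Real.sqrt x ^ 2) ^ 2 * Real.sqrt x by ring, e2]; ring
  have hA : t4 z x = 2 / 5 * Real.sqrt (x - 2 * z) * ((x - 2 * z) * (x + 3 * z)) := by
    rw [t4, show Real.sqrt (x - 2 * z) ^ 5 = (Real.sqrt (x - 2 * z) ^ 2) ^ 2 * Real.sqrt (x - 2 * z) by ring,
      show Real.sqrt (x - 2 * z) ^ 3 = (Real.sqrt (x - 2 * z) ^ 2) * Real.sqrt (x - 2 * z) by ring, e1]; ring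
  have hB1 : 1 / 5 * Real.sqrt x * x ^ 2 ≤ ph (3 * z ^ 2) x := by
    rw [hB]; nlinarith [mul_pos hs hz, sq_nonneg (x - 4 * z), mul_nonneg hs.le (show 0 ≤ x ^ 2 - 15 * z ^ 2 by nlinarith)]
  have hd : (t4 z x - ph (3 * z ^ 2) x) * (t4 z x + ph (3 * z ^ 2) x) = 4 / 25 * (10 * z ^ 3 * x ^ 2 + 15 / 4 * z ^ 4 * x - 72 * z ^ 5) := by
    have : (t4 z x - ph (3 * z ^ 2) x) * (t4 z x + ph (3 * z ^ 2) x) = t4 z x ^ 2 - ph (3 * z ^ 2) x ^ 2 := by ring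
    rw [this, hA, hB, mul_pow, mul_pow, e1, mul_pow (2 / 5 * Real.sqrt x), mul_pow (2 / 5), e2]; ring
  have hd2 : |t4 z x - ph (3 * z ^ 2) x| * (t4 z x + ph (3 * z ^ 2) x) ≤ 4 / 25 * (10 * z ^ 3 + 4 * z ^ 4 + 72 * z ^ 5) * x ^ 2 := by
    have hp : 0 ≤ t4 z x + ph (3 * z ^ 2) x := by
      have : 0 ≤ 1 / 5 * Real.sqrt x * x ^ 2 := by positivity
      linarith
    rw [← abs_of_nonneg hp, ← abs_mul, hd, abs_le]
    have i1 : x ≤ x ^ 2 := by nlinarith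
    have i2 : 1 ≤ x ^ 2 := by nlinarith
    have z3 : 0 < z ^ 3 := by positivity
    have z4 : 0 < z ^ 4 := by positivity
    have z5 : 0 < z ^ 5 := by positivity
    have j1 := mul_le_mul_of_nonneg_left i1 z4.le
    have j2 := mul_le_mul_of_nonneg_left i2 z5.le
    have j3 : 0 ≤ z ^ 3 * x ^ 2 := by positivity
    have j4 : 0 ≤ z ^ 4 * x := by positivity
    constructor <;> nlinarith
  rw [Real.norm_eq_abs, ← div_eq_mul_inv, le_div_iff₀ hs]
  have hn := abs_nonneg (t4 z x - ph (3 * z ^ 2) x)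
  have h6 : |t4 z x - ph (3 * z ^ 2) x| * (1 / 5 * Real.sqrt x * x ^ 2) ≤ 4 / 25 * (10 * z ^ 3 + 4 * z ^ 4 + 72 * z ^ 5) * x ^ 2 :=
    (mul_le_mul_of_nonneg_left (by linarith) hn).trans hd2
  have hx2 : 0 < x ^ 2 := by positivity
  have h7 : |t4 z x - ph (3 * z ^ 2) x| * (1 / 5 * Real.sqrt x) ≤ 4 / 25 * (10 * z ^ 3 + 4 * z ^ 4 + 72 * z ^ 5) := by
    refine le_of_mul_le_mul_right ?_ hx2
    linarith
  linarith

/-- U4 -/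
lemma al_crit {z : ℝ} (hz : 0 < z) : -(3 * Real.pi / 4) < al (3 * z ^ 2) (2 * z ^ 3) := by
  have hP : ∀ x, PP (3 * z ^ 2) (2 * z ^ 3) x = (x + z) ^ 2 * (x - 2 * z) := fun x => by rw [PP]; ring
  have hu := uu_convex (a := 3 * z ^ 2) (l := 2 * z ^ 3) (x₁ := 2 * z) (fun x hx => by
    rw [hP]; exact mul_nonpos_of_nonneg_of_nonpos (sq_nonneg _) (by linarith))
  have ht : Continuous (t4 z) := by unfold t4; fun_prop
  have ht0 : t4 z (2 * z) = 0 := by simp [t4]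
  have ev1 : ∀ᶠ x in nhds (2 * z), t4 z x < Real.pi / 4 := by
    refine (ht.tendsto (2 * z)).eventually_lt_const ?_
    rw [ht0]; positivity
  have ev2 : ∀ᶠ x in nhds (2 * z), 0 < uu (3 * z ^ 2) (2 * z ^ 3) x :=
    (uu_der _ _ (2 * z)).continuousAt.eventually_const_lt (hu (2 * z) le_rfl).1
  obtain ⟨δ, hδ, hb⟩ := Metric.eventually_nhds_iff.1 (ev1.and ev2)
  set x₁ := 2 * z + δ / 2 with hx₁
  have hgt : ∀ x, x₁ ≤ x → 2 * z < x := fun x hx => by linarith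
  have F := Fr_wkb (a := 3 * z ^ 2) (x₁ := x₁) (w := w4 z) (L := L4 z) (θ := t4 z)
    (fun x hx => by
      have := Real.sqrt_pos.2 (sub_pos.2 (hgt x hx))
      have : 0 < x + z := by linarith [hgt x hx]
      rw [w4]; positivity)
    (fun x hx => w4_der hz (hgt x hx)) (fun x hx => L4_der hz (hgt x hx)) (fun x hx => t4_der hz (hgt x hx))
    (w4_lim z hz) (L4_lim z) (t4_lim z hz)
  have h := (al_lower F (2 * z ^ 3) (fun x hx => by
    have hq := sub_pos.2 (hgt x hx)
    rw [hP, w4, mul_pow, Real.sq_sqrt hq.le]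
    have i1 : 0 < ((x + z) ^ 2)⁻¹ := by
      have : 0 < x + z := by linarith
      positivity
    have i2 : 0 < ((x - 2 * z) ^ 2)⁻¹ := by positivity
    nlinarith [sq_nonneg (L4 z x)])).2 (fun y hy => by
      by_cases hc : y ≤ 2 * z
      · exact (hu y hc).1
      · push Not at hc
        refine (hb (y := y) ?_).2
        rw [Real.dist_eq, abs_of_pos (by linarith)]; linarith)
  have h2 := (hb (y := x₁) (by rw [Real.dist_eq, abs_of_pos (by linarith)]; linarith)).1
  linarith

noncomputable def Psi (a l : ℝ) : ℝ := -al a l - Real.pi / 4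
noncomputable def MM (a l : ℝ) : ℝ := ‖cc a l‖ / 2

lemma MM_pos (a l : ℝ) : 0 < MM a l := by
  have := norm_pos_iff.2 (cc_ne a l)
  rw [MM]; positivity

lemma DD_pol (a l : ℝ) : DD a l = MM a l * er (Psi a l) := by
  have h : cj (cc a l) = ‖cc a l‖ * er (-al a l) := by
    nth_rewrite 1 [cc_pol a l]
    rw [map_mul, Complex.conj_ofReal, er_conj]
  rw [DD_eq, h, MM, Psi, sub_eq_add_neg, er_add]
  push_cast
  ring

lemma Psi_cont : Continuous (fun q : ℝ × ℝ => Psi q.1 q.2) := by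
  unfold Psi
  exact al_cont.neg.sub continuous_const
lemma MM_cont : Continuous (fun q : ℝ × ℝ => MM q.1 q.2) := by
  unfold MM
  exact cc_cont.norm.div_const _

lemma Psi_mono (a : ℝ) : StrictMono (Psi a) := fun x y h => by
  have := al_strictAnti a h
  rw [Psi, Psi]; linarith

lemma Psi_cont2 (a : ℝ) : Continuous (Psi a) := by
  have h1 : Continuous fun l : ℝ => (a, l) := by fun_prop
  have h2 := Psi_cont.comp h1
  exact h2
lemma Psi_cont1 (l : ℝ) : Continuous (fun q : ℝ × ℝ => Psi q.1 l) := by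
  have h1 : Continuous fun q : ℝ × ℝ => (q.1, l) := by fun_prop
  have h2 := Psi_cont.comp h1
  exact h2

lemma Psi_surj (a p : ℝ) : ∃ l, Psi a l = p := by
  obtain ⟨l1, h1⟩ := al_small a (p + Real.pi / 4)
  obtain ⟨l2, h2⟩ := al_large a (-p - Real.pi / 4)
  have hc := Psi_cont2 a
  have := mem_range_of_exists_le_of_exists_ge hc (c := p) ⟨l2, by rw [Psi]; linarith⟩ ⟨l1, by rw [Psi]; linarith⟩
  exact this

noncomputable def Lam (a p : ℝ) : ℝ := (Psi_surj a p).choose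
lemma Psi_Lam (a p : ℝ) : Psi a (Lam a p) = p := (Psi_surj a p).choose_spec
lemma Lam_Psi (a l : ℝ) : Lam a (Psi a l) = l := (Psi_mono a).injective (Psi_Lam a _)

lemma Lam_lt {a p l : ℝ} : Lam a p < l ↔ p < Psi a l := by
  nth_rewrite 2 [← Psi_Lam a p]; exact (Psi_mono a).lt_iff_lt.symm
lemma lt_Lam {a p l : ℝ} : l < Lam a p ↔ Psi a l < p := by
  nth_rewrite 2 [← Psi_Lam a p]; exact (Psi_mono a).lt_iff_lt.symm

lemma Lam_cont : Continuous (fun q : ℝ × ℝ => Lam q.1 q.2) := by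
  rw [continuous_iff_continuousAt]
  intro q0
  have h := Psi_cont1
  rw [ContinuousAt, tendsto_order]
  constructor
  · intro l hl
    have := lt_Lam.1 hl
    have h2 := ((h l).tendsto q0).eventually_lt (continuous_snd.tendsto q0) this
    filter_upwards [h2] with q hq
    exact lt_Lam.2 hq
  · intro l hl
    have := Lam_lt.1 hl
    have h2 := (continuous_snd.tendsto q0).eventually_lt ((h l).tendsto q0) this
    filter_upwards [h2] with q hq
    exact Lam_lt.2 hq

lemma eig_iff_Psi (a l : ℝ) : (∃ y, IsCubicEigenfunction a l y) ↔ MM a l * Real.cos (Psi a l) = -1 / 2 := by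
  rw [eig_iff, DD_pol, Complex.re_ofReal_mul, er_re]

/-- U4, in terms of Lam -/
lemma Lam_crit {z p : ℝ} (hz : 0 < z) (hp : Real.pi / 2 ≤ p) : 2 * z ^ 3 < Lam (3 * z ^ 2) p := by
  rw [lt_Lam, Psi]
  linarith [al_crit hz]

lemma Lam_neg {b p : ℝ} (hb : 1 ≤ b) (hp : p + 3 * Real.pi / 4 ≤ b) : Lam (-b) p < 1 + b := by
  rw [Lam_lt, Psi]
  linarith [al_neg_b hb]
end Cub

namespace Cub
local notation "cj" => starRingEnd ℂ

lemma sep_C1 {F : ℂ → ℂ → ℂ} (hc : Continuous (fun q : ℂ × ℂ => F q.1 q.2))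
    (h1 : ∀ y, Differentiable ℂ (fun x => F x y)) :
    Continuous (fun q : ℂ × ℂ => deriv (fun x => F x q.2) q.1) := by
  have hc' : Continuous (fun q : ℂ × ℂ => F q.2 q.1) := hc.comp continuous_swap
  let f : C(ℂ × ℂ, ℂ) := ⟨fun q => F q.2 q.1, hc'⟩
  rw [continuous_iff_continuousAt]
  intro q0
  have ht : Tendsto (fun y => f.curry y) (nhds q0.2) (nhds (f.curry q0.2)) := f.curry.continuous.tendsto q0.2
  rw [ContinuousMap.tendsto_iff_tendstoLocallyUniformly] at ht
  have ht2 := (tendstoLocallyUniformlyOn_univ.2 ht).deriv (Eventually.of_forall fun y => (h1 y).differentiableOn) isOpen_univ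
  rw [tendstoLocallyUniformlyOn_univ, Metric.tendstoLocallyUniformly_iff] at ht2
  rw [ContinuousAt, Metric.tendsto_nhds]
  intro ε hε
  obtain ⟨t, htn, hev⟩ := ht2 (ε / 2) (by positivity) q0.1
  have hcd : Continuous (deriv (fun x => F x q0.2)) := by
    have : ContDiff ℂ 1 (fun x => F x q0.2) := (h1 q0.2).contDiff
    exact this.continuous_deriv le_rfl
  have e1 := (Metric.tendsto_nhds.1 (hcd.tendsto q0.1)) (ε / 2) (by positivity)
  have e2 : ∀ᶠ q : ℂ × ℂ in nhds q0, q.1 ∈ t := (continuous_fst.tendsto q0).eventually htn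
  have e3 := (continuous_snd.tendsto q0).eventually hev
  have e4 := (continuous_fst.tendsto q0).eventually e1
  filter_upwards [e2, e3, e4] with q h2 h3 h4
  have h5 := h3 q.1 h2
  refine (dist_triangle _ (deriv (fun x => F x q0.2) q.1) _).trans_lt ?_
  have h6 : dist (deriv (fun x => F x q.2) q.1) (deriv (fun x => F x q0.2) q.1) < ε / 2 := by
    rw [dist_comm]; exact h5
  linarith

lemma dq_lim {F : ℂ → ℂ → ℂ} (hc : Continuous (fun q : ℂ × ℂ => F q.1 q.2))
    (h1 : ∀ y, Differentiable ℂ (fun x => F x y)) (x0 : ℂ) :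
    TendstoLocallyUniformlyOn (fun (h : ℂ) y => (F (x0 + h) y - F x0 y) / h) (fun y => deriv (fun x => F x y) x0)
      (nhdsWithin 0 {0}ᶜ) Set.univ := by
  rw [tendstoLocallyUniformlyOn_univ, Metric.tendstoLocallyUniformly_iff]
  intro ε hε y0
  have h2 := (sep_C1 hc h1).tendsto (x0, y0)
  obtain ⟨δ, hδ, hb⟩ := Metric.eventually_nhds_iff.1 (Metric.tendsto_nhds.1 h2 (ε / 3) (by positivity))
  refine ⟨Metric.ball y0 δ, Metric.ball_mem_nhds _ hδ, ?_⟩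
  have hn : ∀ᶠ h : ℂ in nhdsWithin 0 {0}ᶜ, h ∈ Metric.ball (0 : ℂ) δ := nhdsWithin_le_nhds (Metric.ball_mem_nhds _ hδ)
  filter_upwards [hn, self_mem_nhdsWithin] with h hh h0 y hy
  have h0 : h ≠ 0 := h0
  rw [Metric.mem_ball, dist_zero_right] at hh
  rw [Metric.mem_ball] at hy
  set d := deriv (fun x => F x y) x0 with hd
  have q0 : dist d (deriv (fun x => F x y0) x0) < ε / 3 := hb (y := (x0, y)) (by
    rw [Prod.dist_eq]; simp [hδ, hy])
  have hder : ∀ x ∈ Metric.ball x0 δ, HasDerivAt (fun x => F x y - x * d) (deriv (fun x => F x y) x - d) x := fun x _ => by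
    refine (((h1 y) x).hasDerivAt.fun_sub ((hasDerivAt_id x).mul_const d)).congr_deriv ?_
    ring
  have hbd : ∀ x ∈ Metric.ball x0 δ, ‖deriv (fun x => F x y) x - d‖ ≤ 2 * ε / 3 := fun x hx => by
    have q1 : dist (deriv (fun x => F x y) x) (deriv (fun x => F x y0) x0) < ε / 3 := hb (y := (x, y)) (by
      rw [Prod.dist_eq]; exact max_lt hx hy)
    rw [← dist_eq_norm]
    have := dist_triangle_right (deriv (fun x => F x y) x) d (deriv (fun x => F x y0) x0)
    linarith
  have hm := (convex_ball x0 δ).norm_image_sub_le_of_norm_hasDerivWithin_le (fun x hx => (hder x hx).hasDerivWithinAt) hbd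
    (Metric.mem_ball_self hδ) (show x0 + h ∈ Metric.ball x0 δ by rw [Metric.mem_ball, dist_eq_norm]; simpa using hh)
  rw [dist_eq_norm]
  have e : d - (F (x0 + h) y - F x0 y) / h = -((F (x0 + h) y - (x0 + h) * d - (F x0 y - x0 * d)) / h) := by field_simp; ring
  rw [e, norm_neg, norm_div, div_lt_iff₀ (norm_pos_iff.2 h0)]
  have : x0 + h - x0 = h := by ring
  rw [this] at hm
  have := norm_pos_iff.2 h0
  nlinarith

/-- line in parameter space -/
noncomputable def Yt (k : ℤ) (a l p1 p2 : ℂ) (t z : ℂ) : ℂ := Yk k (a + t * p1) (l + t * p2) z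
noncomputable def Wt (j k : ℤ) (a l p1 p2 : ℂ) (t : ℂ) : ℂ := Wr j k (a + t * p1) (l + t * p2)
noncomputable def Vk (k : ℤ) (a l p1 p2 : ℂ) (z : ℂ) : ℂ := deriv (fun t => Yt k a l p1 p2 t z) 0

lemma lin_diff (a p : ℂ) : Differentiable ℂ (fun t : ℂ => a + t * p) := by fun_prop

lemma Yt_diff (k : ℤ) (a l p1 p2 z : ℂ) : Differentiable ℂ (fun t => Yt k a l p1 p2 t z) := by
  have h := (Yk_curve k (lin_diff a p1) (lin_diff l p2) (differentiable_const z)).1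
  exact h

lemma Wt_diff (j k : ℤ) (a l p1 p2 : ℂ) : Differentiable ℂ (Wt j k a l p1 p2) := by
  have h1 := (Yk_curve j (lin_diff a p1) (lin_diff l p2) (differentiable_const 0))
  have h2 := (Yk_curve k (lin_diff a p1) (lin_diff l p2) (differentiable_const 0))
  have h3 := (h1.1.mul h2.2).sub (h1.2.mul h2.1)
  exact h3

lemma Yt_cont (k : ℤ) (a l p1 p2 : ℂ) : Continuous (fun q : ℂ × ℂ => Yt k a l p1 p2 q.1 q.2) := by
  have h1 : Continuous (fun q : ℂ × ℂ => ((a + q.1 * p1, l + q.1 * p2), q.2)) := by fun_prop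
  have h2 := (Yk_cont k).comp h1
  exact h2

lemma Yt_der (k : ℤ) (a l p1 p2 : ℂ) (t z : ℂ) : HasDerivAt (Yt k a l p1 p2 t) (Yk' k (a + t * p1) (l + t * p2) z) z :=
  (Yk_isSol k (a + t * p1) (l + t * p2)).1 z

lemma Vk_sol (k : ℤ) (a l p1 p2 : ℂ) : Differentiable ℂ (Vk k a l p1 p2) ∧ ∀ z, HasDerivAt (deriv (Vk k a l p1 p2))
    ((z ^ 3 - a * z + l) * Vk k a l p1 p2 z + (p2 - p1 * z) * Yk k a l z) z := by
  have hlim := dq_lim (Yt_cont k a l p1 p2) (Yt_diff k a l p1 p2) 0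
  have hfd : ∀ h z, HasDerivAt (fun z => (Yt k a l p1 p2 (0 + h) z - Yt k a l p1 p2 0 z) / h)
      ((Yk' k (a + (0 + h) * p1) (l + (0 + h) * p2) z - Yk' k (a + 0 * p1) (l + 0 * p2) z) / h) z := fun h z =>
    ((Yt_der k a l p1 p2 (0 + h) z).fun_sub (Yt_der k a l p1 p2 0 z)).div_const h
  have hdf : ∀ h, Differentiable ℂ (fun z => (Yt k a l p1 p2 (0 + h) z - Yt k a l p1 p2 0 z) / h) := fun h z =>
    (hfd h z).differentiableAt
  have hV : Differentiable ℂ (Vk k a l p1 p2) := by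
    have := hlim.differentiableOn (Eventually.of_forall fun h => (hdf h).differentiableOn) isOpen_univ
    exact differentiableOn_univ.1 this
  refine ⟨hV, fun z => ?_⟩
  have hl1 := hlim.deriv (Eventually.of_forall fun h => (hdf h).differentiableOn) isOpen_univ
  have hl2 := hl1.deriv (Eventually.of_forall fun h => ((hdf h).differentiableOn.deriv isOpen_univ)) isOpen_univ
  have hz1 := hl2.tendsto_at (Set.mem_univ z)
  have hz0 := hlim.tendsto_at (Set.mem_univ z)
  have hV' : Differentiable ℂ (deriv (Vk k a l p1 p2)) :=
    differentiableOn_univ.1 (hV.differentiableOn.deriv isOpen_univ)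
  refine (hV' z).hasDerivAt.congr_deriv ?_
  refine tendsto_nhds_unique hz1 ?_
  have hY : Tendsto (fun h => Yt k a l p1 p2 h z) (nhdsWithin 0 {0}ᶜ) (nhds (Yt k a l p1 p2 0 z)) :=
    ((Yt_diff k a l p1 p2 z).continuous.tendsto 0).mono_left nhdsWithin_le_nhds
  have hs := (hz0.const_mul (z ^ 3 - a * z + l)).add (hY.const_mul (p2 - p1 * z))
  have e0 : Yt k a l p1 p2 0 z = Yk k a l z := by simp [Yt]
  rw [e0] at hs
  refine hs.congr' ?_
  filter_upwards [self_mem_nhdsWithin] with h h0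
  have h0 : h ≠ 0 := h0
  simp only [Function.comp]
  have ed : deriv (fun z => (Yt k a l p1 p2 (0 + h) z - Yt k a l p1 p2 0 z) / h) =
      fun z => ((Yk' k (a + (0 + h) * p1) (l + (0 + h) * p2) z - Yk' k (a + 0 * p1) (l + 0 * p2) z) / h) :=
    funext fun z => (hfd h z).deriv
  rw [ed]
  have h2 := (((Yk_isSol k (a + (0 + h) * p1) (l + (0 + h) * p2)).2 z).fun_sub ((Yk_isSol k (a + 0 * p1) (l + 0 * p2)).2 z)).div_const h
  rw [h2.deriv]
  simp only [Yt, zero_add, zero_mul, add_zero]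
  field_simp
  ring
end Cub

namespace Cub
local notation "cj" => starRingEnd ℂ

lemma Vk_has (k : ℤ) (a l p1 p2 z : ℂ) : HasDerivAt (fun t => Yt k a l p1 p2 t z) (Vk k a l p1 p2 z) 0 :=
  (Yt_diff k a l p1 p2 z 0).hasDerivAt

lemma Yt_zero (k : ℤ) (a l p1 p2 z : ℂ) : Yt k a l p1 p2 0 z = Yk k a l z := by simp [Yt]
lemma Wt_zero (j k : ℤ) (a l p1 p2 : ℂ) : Wt j k a l p1 p2 0 = Wr j k a l := by simp [Wt]

lemma plucker (f g h : ℤ) (a l z : ℂ) :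
    Yk f a l z * Wr g h a l + Yk g a l z * Wr h f a l + Yk h a l z * Wr f g a l = 0 := by
  rw [← Wr_eq g h a l z, ← Wr_eq h f a l z, ← Wr_eq f g a l z]; ring

/-- stationary wronskian -/
def Sta (a l p1 p2 : ℂ) (j k : ℤ) : Prop := HasDerivAt (Wt j k a l p1 p2) 0 0

lemma Sta.swap {a l p1 p2 : ℂ} {j k : ℤ} (h : Sta a l p1 p2 j k) : Sta a l p1 p2 k j := by
  have e : Wt k j a l p1 p2 = fun t => -Wt j k a l p1 p2 t := funext fun t => Wr_swap j k _ _
  rw [Sta, e]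
  have h2 := HasDerivAt.fun_neg h
  rwa [neg_zero] at h2

lemma Sta_adj (a l p1 p2 : ℂ) (k : ℤ) : Sta a l p1 p2 k (k + 1) := by
  have e : Wt k (k + 1) a l p1 p2 = fun _ => 2 * (-1) ^ k * er (3 * Real.pi * (2 * k + 1) / 10) :=
    funext fun t => Wr_adj k _ _
  rw [Sta, e]; exact hasDerivAt_const _ _

lemma plucker_V {a l p1 p2 : ℂ} {f g h : ℤ} (h1 : Sta a l p1 p2 g h) (h2 : Sta a l p1 p2 h f) (h3 : Sta a l p1 p2 f g) (z : ℂ) :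
    Vk f a l p1 p2 z * Wr g h a l + Vk g a l p1 p2 z * Wr h f a l + Vk h a l p1 p2 z * Wr f g a l = 0 := by
  have e : (fun t => Yt f a l p1 p2 t z * Wt g h a l p1 p2 t + Yt g a l p1 p2 t z * Wt h f a l p1 p2 t
    + Yt h a l p1 p2 t z * Wt f g a l p1 p2 t) = fun _ => 0 := funext fun t => plucker f g h _ _ z
  have d := (((Vk_has f a l p1 p2 z).fun_mul h1).fun_add ((Vk_has g a l p1 p2 z).fun_mul h2)).fun_add
    ((Vk_has h a l p1 p2 z).fun_mul h3)
  rw [e] at d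
  have := d.unique (hasDerivAt_const (0 : ℂ) (0 : ℂ))
  simp only [Wt_zero, mul_zero, add_zero] at this
  exact this

noncomputable def BB (a l p1 p2 : ℂ) (j k : ℤ) (z : ℂ) : ℂ :=
  Yk j a l z * Vk k a l p1 p2 z - Yk k a l z * Vk j a l p1 p2 z

lemma BB_rel {a l p1 p2 : ℂ} {f g h : ℤ} (h1 : Sta a l p1 p2 g h) (h2 : Sta a l p1 p2 h f) (h3 : Sta a l p1 p2 f g) (z : ℂ) :
    BB a l p1 p2 f g z * Wr g h a l = BB a l p1 p2 g h z * Wr f g a l := by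
  have e1 := plucker f g h a l z
  have e2 := plucker_V h1 h2 h3 z
  simp only [BB]
  linear_combination Yk g a l z * e2 * (-1) + Vk g a l p1 p2 z * e1

lemma BB_swap (a l p1 p2 : ℂ) (j k : ℤ) (z : ℂ) : BB a l p1 p2 k j z = - BB a l p1 p2 j k z := by
  simp only [BB]; ring

lemma Yk_m2 : Yk (-2) = Yk 3 := by rw [← (Yk_period (-2)).1]; norm_num
lemma Yk'_m2 : Yk' (-2) = Yk' 3 := by rw [← (Yk_period (-2)).2]; norm_num
lemma Vk_m2 : Vk (-2) = Vk 3 := by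
  funext a l p1 p2 z; simp only [Vk, Yt, Yk_m2]
lemma Wr_m2 (k : ℤ) : Wr k (-2) = Wr k 3 := by
  funext a l; simp only [Wr, Yk_m2, Yk'_m2]
lemma Wr_m2' (k : ℤ) : Wr (-2) k = Wr 3 k := by
  funext a l; simp only [Wr, Yk_m2, Yk'_m2]
lemma Wt_m2 (k : ℤ) : Wt k (-2) = Wt k 3 := by
  funext a l p1 p2 t; simp only [Wt, Wr_m2]

set_option maxHeartbeats 1600000 in
lemma BB_chain {a l p1 p2 : ℂ} (s1 : Sta a l p1 p2 0 2) (s2 : Sta a l p1 p2 0 (-2))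
    (n1 : Wr 0 2 a l ≠ 0) (n2 : Wr 0 (-2) a l ≠ 0) (z : ℂ) (k : ℤ) (hk : -2 ≤ k) (hk' : k ≤ 2) :
    BB a l p1 p2 k (k + 1) z = BB a l p1 p2 0 1 z / Wr 0 1 a l * Wr k (k + 1) a l := by
  have a01 := Sta_adj a l p1 p2 0
  have a12 := Sta_adj a l p1 p2 1
  have a23 := Sta_adj a l p1 p2 2
  have am1 := Sta_adj a l p1 p2 (-1)
  have am2 := Sta_adj a l p1 p2 (-2)
  norm_num at a01 a12 a23 am1 am2
  have w01 := Wr_adj_ne 0 a l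
  have w12 := Wr_adj_ne 1 a l
  have w23 := Wr_adj_ne 2 a l
  have wm1 := Wr_adj_ne (-1) a l
  have wm2 := Wr_adj_ne (-2) a l
  norm_num at w01 w12 w23 wm1 wm2
  have s2' : Sta a l p1 p2 0 3 := by rw [Sta, ← Wt_m2]; exact s2
  have n2' : Wr 0 3 a l ≠ 0 := by rwa [← Wr_m2]
  have r1 := BB_rel a12 s1.swap a01 z
  have r2 := BB_rel s1.swap a01 a12 z
  have r3 := BB_rel a23 s2'.swap s1 z
  have r4 := BB_rel s2'.swap s1 a23 z
  have r5 := BB_rel am1 s2 am2 z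
  have r6 := BB_rel s2 am2 am1 z
  set v := BB a l p1 p2 0 1 z / Wr 0 1 a l with hv
  have b01 : BB a l p1 p2 0 1 z = v * Wr 0 1 a l := by rw [hv]; field_simp
  have b12 : BB a l p1 p2 1 2 z = v * Wr 1 2 a l := by
    apply mul_right_cancel₀ w01; rw [← r1, b01]; ring
  have b20 : BB a l p1 p2 2 0 z = v * Wr 2 0 a l := by
    apply mul_right_cancel₀ w12; rw [← r2, b12]; ring
  have b02 : BB a l p1 p2 0 2 z = v * Wr 0 2 a l := by
    rw [BB_swap, b20, Wr_swap 0 2]; ring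
  have b23 : BB a l p1 p2 2 3 z = v * Wr 2 3 a l := by
    apply mul_right_cancel₀ n1; rw [← r3, b02]; ring
  have b30 : BB a l p1 p2 3 0 z = v * Wr 3 0 a l := by
    apply mul_right_cancel₀ w23; rw [← r4, b23]; ring
  have b03 : BB a l p1 p2 0 (-2) z = v * Wr 0 (-2) a l := by
    have : BB a l p1 p2 0 (-2) z = BB a l p1 p2 0 3 z := by simp only [BB, Yk_m2, Vk_m2]
    rw [this, BB_swap, b30, Wr_m2, Wr_swap 0 3]; ring
  have bm1 : BB a l p1 p2 (-1) 0 z = v * Wr (-1) 0 a l := by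
    apply mul_right_cancel₀ n2; rw [r6, b03]; ring
  have bm2 : BB a l p1 p2 (-2) (-1) z = v * Wr (-2) (-1) a l := by
    apply mul_right_cancel₀ wm1; rw [r5, bm1]; ring
  have hc : k = -2 ∨ k = -1 ∨ k = 0 ∨ k = 1 ∨ k = 2 := by omega
  rcases hc with rfl | rfl | rfl | rfl | rfl
  · exact bm2
  · exact bm1
  · exact b01
  · exact b12
  · exact b23

lemma Vk_bound (a l p1 p2 : ℂ) (hp1 : ‖p1‖ ≤ 1) (hp2 : ‖p2‖ ≤ 1) : ∃ R : ℝ, 1 ≤ R ∧ ∀ (k : ℤ) (ρ β : ℝ), R ≤ ρ →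
    |β - k * Real.pi / 10| ≤ Real.pi / 10 → ‖Yk k a l ((ρ * er β) ^ 4)‖ ≤ 2 * ‖Tk k a (ρ * er β)‖ ∧
    ‖Vk k a l p1 p2 ((ρ * er β) ^ 4)‖ ≤ 6 * ρ ^ 2 * ‖Tk k a (ρ * er β)‖ := by
  obtain ⟨R, hR, h⟩ := AS (max ‖a‖ ‖l‖ + 1) 1 (by positivity) one_pos
  refine ⟨R, hR, fun k ρ β hρ hβ => ?_⟩
  have hρ0 : 0 < ρ := by linarith
  have hv0 : (ρ : ℂ) * er β ≠ 0 := by rw [← norm_pos_iff, norm_rho hρ0]; exact hρ0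
  have hY : ∀ a' l' : ℂ, ‖a'‖ ≤ max ‖a‖ ‖l‖ + 1 → ‖l'‖ ≤ max ‖a‖ ‖l‖ + 1 →
      ‖Yk k a' l' ((ρ * er β) ^ 4)‖ ≤ 2 * ‖Tk k a' (ρ * er β)‖ := fun a' l' ha hl => by
    have h1 := (h a' l' ha hl k ρ β hρ hβ).1
    have hT := Tk_ne k a' hv0
    have h2 : ‖Yk k a' l' ((ρ * er β) ^ 4) / Tk k a' (ρ * er β)‖ ≤ 2 := by
      have := norm_add_le (Yk k a' l' ((ρ * er β) ^ 4) / Tk k a' (ρ * er β) - 1) 1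
      rw [sub_add_cancel, norm_one] at this; linarith
    rwa [norm_div, div_le_iff₀ (norm_pos_iff.2 hT)] at h2
  refine ⟨hY a l (by linarith [le_max_left ‖a‖ ‖l‖]) (by linarith [le_max_right ‖a‖ ‖l‖]), ?_⟩
  have hr : 0 < (ρ ^ 2)⁻¹ := by positivity
  have hr1 : (ρ ^ 2)⁻¹ ≤ 1 := inv_le_one_of_one_le₀ (one_le_pow₀ (by linarith))
  have := Complex.norm_deriv_le_of_forall_mem_sphere_norm_le (c := 0) (C := 6 * ‖Tk k a (ρ * er β)‖) hr
    (Yt_diff k a l p1 p2 ((ρ * er β) ^ 4)).diffContOnCl (fun t ht => ?_)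
  · rw [div_inv_eq_mul] at this
    calc _ ≤ _ := this
      _ = _ := by ring
  · rw [mem_sphere_zero_iff_norm] at ht
    have q1 : ‖t * p1‖ ≤ 1 := by rw [norm_mul, ht]; nlinarith [norm_nonneg p1]
    have q2 : ‖t * p2‖ ≤ 1 := by rw [norm_mul, ht]; nlinarith [norm_nonneg p2]
    have := hY (a + t * p1) (l + t * p2) (by linarith [norm_add_le a (t * p1), le_max_left ‖a‖ ‖l‖])
      (by linarith [norm_add_le l (t * p2), le_max_right ‖a‖ ‖l‖])
    refine this.trans ?_
    have e : Tk k (a + t * p1) (ρ * er β) = Tk k a (ρ * er β) * exp ((-1) ^ k * (t * p1 * (ρ * er β) ^ 2)) := by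
      rw [Tk, Tk, mul_assoc _ _ (exp ((-1) ^ k * (t * p1 * (ρ * er β) ^ 2))), ← Complex.exp_add]
      congr 2
      simp only [Sv]; ring
    rw [e, norm_mul]
    have e2 : ‖exp ((-1) ^ k * (t * p1 * (ρ * er β) ^ 2))‖ ≤ 3 := by
      refine (Complex.norm_exp_le_exp_norm _).trans ?_
      have : ‖((-1 : ℂ)) ^ k * (t * p1 * (ρ * er β) ^ 2)‖ ≤ 1 := by
        rw [norm_mul, norm_zpow, norm_neg, norm_one, one_zpow, one_mul, norm_mul, norm_pow, norm_rho hρ0, norm_mul, ht]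
        rw [show (ρ ^ 2)⁻¹ * ‖p1‖ * ρ ^ 2 = ‖p1‖ by field_simp]; exact hp1
      have := Real.exp_le_exp.2 this
      linarith [Real.exp_one_lt_d9]
    nlinarith [norm_nonneg (Tk k a (ρ * er β))]

lemma Tk_prod (k : ℤ) (a : ℂ) (ρ β : ℝ) (hρ : 0 < ρ) : ‖Tk k a (ρ * er β)‖ * ‖Tk (k + 1) a (ρ * er β)‖ = (ρ ^ 6)⁻¹ := by
  rw [norm_Tk, norm_Tk, norm_rho hρ]
  rw [show ρ⁻¹ ^ 3 * Real.exp (-((-1) ^ k * (Sv a (ρ * er β)).re)) * (ρ⁻¹ ^ 3 * Real.exp (-((-1) ^ (k + 1) * (Sv a (ρ * er β)).re))) =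
    (ρ⁻¹ ^ 3 * ρ⁻¹ ^ 3) * (Real.exp (-((-1) ^ k * (Sv a (ρ * er β)).re)) * Real.exp (-((-1) ^ (k + 1) * (Sv a (ρ * er β)).re))) by ring]
  rw [← Real.exp_add, zpow_add_one₀ (by norm_num)]
  rw [show -((-1) ^ k * (Sv a (ρ * er β)).re) + -((-1) ^ k * -1 * (Sv a (ρ * er β)).re) = 0 by ring, Real.exp_zero]
  rw [← pow_add, mul_one, inv_pow]

lemma BB_bound (a l p1 p2 : ℂ) (hp1 : ‖p1‖ ≤ 1) (hp2 : ‖p2‖ ≤ 1) : ∃ R : ℝ, 1 ≤ R ∧ ∀ (k : ℤ) (ρ β : ℝ), R ≤ ρ →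
    k * Real.pi / 10 ≤ β → β ≤ (k + 1) * Real.pi / 10 → ‖BB a l p1 p2 k (k + 1) ((ρ * er β) ^ 4)‖ ≤ 24 / ρ ^ 4 := by
  obtain ⟨R, hR, h⟩ := Vk_bound a l p1 p2 hp1 hp2
  refine ⟨R, hR, fun k ρ β hρ h1 h2 => ?_⟩
  have hρ0 : 0 < ρ := by linarith
  have b1 := h k ρ β hρ (by rw [abs_le]; constructor <;> linarith [Real.pi_pos])
  have b2 := h (k + 1) ρ β hρ (by push_cast; rw [abs_le]; constructor <;> linarith [Real.pi_pos])
  have hT := Tk_prod k a ρ β hρ0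
  set T1 := ‖Tk k a (ρ * er β)‖
  set T2 := ‖Tk (k + 1) a (ρ * er β)‖
  have t1 : 0 ≤ T1 := norm_nonneg _
  have t2 : 0 ≤ T2 := norm_nonneg _
  rw [BB]
  refine (norm_sub_le _ _).trans ?_
  rw [norm_mul, norm_mul]
  have c1 := mul_le_mul b1.1 b2.2 (norm_nonneg _) (by positivity)
  have c2 := mul_le_mul b2.1 b1.2 (norm_nonneg _) (by positivity)
  refine (add_le_add c1 c2).trans ?_
  rw [show 2 * T1 * (6 * ρ ^ 2 * T2) + 2 * T2 * (6 * ρ ^ 2 * T1) = 24 * ρ ^ 2 * (T1 * T2) by ring, hT]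
  apply le_of_eq; field_simp

lemma sector (z : ℂ) (hz : z ≠ 0) : ∃ (k : ℤ) (β : ℝ), -2 ≤ k ∧ k ≤ 2 ∧ k * Real.pi / 10 ≤ β ∧ β ≤ (k + 1) * Real.pi / 10 ∧
    (((‖z‖ ^ (1 / 4 : ℝ) : ℝ) : ℂ) * er β) ^ 4 = z := by
  have hpi := Real.pi_pos
  have key : ∀ β : ℝ, er (4 * β) = er z.arg → (((‖z‖ ^ (1 / 4 : ℝ) : ℝ) : ℂ) * er β) ^ 4 = z := fun β hβ => by
    rw [mul_pow, er_pow, ← Complex.ofReal_pow, ← Real.rpow_natCast, ← Real.rpow_mul (norm_nonneg z)]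
    norm_num
    rw [hβ, er]; exact Complex.norm_mul_exp_arg_mul_I z
  have h1 := Complex.neg_pi_lt_arg z
  have h2 := Complex.arg_le_pi z
  by_cases c : z.arg < -(4 * Real.pi / 5)
  · refine ⟨2, z.arg / 4 + Real.pi / 2, by norm_num, by norm_num, by push_cast; linarith, by push_cast; linarith,
      key _ (er_congr 1 (by push_cast; ring))⟩
  push Not at c
  by_cases c1 : z.arg < -(2 * Real.pi / 5)
  · exact ⟨-2, z.arg / 4, by norm_num, by norm_num, by push_cast; linarith, by push_cast; linarith, key _ (by ring_nf)⟩
  push Not at c1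
  by_cases c2 : z.arg < 0
  · exact ⟨-1, z.arg / 4, by norm_num, by norm_num, by push_cast; linarith, by push_cast; linarith, key _ (by ring_nf)⟩
  push Not at c2
  by_cases c3 : z.arg < 2 * Real.pi / 5
  · exact ⟨0, z.arg / 4, by norm_num, by norm_num, by push_cast; linarith, by push_cast; linarith, key _ (by ring_nf)⟩
  push Not at c3
  by_cases c4 : z.arg < 4 * Real.pi / 5
  · exact ⟨1, z.arg / 4, by norm_num, by norm_num, by push_cast; linarith, by push_cast; linarith, key _ (by ring_nf)⟩
  push Not at c4
  exact ⟨2, z.arg / 4, by norm_num, by norm_num, by push_cast; linarith, by push_cast; linarith, key _ (by ring_nf)⟩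

lemma Wr_adj_norm (k : ℤ) (a l : ℂ) : ‖Wr k (k + 1) a l‖ = 2 := by
  rw [Wr_adj, norm_mul, norm_er, norm_mul, norm_zpow]; simp

lemma BB_zero {a l p1 p2 : ℂ} (hp1 : ‖p1‖ ≤ 1) (hp2 : ‖p2‖ ≤ 1) (s1 : Sta a l p1 p2 0 2) (s2 : Sta a l p1 p2 0 (-2))
    (n1 : Wr 0 2 a l ≠ 0) (n2 : Wr 0 (-2) a l ≠ 0) (z : ℂ) : BB a l p1 p2 0 1 z = 0 := by
  obtain ⟨R, hR, h⟩ := BB_bound a l p1 p2 hp1 hp2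
  have hd : Differentiable ℂ (fun z => BB a l p1 p2 0 1 z) := by
    have d0 := (Vk_sol 0 a l p1 p2).1
    have d1 := (Vk_sol 1 a l p1 p2).1
    have e0 : Differentiable ℂ (Yk 0 a l) := fun z => ((Yk_isSol 0 a l).1 z).differentiableAt
    have e1 : Differentiable ℂ (Yk 1 a l) := fun z => ((Yk_isSol 1 a l).1 z).differentiableAt
    exact (e0.mul d1).sub (e1.mul d0)
  refine hd.apply_eq_of_tendsto_cocompact z (c := 0) ?_
  have hn : Tendsto (fun z : ℂ => ‖z‖) (cocompact ℂ) atTop := tendsto_norm_cocompact_atTop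
  rw [tendsto_zero_iff_norm_tendsto_zero]
  have hlim : Tendsto (fun z : ℂ => 24 / ‖z‖) (cocompact ℂ) (nhds 0) := hn.const_div_atTop 24
  refine squeeze_zero' (Eventually.of_forall fun _ => norm_nonneg _) ?_ hlim
  filter_upwards [hn.eventually_ge_atTop (R ^ 4), hn.eventually_gt_atTop 0] with z hz hz0
  obtain ⟨k, β, k1, k2, b1, b2, e⟩ := sector z (norm_pos_iff.1 hz0)
  have hb := h k (‖z‖ ^ (1 / 4 : ℝ)) β (by
    rw [show R = (R ^ 4) ^ (1 / 4 : ℝ) by rw [← Real.rpow_natCast, ← Real.rpow_mul (by linarith)]; norm_num]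
    exact Real.rpow_le_rpow (by positivity) hz (by norm_num)) b1 b2
  rw [e] at hb
  have e4 : (‖z‖ ^ (1 / 4 : ℝ)) ^ 4 = ‖z‖ := by
    rw [← Real.rpow_natCast, ← Real.rpow_mul (norm_nonneg z)]; norm_num
  rw [e4] at hb
  rw [BB_chain s1 s2 n1 n2 z k k1 k2, norm_mul, Wr_adj_norm, norm_div] at hb
  have := Wr_adj_norm 0 a l
  norm_num at this
  rw [this] at hb
  linarith

lemma p_zero {a l p1 p2 : ℂ} (hB : ∀ z, BB a l p1 p2 0 1 z = 0) : p1 = 0 ∧ p2 = 0 := by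
  have hr : ∀ z, (p2 - p1 * z) = 0 := by
    intro z
    obtain ⟨y0d, y0d'⟩ := Yk_isSol 0 a l
    obtain ⟨y1d, y1d'⟩ := Yk_isSol 1 a l
    obtain ⟨v0, v0'⟩ := Vk_sol 0 a l p1 p2
    obtain ⟨v1, v1'⟩ := Vk_sol 1 a l p1 p2
    have v0d : ∀ z, HasDerivAt (Vk 0 a l p1 p2) (deriv (Vk 0 a l p1 p2) z) z := fun z => (v0 z).hasDerivAt
    have v1d : ∀ z, HasDerivAt (Vk 1 a l p1 p2) (deriv (Vk 1 a l p1 p2) z) z := fun z => (v1 z).hasDerivAt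
    have hw : ∀ z, Yk 0 a l z * Yk' 1 a l z - Yk' 0 a l z * Yk 1 a l z ≠ 0 := fun z => by
      rw [Wr_eq]; exact Wr_adj_ne 0 a l
    simp only [BB] at hB
    generalize Yk 0 a l = y0 at *
    generalize Yk 1 a l = y1 at *
    generalize Yk' 0 a l = y0' at *
    generalize Yk' 1 a l = y1' at *
    generalize deriv (Vk 0 a l p1 p2) = w0 at *
    generalize deriv (Vk 1 a l p1 p2) = w1 at *
    generalize Vk 0 a l p1 p2 = V0 at *
    generalize Vk 1 a l p1 p2 = V1 at *
    have step : ∀ (f f' : ℂ → ℂ), (∀ z, HasDerivAt f (f' z) z) → (∀ z, f z = 0) → ∀ z, f' z = 0 := fun f f' hf h0 z => by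
      have : f = fun _ => 0 := funext h0
      rw [this] at hf
      exact (hf z).unique (hasDerivAt_const _ _)
    have b1 : ∀ z, y0' z * V1 z + y0 z * w1 z - (y1' z * V0 z + y1 z * w0 z) = 0 :=
      step _ _ (fun z => ((y0d z).mul (v1d z)).sub ((y1d z).mul (v0d z))) hB
    have b2' := step _ _ (fun z => ((((y0d' z).mul (v1d z)).add ((y0d z).mul (v1' z))).sub
      (((y1d' z).mul (v0d z)).add ((y1d z).mul (v0' z))))) b1
    have b2 : ∀ z, y0' z * w1 z - y1' z * w0 z = 0 := fun z => by
      have := b2' z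
      have h0 := hB z
      linear_combination 1 / 2 * this - (z ^ 3 - a * z + l) * h0
    have b3 := step _ _ (fun z => ((y0d' z).mul (v1' z)).sub ((y1d' z).mul (v0' z))) b2 z
    have b1z := b1 z
    have : (p2 - p1 * z) * (y0 z * y1' z - y0' z * y1 z) = 0 := by
      linear_combination -b3 + (z ^ 3 - a * z + l) * b1z
    exact (mul_eq_zero.1 this).resolve_right (hw z)
  have h0 := hr 0
  have h1 := hr 1
  constructor
  · linear_combination h0 - h1
  · linear_combination h0
end Cub

namespace Cub
local notation "cj" => starRingEnd ℂ

noncomputable def W2 (a l : ℂ) : ℂ := Wr 0 (-2) a l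
lemma W2_cont : Continuous (fun q : ℂ × ℂ => W2 q.1 q.2) := by
  have h1 : Continuous (fun q : ℂ × ℂ => ((q.1, q.2), (0 : ℂ))) := by fun_prop
  have a1 := (Yk_cont 0).comp h1
  have a2 := (Yk'_cont 0).comp h1
  have a3 := (Yk_cont (-2)).comp h1
  have a4 := (Yk'_cont (-2)).comp h1
  have := (a1.mul a4).sub (a2.mul a3)
  exact this
lemma W2_d1 (l : ℂ) : Differentiable ℂ (fun a => W2 a l) := by
  have h1 := Wt_diff 0 (-2) 0 l 1 0
  have e : (fun a => W2 a l) = Wt 0 (-2) 0 l 1 0 := by funext a; simp [W2, Wt]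
  rw [e]; exact h1
lemma W2_d2 (a : ℂ) : Differentiable ℂ (fun l => W2 a l) := by
  have h1 := Wt_diff 0 (-2) a 0 0 1
  have e : (fun l => W2 a l) = Wt 0 (-2) a 0 0 1 := by funext a; simp [W2, Wt]
  rw [e]; exact h1

lemma sep_C2 {F : ℂ → ℂ → ℂ} (hc : Continuous (fun q : ℂ × ℂ => F q.1 q.2))
    (h1 : ∀ x, Differentiable ℂ (fun y => F x y)) :
    Continuous (fun q : ℂ × ℂ => deriv (fun y => F q.1 y) q.2) := by
  have hc' : Continuous (fun q : ℂ × ℂ => F q.2 q.1) := hc.comp continuous_swap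
  have h := sep_C1 (F := fun l a => F a l) hc' h1
  have h2 := h.comp continuous_swap
  exact h2

lemma W2_strict (q : ℂ × ℂ) : ∃ A : ℂ × ℂ →L[ℂ] ℂ, HasStrictFDerivAt (fun q : ℂ × ℂ => W2 q.1 q.2) A q := by
  have c1 := sep_C1 W2_cont W2_d1
  have c2 := sep_C2 W2_cont W2_d2
  have h := hasStrictFDerivAt_uncurry_coprod (𝕜 := ℂ) (u := q) (f := W2)
    (f₁ := fun a l => ContinuousLinearMap.toSpanSingleton ℂ (deriv (fun x => W2 x l) a))
    (f₂ := fun a l => ContinuousLinearMap.toSpanSingleton ℂ (deriv (fun x => W2 a x) l))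
    (Eventually.of_forall fun v => ((W2_d1 v.2) v.1).hasDerivAt.hasFDerivAt)
    (Eventually.of_forall fun v => ((W2_d2 v.1) v.2).hasDerivAt.hasFDerivAt)
    (by
      have := (ContinuousLinearMap.toSpanSingletonCLE (𝕜 := ℂ) (E := ℂ)).continuous.comp c1
      exact this.continuousAt)
    (by
      have := (ContinuousLinearMap.toSpanSingletonCLE (𝕜 := ℂ) (E := ℂ)).continuous.comp c2
      exact this.continuousAt)
  exact ⟨_, h⟩

lemma Sta_conj {a l p1 p2 : ℝ} (h : Sta a l p1 p2 0 (-2)) : Sta a l p1 p2 0 2 := by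
  have hd := ((Wt_diff 0 2 a l p1 p2) 0).hasDerivAt
  have h1 : HasDerivAt (fun t : ℝ => Wt 0 2 a l p1 p2 t) (deriv (Wt 0 2 a l p1 p2) 0) 0 := by
    have h3 := hd
    rw [← Complex.ofReal_zero] at h3
    have := h3.comp_ofReal
    rwa [Complex.ofReal_zero] at this
  have h2 : HasDerivAt (fun t : ℝ => Wt 0 (-2) a l p1 p2 t) 0 0 := by
    have h3 : HasDerivAt (Wt 0 (-2) (a : ℂ) l p1 p2) 0 ((0 : ℝ) : ℂ) := by rw [Complex.ofReal_zero]; exact h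
    exact h3.comp_ofReal
  have e : (fun t : ℝ => Wt 0 2 (a : ℂ) l p1 p2 t) = fun t : ℝ => cj (Wt 0 (-2) (a : ℂ) l p1 p2 t) := by
    funext t
    have := Wr_conj 0 (-2) (a + t * p1) (l + t * p2)
    simp only [Wt]
    push_cast at this
    simpa using this
  rw [e] at h1
  have h3 := h1.unique (conj_der h2)
  rw [map_zero] at h3
  rw [h3] at hd
  exact hd

lemma DD_ne (a l : ℝ) : DD a l ≠ 0 := by
  rw [DD_pol]; exact mul_ne_zero (by exact_mod_cast (MM_pos a l).ne') (er_ne _)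
lemma W2_ne (a l : ℝ) : Wr 0 (-2) (a : ℂ) l ≠ 0 := by
  intro h; apply DD_ne a l; rw [DD, h]; simp
lemma W2_ne' (a l : ℝ) : Wr 0 2 (a : ℂ) l ≠ 0 := by
  intro h; apply W2_ne a l
  have := Wr_conj 0 2 a l
  rw [h] at this; simpa using this

lemma Sta_zero {a l p1 p2 : ℝ} (hp1 : |p1| ≤ 1) (hp2 : |p2| ≤ 1) (h : Sta a l p1 p2 0 (-2)) : p1 = 0 ∧ p2 = 0 := by
  have := p_zero (BB_zero (by rw [Complex.norm_real]; exact hp1) (by rw [Complex.norm_real]; exact hp2) (Sta_conj h) h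
    (W2_ne' a l) (W2_ne a l))
  exact_mod_cast this

lemma DD_locInj (q0 : ℝ × ℝ) : ∃ U ∈ nhds q0, ∀ x ∈ U, ∀ y ∈ U, DD x.1 x.2 = DD y.1 y.2 → x = y := by
  obtain ⟨A, hA⟩ := W2_strict ((q0.1 : ℂ), (q0.2 : ℂ))
  let J : ℝ × ℝ →L[ℝ] ℂ × ℂ := Complex.ofRealCLM.prodMap Complex.ofRealCLM
  have hJ : ∀ q : ℝ × ℝ, J q = ((q.1 : ℂ), (q.2 : ℂ)) := fun q => rfl
  have hR := (hA.restrictScalars ℝ)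
  rw [← hJ] at hR
  have hC := hR.comp q0 J.hasStrictFDerivAt
  set A' : ℝ × ℝ →L[ℝ] ℂ := (A.restrictScalars ℝ).comp J with hA'
  have hAp : ∀ p1 p2 : ℝ, A' (p1, p2) = 0 → Sta q0.1 q0.2 p1 p2 0 (-2) := by
    intro p1 p2 h0
    have hl : HasDerivAt (fun t : ℂ => (((q0.1 : ℂ), (q0.2 : ℂ)) + t • ((p1 : ℂ), (p2 : ℂ)))) ((p1 : ℂ), (p2 : ℂ)) 0 := by
      have := ((hasDerivAt_id (0 : ℂ)).smul_const (((p1 : ℂ), (p2 : ℂ)))).const_add ((q0.1 : ℂ), (q0.2 : ℂ))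
      simpa using this
    have hA0 : HasFDerivAt (fun q : ℂ × ℂ => W2 q.1 q.2) A ((((q0.1 : ℂ), (q0.2 : ℂ)) + (0 : ℂ) • ((p1 : ℂ), (p2 : ℂ)))) := by
      rw [zero_smul, add_zero]; exact hA.hasFDerivAt
    have h2 := hA0.comp_hasDerivAt (0 : ℂ) hl
    have e : A ((p1 : ℂ), (p2 : ℂ)) = 0 := h0
    rw [e] at h2
    exact h2
  have hker : LinearMap.ker (A' : ℝ × ℝ →ₗ[ℝ] ℂ) = ⊥ := by
    rw [LinearMap.ker_eq_bot']
    intro p hp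
    have hp : A' p = 0 := hp
    have hs : 0 < 1 + ‖p‖ := by positivity
    have h2 : A' ((1 + ‖p‖)⁻¹ • p) = 0 := by rw [map_smul, hp, smul_zero]
    have hn : ‖(1 + ‖p‖)⁻¹ • p‖ ≤ 1 := by
      rw [norm_smul, Real.norm_of_nonneg (by positivity), inv_mul_le_iff₀ hs]; linarith
    have h3 := Sta_zero ((norm_fst_le ((1 + ‖p‖)⁻¹ • p)).trans hn) ((norm_snd_le ((1 + ‖p‖)⁻¹ • p)).trans hn) (hAp _ _ h2)
    have h4 : (1 + ‖p‖)⁻¹ • p = 0 := Prod.ext h3.1 h3.2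
    exact (smul_eq_zero.1 h4).resolve_left (inv_ne_zero hs.ne')
  obtain ⟨K, hK, hAL⟩ := LinearMap.exists_antilipschitzWith (A' : ℝ × ℝ →ₗ[ℝ] ℂ) hker
  have ho := hC.isLittleO
  rw [Asymptotics.isLittleO_iff] at ho
  have hK' : (0 : ℝ) < K := hK
  have hev := ho (c := (2 * (K : ℝ))⁻¹) (by positivity)
  rw [nhds_prod_eq] at hev
  obtain ⟨U, hU, hUU⟩ := mem_prod_same_iff.1 hev
  refine ⟨U, hU, fun x hx y hy hxy => ?_⟩
  have h1 := hUU (Set.mk_mem_prod hx hy)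
  simp only [Set.mem_setOf_eq] at h1
  have e : W2 x.1 x.2 = W2 y.1 y.2 := by
    simp only [DD] at hxy
    have hI : I / 2 ≠ 0 := by simp
    exact mul_left_cancel₀ (er_ne _) (mul_left_cancel₀ hI hxy)
  simp only [Function.comp, hJ] at h1
  rw [e, sub_self, zero_sub, norm_neg] at h1
  have h2 := hAL.le_mul_dist x y
  rw [dist_eq_norm, dist_eq_norm, ← map_sub] at h2
  have h3 : ‖x - y‖ ≤ K * ((2 * (K : ℝ))⁻¹ * ‖x - y‖) := h2.trans (mul_le_mul_of_nonneg_left h1 hK'.le)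
  have h4 : K * ((2 * (K : ℝ))⁻¹ * ‖x - y‖) = ‖x - y‖ / 2 := by field_simp
  have h5 : ‖x - y‖ = 0 := by linarith [norm_nonneg (x - y)]
  exact sub_eq_zero.1 (norm_eq_zero.1 h5)
end Cub

namespace Cub
local notation "cj" => starRingEnd ℂ

noncomputable def Hv (a κ v : ℝ) : ℝ := -(2 / 5 * v ^ 5 - a * v) + κ * v⁻¹ - 3 / 2 * Real.log v
noncomputable def H1v (a κ v : ℝ) : ℝ := v ^ 3 - a / 2 * v⁻¹ + κ / 2 * v⁻¹ ^ 3 + 3 / 4 * v⁻¹ ^ 2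
noncomputable def tq (a κ v : ℝ) : ℝ := v ^ 6 - a * v ^ 2 + κ + a ^ 2 / 4 * v⁻¹ ^ 2 - a * κ / 2 * v⁻¹ ^ 4 + κ ^ 2 / 4 * v⁻¹ ^ 6
  - a * v⁻¹ ^ 3 + 3 * κ / 2 * v⁻¹ ^ 5 + 21 / 16 * v⁻¹ ^ 4
noncomputable def tau (a κ x : ℝ) : ℝ := Real.exp (Hv a κ (Real.sqrt (-x)))
noncomputable def tau' (a κ x : ℝ) : ℝ := H1v a κ (Real.sqrt (-x)) * tau a κ x

lemma nsq_der {x : ℝ} (hx : x < 0) : HasDerivAt (fun x => Real.sqrt (-x)) (-(1 / 2) * (Real.sqrt (-x))⁻¹) x := by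
  have := (sqrt_der (neg_pos.2 hx)).comp x (hasDerivAt_neg x)
  refine HasDerivAt.congr_deriv (f := fun x => Real.sqrt (-x)) this ?_
  ring

lemma Hv_der (a κ : ℝ) {v : ℝ} (hv : 0 < v) : HasDerivAt (Hv a κ) (-(2 * v) * H1v a κ v) v := by
  refine HasDerivAt.congr_deriv (f := Hv a κ) (((((((hasDerivAt_id v).fun_pow 5).const_mul (2 / 5)).fun_sub
    ((hasDerivAt_id v).const_mul a)).fun_neg).fun_add (((hasDerivAt_id v).fun_inv hv.ne').const_mul κ)).fun_sub
    ((Real.hasDerivAt_log hv.ne').const_mul (3 / 2))) ?_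
  norm_num [H1v]
  field_simp
  ring
lemma H1v_der (a κ : ℝ) {v : ℝ} (hv : 0 < v) : HasDerivAt (H1v a κ) (3 * v ^ 2 + a / 2 * v⁻¹ ^ 2 - 3 * κ / 2 * v⁻¹ ^ 4 - 3 / 2 * v⁻¹ ^ 3) v := by
  have hi := (hasDerivAt_id v).fun_inv hv.ne'
  refine HasDerivAt.congr_deriv (f := H1v a κ) (((((hasDerivAt_id v).fun_pow 3).fun_sub (hi.const_mul (a / 2))).fun_add
    ((hi.fun_pow 3).const_mul (κ / 2))).fun_add ((hi.fun_pow 2).const_mul (3 / 4))) ?_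
  norm_num
  field_simp
  ring

lemma tau_der (a κ : ℝ) {x : ℝ} (hx : x < 0) : HasDerivAt (tau a κ) (tau' a κ x) x := by
  have hv := Real.sqrt_pos.2 (neg_pos.2 hx)
  have h := ((Hv_der a κ hv).comp x (nsq_der hx)).exp
  refine HasDerivAt.congr_deriv (f := tau a κ) h ?_
  rw [tau', tau]
  simp only [Function.comp]
  field_simp

lemma tau'_der (a κ : ℝ) {x : ℝ} (hx : x < 0) : HasDerivAt (tau' a κ) (tq a κ (Real.sqrt (-x)) * tau a κ x) x := by
  have hv := Real.sqrt_pos.2 (neg_pos.2 hx)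
  have h := ((H1v_der a κ hv).comp x (nsq_der hx)).fun_mul (tau_der a κ hx)
  refine HasDerivAt.congr_deriv (f := tau' a κ) h ?_
  rw [tau', tq, H1v]
  simp only [Function.comp, H1v]
  field_simp
  ring

lemma tau_pos (a κ x : ℝ) : 0 < tau a κ x := Real.exp_pos _

lemma tau_lim (a κ : ℝ) : Tendsto (fun x => tau a κ (-x) * rq x ^ 3 * Real.exp (ph a x)) atTop (nhds 1) ∧
    Tendsto (fun x => tau' a κ (-x) * (rq x ^ 3)⁻¹ * Real.exp (ph a x)) atTop (nhds 1) := by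
  have e : ∀ x : ℝ, 0 < x → tau a κ (-x) * rq x ^ 3 * Real.exp (ph a x) = Real.exp (κ * (Real.sqrt x)⁻¹) := fun x hx => by
    have h3 : rq x ^ 3 = Real.exp (3 / 2 * Real.log (Real.sqrt x)) := by
      rw [← rq_sq, Real.log_pow]
      rw [show 3 / 2 * (((2 : ℕ) : ℝ) * Real.log (rq x)) = ((3 : ℕ) : ℝ) * Real.log (rq x) by push_cast; ring]
      rw [← Real.log_pow, Real.exp_log (pow_pos (rq_pos hx) 3)]
    rw [tau, neg_neg, h3, ← Real.exp_add, ← Real.exp_add, Hv, ph]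
    congr 1; ring
  have l1 : Tendsto (fun x => tau a κ (-x) * rq x ^ 3 * Real.exp (ph a x)) atTop (nhds 1) := by
    have h := (isqrt_lim.const_mul κ).rexp
    rw [mul_zero, Real.exp_zero] at h
    refine h.congr' ?_
    filter_upwards [eventually_gt_atTop 0] with x hx
    rw [e x hx]
  refine ⟨l1, ?_⟩
  have hi := isqrt_lim
  have h2 : Tendsto (fun x => 1 - a / 2 * (Real.sqrt x)⁻¹ ^ 4 + κ / 2 * (Real.sqrt x)⁻¹ ^ 6 + 3 / 4 * (Real.sqrt x)⁻¹ ^ 5) atTop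
      (nhds (1 - a / 2 * 0 ^ 4 + κ / 2 * 0 ^ 6 + 3 / 4 * 0 ^ 5)) :=
    (((tendsto_const_nhds.sub ((hi.pow 4).const_mul (a / 2)))).add ((hi.pow 6).const_mul (κ / 2))).add ((hi.pow 5).const_mul (3 / 4))
  have h3 := h2.mul l1
  norm_num at h3
  refine h3.congr' ?_
  filter_upwards [eventually_gt_atTop 0] with x hx
  have hs := Real.sqrt_pos.2 hx
  have hr := rq_pos hx
  rw [tau', H1v, neg_neg, ← rq_sq x]
  field_simp

lemma cmp_lim (a l κ : ℝ) : Tendsto (fun x => uu a l x / tau a κ x) atBot (nhds 1) ∧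
    Tendsto (fun x => uu' a l x * tau a κ x - uu a l x * tau' a κ x) atBot (nhds 0) := by
  have hu : Tendsto (fun x => uu a l (-x) * rq x ^ 3 * Real.exp (ph a x)) atTop (nhds 1) ∧
      Tendsto (fun x => uu' a l (-x) * (rq x ^ 3)⁻¹ * Real.exp (ph a x)) atTop (nhds 1) := by
    constructor
    all_goals
      rw [Metric.tendsto_atTop]
      intro ε hε
      obtain ⟨R, hR⟩ := uu_as (max |a| |l|) (ε / 2) (by positivity) (by positivity)
      obtain ⟨hR1, hR2⟩ := hR
      refine ⟨R, fun x hx => ?_⟩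
      have := hR2 a l (le_max_left _ _) (le_max_right _ _) x hx
      rw [Real.dist_eq]
    · linarith [this.1]
    · linarith [this.2]
  have ht := tau_lim a κ
  have hE : Tendsto (fun x => Real.exp (-(2 * ph a x))) atTop (nhds 0) := by
    have : Tendsto (fun x => -(2 * ph a x)) atTop atBot :=
      tendsto_neg_atTop_atBot.comp ((ph_tendsto a).const_mul_atTop two_pos)
    exact Real.tendsto_exp_atBot.comp this
  constructor
  · have h1 := (hu.1.div ht.1 one_ne_zero).comp tendsto_neg_atBot_atTop
    rw [div_one] at h1
    refine h1.congr' ?_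
    filter_upwards [eventually_lt_atBot 0] with x hx
    have hr := rq_pos (neg_pos.2 hx)
    have := Real.exp_pos (ph a (-x))
    have := tau_pos a κ x
    simp only [Function.comp, Pi.div_apply, neg_neg]
    field_simp
  · have h1 := (((hu.2.mul ht.1).sub (hu.1.mul ht.2)).mul hE).comp tendsto_neg_atBot_atTop
    norm_num at h1
    refine h1.congr' ?_
    filter_upwards [eventually_lt_atBot 0] with x hx
    have hr := rq_pos (neg_pos.2 hx)
    have he := Real.exp_pos (ph a (-x))
    have e2 : Real.exp (-(2 * ph a (-x))) = (Real.exp (ph a (-x)) ^ 2)⁻¹ := by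
      rw [Real.exp_neg, ← Real.exp_nat_mul]; norm_num
    simp only [Function.comp, neg_neg, e2]
    field_simp

lemma mono_ge_lim {f f' : ℝ → ℝ} {x0 L : ℝ} (hf : ∀ x, x ≤ x0 → HasDerivAt f (f' x) x) (h0 : ∀ x, x ≤ x0 → 0 ≤ f' x)
    (hL : Tendsto f atBot (nhds L)) : ∀ x, x ≤ x0 → L ≤ f x := by
  have hm : MonotoneOn f (Set.Iic x0) := by
    apply monotoneOn_of_deriv_nonneg (convex_Iic x0)
    · exact fun x hx => (hf x hx).continuousAt.continuousWithinAt
    · intro x hx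
      rw [interior_Iic] at hx
      exact (hf x hx.le).differentiableAt.differentiableWithinAt
    · intro x hx
      rw [interior_Iic] at hx
      rw [(hf x hx.le).deriv]; exact h0 x hx.le
  intro x hx
  refine le_of_tendsto hL ?_
  filter_upwards [eventually_le_atBot x] with y hy
  exact hm (hy.trans hx) hx hy

lemma cmp_low {a l κ x0 : ℝ} (hx0 : x0 < 0) (hu : ∀ x, x ≤ x0 → 0 < uu a l x)
    (hq : ∀ x, x ≤ x0 → tq a κ (Real.sqrt (-x)) ≤ -PP a l x) : tau a κ x0 ≤ uu a l x0 := by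
  have hN := mono_ge_lim (x0 := x0) (f := fun x => uu' a l x * tau a κ x - uu a l x * tau' a κ x)
    (f' := fun x => (-PP a l x - tq a κ (Real.sqrt (-x))) * (uu a l x * tau a κ x)) (fun x hx => by
      have hx1 : x < 0 := by linarith
      refine (((uu'_der a l x).fun_mul (tau_der a κ hx1)).fun_sub ((uu_der a l x).fun_mul (tau'_der a κ hx1))).congr_deriv ?_
      ring) (fun x hx => mul_nonneg (by linarith [hq x hx]) (mul_nonneg (hu x hx).le (tau_pos _ _ _).le)) (cmp_lim a l κ).2
  have hr := mono_ge_lim (x0 := x0) (f := fun x => uu a l x / tau a κ x)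
    (f' := fun x => (uu' a l x * tau a κ x - uu a l x * tau' a κ x) / tau a κ x ^ 2) (fun x hx => by
      have hx1 : x < 0 := by linarith
      exact (uu_der a l x).fun_div (tau_der a κ hx1) (tau_pos _ _ _).ne')
    (fun x hx => div_nonneg (hN x hx) (sq_nonneg _)) (cmp_lim a l κ).1 x0 le_rfl
  rwa [le_div_iff₀ (tau_pos _ _ _), one_mul] at hr

lemma cmp_up {a l κ x0 : ℝ} (hx0 : x0 < 0) (hu : ∀ x, x ≤ x0 → 0 < uu a l x)
    (hq : ∀ x, x ≤ x0 → -PP a l x ≤ tq a κ (Real.sqrt (-x))) : uu a l x0 ≤ tau a κ x0 ∧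
      uu' a l x0 ≤ H1v a κ (Real.sqrt (-x0)) * uu a l x0 := by
  have l2 := (cmp_lim a l κ).2.neg
  rw [neg_zero] at l2
  have hN := mono_ge_lim (x0 := x0) (f := fun x => -(uu' a l x * tau a κ x - uu a l x * tau' a κ x))
    (f' := fun x => (tq a κ (Real.sqrt (-x)) + PP a l x) * (uu a l x * tau a κ x)) (fun x hx => by
      have hx1 : x < 0 := by linarith
      refine (((uu'_der a l x).fun_mul (tau_der a κ hx1)).fun_sub ((uu_der a l x).fun_mul (tau'_der a κ hx1))).fun_neg.congr_deriv ?_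
      ring) (fun x hx => mul_nonneg (by linarith [hq x hx]) (mul_nonneg (hu x hx).le (tau_pos _ _ _).le)) l2
  have hr := mono_ge_lim (x0 := x0) (f := fun x => -(uu a l x / tau a κ x))
    (f' := fun x => -((uu' a l x * tau a κ x - uu a l x * tau' a κ x) / tau a κ x ^ 2)) (fun x hx => by
      have hx1 : x < 0 := by linarith
      exact ((uu_der a l x).fun_div (tau_der a κ hx1) (tau_pos _ _ _).ne').fun_neg)
    (fun x hx => by rw [← neg_div]; exact div_nonneg (hN x hx) (sq_nonneg _)) (cmp_lim a l κ).1.neg x0 le_rfl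
  constructor
  · rw [neg_le_neg_iff, div_le_iff₀ (tau_pos _ _ _), one_mul] at hr
    exact hr
  · have h2 := hN x0 le_rfl
    rw [tau'] at h2
    have ht := tau_pos a κ x0
    have h3 : uu' a l x0 * tau a κ x0 ≤ H1v a κ (Real.sqrt (-x0)) * uu a l x0 * tau a κ x0 := by linarith
    exact le_of_mul_le_mul_right h3 ht
end Cub

namespace Cub
local notation "cj" => starRingEnd ℂ

lemma PP_der (a l x : ℝ) : HasDerivAt (PP a l) (3 * x ^ 2 - a) x := by
  refine HasDerivAt.congr_deriv (f := PP a l) ((((hasDerivAt_id x).fun_pow 3).fun_sub ((hasDerivAt_id x).const_mul a)).sub_const l) ?_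
  norm_num

noncomputable def NN (a l x : ℝ) : ℝ := ‖gg a l x‖ ^ 2
noncomputable def RR (a l x : ℝ) : ℝ := (gg' a l x * cj (gg a l x)).re
noncomputable def VV (a l x : ℝ) : ℝ := ‖gg' a l x‖ ^ 2

lemma nsq_re (w : ℂ) : ‖w‖ ^ 2 = w.re ^ 2 + w.im ^ 2 := by
  rw [← Complex.normSq_eq_norm_sq, Complex.normSq_apply]; ring

lemma NN_der (a l x : ℝ) : HasDerivAt (NN a l) (2 * RR a l x) x := by
  have h1 := re_der (gg_der a l x)
  have h2 := im_der (gg_der a l x)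
  have h := (h1.fun_pow 2).fun_add (h2.fun_pow 2)
  have e : NN a l = fun x => (gg a l x).re ^ 2 + (gg a l x).im ^ 2 := by
    funext x; rw [NN, nsq_re]
  rw [e]
  refine h.congr_deriv ?_
  simp [RR]; ring
lemma VV_der (a l x : ℝ) : HasDerivAt (VV a l) (-2 * PP a l x * RR a l x) x := by
  have h1 := re_der (gg'_der a l x)
  have h2 := im_der (gg'_der a l x)
  have h := (h1.fun_pow 2).fun_add (h2.fun_pow 2)
  have e : VV a l = fun x => (gg' a l x).re ^ 2 + (gg' a l x).im ^ 2 := by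
    funext x; rw [VV, nsq_re]
  rw [e]
  refine h.congr_deriv ?_
  simp [RR]; ring
lemma RR_der (a l x : ℝ) : HasDerivAt (RR a l) (VV a l x - PP a l x * NN a l x) x := by
  have h1 := re_der (gg_der a l x)
  have h2 := im_der (gg_der a l x)
  have h3 := re_der (gg'_der a l x)
  have h4 := im_der (gg'_der a l x)
  have h := (h3.fun_mul h1).fun_add (h4.fun_mul h2)
  have e : RR a l = fun x => (gg' a l x).re * (gg a l x).re + (gg' a l x).im * (gg a l x).im := by
    funext x; simp [RR]
  rw [e]
  refine h.congr_deriv ?_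
  rw [VV, NN, nsq_re, nsq_re]
  simp; ring
lemma RR_sq (a l x : ℝ) : RR a l x ^ 2 ≤ NN a l x * VV a l x := by
  rw [RR, VV, NN, nsq_re, nsq_re]
  simp only [mul_re, conj_re, conj_im]
  nlinarith [sq_nonneg ((gg' a l x).re * (gg a l x).im - (gg' a l x).im * (gg a l x).re)]
lemma NN_nonneg (a l x : ℝ) : 0 ≤ NN a l x := by unfold NN; positivity
lemma VV_nonneg (a l x : ℝ) : 0 ≤ VV a l x := by unfold VV; positivity

/-- `s N + V / s ≥ 2 |R|` -/
lemma RR_le (a l x : ℝ) {s : ℝ} (hs : 0 < s) : 2 * |RR a l x| ≤ s * NN a l x + VV a l x / s := by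
  have h := RR_sq a l x
  have hN := NN_nonneg a l x
  have hV := VV_nonneg a l x
  refine le_of_pow_le_pow_left₀ two_ne_zero (by positivity) ?_
  rw [mul_pow, sq_abs]
  have : (s * NN a l x + VV a l x / s) ^ 2 = (s * NN a l x - VV a l x / s) ^ 2 + 4 * (NN a l x * VV a l x) := by
    field_simp; ring
  rw [this]
  nlinarith [sq_nonneg (s * NN a l x - VV a l x / s)]

noncomputable def sP (a l x : ℝ) : ℝ := Real.sqrt (PP a l x)
noncomputable def JJ (a l x : ℝ) : ℝ := sP a l x * NN a l x + VV a l x / sP a l x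
noncomputable def ff (a l x : ℝ) : ℝ := (3 * x ^ 2 - a) / (2 * sP a l x ^ 3)
noncomputable def ff' (a l x : ℝ) : ℝ := 3 * x / sP a l x ^ 3 - 3 * (3 * x ^ 2 - a) ^ 2 / (4 * sP a l x ^ 5)
noncomputable def KK (a l x : ℝ) : ℝ := JJ a l x + ff a l x * RR a l x

lemma sP_pos {a l x : ℝ} (h : 0 < PP a l x) : 0 < sP a l x := Real.sqrt_pos.2 h
lemma sP_sq {a l x : ℝ} (h : 0 < PP a l x) : sP a l x ^ 2 = PP a l x := Real.sq_sqrt h.le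
lemma sP_der {a l x : ℝ} (h : 0 < PP a l x) : HasDerivAt (sP a l) ((3 * x ^ 2 - a) / (2 * sP a l x)) x :=
  (PP_der a l x).sqrt h.ne'
lemma ff_der {a l x : ℝ} (h : 0 < PP a l x) : HasDerivAt (ff a l) (ff' a l x) x := by
  have hs := sP_pos h
  have h1 := (((hasDerivAt_id x).fun_pow 2).const_mul 3).sub_const a
  have h2 := ((sP_der h).fun_pow 3).const_mul 2
  refine HasDerivAt.congr_deriv (f := ff a l) (h1.fun_div h2 (by positivity)) ?_
  norm_num [ff']
  field_simp
  ring
lemma KK_der {a l x : ℝ} (h : 0 < PP a l x) : HasDerivAt (KK a l) (ff' a l x * RR a l x) x := by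
  have hs := sP_pos h
  have h1 := ((sP_der h).fun_mul (NN_der a l x)).fun_add ((VV_der a l x).fun_div (sP_der h) hs.ne')
  have h2 := (ff_der h).fun_mul (RR_der a l x)
  refine HasDerivAt.congr_deriv (f := KK a l) (h1.fun_add h2) ?_
  rw [ff]
  have e := sP_sq h
  rw [← e]
  field_simp
  ring

lemma PP_lim (a l : ℝ) : Tendsto (fun x => PP a l x / x ^ 3) atTop (nhds 1) := by
  have h1 : Tendsto (fun x : ℝ => x⁻¹) atTop (nhds 0) := tendsto_inv_atTop_zero
  have h2 : Tendsto (fun x : ℝ => 1 - a * x⁻¹ ^ 2 - l * x⁻¹ ^ 3) atTop (nhds (1 - a * 0 ^ 2 - l * 0 ^ 3)) :=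
    (tendsto_const_nhds.sub ((h1.pow 2).const_mul a)).sub ((h1.pow 3).const_mul l)
  norm_num at h2
  refine h2.congr' ?_
  filter_upwards [eventually_gt_atTop 0] with x hx
  rw [PP]; field_simp
lemma PP_atTop (a l : ℝ) : Tendsto (PP a l) atTop atTop := by
  have h := (PP_lim a l).pos_mul_atTop one_pos (tendsto_pow_atTop (α := ℝ) (n := 3) (by norm_num))
  refine h.congr' ?_
  filter_upwards [eventually_gt_atTop 0] with x hx
  field_simp
lemma sP_lim (a l : ℝ) : Tendsto (fun x => sP a l x / rq x ^ 6) atTop (nhds 1) := by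
  have h := (PP_lim a l).sqrt
  rw [Real.sqrt_one] at h
  refine h.congr' ?_
  filter_upwards [eventually_gt_atTop 0] with x hx
  rw [rq6, sP, Real.sqrt_div' _ (by positivity)]
  congr 1
  rw [Real.sqrt_eq_iff_mul_self_eq (by positivity) (by positivity)]
  have := Real.sq_sqrt hx.le
  calc x ^ 3 = (Real.sqrt x ^ 2) ^ 3 := by rw [this]
    _ = Real.sqrt x ^ 3 * Real.sqrt x ^ 3 := by ring
lemma sP_atTop (a l : ℝ) : Tendsto (sP a l) atTop atTop :=
  Real.tendsto_sqrt_atTop.comp (PP_atTop a l)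
lemma JJ_lim (a l : ℝ) : Tendsto (JJ a l) atTop (nhds 2) := by
  obtain ⟨h1, h2⟩ := gg_lim a l
  have h1 := (h1.norm).pow 2
  have h2 := (h2.norm).pow 2
  have h3 := sP_lim a l
  have h := (h3.mul h1).add (h2.div h3 one_ne_zero)
  norm_num at h
  refine h.congr' ?_
  filter_upwards [eventually_gt_atTop 0, (PP_atTop a l).eventually_gt_atTop 0] with x hx hP
  have hr := rq_pos hx
  have hs := sP_pos hP
  rw [norm_er, abs_of_pos hr, JJ, NN, VV]
  field_simp
lemma ff_lim (a l : ℝ) : Tendsto (ff a l) atTop (nhds 0) := by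
  have h1 : Tendsto (fun x : ℝ => x⁻¹) atTop (nhds 0) := tendsto_inv_atTop_zero
  have h2 : Tendsto (fun x : ℝ => 3 * x⁻¹ - a * x⁻¹ ^ 3) atTop (nhds (3 * 0 - a * 0 ^ 3)) :=
    ((h1.const_mul 3).sub ((h1.pow 3).const_mul a))
  have h3 := (tendsto_inv_atTop_zero.comp (sP_atTop a l)).const_mul (1 / 2)
  have h := (h2.div (PP_lim a l) one_ne_zero).mul h3
  norm_num at h
  refine h.congr' ?_
  filter_upwards [eventually_gt_atTop 0, (PP_atTop a l).eventually_gt_atTop 0] with x hx hP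
  have hs := sP_pos hP
  rw [ff, ← sP_sq hP]
  field_simp
lemma KK_lim (a l : ℝ) : Tendsto (KK a l) atTop (nhds 2) := by
  have h : Tendsto (fun x => ff a l x * RR a l x) atTop (nhds 0) := by
    have hb : Tendsto (fun x => |ff a l x| * (JJ a l x / 2)) atTop (nhds 0) := by
      have := (ff_lim a l).abs.mul ((JJ_lim a l).div_const 2)
      simpa using this
    refine squeeze_zero_norm' ?_ hb
    filter_upwards [(PP_atTop a l).eventually_gt_atTop 0] with x hP
    rw [norm_mul, Real.norm_eq_abs, Real.norm_eq_abs]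
    have := RR_le a l x (sP_pos hP)
    have h2 : |RR a l x| ≤ JJ a l x / 2 := by unfold JJ; linarith
    gcongr
  have := (JJ_lim a l).add h
  rw [add_zero] at this
  exact this

/-- WKB bound for the oscillatory region. -/
lemma JJ_bound {a l x₁ : ℝ} (hP : ∀ x, x₁ ≤ x → 0 < PP a l x) (hP1 : ∀ x, x₁ ≤ x → 0 ≤ 3 * x ^ 2 - a)
    (hf : ∀ x, x₁ ≤ x → 3 * x ^ 2 - a ≤ 2 * sP a l x ^ 3)
    (hf' : ∀ x, x₁ ≤ x → 4 * x * PP a l x ≤ (3 * x ^ 2 - a) ^ 2) : JJ a l x₁ ≤ 12 := by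
  have hf0 : ∀ x, x₁ ≤ x → 0 ≤ ff a l x ∧ ff a l x ≤ 1 := by
    intro x hx
    have hs := sP_pos (hP x hx)
    refine ⟨div_nonneg (hP1 x hx) (by positivity), ?_⟩
    rw [ff, div_le_one (by positivity)]; exact hf x hx
  have hf1 : ∀ x, x₁ ≤ x → ff' a l x ≤ 0 := by
    intro x hx
    have hs := sP_pos (hP x hx)
    have := hf' x hx
    rw [← sP_sq (hP x hx)] at this
    have e : ff' a l x = 3 * (4 * x * sP a l x ^ 2 - (3 * x ^ 2 - a) ^ 2) / (4 * sP a l x ^ 5) := by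
      rw [ff']; field_simp
    rw [e]
    exact div_nonpos_of_nonpos_of_nonneg (by linarith) (by positivity)
  have hRJ : ∀ x, x₁ ≤ x → |RR a l x| ≤ JJ a l x / 2 := by
    intro x hx
    have := RR_le a l x (sP_pos (hP x hx))
    unfold JJ; linarith
  have hJK : ∀ x, x₁ ≤ x → JJ a l x ≤ 2 * KK a l x := by
    intro x hx
    have h1 := hRJ x hx
    have h2 := hf0 x hx
    have h3 : |ff a l x * RR a l x| ≤ 1 * (JJ a l x / 2) := by
      rw [abs_mul, abs_of_nonneg h2.1]
      have := abs_nonneg (RR a l x)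
      gcongr
      exact h2.2
    unfold KK
    linarith [neg_abs_le (ff a l x * RR a l x)]
  have hd : ∀ x, x₁ ≤ x → HasDerivAt (fun x => KK a l x * Real.exp (-ff a l x))
      (ff' a l x * RR a l x * Real.exp (-ff a l x) + KK a l x * (Real.exp (-ff a l x) * -ff' a l x)) x :=
    fun x hx => (KK_der (hP x hx)).mul ((ff_der (hP x hx)).neg.exp)
  have hmono : MonotoneOn (fun x => KK a l x * Real.exp (-ff a l x)) (Set.Ici x₁) := by
    refine monotoneOn_of_deriv_nonneg (convex_Ici _) (fun x hx => (hd x hx).continuousAt.continuousWithinAt) ?_ ?_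
    · intro x hx
      rw [interior_Ici] at hx
      exact (hd x (le_of_lt (Set.mem_Ioi.1 hx))).differentiableAt.differentiableWithinAt
    · intro x hx
      rw [interior_Ici] at hx
      have hx := le_of_lt (Set.mem_Ioi.1 hx)
      rw [(hd x hx).deriv]
      have e : ff' a l x * RR a l x * Real.exp (-ff a l x) + KK a l x * (Real.exp (-ff a l x) * -ff' a l x)
        = (-ff' a l x) * (KK a l x - RR a l x) * Real.exp (-ff a l x) := by ring
      rw [e]
      have h1 := hRJ x hx
      have h2 := hJK x hx
      have h3 := hf1 x hx
      have : 0 ≤ KK a l x - RR a l x := by linarith [le_abs_self (RR a l x)]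
      exact mul_nonneg (mul_nonneg (by linarith) this) (Real.exp_nonneg _)
  have hlim : Tendsto (fun x => KK a l x * Real.exp (-ff a l x)) atTop (nhds 2) := by
    have h1 := (Real.continuous_exp.tendsto _).comp (ff_lim a l).neg
    have := (KK_lim a l).mul h1
    simpa using this
  have h2 : KK a l x₁ * Real.exp (-ff a l x₁) ≤ 2 := by
    refine ge_of_tendsto hlim ?_
    filter_upwards [eventually_ge_atTop x₁] with x hx
    exact hmono (Set.mem_Ici.2 le_rfl) hx hx
  have h3 : KK a l x₁ ≤ 2 * Real.exp (ff a l x₁) := by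
    rw [Real.exp_neg, ← div_eq_mul_inv, div_le_iff₀ (Real.exp_pos _)] at h2
    exact h2
  have h4 : Real.exp (ff a l x₁) ≤ Real.exp 1 := Real.exp_le_exp.2 (hf0 x₁ le_rfl).2
  have h5 := Real.exp_one_lt_d9
  linarith [hJK x₁ le_rfl]

noncomputable def FF (a l x : ℝ) : ℝ := VV a l x + PP a l x * NN a l x
lemma FF_der (a l x : ℝ) : HasDerivAt (FF a l) ((3 * x ^ 2 - a) * NN a l x) x := by
  refine HasDerivAt.congr_deriv (f := FF a l) ((VV_der a l x).fun_add ((PP_der a l x).fun_mul (NN_der a l x))) ?_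
  ring
lemma FF_mono {a l x y : ℝ} (hxy : x ≤ y) (h : ∀ t, x ≤ t → 0 ≤ 3 * t ^ 2 - a) : FF a l x ≤ FF a l y := by
  have hmono : MonotoneOn (FF a l) (Set.Ici x) := by
    refine monotoneOn_of_deriv_nonneg (convex_Ici _) (fun x hx => (FF_der a l x).continuousAt.continuousWithinAt)
      (fun x hx => (FF_der a l x).differentiableAt.differentiableWithinAt) ?_
    intro t ht
    rw [interior_Ici] at ht
    rw [(FF_der a l t).deriv]
    exact mul_nonneg (h t (le_of_lt (Set.mem_Ioi.1 ht))) (NN_nonneg a l t)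
  exact hmono (Set.mem_Ici.2 le_rfl) hxy hxy
lemma FF_JJ {a l x : ℝ} (h : 0 < PP a l x) : FF a l x = sP a l x * JJ a l x := by
  have := sP_pos h
  rw [FF, JJ, ← sP_sq h]; field_simp; ring
end Cub

namespace Cub
local notation "cj" => starRingEnd ℂ

set_option maxHeartbeats 1000000 in
lemma turn_bound {ζ l xt : ℝ} (hζ : 2 ≤ ζ) (hx : 2 * ζ ≤ xt) (hl : 0 < l) (h0 : PP (3 * ζ ^ 2) l xt = 0) :
    ‖gg (3 * ζ ^ 2) l xt‖ ≤ 8 := by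
  have hx4 : 4 ≤ xt := by linarith
  obtain ⟨D, hD⟩ : ∃ D, D = 3 * xt ^ 2 - 3 * ζ ^ 2 := ⟨_, rfl⟩
  have hDx : 9 / 4 * xt ^ 2 ≤ D := by rw [hD]; nlinarith
  have hD36 : 36 ≤ D := by nlinarith
  obtain ⟨d, hd0, hd3⟩ : ∃ d : ℝ, 0 < d ∧ d ^ 3 = D := by
    refine ⟨D ^ ((1 : ℝ) / 3), by positivity, ?_⟩
    rw [← Real.rpow_natCast, ← Real.rpow_mul (by linarith)]; norm_num
  have hd : 3 ≤ d := by
    by_contra h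
    push Not at h
    have : d ^ 3 < 3 ^ 3 := by gcongr
    linarith
  have hPh : ∀ h, PP (3 * ζ ^ 2) l (xt + h) = D * h + 3 * xt * h ^ 2 + h ^ 3 := by
    intro h
    have : PP (3 * ζ ^ 2) l (xt + h) = PP (3 * ζ ^ 2) l xt + (D * h + 3 * xt * h ^ 2 + h ^ 3) := by
      rw [PP, PP, hD]; ring
    rw [this, h0, zero_add]
  have hP'h : ∀ h, 3 * (xt + h) ^ 2 - 3 * ζ ^ 2 = D + 6 * xt * h + 3 * h ^ 2 := by
    intro h; rw [hD]; ring
  obtain ⟨δ, hδ⟩ : ∃ δ, δ = d⁻¹ := ⟨_, rfl⟩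
  have hδ0 : 0 < δ := by rw [hδ]; positivity
  have hdδ : d * δ = 1 := by rw [hδ]; field_simp
  have hδ1 : δ ≤ 1 / 3 := by nlinarith
  have hPge : ∀ h, δ ≤ h → d ^ 2 ≤ PP (3 * ζ ^ 2) l (xt + h) := by
    intro h hh
    rw [hPh, ← hd3]
    have h0 : 0 < h := by linarith
    have : 1 ≤ d * h := by nlinarith
    have h2 : d ^ 2 * 1 ≤ d ^ 2 * (d * h) := by gcongr
    have : 0 ≤ 3 * xt * h ^ 2 + h ^ 3 := by positivity
    nlinarith
  have hPpos : ∀ x, xt + δ ≤ x → 0 < PP (3 * ζ ^ 2) l x := by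
    intro x hx
    have := hPge (x - xt) (by linarith)
    rw [add_sub_cancel] at this
    have : 0 < d ^ 2 := by positivity
    linarith
  have hP' : ∀ x, xt ≤ x → 0 ≤ 3 * x ^ 2 - 3 * ζ ^ 2 := by
    intro x hx
    have := hP'h (x - xt)
    rw [add_sub_cancel] at this
    have h1 : 0 ≤ x - xt := by linarith
    rw [this]; positivity
  have hJ : JJ (3 * ζ ^ 2) l (xt + δ) ≤ 12 := by
    refine JJ_bound hPpos (fun x hx => hP' x (by linarith)) ?_ ?_
    · intro x hx
      obtain ⟨h, rfl⟩ : ∃ h, x = xt + h := ⟨x - xt, by ring⟩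
      have hh : δ ≤ h := by linarith
      have hp := hPpos _ hx
      have hs := sP_pos hp
      have hsd : d ≤ sP (3 * ζ ^ 2) l (xt + h) := by
        refine Real.le_sqrt_of_sq_le (hPge h hh)
      have h0 : 0 < h := by linarith
      have hdh : 1 ≤ d * h := by nlinarith
      have e : sP (3 * ζ ^ 2) l (xt + h) ^ 3 = sP (3 * ζ ^ 2) l (xt + h) * PP (3 * ζ ^ 2) l (xt + h) := by
        rw [← sP_sq hp]; ring
      rw [e, hP'h, hPh]
      have h1 : d * PP (3 * ζ ^ 2) l (xt + h) ≤ sP (3 * ζ ^ 2) l (xt + h) * PP (3 * ζ ^ 2) l (xt + h) := by gcongr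
      rw [hPh] at h1
      have t1 : D * 1 ≤ D * (d * h) := by gcongr
      have t2 : (3 * xt * h) * 1 ≤ (3 * xt * h) * (d * h) := by gcongr
      have t3 : 3 * h ^ 2 ≤ D + 2 * h ^ 2 * (d * h) := by
        rcases le_total h 1 with h' | h'
        · have : h ^ 2 ≤ 1 := by nlinarith
          have : 0 ≤ 2 * h ^ 2 * (d * h) := by positivity
          nlinarith
        · have : 3 ≤ d * h := by nlinarith
          have : 2 * h ^ 2 * 3 ≤ 2 * h ^ 2 * (d * h) := by gcongr
          nlinarith
      nlinarith
    · intro x hx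
      have hx0 : 0 < x := by linarith
      have : (3 * x ^ 2 - 3 * ζ ^ 2) ^ 2 - 4 * x * PP (3 * ζ ^ 2) l x = (5 * x ^ 4 - 6 * ζ ^ 2 * x ^ 2 + 9 * ζ ^ 4) + 4 * l * x := by
        rw [PP]; ring
      have h2 : 0 < 4 * l * x := by positivity
      nlinarith [sq_nonneg (x ^ 2 - ζ ^ 2), sq_nonneg (x ^ 2), sq_nonneg (ζ ^ 2)]
  have hp1 := hPpos (xt + δ) le_rfl
  have hs1 := sP_pos hp1
  have hsd1 : d ≤ sP (3 * ζ ^ 2) l (xt + δ) := Real.le_sqrt_of_sq_le (hPge δ le_rfl)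
  have hsd2 : sP (3 * ζ ^ 2) l (xt + δ) ≤ 3 / 2 * d := by
    refine Real.sqrt_le_iff.2 ⟨by positivity, ?_⟩
    rw [hPh]
    have e1 : D * δ = d ^ 2 := by rw [← hd3]; calc d ^ 3 * δ = d ^ 2 * (d * δ) := by ring
                                  _ = _ := by rw [hdδ]; ring
    have e3 : 3 * xt * δ ^ 2 + δ ^ 3 ≤ d ^ 2 := by
      have h1 : 3 * xt + δ ≤ d * D := by
        have u1 : 3 * D ≤ d * D := by gcongr
        have u2 : 9 * xt ≤ D := by nlinarith
        linarith
      have h2 : δ ^ 2 * (3 * xt + δ) ≤ δ ^ 2 * (d * D) := by gcongr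
      have h3 : δ ^ 2 * (d * D) = d ^ 2 := by
        rw [← hd3]; calc δ ^ 2 * (d * d ^ 3) = d ^ 2 * (d * δ) ^ 2 := by ring
                      _ = _ := by rw [hdδ]; ring
      linarith
    rw [e1]
    have : 0 < d ^ 2 := by positivity
    linarith
  have hN1 : ‖gg (3 * ζ ^ 2) l (xt + δ)‖ ≤ 2 := by
    refine le_of_pow_le_pow_left₀ two_ne_zero (by norm_num) ?_
    have hV := VV_nonneg (3 * ζ ^ 2) l (xt + δ)
    have hN := NN_nonneg (3 * ζ ^ 2) l (xt + δ)
    rw [JJ] at hJ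
    have : 0 ≤ VV (3 * ζ ^ 2) l (xt + δ) / sP (3 * ζ ^ 2) l (xt + δ) := by positivity
    change NN (3 * ζ ^ 2) l (xt + δ) ≤ _
    nlinarith
  have hg' : ∀ x ∈ Set.Icc xt (xt + δ), ‖gg' (3 * ζ ^ 2) l x‖ ≤ Real.sqrt (18 * d) := by
    intro x hx
    apply Real.le_sqrt_of_sq_le
    have h1 := FF_mono (a := 3 * ζ ^ 2) (l := l) hx.2 (fun t ht => hP' t (by linarith [hx.1]))
    rw [FF_JJ hp1] at h1
    have h2 : sP (3 * ζ ^ 2) l (xt + δ) * JJ (3 * ζ ^ 2) l (xt + δ) ≤ (3 / 2 * d) * 12 := by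
      have : 0 ≤ JJ (3 * ζ ^ 2) l (xt + δ) := by
        unfold JJ
        have hV := VV_nonneg (3 * ζ ^ 2) l (xt + δ)
        have hN := NN_nonneg (3 * ζ ^ 2) l (xt + δ)
        positivity
      gcongr
    have h3 : 0 ≤ PP (3 * ζ ^ 2) l x := by
      have := hPh (x - xt)
      rw [add_sub_cancel] at this
      have h1 : 0 ≤ x - xt := by linarith [hx.1]
      rw [this]; positivity
    have h4 := mul_nonneg h3 (NN_nonneg (3 * ζ ^ 2) l x)
    rw [FF] at h1
    change VV (3 * ζ ^ 2) l x ≤ _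
    linarith
  have hmv := Convex.norm_image_sub_le_of_norm_hasDerivWithin_le (f := gg (3 * ζ ^ 2) l) (f' := gg' (3 * ζ ^ 2) l)
    (fun x _ => (gg_der (3 * ζ ^ 2) l x).hasDerivWithinAt) hg' (convex_Icc _ _)
    (Set.right_mem_Icc.2 (by linarith)) (Set.left_mem_Icc.2 (by linarith))
  have hn : ‖xt - (xt + δ)‖ = δ := by
    rw [sub_add_cancel_left, norm_neg, Real.norm_eq_abs, abs_of_pos hδ0]
  rw [hn] at hmv
  have hq : Real.sqrt (18 * d) * δ ≤ 3 := by
    refine le_of_pow_le_pow_left₀ two_ne_zero (by norm_num) ?_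
    rw [mul_pow, Real.sq_sqrt (by positivity)]
    nlinarith
  have := norm_le_norm_add_norm_sub' (gg (3 * ζ ^ 2) l xt) (gg (3 * ζ ^ 2) l (xt + δ))
  linarith

lemma MM_large {ζ l : ℝ} (hζ : 2 ≤ ζ) (hl : 2 * ζ ^ 3 < l) :
    tau (3 * ζ ^ 2) 0 (-(Real.sqrt (3 * ζ ^ 2))) ≤ 16 * MM (3 * ζ ^ 2) l := by
  have hζ0 : 0 < ζ := by linarith
  have hl0 : 0 < l := by have : 0 < 2 * ζ ^ 3 := by positivity
                         linarith
  obtain ⟨xt, hxt, h0⟩ : ∃ xt, 2 * ζ ≤ xt ∧ PP (3 * ζ ^ 2) l xt = 0 := by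
    obtain ⟨X, hX, hX2⟩ := (((PP_atTop (3 * ζ ^ 2) l).eventually_ge_atTop 0).and (eventually_ge_atTop (2 * ζ))).exists
    have hc : ContinuousOn (PP (3 * ζ ^ 2) l) (Set.Icc (2 * ζ) X) :=
      fun x _ => (PP_der (3 * ζ ^ 2) l x).continuousAt.continuousWithinAt
    have h1 : PP (3 * ζ ^ 2) l (2 * ζ) ≤ 0 := by rw [PP]; nlinarith
    obtain ⟨x, hx, e⟩ := intermediate_value_Icc hX2 hc ⟨h1, hX⟩
    exact ⟨x, hx.1, e⟩
  have hneg : ∀ x < xt, PP (3 * ζ ^ 2) l x ≤ 0 := by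
    intro x hx
    have e : PP (3 * ζ ^ 2) l x = PP (3 * ζ ^ 2) l xt - (xt - x) * (x ^ 2 + x * xt + xt ^ 2 - 3 * ζ ^ 2) := by
      rw [PP, PP]; ring
    rw [e, h0]
    have : 0 ≤ x ^ 2 + x * xt + xt ^ 2 - 3 * ζ ^ 2 := by nlinarith [sq_nonneg (x + xt / 2)]
    nlinarith
  have hu := uu_convex hneg
  have hr0 : 0 < Real.sqrt (3 * ζ ^ 2) := Real.sqrt_pos.2 (by positivity)
  have hr2 : Real.sqrt (3 * ζ ^ 2) ^ 2 = 3 * ζ ^ 2 := Real.sq_sqrt (by positivity)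
  generalize Real.sqrt (3 * ζ ^ 2) = r at hr0 hr2
  have hrζ : r ≤ 2 * ζ := by
    refine le_of_pow_le_pow_left₀ two_ne_zero (by linarith) ?_
    rw [hr2]; nlinarith
  have hr1 : 1 ≤ r := by nlinarith
  have h1 : tau (3 * ζ ^ 2) 0 (-r) ≤ uu (3 * ζ ^ 2) l (-r) := by
    refine cmp_low (by linarith) (fun x hx => (hu x (by linarith)).1) ?_
    intro x hx
    have hz : r ≤ -x := by linarith
    have hv2 : Real.sqrt (-x) ^ 2 = -x := Real.sq_sqrt (by linarith)
    have hv0 : 0 < Real.sqrt (-x) := Real.sqrt_pos.2 (by linarith)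
    have hv1 : 1 ≤ Real.sqrt (-x) := Real.one_le_sqrt.2 (by linarith)
    generalize Real.sqrt (-x) = v at hv2 hv0 hv1
    have hx' : x = -v ^ 2 := by linarith
    rw [hx', tq, PP]
    have t1 : (3 * ζ ^ 2) ^ 2 / 4 * v⁻¹ ^ 2 ≤ l := by
      rw [← hr2, inv_pow, ← div_eq_mul_inv, div_le_iff₀ (by positivity)]
      have q1 : r ^ 3 ≤ (2 * ζ) ^ 3 := by gcongr
      have q2 : r ^ 3 / 4 ≤ l := by nlinarith
      have q3 : r ≤ v ^ 2 := by linarith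
      have q4 : r ^ 3 / 4 * r ≤ l * v ^ 2 := by gcongr
      nlinarith
    have t2 : 21 / 16 * v⁻¹ ^ 4 ≤ 3 * ζ ^ 2 * v⁻¹ ^ 3 := by
      have : v⁻¹ ^ 4 = v⁻¹ ^ 3 * v⁻¹ := by ring
      rw [this]
      have i1 : v⁻¹ ≤ 1 := inv_le_one_of_one_le₀ hv1
      have i2 : 0 < v⁻¹ ^ 3 := by positivity
      have : v⁻¹ ^ 3 * v⁻¹ ≤ v⁻¹ ^ 3 * 1 := by gcongr
      have i3 : 2 ≤ 3 * ζ ^ 2 := by nlinarith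
      have i4 : 2 * v⁻¹ ^ 3 ≤ 3 * ζ ^ 2 * v⁻¹ ^ 3 := by gcongr
      linarith
    nlinarith
  have h2 : uu (3 * ζ ^ 2) l (-r) ≤ uu (3 * ζ ^ 2) l xt := by
    have hm : MonotoneOn (uu (3 * ζ ^ 2) l) (Set.Iic xt) := by
      refine monotoneOn_of_deriv_nonneg (convex_Iic _) (fun x hx => (uu_der _ l x).continuousAt.continuousWithinAt)
        (fun x hx => (uu_der _ l x).differentiableAt.differentiableWithinAt) ?_
      intro t ht
      rw [interior_Iic] at ht
      rw [(uu_der _ l t).deriv]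
      exact (hu t (le_of_lt (Set.mem_Iio.1 ht))).2.le
    exact hm (Set.mem_Iic.2 (by linarith)) (Set.mem_Iic.2 le_rfl) (by linarith)
  have h3 := turn_bound hζ hxt hl0 h0
  have h4 : uu (3 * ζ ^ 2) l xt ≤ ‖cc (3 * ζ ^ 2) l‖ * 8 := by
    rw [uu_eq]
    refine (Complex.re_le_norm _).trans ?_
    rw [norm_mul]
    gcongr
  rw [MM]
  linarith

lemma MM_large' {a p : ℝ} (ha : 16 ≤ a) (hp : Real.pi / 2 ≤ p) : rq a ≤ 16 * MM a (Lam a p) := by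
  obtain ⟨ζ, hζ0, hζ⟩ : ∃ ζ : ℝ, 0 < ζ ∧ a = 3 * ζ ^ 2 := by
    refine ⟨Real.sqrt (a / 3), Real.sqrt_pos.2 (by linarith), ?_⟩
    rw [Real.sq_sqrt (by linarith)]; ring
  have hζ2 : 2 ≤ ζ := by nlinarith
  have h1 := Lam_crit hζ0 hp
  rw [← hζ] at h1
  have h2 := MM_large hζ2 (l := Lam a p) h1
  rw [← hζ] at h2
  refine le_trans ?_ h2
  rw [tau, neg_neg]
  change rq a ≤ Real.exp (Hv a 0 (rq a))
  have ha4 := rq_four (x := a) (by linarith)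
  have hv0 := rq_pos (x := a) (by linarith)
  generalize rq a = v at ha4 hv0
  have hv : 2 ≤ v := by
    by_contra h
    push Not at h
    have : v ^ 4 < 2 ^ 4 := by gcongr
    linarith
  have hlog := Real.log_le_sub_one_of_pos hv0
  have h5 : v ≤ Hv a 0 v := by
    rw [Hv, ← ha4]
    have : 16 * v ≤ v ^ 5 := by
      have : v * 2 ^ 4 ≤ v * v ^ 4 := by gcongr
      nlinarith
    nlinarith
  linarith [Real.add_one_le_exp (Hv a 0 v)]
end Cub

namespace Cub
local notation "cj" => starRingEnd ℂ

lemma F2_bound {b z l : ℝ} (hb : 4 ≤ b) (hz : 1 ≤ z) (hl : l < 1 + b) (hp : 0 ≤ z ^ 3 + b * z + l) :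
    1 ≤ PP (-b) l 2 ∧ FF (-b) l 2 ≤ 24 * ((z + 2) ^ 3 + b * (z + 2)) := by
  have hP : ∀ x, 2 ≤ x → 1 ≤ PP (-b) l x ∧ 3 * x ^ 2 - -b ≤ 2 * PP (-b) l x := by
    intro x hx
    rw [PP]
    constructor <;> nlinarith [sq_nonneg x]
  have hJ : JJ (-b) l (z + 2) ≤ 12 := by
    refine JJ_bound (fun x hx => by linarith [(hP x (by linarith)).1]) (fun x hx => by nlinarith) ?_ ?_
    · intro x hx
      obtain ⟨h1, h2⟩ := hP x (by linarith)
      have e : sP (-b) l x ^ 3 = sP (-b) l x * PP (-b) l x := by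
        rw [← sP_sq (by linarith : 0 < PP (-b) l x)]; ring
      have h3 : 1 ≤ sP (-b) l x := Real.one_le_sqrt.2 h1
      rw [e]
      nlinarith
    · intro x hx
      have e : (3 * x ^ 2 - -b) ^ 2 - 4 * x * PP (-b) l x = 5 * x ^ 4 + 2 * b * x ^ 2 + b ^ 2 + 4 * l * x := by
        rw [PP]; ring
      have h1 : 4 * x * (z ^ 3 + b * z) ≤ 4 * x * (x ^ 3 + b * x) := by
        have : z ≤ x := by linarith
        have : 0 < x := by linarith
        gcongr
      have h2 : 0 ≤ 4 * x * (z ^ 3 + b * z + l) := mul_nonneg (by linarith) hp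
      nlinarith [sq_nonneg (x ^ 2 - b)]
  have h1 := (hP (z + 2) (by linarith)).1
  have hF := FF_mono (a := -b) (l := l) (by linarith : 2 ≤ z + 2) (fun t ht => by nlinarith)
  rw [FF_JJ (by linarith : 0 < PP (-b) l (z + 2))] at hF
  have h2 : sP (-b) l (z + 2) ≤ PP (-b) l (z + 2) := by
    refine Real.sqrt_le_iff.2 ⟨by linarith, by nlinarith⟩
  have hs := sP_pos (by linarith : 0 < PP (-b) l (z + 2))
  refine ⟨(hP 2 le_rfl).1, hF.trans ?_⟩
  have h3 : sP (-b) l (z + 2) * JJ (-b) l (z + 2) ≤ sP (-b) l (z + 2) * 12 := by gcongr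
  have h4 : PP (-b) l (z + 2) ≤ 2 * ((z + 2) ^ 3 + b * (z + 2)) := by
    rw [PP]
    have : z ^ 3 ≤ (z + 2) ^ 3 := by gcongr; linarith
    nlinarith
  linarith

lemma gron {b z l k : ℝ} (hb : 4 ≤ b) (hz : 1 ≤ z) (hl : l < 1 + b) (hp : 0 ≤ z ^ 3 + b * z + l)
    (hk : 1 ≤ k) (hk2 : k ^ 2 = 1 + (z ^ 3 + b * z + l)) :
    VV (-b) l (-z) + NN (-b) l (-z) ≤ Real.exp (2 * k * (2 + z)) * ((1 + 2 * k ^ 2) * (24 * ((z + 2) ^ 3 + b * (z + 2)))) := by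
  have hPx : ∀ x, -z ≤ x → 1 - k ^ 2 ≤ PP (-b) l x := by
    intro x hx
    have e : PP (-b) l x - (1 - k ^ 2) = (x + z) * (x ^ 2 - x * z + z ^ 2 + b) := by
      rw [PP, hk2]; ring
    have : 0 ≤ (x + z) * (x ^ 2 - x * z + z ^ 2 + b) := mul_nonneg (by linarith) (by nlinarith [sq_nonneg (x - z)])
    linarith
  have hd : ∀ x, HasDerivAt (fun x => (VV (-b) l x + (PP (-b) l x + 2 * k ^ 2) * NN (-b) l x) * Real.exp (2 * k * x))
      (((3 * x ^ 2 - -b) * NN (-b) l x + 4 * k ^ 2 * RR (-b) l x + 2 * k * (VV (-b) l x + (PP (-b) l x + 2 * k ^ 2) * NN (-b) l x)) * Real.exp (2 * k * x)) x := by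
    intro x
    have h1 := (VV_der (-b) l x).fun_add (((PP_der (-b) l x).add_const (2 * k ^ 2)).fun_mul (NN_der (-b) l x))
    have h2 := ((hasDerivAt_id x).const_mul (2 * k)).exp
    refine (h1.fun_mul h2).congr_deriv ?_
    simp only [id]
    ring
  have hmono : MonotoneOn (fun x => (VV (-b) l x + (PP (-b) l x + 2 * k ^ 2) * NN (-b) l x) * Real.exp (2 * k * x)) (Set.Ici (-z)) := by
    refine monotoneOn_of_deriv_nonneg (convex_Ici _) (fun x hx => (hd x).continuousAt.continuousWithinAt)
      (fun x hx => (hd x).differentiableAt.differentiableWithinAt) ?_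
    intro x hx
    rw [interior_Ici] at hx
    have hx := le_of_lt (Set.mem_Ioi.1 hx)
    rw [(hd x).deriv]
    refine mul_nonneg ?_ (Real.exp_nonneg _)
    have hN := NN_nonneg (-b) l x
    have hV := VV_nonneg (-b) l x
    have hR := RR_le (-b) l x (by linarith : 0 < k)
    have h1 : 2 * k * |RR (-b) l x| ≤ k ^ 2 * NN (-b) l x + VV (-b) l x := by
      have := mul_le_mul_of_nonneg_left hR (by linarith : 0 ≤ k)
      have e : k * (k * NN (-b) l x + VV (-b) l x / k) = k ^ 2 * NN (-b) l x + VV (-b) l x := by field_simp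
      linarith
    have h2 := neg_abs_le (RR (-b) l x)
    have h3 : 0 ≤ (3 * x ^ 2 - -b) * NN (-b) l x := mul_nonneg (by nlinarith) hN
    have h4 : 0 ≤ (PP (-b) l x - (1 - k ^ 2)) * NN (-b) l x := mul_nonneg (by linarith [hPx x hx]) hN
    have h5 : 4 * k ^ 2 * |RR (-b) l x| ≤ 2 * k * (k ^ 2 * NN (-b) l x + VV (-b) l x) := by nlinarith
    have h6 : k ^ 2 * NN (-b) l x + VV (-b) l x ≤ VV (-b) l x + (PP (-b) l x + 2 * k ^ 2) * NN (-b) l x := by nlinarith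
    have h7 : 2 * k * (k ^ 2 * NN (-b) l x + VV (-b) l x) ≤ 2 * k * (VV (-b) l x + (PP (-b) l x + 2 * k ^ 2) * NN (-b) l x) := by gcongr
    have h8 : 0 ≤ 4 * k ^ 2 * (RR (-b) l x + |RR (-b) l x|) := mul_nonneg (by positivity) (by linarith)
    nlinarith
  have hm := hmono (Set.mem_Ici.2 le_rfl) (Set.mem_Ici.2 (by linarith : -z ≤ 2)) (by linarith)
  simp only at hm
  obtain ⟨hP2, hF2⟩ := F2_bound hb hz hl hp
  have hN2 := NN_nonneg (-b) l 2
  have hV2 := VV_nonneg (-b) l 2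
  have h1 : VV (-b) l 2 + (PP (-b) l 2 + 2 * k ^ 2) * NN (-b) l 2 ≤ (1 + 2 * k ^ 2) * FF (-b) l 2 := by
    rw [FF]
    have : 0 ≤ 2 * k ^ 2 * (VV (-b) l 2 + (PP (-b) l 2 - 1) * NN (-b) l 2) := by
      have : 0 ≤ PP (-b) l 2 - 1 := by linarith
      positivity
    nlinarith
  have h2 : (1 + 2 * k ^ 2) * FF (-b) l 2 ≤ (1 + 2 * k ^ 2) * (24 * ((z + 2) ^ 3 + b * (z + 2))) := by gcongr
  have h3 : VV (-b) l (-z) + NN (-b) l (-z) ≤ VV (-b) l (-z) + (PP (-b) l (-z) + 2 * k ^ 2) * NN (-b) l (-z) := by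
    have h4 := hPx (-z) le_rfl
    have hN := NN_nonneg (-b) l (-z)
    have : 1 * NN (-b) l (-z) ≤ (PP (-b) l (-z) + 2 * k ^ 2) * NN (-b) l (-z) := by
      gcongr; nlinarith
    linarith
  refine h3.trans ?_
  have e : Real.exp (2 * k * (2 + z)) = Real.exp (2 * k * 2) * Real.exp (-(2 * k * -z)) := by
    rw [← Real.exp_add]; congr 1; ring
  have h5 : VV (-b) l (-z) + (PP (-b) l (-z) + 2 * k ^ 2) * NN (-b) l (-z) =
    (VV (-b) l (-z) + (PP (-b) l (-z) + 2 * k ^ 2) * NN (-b) l (-z)) * Real.exp (2 * k * -z) * Real.exp (-(2 * k * -z)) := by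
    rw [mul_assoc, ← Real.exp_add, add_neg_cancel, Real.exp_zero, mul_one]
  rw [h5, e]
  calc _ ≤ (VV (-b) l 2 + (PP (-b) l 2 + 2 * k ^ 2) * NN (-b) l 2) * Real.exp (2 * k * 2) * Real.exp (-(2 * k * -z)) := by gcongr
    _ ≤ ((1 + 2 * k ^ 2) * (24 * ((z + 2) ^ 3 + b * (z + 2)))) * Real.exp (2 * k * 2) * Real.exp (-(2 * k * -z)) := by
        have := h1.trans h2
        gcongr
    _ = _ := by ring

set_option maxHeartbeats 1000000 in
lemma cc_small {b z l k : ℝ} (hb : 4 ≤ b) (hz : 1 ≤ z) (hl : l < 1 + b) (hp : 0 ≤ z ^ 3 + b * z + l)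
    (hk : 1 ≤ k) (hk2 : k ^ 2 = 1 + (z ^ 3 + b * z + l)) 
    (he : Hv (-b) (1 + b) (Real.sqrt z) + k * (2 + z) ≤ -(z + b)) :
    ‖cc (-b) l‖ ^ 2 ≤ 400000 * (z + b) ^ 10 * Real.exp (-2 * (z + b)) := by
  have hneg : ∀ x < -z, PP (-b) l x ≤ 0 := by
    intro x hx
    have e : PP (-b) l x + (z ^ 3 + b * z + l) = (x + z) * (x ^ 2 - x * z + z ^ 2 + b) := by
      rw [PP]; ring
    have : (x + z) * (x ^ 2 - x * z + z ^ 2 + b) ≤ 0 := mul_nonpos_of_nonpos_of_nonneg (by linarith) (by nlinarith [sq_nonneg (x - z)])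
    linarith
  have hu := uu_convex hneg
  obtain ⟨c1, c2⟩ := cmp_up (a := -b) (κ := 1 + b) (by linarith : -z < 0) (fun x hx => (hu x hx).1) (by
    intro x hx
    have hv2 : Real.sqrt (-x) ^ 2 = -x := Real.sq_sqrt (by linarith)
    have hv0 : 0 < Real.sqrt (-x) := Real.sqrt_pos.2 (by linarith)
    generalize Real.sqrt (-x) = v at hv2 hv0
    have hx' : x = -v ^ 2 := by linarith
    rw [hx', tq, PP]
    have : 0 ≤ (-b) ^ 2 / 4 * v⁻¹ ^ 2 + b * (1 + b) / 2 * v⁻¹ ^ 4 + (1 + b) ^ 2 / 4 * v⁻¹ ^ 6 + b * v⁻¹ ^ 3 + 3 * (1 + b) / 2 * v⁻¹ ^ 5 + 21 / 16 * v⁻¹ ^ 4 := by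
      positivity
    nlinarith)
  rw [neg_neg] at c2
  obtain ⟨hu0, hu1⟩ := hu (-z) le_rfl
  have hg := gron hb hz hl hp hk hk2
  rw [tau, neg_neg] at c1
  have hv1 : 1 ≤ Real.sqrt z := Real.one_le_sqrt.2 hz
  have hvz : Real.sqrt z ^ 2 = z := Real.sq_sqrt (by linarith)
  generalize hvdef : Real.sqrt z = v at he c1 c2 hv1 hvz
  have hL0 : 0 ≤ H1v (-b) (1 + b) v ∧ 1 + H1v (-b) (1 + b) v ≤ 5 * (z + b) ^ 2 := by
    have hi : v⁻¹ ≤ 1 := inv_le_one_of_one_le₀ hv1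
    have hi0 : 0 < v⁻¹ := by positivity
    have hi2 : v⁻¹ ^ 2 ≤ 1 := pow_le_one₀ hi0.le hi
    have hi3 : v⁻¹ ^ 3 ≤ 1 := pow_le_one₀ hi0.le hi
    rw [H1v]
    have e : -b / 2 * v⁻¹ = -(b / 2 * v⁻¹) := by ring
    rw [e]
    constructor
    · have : 0 ≤ v ^ 3 + b / 2 * v⁻¹ + (1 + b) / 2 * v⁻¹ ^ 3 + 3 / 4 * v⁻¹ ^ 2 := by positivity
      linarith
    · have t1 : v ^ 3 ≤ z ^ 2 := by rw [← hvz]; nlinarith [pow_pos (by linarith : 0 < v) 3]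
      have t2 : b / 2 * v⁻¹ ≤ b / 2 * 1 := by gcongr
      have t3 : (1 + b) / 2 * v⁻¹ ^ 3 ≤ (1 + b) / 2 * 1 := by gcongr
      nlinarith
  generalize H1v (-b) (1 + b) v = Λ at c2 hL0
  obtain ⟨hΛ0, hΛ⟩ := hL0
  have hcc : ‖cc (-b) l‖ ≤ uu (-b) l (-z) * (‖gg' (-b) l (-z)‖ + Λ * ‖gg (-b) l (-z)‖) := by
    rw [cc_eq (-b) l (-z), norm_mul, norm_I, one_mul]
    refine (norm_sub_le _ _).trans ?_
    rw [norm_mul, norm_mul, Complex.norm_real, Complex.norm_real, RCLike.norm_conj, RCLike.norm_conj, Real.norm_eq_abs, Real.norm_eq_abs,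
      abs_of_pos hu0, abs_of_pos hu1]
    have : uu' (-b) l (-z) * ‖gg (-b) l (-z)‖ ≤ Λ * uu (-b) l (-z) * ‖gg (-b) l (-z)‖ := by gcongr
    linarith
  have hgg : (‖gg' (-b) l (-z)‖ + Λ * ‖gg (-b) l (-z)‖) ^ 2 ≤ (1 + Λ) ^ 2 * (VV (-b) l (-z) + NN (-b) l (-z)) := by
    rw [VV, NN]
    have h1 := norm_nonneg (gg' (-b) l (-z))
    have h2 := norm_nonneg (gg (-b) l (-z))
    generalize ‖gg' (-b) l (-z)‖ = p at h1
    generalize ‖gg (-b) l (-z)‖ = q at h2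
    have : (1 + Λ) ^ 2 * (p ^ 2 + q ^ 2) - (p + Λ * q) ^ 2 = (1 + Λ) ^ 2 * (p ^ 2 + q ^ 2) - p ^ 2 - 2 * Λ * (p * q) - Λ ^ 2 * q ^ 2 := by ring
    nlinarith [mul_nonneg hΛ0 (sq_nonneg (p - q)), mul_nonneg (sq_nonneg Λ) (sq_nonneg p), mul_nonneg hΛ0 (sq_nonneg p), mul_nonneg hΛ0 (sq_nonneg q), sq_nonneg q]
  have hS1 : 1 ≤ z + b := by linarith
  have hexp : Real.exp (Hv (-b) (1 + b) v) ^ 2 * Real.exp (2 * k * (2 + z)) ≤ Real.exp (-2 * (z + b)) := by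
    rw [← Real.exp_nat_mul, ← Real.exp_add]
    apply Real.exp_le_exp.2
    push_cast
    linarith
  obtain ⟨S, hS⟩ : ∃ S, S = z + b := ⟨_, rfl⟩
  rw [← hS] at hS1 hΛ hexp ⊢
  have hzS : z ≤ S := by linarith
  have hbS : b ≤ S := by linarith
  have hkS : 1 + 2 * k ^ 2 ≤ 11 * S ^ 3 := by
    rw [hk2]
    have : z ^ 3 ≤ S ^ 3 := by gcongr
    have h2 : b * z ≤ S * S := by gcongr
    have h3 : S ^ 2 ≤ S ^ 3 := pow_le_pow_right₀ hS1 (by norm_num)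
    have h4 : S ≤ S ^ 3 := le_self_pow₀ hS1 (by norm_num)
    nlinarith
  have hxS : (z + 2) ^ 3 + b * (z + 2) ≤ 30 * S ^ 3 := by
    have h1 : (z + 2) ^ 3 ≤ (3 * S) ^ 3 := by gcongr; linarith
    have h2 : b * (z + 2) ≤ S * (3 * S) := by gcongr; linarith
    have h3 : S ^ 2 ≤ S ^ 3 := pow_le_pow_right₀ hS1 (by norm_num)
    nlinarith
  calc ‖cc (-b) l‖ ^ 2 ≤ (uu (-b) l (-z) * (‖gg' (-b) l (-z)‖ + Λ * ‖gg (-b) l (-z)‖)) ^ 2 := by gcongr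
    _ = uu (-b) l (-z) ^ 2 * (‖gg' (-b) l (-z)‖ + Λ * ‖gg (-b) l (-z)‖) ^ 2 := by ring
    _ ≤ Real.exp (Hv (-b) (1 + b) v) ^ 2 * ((1 + Λ) ^ 2 * (Real.exp (2 * k * (2 + z)) * ((1 + 2 * k ^ 2) * (24 * ((z + 2) ^ 3 + b * (z + 2)))))) := by
        gcongr
        exact hgg.trans (by gcongr)
    _ = (Real.exp (Hv (-b) (1 + b) v) ^ 2 * Real.exp (2 * k * (2 + z))) * ((1 + Λ) ^ 2 * ((1 + 2 * k ^ 2) * (24 * ((z + 2) ^ 3 + b * (z + 2))))) := by ring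
    _ ≤ Real.exp (-2 * S) * ((5 * S ^ 2) ^ 2 * ((11 * S ^ 3) * (24 * (30 * S ^ 3)))) := by gcongr
    _ = 198000 * (S ^ 10 * Real.exp (-2 * S)) := by ring
    _ ≤ 400000 * (S ^ 10 * Real.exp (-2 * S)) := by gcongr; norm_num
    _ = _ := by ring

lemma cc_small' {b l : ℝ} (hb : 10000 ≤ b) (hl : l < 1 + b) : ∃ z, 0 ≤ z ∧ 
    ‖cc (-b) l‖ ^ 2 ≤ 400000 * (z + b) ^ 10 * Real.exp (-2 * (z + b)) := by
  obtain ⟨β, hβ0, hβ⟩ : ∃ β : ℝ, 0 < β ∧ b = β ^ 4 := ⟨rq b, rq_pos (by linarith), (rq_four (by linarith)).symm⟩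
  have hβ10 : 10 ≤ β := by
    by_contra h
    push Not at h
    have : β ^ 4 < 10 ^ 4 := by gcongr
    linarith
  rcases le_total 0 ((β ^ 2 / 4) ^ 3 + b * (β ^ 2 / 4) + l) with hp | hp
  · have hz : 1 ≤ β ^ 2 / 4 := by nlinarith
    refine ⟨β ^ 2 / 4, by linarith, cc_small (k := Real.sqrt (1 + ((β ^ 2 / 4) ^ 3 + b * (β ^ 2 / 4) + l))) (by linarith) hz hl hp ?_ ?_ ?_⟩
    · exact Real.one_le_sqrt.2 (by linarith)
    · exact Real.sq_sqrt (by linarith)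
    · have e : Real.sqrt (β ^ 2 / 4) = β / 2 := by
        rw [Real.sqrt_eq_iff_mul_self_eq (by positivity) (by positivity)]; ring
      have hk : Real.sqrt (1 + ((β ^ 2 / 4) ^ 3 + b * (β ^ 2 / 4) + l)) ≤ 3 / 5 * β ^ 3 := by
        refine Real.sqrt_le_iff.2 ⟨by positivity, ?_⟩
        have h1 : β ^ 4 * 10 ^ 2 ≤ β ^ 4 * β ^ 2 := by gcongr
        nlinarith
      have hlog : 0 ≤ Real.log (β / 2) := Real.log_nonneg (by linarith)
      rw [e, Hv]
      have h1 : Real.sqrt (1 + ((β ^ 2 / 4) ^ 3 + b * (β ^ 2 / 4) + l)) * (2 + β ^ 2 / 4) ≤ 3 / 5 * β ^ 3 * (2 + β ^ 2 / 4) := by gcongr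
      have h2 : (1 + b) * (β / 2)⁻¹ ≤ 2 * β ^ 3 + 1 := by
        rw [← div_eq_mul_inv, div_le_iff₀ (by positivity), hβ]
        nlinarith
      have h3 : β ^ 4 * 10 ≤ β ^ 4 * β := by gcongr
      have h4 : β ^ 3 * 10 ^ 2 ≤ β ^ 3 * β ^ 2 := by gcongr
      have h5 : β ^ 2 * 10 ^ 3 ≤ β ^ 2 * β ^ 3 := by gcongr
      have h6 : 1 ≤ β ^ 2 := by nlinarith
      rw [hβ] at h2 ⊢
      rw [hβ] at h1
      nlinarith
  · obtain ⟨z, hz, h0⟩ : ∃ z, β ^ 2 / 4 ≤ z ∧ z ^ 3 + b * z + l = 0 := by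
      have hX2 : β ^ 2 / 4 ≤ β ^ 2 / 4 + |l| := by linarith [abs_nonneg l]
      have hc : ContinuousOn (fun z : ℝ => z ^ 3 + b * z + l) (Set.Icc (β ^ 2 / 4) (β ^ 2 / 4 + |l|)) := by fun_prop
      have h1 : 0 ≤ (β ^ 2 / 4 + |l|) ^ 3 + b * (β ^ 2 / 4 + |l|) + l := by
        have : 0 ≤ (β ^ 2 / 4 + |l|) ^ 3 := by positivity
        have h2 : 1 * (β ^ 2 / 4 + |l|) ≤ b * (β ^ 2 / 4 + |l|) := by gcongr; linarith
        nlinarith [neg_abs_le l]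
      obtain ⟨x, hx, e⟩ := intermediate_value_Icc hX2 hc ⟨hp, h1⟩
      exact ⟨x, hx.1, e⟩
    have hz25 : 25 ≤ z := by nlinarith
    refine ⟨z, by linarith, cc_small (k := 1) (by linarith) (by linarith) hl h0.ge le_rfl (by rw [h0]; ring) ?_⟩
    have hv2 : Real.sqrt z ^ 2 = z := Real.sq_sqrt (by linarith)
    have hv5 : 5 ≤ Real.sqrt z := Real.le_sqrt_of_sq_le (by linarith)
    generalize Real.sqrt z = v at hv2 hv5
    have hlog : 0 ≤ Real.log v := Real.log_nonneg (by linarith)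
    rw [Hv]
    have h2 : (1 + b) * v⁻¹ ≤ 1 + b := by
      have : v⁻¹ ≤ 1 := inv_le_one_of_one_le₀ (by linarith)
      have : (1 + b) * v⁻¹ ≤ (1 + b) * 1 := by gcongr
      linarith
    have h3 : b * 5 ≤ b * v := by gcongr
    have h4 : v ^ 2 * 5 ^ 3 ≤ v ^ 2 * v ^ 3 := by gcongr
    nlinarith

lemma MM_small {b p : ℝ} (hb : 10000 ≤ b) (hp : p + 3 * Real.pi / 4 ≤ b) :
    MM (-b) (Lam (-b) p) ^ 2 ≤ 400000 * 39916800 / b := by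
  obtain ⟨z, hz, h⟩ := cc_small' hb (Lam_neg (by linarith) hp)
  have h1 : MM (-b) (Lam (-b) p) ^ 2 ≤ ‖cc (-b) (Lam (-b) p)‖ ^ 2 := by
    rw [MM]
    nlinarith [sq_nonneg ‖cc (-b) (Lam (-b) p)‖]
  refine h1.trans (h.trans ?_)
  obtain ⟨S, hS⟩ : ∃ S, S = z + b := ⟨_, rfl⟩
  have hSb : b ≤ S := by linarith
  rw [← hS]
  have h0 : 0 < S := by linarith
  have h2 := Real.pow_div_factorial_le_exp S h0.le 11
  have h3 : ((Nat.factorial 11 : ℕ) : ℝ) = 39916800 := by norm_num [Nat.factorial]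
  rw [h3, div_le_iff₀ (by norm_num)] at h2
  have h4 : Real.exp (-2 * S) ≤ (Real.exp S)⁻¹ := by
    rw [← Real.exp_neg]; exact Real.exp_le_exp.2 (by linarith)
  calc 400000 * S ^ 10 * Real.exp (-2 * S) ≤ 400000 * S ^ 10 * (Real.exp S)⁻¹ := by gcongr
    _ ≤ 400000 * 39916800 / S := by
        rw [← div_eq_mul_inv, div_le_div_iff₀ (Real.exp_pos _) h0]
        nlinarith
    _ ≤ _ := by gcongr
end Cub

namespace Cub

lemma inj_of_locInj {f : ℝ → ℝ} (hf : Continuous f) (h : ∀ x, ∃ U ∈ nhds x, Set.InjOn f U) : Function.Injective f := by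
  have key : ∀ a b : ℝ, a < b → f a = f b → False := by
    intro a b hab he
    obtain ⟨c, -, hc⟩ := exists_isLocalExtr_Ioo hab hf.continuousOn he
    obtain ⟨U, hU, hinj⟩ := h c
    have hev : ∀ᶠ x in nhds c, (x ∈ U) := hU
    rcases hc with hc | hc
    · obtain ⟨ε, hε, hb⟩ := Metric.eventually_nhds_iff.1 (hev.and hc)
      have hI : ∀ x ∈ Set.Icc (c - ε / 2) (c + ε / 2), dist x c < ε := fun x hx => by
        rw [Real.dist_eq, abs_lt]; constructor <;> linarith [hx.1, hx.2]
      have hm := hf.continuousOn.strictMonoOn_of_injOn_Icc' (by linarith : c - ε / 2 ≤ c + ε / 2)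
        (hinj.mono fun x hx => (hb (hI x hx)).1)
      have m1 : c - ε / 2 ∈ Set.Icc (c - ε / 2) (c + ε / 2) := ⟨le_rfl, by linarith⟩
      have m2 : c + ε / 2 ∈ Set.Icc (c - ε / 2) (c + ε / 2) := ⟨by linarith, le_rfl⟩
      have m3 : c ∈ Set.Icc (c - ε / 2) (c + ε / 2) := ⟨by linarith, by linarith⟩
      have b1 := (hb (hI _ m1)).2
      have b2 := (hb (hI _ m2)).2
      rcases hm with hm | hm
      · exact absurd (hm m1 m3 (by linarith)) (not_lt.2 b1)
      · exact absurd (hm m3 m2 (by linarith)) (not_lt.2 b2)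
    · obtain ⟨ε, hε, hb⟩ := Metric.eventually_nhds_iff.1 (hev.and hc)
      have hI : ∀ x ∈ Set.Icc (c - ε / 2) (c + ε / 2), dist x c < ε := fun x hx => by
        rw [Real.dist_eq, abs_lt]; constructor <;> linarith [hx.1, hx.2]
      have hm := hf.continuousOn.strictMonoOn_of_injOn_Icc' (by linarith : c - ε / 2 ≤ c + ε / 2)
        (hinj.mono fun x hx => (hb (hI x hx)).1)
      have m1 : c - ε / 2 ∈ Set.Icc (c - ε / 2) (c + ε / 2) := ⟨le_rfl, by linarith⟩
      have m2 : c + ε / 2 ∈ Set.Icc (c - ε / 2) (c + ε / 2) := ⟨by linarith, le_rfl⟩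
      have m3 : c ∈ Set.Icc (c - ε / 2) (c + ε / 2) := ⟨by linarith, by linarith⟩
      have b1 := (hb (hI _ m1)).2
      have b2 := (hb (hI _ m2)).2
      rcases hm with hm | hm
      · exact absurd (hm m3 m2 (by linarith)) (not_lt.2 b2)
      · exact absurd (hm m1 m3 (by linarith)) (not_lt.2 b1)
  intro a b he
  rcases lt_trichotomy a b with h | h | h
  · exact (key a b h he).elim
  · exact h
  · exact (key b a h he.symm).elim

noncomputable def mM (q : ℝ × ℝ) : ℝ := MM q.1 (Lam q.1 q.2)
lemma mM_cont : Continuous mM := by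
  have h : Continuous (fun q : ℝ × ℝ => (q.1, Lam q.1 q.2)) := continuous_fst.prodMk Lam_cont
  have h2 := MM_cont.comp h
  exact h2
lemma mM_cont1 (p : ℝ) : Continuous (fun a => mM (a, p)) := by
  have h : Continuous (fun a : ℝ => (a, p)) := by fun_prop
  exact mM_cont.comp h
lemma mM_inj (p : ℝ) : Function.Injective (fun a => mM (a, p)) := by
  refine inj_of_locInj (mM_cont1 p) ?_
  intro a
  obtain ⟨U, hU, hi⟩ := DD_locInj (a, Lam a p)
  have hc : Continuous (fun a : ℝ => (a, Lam a p)) := by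
    have h : Continuous (fun a : ℝ => (a, p)) := by fun_prop
    have h2 := Lam_cont.comp h
    exact continuous_id.prodMk h2
  refine ⟨_, hc.continuousAt.preimage_mem_nhds hU, ?_⟩
  intro x hx y hy he
  have := hi _ hx _ hy (by
    change DD x (Lam x p) = DD y (Lam y p)
    rw [DD_pol, DD_pol, Psi_Lam, Psi_Lam]
    have he : MM x (Lam x p) = MM y (Lam y p) := he
    rw [he])
  exact congrArg Prod.fst this
lemma mM_big {p : ℝ} (hp : Real.pi / 2 ≤ p) (y : ℝ) : ∃ a0, ∀ a, a0 ≤ a → y < mM (a, p) := by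
  have h : Tendsto rq atTop atTop := Real.tendsto_sqrt_atTop.comp Real.tendsto_sqrt_atTop
  obtain ⟨a0, h0⟩ := eventually_atTop.1 ((h.eventually_gt_atTop (16 * y)).and (eventually_ge_atTop 16))
  refine ⟨a0, fun a ha => ?_⟩
  obtain ⟨h1, h2⟩ := h0 a ha
  have := MM_large' h2 hp
  change y < MM a (Lam a p)
  linarith
lemma mM_little (p : ℝ) {y : ℝ} (hy : 0 < y) : ∃ a0, ∀ a, a ≤ a0 → mM (a, p) < y := by
  have h : Tendsto (fun b : ℝ => 400000 * 39916800 / b) atTop (nhds 0) := tendsto_const_nhds.div_atTop tendsto_id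
  obtain ⟨b0, h0⟩ := eventually_atTop.1 ((h.eventually_lt_const (sq_pos_of_pos hy : 0 < y ^ 2)).and
    ((eventually_ge_atTop 10000).and (eventually_ge_atTop (p + 3 * Real.pi / 4))))
  refine ⟨-b0, fun a ha => ?_⟩
  obtain ⟨h1, h2, h3⟩ := h0 (-a) (by linarith)
  have := MM_small h2 h3
  rw [neg_neg] at this
  change MM a (Lam a p) < y
  exact lt_of_pow_lt_pow_left₀ 2 hy.le (this.trans_lt h1)
lemma mM_mono {p : ℝ} (hp : Real.pi / 2 ≤ p) : StrictMono (fun a => mM (a, p)) := by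
  rcases (mM_cont1 p).strictMono_of_inj (mM_inj p) with h | h
  · exact h
  · exfalso
    obtain ⟨a0, h0⟩ := mM_big hp 1
    obtain ⟨a1, h1⟩ := mM_little p one_pos
    have : mM (max a0 a1, p) ≤ mM (min a0 a1, p) := h.antitone ((min_le_right a0 a1).trans (le_max_right a0 a1))
    have e := h0 _ (le_max_left a0 a1)
    have e2 := h1 _ (min_le_right a0 a1)
    linarith
lemma mM_surj {p : ℝ} (hp : Real.pi / 2 ≤ p) {y : ℝ} (hy : 0 < y) : ∃ a, mM (a, p) = y := by
  obtain ⟨a0, h0⟩ := mM_big hp y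
  obtain ⟨a1, h1⟩ := mM_little p hy
  have := mem_range_of_exists_le_of_exists_ge (mM_cont1 p) ⟨a1, (h1 a1 le_rfl).le⟩ ⟨a0, (h0 a0 le_rfl).le⟩
  exact this

noncomputable def pt (n : ℕ) (τ : ℝ) : ℝ := Real.pi + 2 * Real.pi * n + Real.arctan τ
noncomputable def rt' (τ : ℝ) : ℝ := Real.sqrt (1 + τ ^ 2) / 2
lemma pt_ge (n : ℕ) (τ : ℝ) : Real.pi / 2 ≤ pt n τ := by
  have := Real.neg_pi_div_two_lt_arctan τ
  have h2 := Real.pi_pos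
  have : 0 ≤ 2 * Real.pi * n := by positivity
  unfold pt; linarith
lemma pt_cont (n : ℕ) : Continuous (pt n) := by unfold pt; fun_prop
lemma rt'_cont : Continuous rt' := by unfold rt'; fun_prop
lemma rt'_pos (τ : ℝ) : 0 < rt' τ := by unfold rt'; positivity
lemma pt_cos (n : ℕ) (τ : ℝ) : rt' τ * Real.cos (pt n τ) = -1 / 2 := by
  have e : pt n τ = Real.arctan τ + Real.pi + n * (2 * Real.pi) := by unfold pt; ring
  rw [e, Real.cos_add_nat_mul_two_pi, Real.cos_add_pi, Real.cos_arctan, rt']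
  have : 0 < Real.sqrt (1 + τ ^ 2) := by positivity
  field_simp

noncomputable def Ac (n : ℕ) (τ : ℝ) : ℝ := (mM_surj (pt_ge n τ) (rt'_pos τ)).choose
lemma Ac_spec (n : ℕ) (τ : ℝ) : mM (Ac n τ, pt n τ) = rt' τ := (mM_surj (pt_ge n τ) (rt'_pos τ)).choose_spec
lemma Ac_spec' (n : ℕ) (τ : ℝ) : MM (Ac n τ) (Lam (Ac n τ) (pt n τ)) = rt' τ := by
  have := Ac_spec n τ
  unfold mM at this
  simpa only using this
lemma Ac_cont (n : ℕ) : Continuous (Ac n) := by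
  rw [continuous_iff_continuousAt]
  intro τ0
  rw [ContinuousAt, tendsto_order]
  have hc : ∀ a, Continuous (fun τ => mM (a, pt n τ)) := fun a => by
    have h : Continuous (fun τ => (a, pt n τ)) := continuous_const.prodMk (pt_cont n)
    exact mM_cont.comp h
  constructor
  · intro a ha
    have h1 : mM (a, pt n τ0) < rt' τ0 := by rw [← Ac_spec n τ0]; exact mM_mono (pt_ge n τ0) ha
    filter_upwards [(hc a).continuousAt.eventually_lt rt'_cont.continuousAt h1] with τ h
    rw [← Ac_spec n τ] at h
    exact (mM_mono (pt_ge n τ)).lt_iff_lt.1 h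
  · intro a ha
    have h1 : rt' τ0 < mM (a, pt n τ0) := by rw [← Ac_spec n τ0]; exact mM_mono (pt_ge n τ0) ha
    filter_upwards [rt'_cont.continuousAt.eventually_lt (hc a).continuousAt h1] with τ h
    rw [← Ac_spec n τ] at h
    exact (mM_mono (pt_ge n τ)).lt_iff_lt.1 h

lemma fc_cont (n : ℕ) : Continuous (fun τ => (Ac n τ, Lam (Ac n τ) (pt n τ))) := by
  have h : Continuous (fun τ => (Ac n τ, pt n τ)) := (Ac_cont n).prodMk (pt_cont n)
  have h2 := Lam_cont.comp h
  exact (Ac_cont n).prodMk h2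

/-- The parametrised spectral curves. -/
lemma curve_ex (n : ℕ) : ∃ f : ℝ → ℝ × ℝ, Continuous f ∧ Function.Injective f ∧
    (∀ K : Set (ℝ × ℝ), IsCompact K → IsCompact (f ⁻¹' K)) ∧
    Set.range f = {q : ℝ × ℝ | MM q.1 q.2 * Real.cos (Psi q.1 q.2) = -1 / 2 ∧
      Real.pi / 2 + 2 * Real.pi * n < Psi q.1 q.2 ∧ Psi q.1 q.2 < 3 * Real.pi / 2 + 2 * Real.pi * n} := by
  refine ⟨fun τ => (Ac n τ, Lam (Ac n τ) (pt n τ)), ?_, ?_, ?_, ?_⟩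
  · exact fc_cont n
  · intro s t h
    simp only [Prod.mk.injEq] at h
    obtain ⟨h1, h2⟩ := h
    have h3 := Psi_Lam (Ac n s) (pt n s)
    rw [h2, h1, Psi_Lam] at h3
    have : Real.arctan s = Real.arctan t := by unfold pt at h3; linarith
    exact Real.arctan_injective this
  · intro K hK
    have hf : Continuous (fun τ => (Ac n τ, Lam (Ac n τ) (pt n τ))) := fc_cont n
    obtain ⟨C, hC⟩ := hK.bddAbove_image (f := fun q : ℝ × ℝ => MM q.1 q.2) MM_cont.continuousOn
    have hC' : ∀ q ∈ K, MM q.1 q.2 ≤ C := fun q hq => hC (Set.mem_image_of_mem (fun q : ℝ × ℝ => MM q.1 q.2) hq)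
    refine IsCompact.of_isClosed_subset (isCompact_Icc (a := -(2 * C)) (b := 2 * C)) (hK.isClosed.preimage hf) ?_
    intro τ hτ
    have h1 : rt' τ ≤ C := by
      have h0 : MM (Ac n τ) (Lam (Ac n τ) (pt n τ)) = rt' τ := Ac_spec' n τ
      have h2 := hC' _ (Set.mem_preimage.1 hτ)
      simp only at h2
      rw [← h0]
      exact h2
    clear hC' hC
    have h2 : |τ| ≤ Real.sqrt (1 + τ ^ 2) := Real.abs_le_sqrt (by linarith)
    unfold rt' at h1
    exact abs_le.1 (by linarith)
  · ext q
    constructor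
    · rintro ⟨τ, rfl⟩
      have h1 : MM (Ac n τ) (Lam (Ac n τ) (pt n τ)) = rt' τ := Ac_spec' n τ
      refine ⟨?_, ?_, ?_⟩
      · simp only [Psi_Lam, h1]; exact pt_cos n τ
      · simp only [Psi_Lam]; unfold pt; linarith [Real.neg_pi_div_two_lt_arctan τ]
      · simp only [Psi_Lam]; unfold pt; linarith [Real.arctan_lt_pi_div_two τ]
    · rintro ⟨h1, h2, h3⟩
      refine ⟨Real.tan (Psi q.1 q.2 - Real.pi - 2 * Real.pi * n), ?_⟩
      obtain ⟨a, l⟩ := q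
      simp only at h1 h2 h3 ⊢
      have hp : pt n (Real.tan (Psi a l - Real.pi - 2 * Real.pi * n)) = Psi a l := by
        unfold pt
        rw [Real.arctan_tan (by linarith) (by linarith)]; ring
      generalize Real.tan (Psi a l - Real.pi - 2 * Real.pi * n) = τ at hp
      have h4 := pt_cos n τ
      rw [hp] at h4
      have hcn : Real.cos (Psi a l) ≠ 0 := by intro h; rw [h] at h1; norm_num at h1
      have h5 : MM a l = rt' τ := mul_right_cancel₀ hcn (h1.trans h4.symm)
      have h6 : a = Ac n τ := by
        refine mM_inj (pt n τ) ?_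
        change mM (a, pt n τ) = mM (Ac n τ, pt n τ)
        rw [Ac_spec, hp]
        change MM a (Lam a (Psi a l)) = _
        rw [Lam_Psi, h5]
      rw [← h6, hp, Lam_Psi]
end Cub

namespace Cub
local notation "cj" => starRingEnd ℂ

lemma entire_factor (f : ℂ → ℂ) (hf : Differentiable ℂ f) (S : Finset ℂ) (hS : ∀ s ∈ S, f s = 0) :
    ∃ F : ℂ → ℂ, Differentiable ℂ F ∧ ∀ z, f z = (∏ s ∈ S, (z - s)) * F z := by
  induction S using Finset.induction_on with
  | empty => exact ⟨f, hf, by simp⟩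
  | insert b S hb ih =>
    obtain ⟨F, hF, hfac⟩ := ih (fun s hs => hS s (Finset.mem_insert_of_mem hs))
    have hFb : F b = 0 := by
      have h1 := hfac b
      rw [hS b (Finset.mem_insert_self _ _)] at h1
      rcases mul_eq_zero.1 h1.symm with h | h
      · obtain ⟨s, hs, h0⟩ := Finset.prod_eq_zero_iff.1 h
        have : b = s := sub_eq_zero.1 h0
        subst this
        exact absurd hs hb
      · exact h
    refine ⟨dslope F b, ?_, fun z => ?_⟩
    · rw [← differentiableOn_univ]
      exact (Complex.differentiableOn_dslope Filter.univ_mem).2 hF.differentiableOn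
    · rw [Finset.prod_insert hb, hfac z]
      have h := sub_smul_dslope F b z
      rw [hFb, sub_zero, smul_eq_mul] at h
      rw [← h]
      ring

lemma entire_factor_ne (f F : ℂ → ℂ) (hF : Differentiable ℂ F) (S : Finset ℂ)
    (hfac : ∀ z, f z = (∏ s ∈ S, (z - s)) * F z) (b : ℂ) (hb : b ∈ S) (hd : deriv f b ≠ 0) : F b ≠ 0 := by
  intro h0
  apply hd
  have h1 : HasDerivAt F (deriv F b) b := (hF b).hasDerivAt
  have h2 : HasDerivAt (fun z => ∏ s ∈ S, (z - s)) (deriv (fun z => ∏ s ∈ S, (z - s)) b) b := by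
    apply DifferentiableAt.hasDerivAt
    fun_prop
  have h3 := h2.fun_mul h1
  have h4 : f = fun z => (∏ s ∈ S, (z - s)) * F z := funext hfac
  have h5 : ∏ s ∈ S, (b - s) = 0 := Finset.prod_eq_zero hb (sub_self b)
  rw [h4, h3.deriv, h0, h5]
  simp

lemma log_ball (F : ℂ → ℂ) (hF : Differentiable ℂ F) (R : ℝ) (hR : 0 < R) (hn : ∀ z, ‖z‖ ≤ R → F z ≠ 0) :
    ∃ h : ℂ → ℂ, ContinuousOn h (Metric.closedBall 0 R) ∧ ∀ z, ‖z‖ ≤ R → Complex.exp (h z) = F z := by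
  have hop : IsOpen {z | F z ≠ 0} := isOpen_ne_fun hF.continuous continuous_const
  have hsub : Metric.closedBall (0:ℂ) R ⊆ {z | F z ≠ 0} := fun z hz => hn z (by simpa using hz)
  obtain ⟨δ, hδ, hth⟩ := (isCompact_closedBall (0:ℂ) R).exists_thickening_subset_open hop hsub
  rw [thickening_closedBall hδ hR.le] at hth
  have hd : DifferentiableOn ℂ (fun z => deriv F z / F z) (Metric.ball 0 (δ + R)) := by
    intro z hz
    have h1 : DifferentiableAt ℂ (deriv F) z :=
      ((hF.contDiff (n := 2)).differentiable_deriv_two) z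
    exact (h1.div (hF z) (hth hz)).differentiableWithinAt
  obtain ⟨G, hG⟩ := hd.isExactOn_ball
  have hcd : ∀ z ∈ Metric.ball (0:ℂ) (δ + R), HasDerivAt (fun z => F z * Complex.exp (-(G z))) 0 z := by
    intro z hz
    have h1 := ((hF z).hasDerivAt).fun_mul ((hG z hz).fun_neg.cexp)
    refine h1.congr_deriv ?_
    have : F z ≠ 0 := hth hz
    field_simp
    ring
  have h0m : (0:ℂ) ∈ Metric.ball (0:ℂ) (δ + R) := by simp; linarith
  have hconst : ∀ z ∈ Metric.ball (0:ℂ) (δ + R), F z * Complex.exp (-(G z)) = F 0 * Complex.exp (-(G 0)) := by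
    intro z hz
    have := (convex_ball (0:ℂ) (δ + R)).is_const_of_fderivWithin_eq_zero (𝕜 := ℂ)
      (f := fun z => F z * Complex.exp (-(G z)))
      (fun x hx => (hcd x hx).differentiableAt.differentiableWithinAt)
      (fun x hx => by
        rw [fderivWithin_of_isOpen Metric.isOpen_ball hx]
        ext
        simp [(hcd x hx).hasFDerivAt.fderiv]) hz h0m
    exact this
  set c := F 0 * Complex.exp (-(G 0)) with hc
  have hcne : c ≠ 0 := mul_ne_zero (hth h0m) (Complex.exp_ne_zero _)
  have hball : ∀ z : ℂ, ‖z‖ ≤ R → z ∈ Metric.ball (0:ℂ) (δ + R) := fun z hz => by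
    simp; linarith
  refine ⟨fun z => G z + Complex.log c, ?_, ?_⟩
  · intro z hz
    have hz' := hball z (by simpa using hz)
    exact ((hG z hz').continuousAt.add continuousAt_const).continuousWithinAt
  · intro z hz
    rw [Complex.exp_add, Complex.exp_log hcne, ← hconst z (hball z hz), Complex.exp_neg]
    field_simp [Complex.exp_ne_zero]

lemma lift_unique (f : ℝ → ℂ) (b : ℝ) (hb : 0 ≤ b) (hf : ContinuousOn f (Set.Icc 0 b)) (c : ℂ)
    (hc : ∀ t ∈ Set.Icc 0 b, Complex.exp (f t) = c) : f 0 = f b := by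
  have h0 : (0:ℝ) ∈ Set.Icc 0 b := ⟨le_rfl, hb⟩
  have hbm : b ∈ Set.Icc 0 b := ⟨hb, le_rfl⟩
  have hperiod : ∀ t ∈ Set.Icc 0 b, ∃ n : ℤ, f t = f 0 + n * (2 * Real.pi * I) := fun t ht =>
    Complex.exp_eq_exp_iff_exists_int.1 ((hc t ht).trans (hc 0 h0).symm)
  have hg : ContinuousOn (fun t => ((f t).im - (f 0).im) / (2 * Real.pi)) (Set.Icc 0 b) :=
    ((Complex.continuous_im.comp_continuousOn hf).sub continuousOn_const).div_const _
  have hgi : ∀ t ∈ Set.Icc 0 b, ∃ n : ℤ, ((f t).im - (f 0).im) / (2 * Real.pi) = n ∧ f t = f 0 + n * (2 * Real.pi * I) := by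
    intro t ht
    obtain ⟨n, hn⟩ := hperiod t ht
    refine ⟨n, ?_, hn⟩
    rw [hn]
    have := Real.pi_pos
    simp
  obtain ⟨n, hn, hfb⟩ := hgi b hbm
  have hhalf : ∀ m : ℤ, (m : ℝ) ≠ 1/2 ∧ (m:ℝ) ≠ -1/2 := by
    intro m
    constructor
    · intro h
      have : (2 * m : ℝ) = 1 := by linarith
      have : 2 * m = 1 := by exact_mod_cast this
      omega
    · intro h
      have : (2 * m : ℝ) = -1 := by linarith
      have : 2 * m = -1 := by exact_mod_cast this
      omega
  rcases lt_trichotomy n 0 with h | h | h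
  · have hn1 : (n:ℝ) ≤ -1 := by exact_mod_cast (by omega : n ≤ -1)
    obtain ⟨t, ht, he⟩ := intermediate_value_Icc' hb hg
      (show (-1/2 : ℝ) ∈ Set.Icc _ _ from ⟨by rw [hn]; linarith, by norm_num⟩)
    obtain ⟨m, hm, -⟩ := hgi t ht
    exact absurd (hm.symm.trans he) (hhalf m).2
  · rw [hfb, h]; simp
  · have hn1 : (1:ℝ) ≤ n := by exact_mod_cast (by omega : 1 ≤ n)
    obtain ⟨t, ht, he⟩ := intermediate_value_Icc hb hg
      (show (1/2 : ℝ) ∈ Set.Icc _ _ from ⟨by simp, by rw [hn]; linarith⟩)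
    obtain ⟨m, hm, -⟩ := hgi t ht
    exact absurd (hm.symm.trans he) (hhalf m).1

/-- the logarithm of `R e^{iθ} - s` along the circle -/
noncomputable def Ls (R : ℝ) (s : ℂ) (t : ℝ) : ℂ := (Real.log R : ℂ) + t * I + Complex.log (1 - s * er (-t) / R)

lemma Ls_slit (R : ℝ) (hR : 0 < R) (s : ℂ) (hs : ‖s‖ < R) (t : ℝ) : 1 - s * er (-t) / R ∈ slitPlane := by
  have h : ‖-(s * er (-t) / R)‖ < 1 := by
    rw [norm_neg, norm_div, norm_mul, norm_er, mul_one, Complex.norm_real, Real.norm_of_nonneg hR.le, div_lt_one hR]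
    exact hs
  have := Complex.mem_slitPlane_of_norm_lt_one h
  rwa [← sub_eq_add_neg] at this

lemma Ls_exp (R : ℝ) (hR : 0 < R) (s : ℂ) (hs : ‖s‖ < R) (t : ℝ) : Complex.exp (Ls R s t) = R * er t - s := by
  unfold Ls
  rw [Complex.exp_add, Complex.exp_add, Complex.exp_log (slitPlane_ne_zero (Ls_slit R hR s hs t)),
    ← Complex.ofReal_exp, Real.exp_log hR]
  have h1 : Complex.exp (t * I) = er t := rfl
  have h2 := er_neg_mul t
  have hR' : (R:ℂ) ≠ 0 := by exact_mod_cast hR.ne'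
  rw [h1]
  field_simp
  linear_combination (-s) * h2

lemma Ls_cont (R : ℝ) (hR : 0 < R) (s : ℂ) (hs : ‖s‖ < R) : Continuous (Ls R s) := by
  unfold Ls
  refine ((continuous_const.add ((Complex.continuous_ofReal).mul continuous_const))).add ?_
  have h : Continuous (fun t : ℝ => 1 - s * er (-t) / R) :=
    continuous_const.sub ((continuous_const.mul (er_cont.comp continuous_neg)).div_const _)
  exact h.clog (fun t => Ls_slit R hR s hs t)

lemma Ls_jump (R : ℝ) (s : ℂ) : Ls R s Real.pi - Ls R s (-Real.pi) = 2 * Real.pi * I := by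
  unfold Ls
  have h : er (-Real.pi) = er (-(-Real.pi)) := er_congr (-1) (by push_cast; ring)
  rw [h]
  push_cast
  ring

lemma arg_principle (y : ℂ → ℂ) (hy : Differentiable ℂ y) (u : ℂ) (hu : u ≠ 0) (hsym : ∀ z, y (cj z) = u * cj (y z))
    (R : ℝ) (hR : 0 < R) (Z : Finset ℂ) (hZ : ∀ z, z ∈ Z ↔ (‖z‖ ≤ R ∧ y z = 0)) (hZR : ∀ s ∈ Z, ‖s‖ < R)
    (hd : ∀ s ∈ Z, deriv y s ≠ 0) (L : ℝ → ℂ) (hL : ContinuousOn L (Set.Icc 0 Real.pi))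
    (hLe : ∀ t ∈ Set.Icc 0 Real.pi, Complex.exp (L t) = y (R * er t)) :
    (L Real.pi - L 0).im = Real.pi * Z.card := by
  obtain ⟨F, hF, hfac⟩ := entire_factor y hy Z (fun s hs => ((hZ s).1 hs).2)
  have hFn : ∀ z, ‖z‖ ≤ R → F z ≠ 0 := by
    intro z hz h0
    by_cases hzZ : z ∈ Z
    · exact entire_factor_ne y F hF Z hfac z hzZ (hd z hzZ) h0
    · exact hzZ ((hZ z).2 ⟨hz, by rw [hfac, h0, mul_zero]⟩)
  obtain ⟨h, hhc, hhe⟩ := log_ball F hF R hR hFn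
  have hnorm : ∀ t : ℝ, ‖(R:ℂ) * er t‖ ≤ R := by
    intro t
    rw [norm_mul, norm_er, mul_one, Complex.norm_real, Real.norm_of_nonneg hR.le]
  have hhcirc : Continuous (fun t : ℝ => h (R * er t)) :=
    hhc.comp_continuous (continuous_const.mul er_cont) (fun t => by simpa using hnorm t)
  have hE : ∀ t : ℝ, Complex.exp ((∑ s ∈ Z, Ls R s t) + h (R * er t)) = y (R * er t) := by
    intro t
    rw [Complex.exp_add, Complex.exp_sum, hhe _ (hnorm t), hfac]
    congr 1
    exact Finset.prod_congr rfl (fun s hs => Ls_exp R hR s (hZR s hs) t)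
  have hEc : Continuous (fun t : ℝ => (∑ s ∈ Z, Ls R s t) + h (R * er t)) :=
    (continuous_finsetSum _ (fun s hs => Ls_cont R hR s (hZR s hs))).add hhcirc
  have hpi := Real.pi_pos.le
  have e1 := lift_unique (fun t => L t - ((∑ s ∈ Z, Ls R s t) + h (R * er t))) Real.pi hpi (hL.sub hEc.continuousOn) 1
    (fun t ht => by
      rw [Complex.exp_sub, hLe t ht, hE, div_self]
      rw [← hLe t ht]; exact Complex.exp_ne_zero _)
  have e2 := lift_unique (fun t => cj (L t) - ((∑ s ∈ Z, Ls R s (-t)) + h (R * er (-t)))) Real.pi hpi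
    ((Complex.continuous_conj.comp_continuousOn hL).sub (hEc.comp continuous_neg).continuousOn) u⁻¹
    (fun t ht => by
      have h1 : (R:ℂ) * er (-t) = cj (R * er t) := by
        rw [map_mul, er_conj, Complex.conj_ofReal]
      rw [Complex.exp_sub, hE, h1, hsym, Complex.exp_conj, hLe t ht]
      have : cj (y (R * er t)) ≠ 0 := by
        rw [Ne, map_eq_zero, ← hLe t ht]; exact Complex.exp_ne_zero _
      field_simp)
  have hpp : er (-Real.pi) = er Real.pi := er_congr (-1) (by push_cast; ring)
  have hsum : (∑ s ∈ Z, Ls R s Real.pi) - (∑ s ∈ Z, Ls R s (-Real.pi)) = Z.card * (2 * Real.pi * I) := by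
    rw [← Finset.sum_sub_distrib, Finset.sum_congr rfl (fun s _ => Ls_jump R s)]
    simp
  simp only [neg_zero, hpp] at e1 e2
  have e3 : (L Real.pi - cj (L Real.pi)) - (L 0 - cj (L 0)) = Z.card * (2 * Real.pi * I) := by
    rw [← hsum]; linear_combination e2 - e1
  have e4 := congrArg Complex.im e3
  have hr : ((Z.card : ℂ) * (2 * Real.pi * I)).im = Z.card * (2 * Real.pi) := by simp
  rw [hr] at e4
  simp at e4
  rw [Complex.sub_im]
  linarith

lemma finite_zeros (y : ℂ → ℂ) (y' : ℂ → ℂ) (hy : ∀ z, HasDerivAt y (y' z) z) (hn : ∀ z, y z = 0 → y' z ≠ 0) (R : ℝ) :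
    {z | ‖z‖ ≤ R ∧ y z = 0}.Finite := by
  have h := (isCompact_closedBall (0:ℂ) R).induction_on (p := fun s => (s ∩ {z | y z = 0}).Finite)
    (by simp) (fun s t hst ht => ht.subset (Set.inter_subset_inter_left _ hst))
    (fun s t hs ht => by rw [Set.union_inter_distrib_right]; exact hs.union ht)
    (fun x hx => by
      by_cases h0 : y x = 0
      · have h1 := (hy x).eventually_ne (c := 0) (hn x h0)
        rw [eventually_nhdsWithin_iff] at h1
        refine ⟨_, mem_nhdsWithin_of_mem_nhds h1, (Set.finite_singleton x).subset ?_⟩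
        rintro z ⟨hz, hz0⟩
        by_contra hne
        exact hz hne hz0
      · have h1 := (hy x).continuousAt.eventually_ne h0
        refine ⟨_, mem_nhdsWithin_of_mem_nhds h1, ?_⟩
        have : {z | y z ≠ 0} ∩ {z | y z = 0} = ∅ := by ext z; simp
        exact (Set.finite_empty).subset this.subset)
  refine h.subset ?_
  rintro z ⟨hz, h0⟩
  exact ⟨by simpa using hz, h0⟩

end Cub

namespace Cub
local notation "cj" => starRingEnd ℂ

lemma eig_sym (a l : ℝ) (h : Wr 1 (-1) a l = 0) : ∃ u : ℂ, ‖u‖ = 1 ∧ (∀ z, Yk 1 a l (cj z) = u * cj (Yk 1 a l z)) ∧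
    ∀ z, Yk 1 a l z = u * Yk (-1) a l z := by
  obtain ⟨c, hc⟩ := sol_prop_of_wr (k := -1) (Yk_isSol 1 a l) h
  have hs : ∀ z, Yk 1 a l (cj z) = c * cj (Yk 1 a l z) := fun z => by
    rw [hc, (Yk_conj 1 a l z).1]
  refine ⟨c, ?_, hs, hc⟩
  obtain ⟨z, hz⟩ : ∃ z, Yk 1 a l z ≠ 0 := by
    by_contra hcon
    push Not at hcon
    exact Yk_ne 1 a l (funext hcon)
  have h1 := hs (cj z)
  rw [Complex.conj_conj, hs z, map_mul, Complex.conj_conj] at h1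
  have h2 : c * cj c = 1 := by
    apply mul_right_cancel₀ hz
    linear_combination -h1
  rw [Complex.mul_conj, Complex.normSq_eq_norm_sq] at h2
  have h3 : ‖c‖ ^ 2 = 1 := by exact_mod_cast h2
  nlinarith [norm_nonneg c]

lemma Y1_simple (a l : ℂ) (z : ℂ) (h0 : Yk 1 a l z = 0) : Yk' 1 a l z ≠ 0 := by
  intro h1
  have := Wr_eq 1 2 a l z
  rw [h0, h1] at this
  exact Wr_adj_ne 1 a l (by rw [show (1:ℤ) + 1 = 2 by norm_num, ← this]; ring)

lemma unit_er (u : ℂ) (h : ‖u‖ = 1) : ∃ t : ℝ, u = er t := by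
  refine ⟨u.arg, ?_⟩
  have := Complex.norm_mul_exp_arg_mul_I u
  rw [h] at this
  rw [er]; simpa using this.symm

lemma Y1_rep (a l : ℝ) (h : Wr 1 (-1) a l = 0) : ∃ η : ℝ,
    ∀ z, Yk 1 a l z = er (-(6 * Real.pi / 10)) * Yk 3 a l z + er (η + 3 * Real.pi / 20) * Yk 2 a l z := by
  obtain ⟨u, hu, hs, hc⟩ := eig_sym a l h
  have hw2 := Wr_adj 2 a l
  have hw1 := Wr_adj 1 a l
  norm_num at hw1 hw2
  have hc' : Yk' 1 a l 0 = u * Yk' (-1) a l 0 := by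
    have h1 := (Yk_isSol 1 a l).1 0
    have h2 := ((Yk_isSol (-1) a l).1 0).const_mul u
    rw [show (fun z => u * Yk (-1) a l z) = Yk 1 a l from (funext hc).symm] at h2
    exact h1.unique h2
  have h13 : ‖Wr 1 3 a l‖ = 2 := by
    have e1 : Wr 1 3 a l = Wr 1 (-2) a l := by
      simp only [Wr, Yk_m2, Yk'_m2]
    have e2 : Wr 1 (-2) a l = u * Wr (-1) (-2) a l := by
      simp only [Wr]; rw [hc 0, hc']; ring
    rw [e1, e2, Wr_conj, norm_mul, hu, hw1]
    simp [norm_er]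
  have h23 : ‖Wr 2 3 a l‖ = 2 := by
    rw [hw2]; simp [norm_er]
  have hq : ‖Wr 1 3 a l / Wr 2 3 a l‖ = 1 := by rw [norm_div, h13, h23]; norm_num
  obtain ⟨t, ht⟩ := unit_er _ hq
  refine ⟨t - 3 * Real.pi / 20, fun z => ?_⟩
  have hcomb := (comb_of_wr (w := Wr 2 3 a l) (Yk_isSol 2 a l) (Yk_isSol 3 a l) (Yk_isSol 1 a l) rfl
    (by rw [← norm_ne_zero_iff, h23]; norm_num) z).1
  rw [hcomb, sub_add_cancel, ← ht]
  have hp : Wr 2 1 a l / Wr 2 3 a l = er (-(6 * Real.pi / 10)) := by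
    rw [Wr_swap 1 2, hw1, hw2, div_eq_iff (mul_ne_zero two_ne_zero (er_ne _))]
    have := er_add (-(6 * Real.pi / 10)) (3 * Real.pi * 5 / 10)
    rw [show -(6 * Real.pi / 10) + 3 * Real.pi * 5 / 10 = 3 * Real.pi * 3 / 10 by ring] at this
    rw [this]; ring
  rw [← hp]
  simp only [Wr]
  ring

lemma er_two_cos (s t : ℝ) : er s + er t = 2 * er ((s + t) / 2) * (Real.cos ((s - t) / 2) : ℂ) := by
  have h1 : er s = er ((s + t) / 2) * er ((s - t) / 2) := by rw [← er_add]; congr 1; ring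
  have h2 : er t = er ((s + t) / 2) * er (-((s - t) / 2)) := by rw [← er_add]; congr 1; ring
  have h3 : er ((s - t) / 2) + er (-((s - t) / 2)) = 2 * (Real.cos ((s - t) / 2) : ℂ) := by
    apply Complex.ext
    · simp only [Complex.add_re, er_re, Real.cos_neg]
      rw [show (2:ℂ) = ((2:ℝ):ℂ) by norm_num, ← Complex.ofReal_mul, Complex.ofReal_re]; ring
    · simp only [Complex.add_im, er_im, Real.sin_neg]
      rw [show (2:ℂ) = ((2:ℝ):ℂ) by norm_num, ← Complex.ofReal_mul, Complex.ofReal_im]; ring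
  rw [h1, h2]
  linear_combination er ((s + t) / 2) * h3

/-- values of the rotated solutions on the negative axis -/
lemma Y23_neg (a l x : ℝ) : Yk 3 a l (-(x:ℂ)) = er (3 * Real.pi / 20) * (‖gg a l x‖ * er (psi a l x)) ∧
    Yk 2 a l (-(x:ℂ)) = er (-(3 * Real.pi / 20)) * (‖gg a l x‖ * er (-(psi a l x))) := by
  have hp := psi_pol a l x
  have hg := (gg_conj a l x).1
  have hi := er_neg_mul (3 * Real.pi / 20)
  constructor
  · rw [← hp, ← Yk_m2, gg]
    linear_combination (-(Yk (-2) a l (-(x:ℂ)))) * hi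
  · have h2 : cj (gg a l x) = ‖gg a l x‖ * er (-(psi a l x)) := by
      conv_lhs => rw [hp]
      rw [map_mul, er_conj, Complex.conj_ofReal]
    rw [← h2, hg]
    linear_combination (-(Yk 2 a l (-(x:ℂ)))) * hi

lemma Y1_neg (a l η : ℝ) (h : ∀ z, Yk 1 a l z = er (-(6 * Real.pi / 10)) * Yk 3 a l z + er (η + 3 * Real.pi / 20) * Yk 2 a l z)
    (x : ℝ) : Yk 1 a l (-(x:ℂ)) = ‖gg a l x‖ * (2 * er ((η - 9 * Real.pi / 20) / 2) *
      (Real.cos (psi a l x - (η + 9 * Real.pi / 20) / 2) : ℂ)) := by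
  have hh := Y23_neg a l x
  rw [h, hh.1, hh.2]
  have h1 := er_two_cos (-(9 * Real.pi / 20) + psi a l x) (η - psi a l x)
  rw [show (-(9 * Real.pi / 20) + psi a l x + (η - psi a l x)) / 2 = (η - 9 * Real.pi / 20) / 2 by ring,
    show (-(9 * Real.pi / 20) + psi a l x - (η - psi a l x)) / 2 = psi a l x - (η + 9 * Real.pi / 20) / 2 by ring] at h1
  rw [← h1]
  have e1 : er (-(9 * Real.pi / 20) + psi a l x) = er (-(6 * Real.pi / 10)) * er (3 * Real.pi / 20) * er (psi a l x) := by
    rw [← er_add, ← er_add]; congr 1; ring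
  have e2 : er (η - psi a l x) = er (η + 3 * Real.pi / 20) * er (-(3 * Real.pi / 20)) * er (-(psi a l x)) := by
    rw [← er_add, ← er_add]; congr 1; ring
  rw [e1, e2]
  ring

lemma Y23_one (a l η R : ℝ) (j : ℤ) (hj : psi a l R - (η + 9 * Real.pi / 20) / 2 = Real.pi * j) :
    er (η + 3 * Real.pi / 20) * Yk 2 a l (-(R:ℂ)) = er (-(6 * Real.pi / 10)) * Yk 3 a l (-(R:ℂ)) := by
  have hh := Y23_neg a l R
  rw [hh.1, hh.2]
  have e1 : er (-(6 * Real.pi / 10)) * er (3 * Real.pi / 20) * er (psi a l R) = er (-(9 * Real.pi / 20) + psi a l R) := by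
    rw [← er_add, ← er_add]; congr 1; ring
  have e2 : er (η + 3 * Real.pi / 20) * er (-(3 * Real.pi / 20)) * er (-(psi a l R)) = er (η - psi a l R) := by
    rw [← er_add, ← er_add]; congr 1; ring
  have e3 : er (η - psi a l R) = er (-(9 * Real.pi / 20) + psi a l R) := er_congr (-j) (by push_cast; linear_combination -2 * hj)
  rw [e3] at e2
  linear_combination (‖gg a l R‖ : ℂ) * (e2 - e1)

lemma ratio_near {x y z w : ℂ} (hx : ‖x - 1‖ ≤ 1/100) (hy : ‖y - 1‖ ≤ 1/100) (hz : ‖z - 1‖ ≤ 1/100) (hw : ‖w - 1‖ ≤ 1/100) :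
    ‖x * y / (z * w) - 1‖ ≤ 1/10 := by
  have key : ∀ s t : ℂ, ‖s - 1‖ ≤ 1/100 → ‖t - 1‖ ≤ 1/100 → ‖s * t - 1‖ ≤ 21/1000 := by
    intro s t hs ht
    have : s * t - 1 = (s - 1) * (t - 1) + (s - 1) + (t - 1) := by ring
    rw [this]
    refine (norm_add₃_le).trans ?_
    rw [norm_mul]
    nlinarith [norm_nonneg (s - 1), norm_nonneg (t - 1)]
  have h1 := key x y hx hy
  have h2 := key z w hz hw
  have h3 : 979/1000 ≤ ‖z * w‖ := by
    have := norm_sub_norm_le (1:ℂ) (1 - z * w)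
    rw [sub_sub_cancel, norm_one, norm_sub_rev] at this
    linarith
  have hne : z * w ≠ 0 := by
    rw [← norm_pos_iff]; linarith
  have h4 : x * y / (z * w) - 1 = ((x * y - 1) - (z * w - 1)) / (z * w)   := by
    rw [sub_sub_sub_cancel_right, sub_div, div_self hne]
  rw [h4, norm_div, div_le_iff₀ (by linarith)]
  have := norm_sub_le (x * y - 1) (z * w - 1)
  linarith

/-- the factor `1 + q` has positive real part -/
lemma q_re {ζ w : ℂ} {X : ℝ} (h1 : ζ.re ≤ -X / 2) (h2 : X ≤ 1 → |ζ.im| ≤ 1) (hw : ‖w - 1‖ ≤ 1/10) :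
    0 < (1 + Complex.exp ζ * w).re := by
  rw [Complex.add_re, Complex.one_re]
  have hwre := (abs_re_le_norm (w - 1)).trans hw
  have hwim := (abs_im_le_norm (w - 1)).trans hw
  simp only [Complex.sub_re, Complex.sub_im, Complex.one_re, Complex.one_im, sub_zero] at hwre hwim
  rcases le_or_gt X 1 with hX | hX
  · rw [Complex.mul_re, Complex.exp_re, Complex.exp_im]
    have h3 := h2 hX
    have h4 := Real.one_sub_sq_div_two_le_cos (x := ζ.im)
    have h5 : ζ.im ^ 2 ≤ 1 := by rw [← sq_abs]; nlinarith [abs_nonneg ζ.im]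
    have h6 := Real.exp_pos ζ.re
    have h7 := Real.neg_one_le_sin ζ.im
    have h8 := Real.sin_le_one ζ.im
    obtain ⟨h9, h10⟩ := abs_le.1 hwre
    obtain ⟨h11, h12⟩ := abs_le.1 hwim
    have h13 : 0 < Real.cos ζ.im * w.re - Real.sin ζ.im * w.im := by
      have e1 : 9/20 ≤ Real.cos ζ.im * w.re := by nlinarith
      have e2 : |Real.sin ζ.im * w.im| ≤ 1 * (1/10) := by
        rw [abs_mul]
        exact mul_le_mul (abs_le.2 ⟨h7, h8⟩) hwim (abs_nonneg _) zero_le_one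
      linarith [(abs_le.1 e2).2]
    have h14 := mul_pos h6 h13
    nlinarith
  · have h3 : ‖Complex.exp ζ‖ ≤ 2/3 := by
      rw [Complex.norm_exp]
      have e1 : Real.exp ζ.re ≤ Real.exp (-(1/2)) := Real.exp_le_exp.2 (by linarith)
      have e2 := Real.add_one_le_exp (1/2 : ℝ)
      rw [Real.exp_neg] at e1
      refine e1.trans ?_
      rw [inv_le_comm₀ (Real.exp_pos _) (by norm_num)]
      linarith
    have h4 : ‖w‖ ≤ 11/10 := by
      have := norm_add_le (w - 1) 1
      rw [sub_add_cancel, norm_one] at this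
      linarith
    have h5 : ‖Complex.exp ζ * w‖ ≤ 2/3 * (11/10) := by
      rw [norm_mul]; exact mul_le_mul h3 h4 (norm_nonneg _) (by norm_num)
    linarith [(abs_le.1 ((abs_re_le_norm _).trans h5)).1]

lemma slit_prod {h w : ℂ} (hh : ‖h - 1‖ ≤ 1/2) (hw : 0 < w.re) : h * w ∈ slitPlane := by
  by_contra hcon
  rw [Complex.mem_slitPlane_iff_not_le_zero, not_not] at hcon
  have hre := (abs_re_le_norm (h - 1)).trans hh
  simp only [Complex.sub_re, Complex.one_re] at hre
  have hre' := (abs_le.1 hre).1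
  have h1 : (h * w).im = 0 := by
    have := (Complex.le_def.1 hcon).2; simpa using this
  have h2 : (h * w).re ≤ 0 := by
    have := (Complex.le_def.1 hcon).1; simpa using this
  have h3 : w.re * (h.re ^ 2 + h.im ^ 2) = (h * w).re * h.re + (h * w).im * h.im := by
    rw [Complex.mul_re, Complex.mul_im]; ring
  rw [h1] at h3
  have h4 : 0 < w.re * (h.re ^ 2 + h.im ^ 2) := mul_pos hw (by nlinarith [sq_nonneg h.im])
  nlinarith

set_option maxHeartbeats 1000000 in
lemma zeta_bound (a ρ μ : ℝ) (hρ : 2 ≤ ρ) (ha : 20 * |a| ≤ ρ ^ 8) (hμ0 : 0 ≤ μ) (hμ : μ ≤ Real.pi / 20) :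
    (-(2 * (Sv a (ρ * er (Real.pi / 4 - μ)) - Sv a (ρ * er (Real.pi / 4))))).re ≤ -(ρ ^ 10 * Real.sin (10 * μ)) / 2 ∧
    (ρ ^ 10 * Real.sin (10 * μ) ≤ 1 → |(-(2 * (Sv a (ρ * er (Real.pi / 4 - μ)) - Sv a (ρ * er (Real.pi / 4))))).im| ≤ 1) := by
  have hpi := Real.pi_pos
  have hre : (-(2 * (Sv a (ρ * er (Real.pi / 4 - μ)) - Sv a (ρ * er (Real.pi / 4))))).re =
      -(2 * ((Sv a (ρ * er (Real.pi / 4 - μ))).re - (Sv a (ρ * er (Real.pi / 4))).re)) := by simp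
  have him : (-(2 * (Sv a (ρ * er (Real.pi / 4 - μ)) - Sv a (ρ * er (Real.pi / 4))))).im =
      -(2 * ((Sv a (ρ * er (Real.pi / 4 - μ))).im - (Sv a (ρ * er (Real.pi / 4))).im)) := by simp
  rw [hre, him, Sv_re, Sv_re, Sv_im, Sv_im]
  have c1 : Real.cos (10 * (Real.pi / 4 - μ)) = Real.sin (10 * μ) := by
    rw [show 10 * (Real.pi / 4 - μ) = (Real.pi / 2 - 10 * μ) + 2 * Real.pi by ring, Real.cos_add_two_pi, Real.cos_pi_div_two_sub]
  have c2 : Real.cos (2 * (Real.pi / 4 - μ)) = Real.sin (2 * μ) := by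
    rw [show 2 * (Real.pi / 4 - μ) = (Real.pi / 2 - 2 * μ) by ring, Real.cos_pi_div_two_sub]
  have c3 : Real.cos (10 * (Real.pi / 4)) = 0 := by
    rw [show 10 * (Real.pi / 4) = (Real.pi / 2) + 2 * Real.pi by ring, Real.cos_add_two_pi, Real.cos_pi_div_two]
  have c4 : Real.cos (2 * (Real.pi / 4)) = 0 := by
    rw [show 2 * (Real.pi / 4) = (Real.pi / 2) by ring, Real.cos_pi_div_two]
  have s1 : Real.sin (10 * (Real.pi / 4 - μ)) = Real.cos (10 * μ) := by
    rw [show 10 * (Real.pi / 4 - μ) = (Real.pi / 2 - 10 * μ) + 2 * Real.pi by ring, Real.sin_add_two_pi, Real.sin_pi_div_two_sub]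
  have s2 : Real.sin (2 * (Real.pi / 4 - μ)) = Real.cos (2 * μ) := by
    rw [show 2 * (Real.pi / 4 - μ) = (Real.pi / 2 - 2 * μ) by ring, Real.sin_pi_div_two_sub]
  have s3 : Real.sin (10 * (Real.pi / 4)) = 1 := by
    rw [show 10 * (Real.pi / 4) = (Real.pi / 2) + 2 * Real.pi by ring, Real.sin_add_two_pi, Real.sin_pi_div_two]
  have s4 : Real.sin (2 * (Real.pi / 4)) = 1 := by
    rw [show 2 * (Real.pi / 4) = (Real.pi / 2) by ring, Real.sin_pi_div_two]
  rw [c1, c2, c3, c4, s1, s2, s3, s4]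
  have hs0 : 0 ≤ Real.sin (10 * μ) := Real.sin_nonneg_of_nonneg_of_le_pi (by linarith) (by linarith)
  have hs1 : Real.sin (10 * μ) ≤ 1 := Real.sin_le_one _
  have ht0 : 0 ≤ Real.sin (2 * μ) := Real.sin_nonneg_of_nonneg_of_le_pi (by linarith) (by linarith)
  have hts : Real.sin (2 * μ) ≤ Real.sin (10 * μ) :=
    Real.sin_le_sin_of_le_of_le_pi_div_two (by linarith) (by linarith) (by linarith)
  have hc0 : 0 ≤ Real.cos (10 * μ) := Real.cos_nonneg_of_neg_pi_div_two_le_of_le (by linarith) (by linarith)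
  have hc1 : Real.cos (10 * μ) ≤ 1 := Real.cos_le_one _
  have hd1 : Real.cos (2 * μ) ≤ 1 := Real.cos_le_one _
  have hcd : Real.cos (10 * μ) ≤ Real.cos (2 * μ) :=
    Real.cos_le_cos_of_nonneg_of_le_pi (by linarith) (by linarith) (by linarith)
  have hcs := Real.sin_sq_add_cos_sq (10 * μ)
  have haρ : |a| * ρ ^ 2 ≤ ρ ^ 10 / 20 := by
    have : ρ ^ 10 = ρ ^ 8 * ρ ^ 2 := by ring
    rw [this]; nlinarith [sq_nonneg ρ]
  generalize Real.sin (10 * μ) = s at *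
  generalize Real.sin (2 * μ) = t at *
  generalize Real.cos (10 * μ) = c at *
  generalize Real.cos (2 * μ) = d at *
  have hP : 1024 ≤ ρ ^ 10 := by
    have := pow_le_pow_left₀ (by norm_num) hρ 10
    norm_num at this
    exact this
  have hat : |a * ρ ^ 2 * t| ≤ ρ ^ 10 / 20 * s := by
    rw [abs_mul, abs_mul, abs_of_nonneg (sq_nonneg ρ), abs_of_nonneg ht0]
    exact mul_le_mul haρ hts ht0 (by positivity)
  have had : |a * ρ ^ 2 * (1 - d)| ≤ ρ ^ 10 / 20 * (1 - c) := by
    rw [abs_mul, abs_mul, abs_of_nonneg (sq_nonneg ρ), abs_of_nonneg (by linarith : 0 ≤ 1 - d)]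
    exact mul_le_mul haρ (by linarith) (by linarith) (by positivity)
  generalize hPP : ρ ^ 10 = P at *
  constructor
  · have h1 := (abs_le.1 hat).2
    have h2 : 0 ≤ P * s := by positivity
    nlinarith
  · intro hX
    have h1 := abs_le.1 had
    have h2 : 1 - c ≤ s ^ 2 := by nlinarith
    have h3 : P * (1 - c) ≤ 1 / 100 := by
      have e1 : P * (1 - c) ≤ (P * s) * s := by
        have := mul_le_mul_of_nonneg_left h2 (by linarith : (0:ℝ) ≤ P)
        linarith
      have e2 : s ≤ 1 / 1000 := by
        have := mul_le_mul_of_nonneg_right hP hs0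
        linarith
      have e3 : (P * s) * s ≤ 1 * s := mul_le_mul_of_nonneg_right hX hs0
      linarith
    have h4 : 0 ≤ P * (1 - c) := by
      have : 0 ≤ 1 - c := by linarith
      positivity
    have e : -(2 * (2 / 5 * P * c - a * ρ ^ 2 * d - (2 / 5 * P * 1 - a * ρ ^ 2 * 1))) =
      4 / 5 * (P * (1 - c)) - 2 * (a * ρ ^ 2 * (1 - d)) := by ring
    rw [e, abs_le]
    constructor <;> linarith

lemma arg_near {z : ℂ} {ε : ℝ} (h : ‖z - 1‖ ≤ ε) (hε : ε ≤ 1/2) : |z.arg| ≤ 3/2 * ε := by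
  have h1 := Complex.norm_log_one_add_half_le_self (h.trans hε)
  rw [add_sub_cancel] at h1
  have h2 := abs_im_le_norm (Complex.log z)
  rw [Complex.log_im] at h2
  linarith

/-- quotient of Y_1 by its asymptotic form -/
noncomputable def Hq (a l ρ β : ℝ) : ℂ := Yk 1 a l ((ρ * er β) ^ 4) / Tk 1 a (ρ * er β)

lemma Hq_cont (a l ρ : ℝ) (hρ : 0 < ρ) : Continuous (Hq a l ρ) := by
  have hv : Continuous (fun β : ℝ => (ρ:ℂ) * er β) := continuous_const.mul er_cont
  have hne : ∀ β : ℝ, (ρ:ℂ) * er β ≠ 0 := fun β => mul_ne_zero (by exact_mod_cast hρ.ne') (er_ne β)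
  have hY : Continuous (Yk 1 a l) :=
    continuous_iff_continuousAt.2 fun z => ((Yk_isSol 1 a l).1 z).continuousAt
  have h1 : Continuous (fun β : ℝ => Yk 1 a l ((ρ * er β) ^ 4)) := hY.comp (hv.pow 4)
  have h2 : Continuous (fun β : ℝ => Tk 1 a (ρ * er β)) := by
    unfold Tk Sv
    exact (continuous_const.mul ((hv.inv₀ hne).pow 3)).mul (Continuous.cexp
      (continuous_const.mul ((continuous_const.mul (hv.pow 10)).sub (continuous_const.mul (hv.pow 2)))).neg)
  exact h1.div h2 (fun β => Tk_ne 1 a (hne β))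

lemma T23 (k : ℤ) (a v : ℂ) (hv : v ≠ 0) : Tk 2 a v = Tk 3 a v * (er (-(3 * Real.pi / 10)) * Complex.exp (-(2 * Sv a v))) ∧
    Tk 3 a v * er (-(6 * Real.pi / 10)) = Tk 1 a v := by
  unfold Tk
  have z2 : ((-1:ℂ)) ^ (2:ℤ) = 1 := by norm_num
  have z3 : ((-1:ℂ)) ^ (3:ℤ) = -1 := by
    rw [show (3:ℤ) = ((3:ℕ):ℤ) by norm_num, zpow_natCast]; norm_num
  rw [z2, z3, zpow_one]
  have e1 : er (3 * Real.pi * ((2:ℤ):ℝ) / 10) = er (3 * Real.pi * ((3:ℤ):ℝ) / 10) * er (-(3 * Real.pi / 10)) := by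
    rw [← er_add]; congr 1; push_cast; ring
  have e2 : er (3 * Real.pi * ((1:ℤ):ℝ) / 10) = er (3 * Real.pi * ((3:ℤ):ℝ) / 10) * er (-(6 * Real.pi / 10)) := by
    rw [← er_add]; congr 1; push_cast; ring
  have e3 : Complex.exp (-(1 * Sv a v)) = Complex.exp (-(-1 * Sv a v)) * Complex.exp (-(2 * Sv a v)) := by
    rw [← Complex.exp_add]; congr 1; ring
  rw [e1, e2, e3]
  constructor <;> ring

end Cub

namespace Cub
local notation "cj" => starRingEnd ℂ

noncomputable def hk (k : ℤ) (a l ρ β : ℝ) : ℂ := Yk k a l ((ρ * er β) ^ 4) / Tk k a (ρ * er β)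

lemma Hq_rep (a l η : ℝ) (h : ∀ z, Yk 1 a l z = er (-(6 * Real.pi / 10)) * Yk 3 a l z + er (η + 3 * Real.pi / 20) * Yk 2 a l z)
    (ρ : ℝ) (hρ : 0 < ρ) (β : ℝ) : Hq a l ρ β = hk 3 a l ρ β +
      er (η + 9 * Real.pi / 20) * Complex.exp (-(2 * Sv a (ρ * er β))) * hk 2 a l ρ β := by
  have hne : (ρ:ℂ) * er β ≠ 0 := mul_ne_zero (by exact_mod_cast hρ.ne') (er_ne β)
  unfold Hq hk
  obtain ⟨h1, h2⟩ := T23 1 a _ hne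
  have n3 := Tk_ne 3 a hne
  have n2 := Tk_ne 2 a hne
  rw [h]
  have e1 : er (-(6 * Real.pi / 10)) * Yk 3 a l ((ρ * er β) ^ 4) / Tk 1 a (ρ * er β) =
      Yk 3 a l ((ρ * er β) ^ 4) / Tk 3 a (ρ * er β) := by
    rw [← h2]
    have := er_ne (-(6 * Real.pi / 10))
    field_simp
  have e2 : er (η + 3 * Real.pi / 20) * Yk 2 a l ((ρ * er β) ^ 4) / Tk 1 a (ρ * er β) =
      er (η + 9 * Real.pi / 20) * Complex.exp (-(2 * Sv a (ρ * er β))) * (Yk 2 a l ((ρ * er β) ^ 4) / Tk 2 a (ρ * er β)) := by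
    have e3 : er (η + 3 * Real.pi / 20) = er (η + 9 * Real.pi / 20) * er (3 * Real.pi / 10) * er (-(6 * Real.pi / 10)) := by
      rw [← er_add, ← er_add]; congr 1; ring
    have e5 := er_neg_mul (3 * Real.pi / 10)
    have e6 : Tk 1 a (ρ * er β) ≠ 0 := Tk_ne 1 a hne
    have e7 : Tk 3 a (ρ * er β) * Complex.exp (-(2 * Sv a (ρ * er β))) = Tk 2 a (ρ * er β) * er (3 * Real.pi / 10) := by
      rw [h1]
      linear_combination (-(Tk 3 a (ρ * er β) * Complex.exp (-(2 * Sv a (ρ * er β))))) * e5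
    have e8 : Yk 2 a l ((ρ * er β) ^ 4) / Tk 2 a (ρ * er β) * Tk 2 a (ρ * er β) = Yk 2 a l ((ρ * er β) ^ 4) := div_mul_cancel₀ _ n2
    rw [div_eq_iff e6, ← h2, e3]
    generalize Yk 2 a l ((ρ * er β) ^ 4) / Tk 2 a (ρ * er β) = Q at e8 ⊢
    linear_combination (-(er (η + 9 * Real.pi / 20) * Q * er (-(6 * Real.pi / 10)))) * e7 - er (η + 9 * Real.pi / 20) * er (3 * Real.pi / 10) * er (-(6 * Real.pi / 10)) * e8
  rw [add_div, e1, e2]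

lemma v0_four (R : ℝ) (hR : 0 < R) (t : ℝ) : ((rq R : ℂ) * er (t / 4)) ^ 4 = R * er t := by
  have h4 : ((rq R : ℂ)) ^ 4 = R := by exact_mod_cast rq_four hR.le
  rw [mul_pow, h4, er_pow]
  congr 2; push_cast; ring

lemma Hq_end (a l η R : ℝ) (hR : 0 < R) (j : ℤ) (hj : psi a l R - (η + 9 * Real.pi / 20) / 2 = Real.pi * j)
    (h : ∀ z, Yk 1 a l z = er (-(6 * Real.pi / 10)) * Yk 3 a l z + er (η + 3 * Real.pi / 20) * Yk 2 a l z) :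
    Hq a l (rq R) (Real.pi / 4) = 2 * hk 3 a l (rq R) (Real.pi / 4) := by
  have hρ := rq_pos hR
  have hne : (rq R:ℂ) * er (Real.pi / 4) ≠ 0 := mul_ne_zero (by exact_mod_cast hρ.ne') (er_ne _)
  have hv : ((rq R : ℂ) * er (Real.pi / 4)) ^ 4 = -(R:ℂ) := by
    rw [v0_four R hR, er_pi]; ring
  obtain ⟨h1, h2⟩ := T23 1 a _ hne
  have h3 := Y23_one a l η R j hj
  unfold Hq hk
  rw [hv, h, h3, ← h2]
  have n3 := Tk_ne 3 a hne
  have := er_ne (-(6 * Real.pi / 10))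
  field_simp
  ring

lemma Hq_prod (a l η R : ℝ) (hR : 0 < R) (j : ℤ) (hj : psi a l R - (η + 9 * Real.pi / 20) / 2 = Real.pi * j)
    (h : ∀ z, Yk 1 a l z = er (-(6 * Real.pi / 10)) * Yk 3 a l z + er (η + 3 * Real.pi / 20) * Yk 2 a l z) (β : ℝ)
    (n1 : hk 3 a l (rq R) β ≠ 0) (n2 : hk 2 a l (rq R) (Real.pi / 4) ≠ 0) :
    Hq a l (rq R) β = hk 3 a l (rq R) β * (1 + Complex.exp (-(2 * (Sv a (rq R * er β) - Sv a (rq R * er (Real.pi / 4))))) *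
      (hk 2 a l (rq R) β * hk 3 a l (rq R) (Real.pi / 4) / (hk 3 a l (rq R) β * hk 2 a l (rq R) (Real.pi / 4)))) := by
  have hρ := rq_pos hR
  have e0 := Hq_end a l η R hR j hj h
  rw [Hq_rep a l η h _ hρ] at e0
  rw [Hq_rep a l η h _ hρ]
  have e1 : hk 3 a l (rq R) (Real.pi / 4) = er (η + 9 * Real.pi / 20) * Complex.exp (-(2 * Sv a (rq R * er (Real.pi / 4)))) * hk 2 a l (rq R) (Real.pi / 4) := by
    linear_combination -e0
  have e2 : Complex.exp (-(2 * Sv a (rq R * er β))) =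
     Complex.exp (-(2 * (Sv a (rq R * er β) - Sv a (rq R * er (Real.pi / 4))))) * Complex.exp (-(2 * Sv a (rq R * er (Real.pi / 4)))) := by
    rw [← Complex.exp_add]; congr 1; ring
  rw [e1, e2]
  field_simp

lemma Hq_slit (a l η R ε : ℝ) (hε : ε ≤ 1/100) (hR : 0 < R) (hρ : 2 ≤ rq R) (ha : 20 * |a| ≤ rq R ^ 8) (j : ℤ)
    (hj : psi a l R - (η + 9 * Real.pi / 20) / 2 = Real.pi * j)
    (h : ∀ z, Yk 1 a l z = er (-(6 * Real.pi / 10)) * Yk 3 a l z + er (η + 3 * Real.pi / 20) * Yk 2 a l z)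
    (hA : ∀ (k : ℤ) (β : ℝ), |β - k * Real.pi / 10| ≤ Real.pi / 10 → ‖hk k a l (rq R) β - 1‖ ≤ ε) (β : ℝ) (h0 : 0 ≤ β)
    (h1 : β ≤ Real.pi / 4) : Hq a l (rq R) β ∈ slitPlane := by
  have hpi := Real.pi_pos
  rcases le_total β (Real.pi / 5) with hb | hb
  · refine slit_of_near ((hA 1 β ?_).trans (by linarith))
    rw [abs_le]; push_cast; constructor <;> linarith
  · have b3 := (hA 3 β (by rw [abs_le]; push_cast; constructor <;> linarith)).trans hε
    have b2 := (hA 2 β (by rw [abs_le]; push_cast; constructor <;> linarith)).trans hε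
    have c3 := (hA 3 (Real.pi / 4) (by rw [abs_le]; push_cast; constructor <;> linarith)).trans hε
    have c2 := (hA 2 (Real.pi / 4) (by rw [abs_le]; push_cast; constructor <;> linarith)).trans hε
    rw [Hq_prod a l η R hR j hj h β (slitPlane_ne_zero (slit_of_near (b3.trans (by norm_num))))
      (slitPlane_ne_zero (slit_of_near (c2.trans (by norm_num))))]
    obtain ⟨z1, z2⟩ := zeta_bound a (rq R) (Real.pi / 4 - β) hρ ha (by linarith) (by linarith)
    rw [sub_sub_cancel] at z1 z2
    exact slit_prod (b3.trans (by norm_num)) (q_re z1 z2 (ratio_near b2 c3 b3 c2))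

lemma T1_exp (a ρ t : ℝ) (hρ : 0 < ρ) : Complex.exp (((3 * Real.pi / 10 - 3 * (t / 4) : ℝ) : ℂ) * I - 3 * (Real.log ρ : ℂ)
    + Sv a (ρ * er (t / 4))) = Tk 1 a (ρ * er (t / 4)) := by
  unfold Tk
  rw [Complex.exp_add, Complex.exp_sub, zpow_one]
  have e1 : Complex.exp (3 * (Real.log ρ : ℂ)) = (ρ:ℂ) ^ 3 := by
    rw [show (3 : ℂ) * (Real.log ρ : ℂ) = ((3:ℕ) : ℂ) * (Real.log ρ : ℂ) by norm_num, Complex.exp_nat_mul, ← Complex.ofReal_exp, Real.exp_log hρ]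
  have e2 : Complex.exp (((3 * Real.pi / 10 - 3 * (t / 4) : ℝ) : ℂ) * I) = er (3 * Real.pi * ((1:ℤ):ℝ) / 10) * (er (t / 4))⁻¹ ^ 3 := by
    rw [← er_neg, er_pow, ← er_add, er]
    congr 3; push_cast; ring
  rw [e1, e2, mul_inv, mul_pow, show -(-1 * Sv (a:ℂ) (ρ * er (t / 4))) = Sv a (ρ * er (t / 4)) by ring]
  have : (ρ:ℂ) ≠ 0 := by exact_mod_cast hρ.ne'
  field_simp

/-- logarithm of Y_1 along the upper half circle -/
noncomputable def LL (a l R t : ℝ) : ℂ := ((3 * Real.pi / 10 - 3 * (t / 4) : ℝ) : ℂ) * I - 3 * (Real.log (rq R) : ℂ)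
    + Sv a (rq R * er (t / 4)) + Complex.log (Hq a l (rq R) (t / 4))

lemma LL_exp (a l R t : ℝ) (hR : 0 < R) (h : Hq a l (rq R) (t / 4) ≠ 0) : Complex.exp (LL a l R t) = Yk 1 a l (R * er t) := by
  have hρ := rq_pos hR
  have hne : (rq R:ℂ) * er (t / 4) ≠ 0 := mul_ne_zero (by exact_mod_cast hρ.ne') (er_ne _)
  unfold LL
  rw [Complex.exp_add, T1_exp a _ t hρ, Complex.exp_log h]
  unfold Hq
  rw [mul_div_cancel₀ _ (Tk_ne 1 a hne), v0_four R hR]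

lemma LL_cont (a l R : ℝ) (hR : 0 < R) (h : ∀ t ∈ Set.Icc 0 Real.pi, Hq a l (rq R) (t / 4) ∈ slitPlane) :
    ContinuousOn (LL a l R) (Set.Icc 0 Real.pi) := by
  have hq : Continuous (fun t : ℝ => Hq a l (rq R) (t / 4)) := (Hq_cont a l _ (rq_pos hR)).comp (continuous_id.div_const 4)
  have hv : Continuous (fun t : ℝ => (rq R:ℂ) * er (t / 4)) := continuous_const.mul (er_cont.comp (continuous_id.div_const 4))
  have h1 : Continuous (fun t : ℝ => ((3 * Real.pi / 10 - 3 * (t / 4) : ℝ) : ℂ) * I - 3 * (Real.log (rq R) : ℂ)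
    + Sv a (rq R * er (t / 4))) := by
    unfold Sv
    refine Continuous.add ?_ ((continuous_const.mul (hv.pow 10)).sub (continuous_const.mul (hv.pow 2)))
    fun_prop
  exact h1.continuousOn.add (hq.continuousOn.clog h)

lemma LL_im (a l R : ℝ) (hR : 0 < R) : (LL a l R Real.pi - LL a l R 0).im = ph a R - 3 * Real.pi / 4
    + (Hq a l (rq R) (Real.pi / 4)).arg - (Hq a l (rq R) 0).arg := by
  have key : ∀ t, (LL a l R t).im = 3 * Real.pi / 10 - 3 * (t / 4) + (Sv a (rq R * er (t / 4))).im + (Hq a l (rq R) (t / 4)).arg := by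
    intro t
    unfold LL
    rw [Complex.add_im, Complex.log_im, Complex.add_im, Complex.sub_im, Complex.im_ofReal_mul, I_im,
      show (3:ℂ) * (Real.log (rq R) : ℂ) = ((3 * Real.log (rq R) : ℝ) : ℂ) by push_cast; ring, Complex.ofReal_im]
    ring
  rw [Complex.sub_im, key, key, Sv_im, Sv_im, ph_eq, zero_div]
  rw [show 10 * (Real.pi / 4) = (Real.pi / 2) + 2 * Real.pi by ring, Real.sin_add_two_pi, Real.sin_pi_div_two,
    show 2 * (Real.pi / 4) = (Real.pi / 2) by ring, Real.sin_pi_div_two]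
  simp
  ring

/-- counting of all zeros in a large disc -/
lemma circle_count (a l η ε : ℝ) (hε0 : 0 < ε) (hε : ε ≤ 1/100) (hW : Wr 1 (-1) a l = 0)
    (h : ∀ z, Yk 1 a l z = er (-(6 * Real.pi / 10)) * Yk 3 a l z + er (η + 3 * Real.pi / 20) * Yk 2 a l z) :
    ∀ᶠ R in atTop, ∀ j : ℤ, psi a l R - (η + 9 * Real.pi / 20) / 2 = Real.pi * j → ∀ Z : Finset ℂ,
      (∀ z, z ∈ Z ↔ (‖z‖ ≤ R ∧ Yk 1 a l z = 0)) → (∀ z ∈ Z, ‖z‖ < R) ∧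
      |Real.pi * Z.card - (ph a R - 3 * Real.pi / 4)| ≤ 3 * ε := by
  obtain ⟨R1, hR1, hAS⟩ := AS (|a| + |l|) ε (by positivity) hε0
  have hpi := Real.pi_pos
  filter_upwards [eventually_ge_atTop (R1 ^ 4), eventually_ge_atTop (16:ℝ), eventually_ge_atTop (20 * |a|)] with R e1 e2 e3
  intro j hj Z hZ
  have hR : 0 < R := by linarith
  have hρ4 := rq_four hR.le
  have hρ1 : R1 ≤ rq R := le_of_pow_le_pow_left₀ (n := 4) (by norm_num) (rq_nonneg R) (by rw [hρ4]; exact e1)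
  have hρ2 : 2 ≤ rq R := le_of_pow_le_pow_left₀ (n := 4) (by norm_num) (rq_nonneg R) (by rw [hρ4]; linarith)
  have hρ8 : 20 * |a| ≤ rq R ^ 8 := by
    have : rq R ^ 8 = R * R := by
      calc rq R ^ 8 = rq R ^ 4 * rq R ^ 4 := by ring
        _ = R * R := by rw [hρ4]
    rw [this]; nlinarith
  have hA : ∀ (k : ℤ) (β : ℝ), |β - k * Real.pi / 10| ≤ Real.pi / 10 → ‖hk k a l (rq R) β - 1‖ ≤ ε := by
    intro k β hβ
    refine (hAS a l ?_ ?_ k (rq R) β hρ1 hβ).1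
    · rw [Complex.norm_real, Real.norm_eq_abs]; linarith [abs_nonneg l]
    · rw [Complex.norm_real, Real.norm_eq_abs]; linarith [abs_nonneg a]
  have hslit : ∀ t ∈ Set.Icc 0 Real.pi, Hq a l (rq R) (t / 4) ∈ slitPlane := fun t ht =>
    Hq_slit a l η R ε hε hR hρ2 hρ8 j hj h hA (t / 4) (by linarith [ht.1]) (by linarith [ht.2])
  have hexp : ∀ t ∈ Set.Icc 0 Real.pi, Complex.exp (LL a l R t) = Yk 1 a l (R * er t) := fun t ht =>
    LL_exp a l R t hR (slitPlane_ne_zero (hslit t ht))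
  obtain ⟨u, hu, hsym, -⟩ := eig_sym a l hW
  have hu0 : u ≠ 0 := by rw [← norm_ne_zero_iff, hu]; norm_num
  have hcirc : ∀ z ∈ Z, ‖z‖ < R := by
    intro z hz
    obtain ⟨hz1, hz2⟩ := (hZ z).1 hz
    refine lt_of_le_of_ne hz1 fun hz3 => ?_
    have key : ∀ w : ℂ, ‖w‖ = R → 0 ≤ w.im → Yk 1 a l w ≠ 0 := by
      intro w hw him h0
      have := hexp w.arg ⟨Complex.arg_nonneg_iff.2 him, Complex.arg_le_pi w⟩
      have hw2 : (R:ℂ) * er w.arg = w := by rw [← hw]; exact Complex.norm_mul_exp_arg_mul_I w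
      rw [hw2, h0] at this
      exact Complex.exp_ne_zero _ this
    rcases le_total 0 z.im with him | him
    · exact key z hz3 him hz2
    · refine key (cj z) (by rw [RCLike.norm_conj, hz3]) (by simpa using him) ?_
      rw [hsym, hz2, map_zero, mul_zero]
  refine ⟨hcirc, ?_⟩
  have hcount := arg_principle (Yk 1 a l) (fun z => ((Yk_isSol 1 a l).1 z).differentiableAt) u hu0 hsym R hR Z hZ hcirc
    (fun s hs => by
      rw [((Yk_isSol 1 a l).1 s).deriv]
      exact Y1_simple a l s ((hZ s).1 hs).2) (LL a l R) (LL_cont a l R hR hslit) hexp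
  rw [← hcount, LL_im a l R hR, Hq_end a l η R hR j hj h]
  have a1 : |(Hq a l (rq R) 0).arg| ≤ 3/2 * ε := arg_near (hA 1 0 (by rw [abs_le]; push_cast; constructor <;> linarith)) (by linarith)
  have a2 : |(hk 3 a l (rq R) (Real.pi / 4)).arg| ≤ 3/2 * ε :=
    arg_near (hA 3 (Real.pi / 4) (by rw [abs_le]; push_cast; constructor <;> linarith)) (by linarith)
  have a3 : (2 * hk 3 a l (rq R) (Real.pi / 4)).arg = (hk 3 a l (rq R) (Real.pi / 4)).arg := by
    have := Complex.arg_real_mul (hk 3 a l (rq R) (Real.pi / 4)) (show (0:ℝ) < 2 by norm_num)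
    exact_mod_cast this
  rw [a3]
  rw [abs_le] at a1 a2 ⊢
  constructor <;> linarith [a1.1, a1.2, a2.1, a2.2]

end Cub

namespace Cub

lemma psi_cont1 (a l : ℝ) : Continuous (psi a l) :=
  continuous_iff_continuousAt.2 fun x => (psi_der a l x).continuousAt

lemma psi_tendsto (a l : ℝ) : Tendsto (psi a l) atTop atTop := by
  have h := (psi_lim a l).add_atTop (ph_tendsto a)
  refine h.congr fun x => ?_
  ring

lemma good_R (a l α R0 : ℝ) : ∃ R, R0 ≤ R ∧ ∃ j : ℤ, psi a l R - α = Real.pi * j := by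
  have hpi := Real.pi_pos
  obtain ⟨j, hj⟩ := exists_int_gt ((psi a l R0 - α) / Real.pi)
  rw [div_lt_iff₀ hpi] at hj
  obtain ⟨R1, h1, h2⟩ := ((eventually_ge_atTop R0).and ((psi_tendsto a l).eventually_ge_atTop (α + Real.pi * j))).exists
  obtain ⟨R, hR, hRe⟩ := intermediate_value_Icc h1 (psi_cont1 a l).continuousOn
    (show α + Real.pi * j ∈ Set.Icc _ _ from ⟨by linarith, h2⟩)
  exact ⟨R, hR.1, j, by rw [hRe]; ring⟩

lemma Y1_neg_zero (a l η : ℝ) (h : ∀ z, Yk 1 a l z = er (-(6 * Real.pi / 10)) * Yk 3 a l z + er (η + 3 * Real.pi / 20) * Yk 2 a l z)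
    (x : ℝ) : Yk 1 a l (-(x:ℂ)) = 0 ↔ ∃ m : ℤ, psi a l x - (η + 9 * Real.pi / 20) / 2 = (2 * m + 1) * Real.pi / 2 := by
  rw [Y1_neg a l η h, ← Real.cos_eq_zero_iff]
  have h1 : (‖gg a l x‖ : ℂ) ≠ 0 := by exact_mod_cast norm_ne_zero_iff.2 (gg_ne a l x)
  have h2 := er_ne ((η - 9 * Real.pi / 20) / 2)
  simp only [mul_eq_zero, h1, h2, false_or, OfNat.ofNat_ne_zero, Complex.ofReal_eq_zero]

/-- counting of the real zeros in a disc -/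
lemma real_count (a l η R : ℝ) (hR : 0 < R)
    (h : ∀ z, Yk 1 a l z = er (-(6 * Real.pi / 10)) * Yk 3 a l z + er (η + 3 * Real.pi / 20) * Yk 2 a l z)
    (j : ℤ) (hj : psi a l R - (η + 9 * Real.pi / 20) / 2 = Real.pi * j) (Z : Finset ℂ)
    (hZ : ∀ z, z ∈ Z ↔ ((‖z‖ ≤ R ∧ Yk 1 a l z = 0) ∧ z.im = 0)) :
    |Real.pi * Z.card - (psi a l R - psi a l (-R))| ≤ Real.pi / 2 := by
  have hpi := Real.pi_pos
  have hiff := Y1_neg_zero a l η h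
  set α := (η + 9 * Real.pi / 20) / 2 with hα
  set t := (psi a l (-R) - α) / Real.pi - 1/2 with ht
  have htp : Real.pi * t = psi a l (-R) - α - Real.pi / 2 := by rw [ht]; field_simp
  have hmono := psi_strictMono a l
  have hlt : psi a l (-R) < psi a l R := hmono (by linarith)
  have hreal : ∀ z ∈ Z, z = -(((-z.re : ℝ)) : ℂ) ∧ -R ≤ -z.re ∧ -z.re ≤ R ∧
      ∃ m : ℤ, psi a l (-z.re) - α = (2 * m + 1) * Real.pi / 2 := by
    intro z hz
    obtain ⟨⟨h1, h2⟩, h3⟩ := (hZ z).1 hz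
    have e1 : z = -(((-z.re : ℝ)) : ℂ) := by
      apply Complex.ext
      · simp
      · simp [h3]
    have e2 := (abs_re_le_norm z).trans h1
    rw [abs_le] at e2
    refine ⟨e1, by linarith [e2.2], by linarith [e2.1], (hiff _).1 ?_⟩
    rw [← e1]; exact h2
  have hfl : ∀ (x : ℝ) (m : ℤ), psi a l x - α = (2 * m + 1) * Real.pi / 2 → ⌊(psi a l x - α) / Real.pi⌋ = m := by
    intro x m hm
    rw [Int.floor_eq_iff, hm]
    have : (2 * (m:ℝ) + 1) * Real.pi / 2 / Real.pi = m + 1/2 := by field_simp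
    rw [this]; constructor <;> linarith
  have hcard : Z.card = (Finset.Icc ⌈t⌉ (j - 1)).card := by
    refine Finset.card_nbij (fun z => ⌊(psi a l (-z.re) - α) / Real.pi⌋) ?_ ?_ ?_
    · intro z hz
      obtain ⟨e1, e2, e3, m, hm⟩ := hreal z hz
      simp only
      rw [hfl _ m hm, Finset.coe_Icc, Set.mem_Icc, Int.ceil_le]
      constructor
      · have := hmono.monotone e2
        by_contra hcon
        push Not at hcon
        nlinarith
      · have := hmono.monotone e3
        have h4 : (m:ℝ) < j := by
          by_contra hcon
          push Not at hcon
          nlinarith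
        have : m < j := by exact_mod_cast h4
        omega
    · intro z hz w hw hzw
      obtain ⟨e1, e2, e3, m, hm⟩ := hreal z hz
      obtain ⟨f1, f2, f3, n, hn⟩ := hreal w hw
      simp only at hzw
      rw [hfl _ m hm, hfl _ n hn] at hzw
      subst hzw
      have : psi a l (-z.re) = psi a l (-w.re) := by linarith
      rw [e1, f1, hmono.injective this]
    · intro m hm
      rw [Finset.coe_Icc, Set.mem_Icc, Int.ceil_le] at hm
      have hm2 : (m:ℝ) ≤ j - 1 := by exact_mod_cast hm.2
      obtain ⟨x, hx, hxe⟩ := intermediate_value_Icc (show -R ≤ R by linarith) (psi_cont1 a l).continuousOn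
        (show α + (2 * m + 1) * Real.pi / 2 ∈ Set.Icc _ _ from ⟨by nlinarith [hm.1], by nlinarith⟩)
      have hxm : psi a l x - α = (2 * m + 1) * Real.pi / 2 := by rw [hxe]; ring
      refine ⟨-(x:ℂ), (hZ _).2 ⟨⟨?_, (hiff x).2 ⟨m, hxm⟩⟩, by simp⟩, ?_⟩
      · rw [norm_neg, Complex.norm_real, Real.norm_eq_abs, abs_le]; exact hx
      · simp only [neg_re, ofReal_re, neg_neg]
        exact hfl x m hxm
  rw [Int.card_Icc] at hcard
  have hce := Int.le_ceil t
  have hce2 := Int.ceil_lt_add_one t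
  have hle : ⌈t⌉ ≤ j := by
    rw [Int.ceil_le]
    by_contra hcon
    push Not at hcon
    nlinarith
  have hc2 : (Z.card : ℝ) = j - ⌈t⌉ := by
    have : (Z.card : ℤ) = j - ⌈t⌉ := by rw [hcard]; omega
    exact_mod_cast this
  rw [hc2, abs_le]
  constructor <;> nlinarith

lemma disc_count (a l η : ℝ) (hW : Wr 1 (-1) a l = 0)
    (h : ∀ z, Yk 1 a l z = er (-(6 * Real.pi / 10)) * Yk 3 a l z + er (η + 3 * Real.pi / 20) * Yk 2 a l z)
    (k : ℤ) (h1 : Real.pi / 2 + 2 * Real.pi * k < Psi a l) (h2 : Psi a l < 3 * Real.pi / 2 + 2 * Real.pi * k) :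
    ∀ᶠ R in atTop, ∀ j : ℤ, psi a l R - (η + 9 * Real.pi / 20) / 2 = Real.pi * j → ∀ Z : Finset ℂ,
      (∀ z, z ∈ Z ↔ (‖z‖ ≤ R ∧ Yk 1 a l z = 0)) → ((Z.filter (fun z => z.im ≠ 0)).card : ℤ) = 2 * k := by
  have hpi := Real.pi_pos
  set g := Real.pi / 2 - |Psi a l - Real.pi - 2 * Real.pi * k| with hg
  have hg0 : 0 < g := by
    have : |Psi a l - Real.pi - 2 * Real.pi * k| < Real.pi / 2 := by rw [abs_lt]; constructor <;> linarith
    linarith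
  set ε := min (1/100) (g / 12) with hε
  have hε0 : 0 < ε := lt_min (by norm_num) (by linarith)
  have hε1 : ε ≤ g / 12 := min_le_right _ _
  have c1 := circle_count a l η ε hε0 (min_le_left _ _) hW h
  have c2 := (Metric.tendsto_nhds.1 (psi_lim a l)) (g / 8) (by linarith)
  have c3 := (Metric.tendsto_nhds.1 ((Theta_lim a l).comp tendsto_neg_atTop_atBot)) (g / 8) (by linarith)
  filter_upwards [c1, c2, c3, eventually_gt_atTop 0] with R d1 d2 d3 hR
  intro j hj Z hZ
  obtain ⟨-, d4⟩ := d1 j hj Z hZ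
  have d5 := real_count a l η R hR h j hj (Z.filter (fun z => z.im = 0)) (fun z => by
    rw [Finset.mem_filter, hZ])
  have hsum := Finset.card_filter_add_card_filter_not (s := Z) (fun z : ℂ => z.im = 0)
  have hsum' : ((Z.filter (fun z => z.im = 0)).card : ℝ) + ((Z.filter (fun z => z.im ≠ 0)).card : ℝ) = Z.card := by
    exact_mod_cast hsum
  simp only [Function.comp, Real.dist_eq, sub_zero, sub_neg_eq_add] at d2 d3
  have hal : al a l = -Psi a l - Real.pi / 4 := by rw [Psi]; ring
  rw [hal] at d3
  generalize (Z.filter (fun z => z.im ≠ 0)).card = M at *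
  generalize (Z.filter (fun z => z.im = 0)).card = N at *
  generalize Z.card = T at *
  have hb : |Psi a l - Real.pi - 2 * Real.pi * k| = Real.pi / 2 - g := by rw [hg]; ring
  have hb' := hb.le
  rw [abs_le] at hb' d4 d5
  rw [abs_lt] at d2 d3
  have hπ : Real.pi * T = Real.pi * N + Real.pi * M := by rw [← hsum']; ring
  have u1 : Real.pi * (M - 2 * k) < Real.pi * 1 := by
    linarith [hb'.1, hb'.2, d4.1, d4.2, d5.1, d5.2, d2.1, d2.2, d3.1, d3.2]
  have u2 : Real.pi * (-1) < Real.pi * (M - 2 * k) := by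
    linarith [hb'.1, hb'.2, d4.1, d4.2, d5.1, d5.2, d2.1, d2.2, d3.1, d3.2]
  have v1 := lt_of_mul_lt_mul_left u1 hpi.le
  have v2 := lt_of_mul_lt_mul_left u2 hpi.le
  have w1 : (M:ℤ) - 2 * k < 1 := by exact_mod_cast v1
  have w2 : -1 < (M:ℤ) - 2 * k := by exact_mod_cast v2
  omega

/-- Main lemma on zeros -/
lemma zero_count (a l : ℝ) (hW : Wr 1 (-1) a l = 0) (k : ℤ) (h1 : Real.pi / 2 + 2 * Real.pi * k < Psi a l)
    (h2 : Psi a l < 3 * Real.pi / 2 + 2 * Real.pi * k) :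
    (nonrealZeros (Yk 1 a l)).Finite ∧ ((nonrealZeros (Yk 1 a l)).ncard : ℤ) = 2 * k := by
  obtain ⟨η, hη⟩ := Y1_rep a l hW
  obtain ⟨R0, hR0⟩ := eventually_atTop.1 (disc_count a l η hW hη k h1 h2)
  have key : ∀ T : Finset ℂ, (∀ z ∈ T, z ∈ nonrealZeros (Yk 1 a l)) → ∃ S : Finset ℂ, T ⊆ S ∧
      (∀ z ∈ S, z ∈ nonrealZeros (Yk 1 a l)) ∧ (S.card : ℤ) = 2 * k := by
    intro T hT
    obtain ⟨C, hC⟩ := T.finite_toSet.isBounded.exists_norm_le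
    obtain ⟨R, hR, j, hj⟩ := good_R a l ((η + 9 * Real.pi / 20) / 2) (max R0 C)
    have hfin := finite_zeros (Yk 1 a l) (Yk' 1 a l) (Yk_isSol 1 a l).1 (Y1_simple a l) R
    refine ⟨hfin.toFinset.filter (fun z => z.im ≠ 0), ?_, ?_, hR0 R ((le_max_left _ _).trans hR) j hj _ (fun z => by simp)⟩
    · intro z hz
      have h3 := hT z hz
      rw [Finset.mem_filter, Set.Finite.mem_toFinset]
      exact ⟨⟨(hC z hz).trans ((le_max_right _ _).trans hR), h3.1⟩, h3.2⟩
    · intro z hz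
      rw [Finset.mem_filter, Set.Finite.mem_toFinset] at hz
      exact ⟨hz.1.2, hz.2⟩
  have hfin : (nonrealZeros (Yk 1 a l)).Finite := by
    by_contra hinf
    obtain ⟨T, hT, hc⟩ := Set.Infinite.exists_subset_card_eq hinf ((2 * k).toNat + 1)
    obtain ⟨S, hS1, -, hS3⟩ := key T (fun z hz => hT hz)
    have := Finset.card_le_card hS1
    omega
  refine ⟨hfin, ?_⟩
  obtain ⟨S, hS1, hS2, hS3⟩ := key hfin.toFinset (fun z hz => by simpa using hz)
  have hE : hfin.toFinset = S := Finset.Subset.antisymm hS1 (fun z hz => by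
    rw [Set.Finite.mem_toFinset]; exact hS2 z hz)
  rw [Set.ncard_eq_toFinset_card _ hfin, hE, hS3]

lemma nrz_mul (y w : ℂ → ℂ) (c : ℂ) (hc : c ≠ 0) (h : ∀ z, y z = c * w z) : nonrealZeros y = nonrealZeros w := by
  ext z
  simp only [nonrealZeros, Set.mem_setOf_eq, h z, mul_eq_zero, hc, false_or]

lemma cos_neg_int (p : ℝ) (h : Real.cos p < 0) : ∃ k : ℤ, Real.pi / 2 + 2 * Real.pi * k < p ∧ p < 3 * Real.pi / 2 + 2 * Real.pi * k := by
  have hpi := Real.pi_pos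
  set k := ⌊(p + Real.pi / 2) / (2 * Real.pi)⌋ with hk
  have e1 := Int.floor_le ((p + Real.pi / 2) / (2 * Real.pi))
  have e2 := Int.lt_floor_add_one ((p + Real.pi / 2) / (2 * Real.pi))
  rw [← hk, le_div_iff₀ (by positivity)] at e1
  rw [← hk, div_lt_iff₀ (by positivity)] at e2
  refine ⟨k, ?_, by linarith⟩
  by_contra hcon
  push Not at hcon
  have h3 : 0 ≤ Real.cos (p - k * (2 * Real.pi)) := Real.cos_nonneg_of_neg_pi_div_two_le_of_le (by linarith) (by linarith)
  rw [Real.cos_sub_int_mul_two_pi] at h3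
  linarith

lemma locus_int (a l : ℝ) (h : ∃ y, IsCubicEigenfunction a l y) : ∃ k : ℤ, Real.pi / 2 + 2 * Real.pi * k < Psi a l ∧
    Psi a l < 3 * Real.pi / 2 + 2 * Real.pi * k := by
  have h1 := (eig_iff_Psi a l).1 h
  refine cos_neg_int _ ?_
  by_contra hcon
  push Not at hcon
  nlinarith [MM_pos a l]

lemma gamma_eq (n : ℕ) : cubicGamma n = {q : ℝ × ℝ | MM q.1 q.2 * Real.cos (Psi q.1 q.2) = -1/2 ∧
    Real.pi/2 + 2*Real.pi*n < Psi q.1 q.2 ∧ Psi q.1 q.2 < 3*Real.pi/2 + 2*Real.pi*n} := by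
  ext q
  constructor
  · rintro ⟨y, hy, hf, hc⟩
    have hex : ∃ y, IsCubicEigenfunction (q.1:ℂ) (q.2:ℂ) y := ⟨y, hy⟩
    obtain ⟨k, h1, h2⟩ := locus_int q.1 q.2 hex
    obtain ⟨c, hc0, hcy⟩ := eig_mult hy
    have hz := (zero_count q.1 q.2 ((eig_iff_wr q.1 q.2).1 hex) k h1 h2).2
    rw [nrz_mul y _ c hc0 hcy] at hc
    rw [hc] at hz
    have hkn : k = n := by push_cast at hz; omega
    refine ⟨(eig_iff_Psi q.1 q.2).1 hex, ?_, ?_⟩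
    · rw [hkn] at h1; exact_mod_cast h1
    · rw [hkn] at h2; exact_mod_cast h2
  · rintro ⟨h0, h1, h2⟩
    have hex := (eig_iff_Psi q.1 q.2).2 h0
    obtain ⟨hf, hz⟩ := zero_count q.1 q.2 ((eig_iff_wr q.1 q.2).1 hex) n (by exact_mod_cast h1) (by exact_mod_cast h2)
    obtain ⟨y, hy⟩ := hex
    obtain ⟨c, hc0, hcy⟩ := eig_mult hy
    refine ⟨y, hy, ?_, ?_⟩
    · rw [nrz_mul y _ c hc0 hcy]; exact hf
    · rw [nrz_mul y _ c hc0 hcy]; exact_mod_cast hz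

end Cub

theorem cubic_real_locus_decomposition :
    (∀ n : ℕ, (cubicGamma n).Nonempty ∧
      ∃ f : ℝ → ℝ × ℝ, Continuous f ∧ Function.Injective f ∧
        (∀ K : Set (ℝ × ℝ), IsCompact K → IsCompact (f ⁻¹' K)) ∧
        Set.range f = cubicGamma n) ∧
    (∀ m n : ℕ, m ≠ n → Disjoint (cubicGamma m) (cubicGamma n)) ∧
    (⋃ n : ℕ, cubicGamma n) = cubicRealLocus := by
  refine ⟨fun n => ?_, fun m n hmn => ?_, ?_⟩
  · obtain ⟨f, h1, h2, h3, h4⟩ := Cub.curve_ex n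
    rw [← Cub.gamma_eq n] at h4
    exact ⟨⟨f 0, h4 ▸ Set.mem_range_self 0⟩, f, h1, h2, h3, h4⟩
  · rw [Set.disjoint_left]
    rintro q ⟨y, hy, hf, hc⟩ ⟨w, hw, hg, hd⟩
    obtain ⟨c, hc0, hcy⟩ := Cub.eig_mult hy
    obtain ⟨d, hd0, hdw⟩ := Cub.eig_mult hw
    rw [Cub.nrz_mul y _ c hc0 hcy] at hc
    rw [Cub.nrz_mul w _ d hd0 hdw] at hd
    omega
  · ext q
    rw [Set.mem_iUnion]
    constructor
    · rintro ⟨n, y, hy, -⟩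
      exact ⟨y, hy⟩
    · rintro ⟨y, hy⟩
      obtain ⟨k, h1, h2⟩ := Cub.locus_int q.1 q.2 ⟨y, hy⟩
      obtain ⟨hf, hz⟩ := Cub.zero_count q.1 q.2 ((Cub.eig_iff_wr q.1 q.2).1 ⟨y, hy⟩) k h1 h2
      obtain ⟨c, hc0, hcy⟩ := Cub.eig_mult hy
      refine ⟨k.toNat, y, hy, ?_, ?_⟩
      · rw [Cub.nrz_mul y _ c hc0 hcy]; exact hf
      · rw [Cub.nrz_mul y _ c hc0 hcy]; omega
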